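/- Let d ≥ 1, p ∈ (1,2], m ∈ [0,2], and let A : ℝ^d → ℝ be locally Hölder continuous with C₀^{-1}(1+|x|)^m ≤ A(x) ≤ C₀(1+|x|)^m for all x and some C₀ > 0. Let α, β : ℝ^d → ℝ be locally Hölder continuous with α > 0 and β bounded from above, and suppose that there exist C, ε > 0 and δ < ε such that α(x) ≤ C exp(−|x|^{2−m+ε}) and β(x) ≥ −C(1+|x|)^{2−m+2δ} for all x ∈ ℝ^d. Then there exists a function u : ℝ^d × [0,∞) → ℝ, not identically zero, that is continuous, nonnegative, twice continuously differentiable in x and once in t on ℝ^d × (0,∞), satisfies ∂u/∂t = A(x)Δu + β(x)u − α(x)u^p on ℝ^d × (0,∞), and satisfies u(x,0) = 0 for all x ∈ ℝ^d. -/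

import Mathlib

open Set

/-- The `i`-th partial derivative of a function on `ℝ^d`. -/
noncomputable def pd {d : ℕ} (i : Fin d) (f : EuclideanSpace ℝ (Fin d) → ℝ)
    (x : EuclideanSpace ℝ (Fin d)) : ℝ :=
  fderiv ℝ f x (EuclideanSpace.single i 1)

/-- `f` is locally Hölder continuous. -/
def LocHolder {d : ℕ} (f : EuclideanSpace ℝ (Fin d) → ℝ) : Prop :=
  ∀ K : Set (EuclideanSpace ℝ (Fin d)), IsCompact K →
    ∃ κ C : ℝ, 0 < κ ∧ κ ≤ 1 ∧ 0 ≤ C ∧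
      ∀ x ∈ K, ∀ y ∈ K, |f x - f y| ≤ C * ‖x - y‖ ^ κ

/-- `d`-dimensional Euclidean space. -/
abbrev Eu (d : ℕ) : Type := EuclideanSpace ℝ (Fin d)

open MeasureTheory Filter Topology
open scoped ContDiff

/-- The coordinate functional. -/
noncomputable abbrev prj {d : ℕ} (i : Fin d) : Eu d →L[ℝ] ℝ := EuclideanSpace.proj i

/-- A polynomial times a Gaussian. -/
noncomputable def pgk {d : ℕ} (P : MvPolynomial (Fin d) ℝ) (z : Eu d) : ℝ :=
  MvPolynomial.eval (fun i => z i) P * Real.exp (-‖z‖ ^ 2 / 4)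

/-- The polynomial factor of the `i`-th partial derivative of `pgk P`. -/
noncomputable def dpg {d : ℕ} (i : Fin d) (P : MvPolynomial (Fin d) ℝ) :
    MvPolynomial (Fin d) ℝ :=
  MvPolynomial.pderiv i P - MvPolynomial.C (1 / 2) * MvPolynomial.X i * P

theorem hasFDerivAt_mvEval {d : ℕ} (P : MvPolynomial (Fin d) ℝ) (z : Eu d) :
    HasFDerivAt (fun z : Eu d => MvPolynomial.eval (fun i => z i) P)
      (∑ i, MvPolynomial.eval (fun i => z i) (MvPolynomial.pderiv i P) • prj i) z := by
  induction P using MvPolynomial.induction_on with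
  | C a => simpa using hasFDerivAt_const a z
  | add p q hp hq =>
    simp only [map_add]
    refine (hp.add hq).congr_fderiv ?_
    simp [add_smul, Finset.sum_add_distrib]
  | mul_X p j hp =>
    have hj : HasFDerivAt (fun z : Eu d => z j) (prj j) z := (prj (d := d) j).hasFDerivAt
    simp only [map_mul, MvPolynomial.eval_X]
    refine (hp.mul hj).congr_fderiv ?_
    · ext v
      simp only [map_mul, Derivation.leibniz, MvPolynomial.pderiv_X, smul_eq_mul, map_add,
        MvPolynomial.eval_X, add_smul, Finset.sum_add_distrib, add_apply,
        smul_apply, sum_apply, Finset.mul_sum]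
      congr 1
      · rw [Finset.sum_eq_single j]
        · simp
        · intro b _ hb; simp [hb.symm]
        · simp
      · refine Finset.sum_congr rfl fun i _ => ?_
        ring

theorem hasFDerivAt_normSq {d : ℕ} (z : Eu d) :
    HasFDerivAt (fun z : Eu d => ‖z‖ ^ 2) (∑ i, (2 * z i) • prj i) z := by
  refine (hasStrictFDerivAt_norm_sq z).hasFDerivAt.congr_fderiv ?_
  ext v
  simp [PiLp.inner_apply, Finset.mul_sum]
  exact Finset.sum_congr rfl fun i _ => by ring

theorem hasFDerivAt_pgk {d : ℕ} (P : MvPolynomial (Fin d) ℝ) (z : Eu d) :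
    HasFDerivAt (pgk P) (∑ i, pgk (dpg i P) z • prj i) z := by
  have h1 := hasFDerivAt_mvEval P z
  have h2 : HasFDerivAt (fun z : Eu d => -‖z‖ ^ 2 / 4) _ z :=
    ((hasFDerivAt_normSq z).neg).mul_const (1 / 4) |>.congr_of_eventuallyEq
      (Eventually.of_forall fun z => by simp only [Pi.neg_apply]; ring)
  refine (h1.mul h2.exp).congr_fderiv ?_
  ext v
  simp only [pgk, dpg, map_sub, map_mul, MvPolynomial.eval_C, MvPolynomial.eval_X,
    add_apply, smul_apply, sum_apply,
    neg_apply, smul_eq_mul, Finset.mul_sum, ← Finset.sum_neg_distrib,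
    ← Finset.sum_add_distrib]
  exact Finset.sum_congr rfl fun i _ => by ring

theorem continuous_pgk {d : ℕ} (P : MvPolynomial (Fin d) ℝ) : Continuous (pgk P) :=
  continuous_iff_continuousAt.2 fun z => (hasFDerivAt_pgk P z).continuousAt

theorem exists_mvEval_le {d : ℕ} (P : MvPolynomial (Fin d) ℝ) :
    ∃ C : ℝ, ∃ n : ℕ, 0 ≤ C ∧
      ∀ z : Eu d, |MvPolynomial.eval (fun i => z i) P| ≤ C * (1 + ‖z‖) ^ n := by
  induction P using MvPolynomial.induction_on with
  | C a => exact ⟨|a|, 0, abs_nonneg _, fun z => by simp⟩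
  | add p q hp hq =>
    obtain ⟨C1, n1, h1, hp⟩ := hp
    obtain ⟨C2, n2, h2, hq⟩ := hq
    refine ⟨C1 + C2, n1 + n2, by positivity, fun z => ?_⟩
    rw [map_add]
    have hz : 1 ≤ 1 + ‖z‖ := by linarith [norm_nonneg z]
    calc _ ≤ _ := abs_add_le _ _
      _ ≤ C1 * (1 + ‖z‖) ^ (n1 + n2) + C2 * (1 + ‖z‖) ^ (n1 + n2) := by
        refine add_le_add ((hp z).trans ?_) ((hq z).trans ?_)
        · gcongr
          · omega
        · gcongr
          · omega
      _ = _ := by ring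
  | mul_X p j hp =>
    obtain ⟨C1, n1, h1, hp⟩ := hp
    refine ⟨C1, n1 + 1, h1, fun z => ?_⟩
    rw [map_mul, abs_mul, MvPolynomial.eval_X, pow_succ, ← mul_assoc]
    refine mul_le_mul (hp z) ?_ (abs_nonneg _) (by positivity)
    have := PiLp.norm_apply_le z j
    rw [Real.norm_eq_abs] at this
    linarith

theorem exists_pow_le_exp_sq (n : ℕ) (c : ℝ) (hc : 0 < c) :
    ∃ C : ℝ, 0 ≤ C ∧ ∀ r : ℝ, 0 ≤ r → (1 + r) ^ n ≤ C * Real.exp (c * r ^ 2) := by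
  have hb : 0 < (2 * c)⁻¹ := by positivity
  refine ⟨(n.factorial : ℝ) * Real.exp (1 + (4 * c)⁻¹), by positivity, fun r hr => ?_⟩
  have h1 : (1 + r) ^ n ≤ n.factorial * Real.exp (1 + r) := by
    have := Real.pow_div_factorial_le_exp (1 + r) (by positivity) n
    rwa [div_le_iff₀ (by positivity), mul_comm] at this
  refine h1.trans ?_
  rw [mul_assoc, ← Real.exp_add]
  refine mul_le_mul_of_nonneg_left (Real.exp_le_exp.2 ?_) (by positivity)
  have : 0 ≤ c * (r - (2 * c)⁻¹) ^ 2 := by positivity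
  have e : c * (r - (2 * c)⁻¹) ^ 2 = c * r ^ 2 - r + (4 * c)⁻¹ := by field_simp; ring
  linarith

theorem exists_pgk_bound {d : ℕ} (n : ℕ) (P : MvPolynomial (Fin d) ℝ) :
    ∃ C : ℝ, 0 ≤ C ∧ ∀ z : Eu d,
      (1 + ‖z‖) ^ n * |pgk P z| ≤ C * Real.exp (-(1 / 8) * ‖z‖ ^ 2) := by
  obtain ⟨C1, n1, h1, hp⟩ := exists_mvEval_le P
  obtain ⟨C2, h2, hq⟩ := exists_pow_le_exp_sq (n + n1) (1 / 8) (by norm_num)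
  refine ⟨C1 * C2, by positivity, fun z => ?_⟩
  rw [pgk, abs_mul, Real.abs_exp]
  calc _ ≤ (1 + ‖z‖) ^ n * (C1 * (1 + ‖z‖) ^ n1 * Real.exp (-‖z‖ ^ 2 / 4)) := by
        gcongr; exact hp z
    _ = C1 * (1 + ‖z‖) ^ (n + n1) * Real.exp (-‖z‖ ^ 2 / 4) := by ring
    _ ≤ C1 * (C2 * Real.exp (1 / 8 * ‖z‖ ^ 2)) * Real.exp (-‖z‖ ^ 2 / 4) := by
        gcongr; exact hq _ (norm_nonneg _)
    _ = _ := by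
        rw [mul_assoc, mul_assoc, mul_assoc, ← Real.exp_add]; ring_nf

theorem integrable_gauss {d : ℕ} (b : ℝ) (hb : 0 < b) :
    Integrable (fun z : Eu d => Real.exp (-b * ‖z‖ ^ 2)) := by
  by_contra h
  have h1 := GaussianFourier.integral_rexp_neg_mul_sq_norm (V := Eu d) hb
  rw [integral_undef h] at h1
  have : 0 < (Real.pi / b) ^ ((Module.finrank ℝ (Eu d) : ℝ) / 2) := by positivity
  linarith

theorem integrable_pow_mul_pgk {d : ℕ} (n : ℕ) (P : MvPolynomial (Fin d) ℝ) :
    Integrable (fun z : Eu d => (1 + ‖z‖) ^ n * |pgk P z|) := by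
  obtain ⟨C, hC, h⟩ := exists_pgk_bound n P
  refine ((integrable_gauss (1 / 8) (by norm_num)).const_mul C).mono'
    (by have := continuous_pgk P; exact Continuous.aestronglyMeasurable (by fun_prop))
    (Eventually.of_forall fun z => ?_)
  rw [Real.norm_of_nonneg (by positivity)]
  exact h z

theorem integrable_pgk {d : ℕ} (P : MvPolynomial (Fin d) ℝ) : Integrable (pgk P) := by
  have := integrable_pow_mul_pgk 0 P
  simp only [pow_zero, one_mul] at this
  exact (integrable_norm_iff (continuous_pgk P).aestronglyMeasurable).1 this

theorem rpow_le_one_add_sq {r κ : ℝ} (hr : 0 ≤ r) (h0 : 0 ≤ κ) (h2 : κ ≤ 2) :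
    r ^ κ ≤ (1 + r) ^ 2 := by
  calc r ^ κ ≤ (1 + r) ^ κ := Real.rpow_le_rpow hr (by linarith) h0
    _ ≤ (1 + r) ^ (2 : ℝ) := Real.rpow_le_rpow_of_exponent_le (by linarith) h2
    _ = _ := by norm_cast

theorem integral_pgk_dpg {d : ℕ} (i : Fin d) (P : MvPolynomial (Fin d) ℝ) :
    ∫ z, pgk (dpg i P) z = 0 := by
  have h := integral_mul_fderiv_eq_neg_fderiv_mul_of_integrable (μ := volume)
    (f := fun _ : Eu d => (1 : ℝ)) (g := pgk P) (v := EuclideanSpace.single i 1)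
    (by simp) (by
      simp only [one_mul]
      refine (integrable_pgk (dpg i P)).congr (Eventually.of_forall fun z => ?_)
      simp only [(hasFDerivAt_pgk P z).fderiv]
      simp [sum_apply, PiLp.single_apply])
    (by simpa using integrable_pgk P)
    (fun z _ => by fun_prop) (fun z _ => (hasFDerivAt_pgk P z).differentiableAt)
  simp only [one_mul, fderiv_fun_const, Pi.zero_apply, zero_apply, zero_mul,
    integral_zero, neg_zero] at h
  rw [← h]
  refine integral_congr_ae (Eventually.of_forall fun z => ?_)
  simp only [(hasFDerivAt_pgk P z).fderiv]
  simp [sum_apply, PiLp.single_apply]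

/-- The parabolically rescaled kernel `σ ^ (-(d + j) / 2) * pgk P (z / √σ)`. -/
noncomputable def Ks {d : ℕ} (j : ℕ) (P : MvPolynomial (Fin d) ℝ) (σ : ℝ) (z : Eu d) : ℝ :=
  ((√σ) ^ (d + j))⁻¹ * pgk P ((√σ)⁻¹ • z)

/-- The polynomial factor of the time derivative of `Ks j P`. -/
noncomputable def lpg {d : ℕ} (j : ℕ) (P : MvPolynomial (Fin d) ℝ) : MvPolynomial (Fin d) ℝ :=
  MvPolynomial.C (-1 / 2) *
    (MvPolynomial.C ((d + j : ℕ) : ℝ) * P + ∑ i, MvPolynomial.X i * dpg i P)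

theorem hasFDerivAt_Ks {d : ℕ} (j : ℕ) (P : MvPolynomial (Fin d) ℝ) {σ : ℝ} (hσ : 0 < σ)
    (z : Eu d) :
    HasFDerivAt (Ks j P σ) (∑ i, Ks (j + 1) (dpg i P) σ z • prj i) z := by
  have h1 : HasFDerivAt (fun z : Eu d => (√σ)⁻¹ • z)
      ((√σ)⁻¹ • ContinuousLinearMap.id ℝ (Eu d)) z :=
    ((√σ)⁻¹ • ContinuousLinearMap.id ℝ (Eu d)).hasFDerivAt
  have h2 := ((hasFDerivAt_pgk P ((√σ)⁻¹ • z)).comp z h1).const_mul ((√σ) ^ (d + j))⁻¹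
  refine h2.congr_fderiv ?_
  ext v
  simp only [smul_apply, ContinuousLinearMap.comp_apply, sum_apply, smul_eq_mul, Finset.mul_sum,
    ContinuousLinearMap.id_apply, Ks, map_smul]
  refine Finset.sum_congr rfl fun i _ => ?_
  have : 0 < √σ := Real.sqrt_pos.2 hσ
  rw [← add_assoc, pow_succ (√σ)]
  field_simp

theorem hasDerivAt_Ks {d : ℕ} (j : ℕ) (P : MvPolynomial (Fin d) ℝ) {σ : ℝ} (hσ : 0 < σ)
    (z : Eu d) :
    HasDerivAt (fun σ => Ks j P σ z) (Ks (j + 2) (lpg j P) σ z) σ := by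
  have hs : 0 < √σ := Real.sqrt_pos.2 hσ
  have h0 : HasDerivAt (fun σ : ℝ => √σ) (1 / (2 * √σ)) σ := Real.hasDerivAt_sqrt hσ.ne'
  have hi : HasDerivAt (fun σ : ℝ => (√σ)⁻¹) (-(1 / (2 * √σ)) / (√σ) ^ 2) σ := h0.inv hs.ne'
  have h1 : HasDerivAt (fun σ : ℝ => (√σ)⁻¹ • z) ((-(1 / (2 * √σ)) / (√σ) ^ 2) • z) σ :=
    hi.smul_const z
  have h2 := (hasFDerivAt_pgk P ((√σ)⁻¹ • z)).comp_hasDerivAt σ h1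
  have h3 : HasDerivAt (fun σ : ℝ => ((√σ) ^ (d + j))⁻¹)
      (-(((d + j : ℕ) : ℝ) * (√σ) ^ (d + j - 1) * (1 / (2 * √σ))) / ((√σ) ^ (d + j)) ^ 2) σ :=
    (h0.pow (d + j)).inv (pow_pos hs _).ne'
  refine (h3.mul h2).congr_deriv ?_
  simp only [sum_apply, smul_apply, map_smul, smul_eq_mul, Ks, Function.comp, lpg, pgk, map_mul,
    map_add, map_sum, MvPolynomial.eval_C, MvPolynomial.eval_X]
  have e1 : (√σ) ^ (d + j + 2) = (√σ) ^ (d + j) * (√σ) ^ 2 := pow_add _ _ _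
  have e2 : ((d + j : ℕ) : ℝ) * (√σ) ^ (d + j - 1) = ((d + j : ℕ) : ℝ) * (√σ) ^ (d + j) / √σ := by
    rcases Nat.eq_zero_or_pos (d + j) with h | h
    · simp [h]
    · rw [mul_div_assoc]; congr 1
      rw [eq_div_iff hs.ne', ← pow_succ, Nat.sub_add_cancel h]
  rw [← add_assoc, e1, e2]
  have hz : ∀ i, prj i z = z i := fun _ => rfl
  simp only [PiLp.smul_apply, smul_eq_mul, hz]
  simp only [mul_add, add_mul, Finset.mul_sum, Finset.sum_mul]
  congr 1
  · field_simp
  · refine Finset.sum_congr rfl fun i _ => ?_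
    field_simp

theorem exists_Ks_bound {d : ℕ} (j : ℕ) (P : MvPolynomial (Fin d) ℝ) :
    ∃ C : ℝ, 0 ≤ C ∧ ∀ σ : ℝ, 0 < σ → ∀ z : Eu d,
      |Ks j P σ z| ≤ C * ((√σ) ^ (d + j))⁻¹ * Real.exp (-‖z‖ ^ 2 / (8 * σ)) := by
  obtain ⟨C, hC, h⟩ := exists_pgk_bound 0 P
  refine ⟨C, hC, fun σ hσ z => ?_⟩
  have hs : 0 < √σ := Real.sqrt_pos.2 hσ
  have := h ((√σ)⁻¹ • z)
  rw [pow_zero, one_mul, norm_smul, mul_pow, norm_inv, Real.norm_of_nonneg hs.le, inv_pow,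
    Real.sq_sqrt hσ.le] at this
  rw [Ks, abs_mul, abs_of_nonneg (by positivity : 0 ≤ ((√σ) ^ (d + j))⁻¹)]
  calc _ ≤ ((√σ) ^ (d + j))⁻¹ * (C * Real.exp (-(1 / 8) * (σ⁻¹ * ‖z‖ ^ 2))) := by gcongr
    _ = C * ((√σ) ^ (d + j))⁻¹ * Real.exp (-(1 / 8) * (σ⁻¹ * ‖z‖ ^ 2)) := by ring
    _ = _ := by congr 2; field_simp

theorem continuousOn_Ks {d : ℕ} (j : ℕ) (P : MvPolynomial (Fin d) ℝ) :
    ContinuousOn (fun p : ℝ × Eu d => Ks j P p.1 p.2) (Ioi 0 ×ˢ univ) := by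
  have hk := continuous_pgk P
  have hs : ∀ p : ℝ × Eu d, p ∈ Ioi (0 : ℝ) ×ˢ (univ : Set (Eu d)) → √p.1 ≠ 0 :=
    fun p hp => (Real.sqrt_pos.2 hp.1).ne'
  have h1 : ContinuousOn (fun p : ℝ × Eu d => (√p.1)⁻¹ • p.2) (Ioi 0 ×ˢ univ) :=
    (ContinuousOn.inv₀ (by fun_prop) hs).smul continuousOn_snd
  refine ContinuousOn.mul (ContinuousOn.inv₀ (by fun_prop) fun p hp => pow_ne_zero _ (hs p hp)) ?_
  exact hk.comp_continuousOn h1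

theorem integral_comp_inv_smul_sub {d : ℕ} (g : Eu d → ℝ) {r : ℝ} (hr : 0 < r) (x : Eu d) :
    ∫ y, (r ^ d)⁻¹ * g (r⁻¹ • (x - y)) = ∫ w, g w := by
  rw [integral_const_mul, integral_sub_left_eq_self (fun y => g (r⁻¹ • y)) volume x,
    Measure.integral_comp_inv_smul volume g r]
  rw [finrank_euclideanSpace_fin, abs_of_pos (by positivity), smul_eq_mul, ← mul_assoc,
    inv_mul_cancel₀ (by positivity), one_mul]

theorem integrable_comp_inv_smul_sub {d : ℕ} {g : Eu d → ℝ} {r : ℝ} (hr : 0 < r) (x : Eu d)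
    (hg : Integrable g) : Integrable (fun y => g (r⁻¹ • (x - y))) := by
  have h1 : Integrable (fun y => g (r⁻¹ • y)) := (integrable_comp_smul_iff volume g
    (inv_ne_zero hr.ne')).2 hg
  exact h1.comp_sub_left x

/-- Change of variables `y = x - √σ w`. -/
theorem integral_Ks_mul {d : ℕ} (j : ℕ) (P : MvPolynomial (Fin d) ℝ) {σ : ℝ} (hσ : 0 < σ)
    (x : Eu d) (f : Eu d → ℝ) :
    ∫ y, Ks j P σ (x - y) * f y = ((√σ) ^ j)⁻¹ * ∫ w, pgk P w * f (x - √σ • w) := by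
  have hs : 0 < √σ := Real.sqrt_pos.2 hσ
  rw [← integral_comp_inv_smul_sub (fun w => pgk P w * f (x - √σ • w)) hs x, ← integral_const_mul]
  refine integral_congr_ae (Eventually.of_forall fun y => ?_)
  simp only [Ks, smul_smul, mul_inv_cancel₀ hs.ne', one_smul, sub_sub_cancel, pow_add, mul_inv]
  ring

theorem integrable_Ks {d : ℕ} (j : ℕ) (P : MvPolynomial (Fin d) ℝ) {σ : ℝ} (hσ : 0 < σ)
    (x : Eu d) : Integrable (fun y => Ks j P σ (x - y)) :=
  (integrable_comp_inv_smul_sub (Real.sqrt_pos.2 hσ) x (integrable_pgk P)).const_mul _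

/-- The weighted `L¹` norm of a polynomial times a Gaussian. -/
noncomputable def wn {d : ℕ} (κ : ℝ) (P : MvPolynomial (Fin d) ℝ) : ℝ :=
  ∫ w : Eu d, ‖w‖ ^ κ * |pgk P w|

theorem wn_nonneg {d : ℕ} (κ : ℝ) (P : MvPolynomial (Fin d) ℝ) : 0 ≤ wn κ P :=
  integral_nonneg fun _ => by positivity

theorem integrable_rpow_mul_pgk {d : ℕ} {κ : ℝ} (h0 : 0 ≤ κ) (h2 : κ ≤ 2)
    (P : MvPolynomial (Fin d) ℝ) : Integrable (fun w : Eu d => ‖w‖ ^ κ * |pgk P w|) := by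
  refine (integrable_pow_mul_pgk 2 P).mono' ?_ (Eventually.of_forall fun w => ?_)
  · have := continuous_pgk P
    have h : Continuous fun w : Eu d => ‖w‖ ^ κ := by
      exact continuous_norm.rpow_const fun _ => Or.inr h0
    exact (h.mul this.abs).aestronglyMeasurable
  · rw [Real.norm_of_nonneg (by positivity)]
    gcongr
    exact rpow_le_one_add_sq (norm_nonneg _) h0 h2

/-- Singular integral bound: if `|f y| ≤ M |x - y| ^ κ` then the kernel gains `σ ^ (κ / 2)`. -/
theorem abs_integral_Ks_mul_le {d : ℕ} (j : ℕ) (P : MvPolynomial (Fin d) ℝ) {σ κ M : ℝ}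
    (hσ : 0 < σ) (h0 : 0 ≤ κ) (h2 : κ ≤ 2) (x : Eu d) (f : Eu d → ℝ)
    (hf : ∀ y, |f y| ≤ M * ‖x - y‖ ^ κ) :
    |∫ y, Ks j P σ (x - y) * f y| ≤ wn κ P * M * ((√σ) ^ j)⁻¹ * (√σ) ^ κ := by
  have hs : 0 < √σ := Real.sqrt_pos.2 hσ
  rw [integral_Ks_mul j P hσ, abs_mul, abs_of_nonneg (by positivity)]
  have : |∫ w, pgk P w * f (x - √σ • w)| ≤ ∫ w, M * (√σ) ^ κ * (‖w‖ ^ κ * |pgk P w|) := by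
    rw [← Real.norm_eq_abs]
    refine norm_integral_le_of_norm_le ((integrable_rpow_mul_pgk h0 h2 P).const_mul _)
      (Eventually.of_forall fun w => ?_)
    rw [norm_mul, Real.norm_eq_abs, Real.norm_eq_abs]
    have := hf (x - √σ • w)
    rw [sub_sub_cancel, norm_smul, Real.norm_of_nonneg hs.le,
      Real.mul_rpow hs.le (norm_nonneg _)] at this
    calc _ ≤ |pgk P w| * (M * ((√σ) ^ κ * ‖w‖ ^ κ)) := by gcongr
      _ = _ := by ring
  rw [integral_const_mul] at this
  calc _ ≤ ((√σ) ^ j)⁻¹ * (M * (√σ) ^ κ * wn κ P) := by gcongr; exact this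
    _ = _ := by ring

theorem integral_abs_Ks {d : ℕ} (j : ℕ) (P : MvPolynomial (Fin d) ℝ) {σ : ℝ} (hσ : 0 < σ)
    (x : Eu d) : ∫ y, |Ks j P σ (x - y)| = ((√σ) ^ j)⁻¹ * wn 0 P := by
  have hs : 0 < √σ := Real.sqrt_pos.2 hσ
  have := integral_comp_inv_smul_sub (fun w => |pgk P w|) hs x
  simp only [wn, Real.rpow_zero, one_mul]
  rw [← this, ← integral_const_mul]
  refine integral_congr_ae (Eventually.of_forall fun y => ?_)
  simp only [Ks, abs_mul, abs_inv, abs_pow, abs_of_pos hs, pow_add, mul_inv]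
  ring

theorem integral_gauss_scale {d : ℕ} {σ b : ℝ} (hσ : 0 < σ) (x : Eu d) :
    ∫ y, Real.exp (-b * ‖x - y‖ ^ 2 / σ) = (√σ) ^ d * ∫ w : Eu d, Real.exp (-b * ‖w‖ ^ 2) := by
  have hs : 0 < √σ := Real.sqrt_pos.2 hσ
  rw [← integral_comp_inv_smul_sub (fun w : Eu d => Real.exp (-b * ‖w‖ ^ 2)) hs x,
    ← integral_const_mul]
  refine integral_congr_ae (Eventually.of_forall fun y => ?_)
  simp only [norm_smul, norm_inv, Real.norm_of_nonneg hs.le, mul_pow, inv_pow, Real.sq_sqrt hσ.le]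
  field_simp

theorem integrable_gauss_scale {d : ℕ} {σ b : ℝ} (hσ : 0 < σ) (hb : 0 < b) (x : Eu d) :
    Integrable (fun y => Real.exp (-b * ‖x - y‖ ^ 2 / σ)) := by
  have hs : 0 < √σ := Real.sqrt_pos.2 hσ
  refine (integrable_comp_inv_smul_sub hs x (integrable_gauss b hb)).congr
    (Eventually.of_forall fun y => ?_)
  simp only [norm_smul, norm_inv, Real.norm_of_nonneg hs.le, mul_pow, inv_pow, Real.sq_sqrt hσ.le]
  field_simp

theorem min_one_le_rpow {x θ : ℝ} (hx : 0 ≤ x) (h0 : 0 ≤ θ) (h1 : θ ≤ 1) : min 1 x ≤ x ^ θ := by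
  rcases le_total x 1 with h | h
  · rw [min_eq_right h]
    rcases hx.eq_or_lt with rfl | hx
    · positivity
    · simpa using Real.rpow_le_rpow_of_exponent_ge hx h h1
  · rw [min_eq_left h]
    exact Real.one_le_rpow h h0

/-- `L¹` modulus of continuity of the kernels in time. -/
theorem exists_Ks_time_diff {d : ℕ} (j : ℕ) (P : MvPolynomial (Fin d) ℝ) :
    ∃ C : ℝ, 0 ≤ C ∧ ∀ σ h : ℝ, 0 < σ → 0 ≤ h → ∀ x : Eu d,
      ∫ y, |Ks j P (σ + h) (x - y) - Ks j P σ (x - y)| ≤ C * ((√σ) ^ j)⁻¹ * min 1 (h / σ) := by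
  obtain ⟨C, hC, hb⟩ := exists_Ks_bound (j + 2) (lpg j P)
  obtain ⟨I, hI'⟩ : ∃ I : ℝ, I = ∫ w : Eu d, Real.exp (-(1 / 16) * ‖w‖ ^ 2) := ⟨_, rfl⟩
  have hI : 0 ≤ I := hI' ▸ integral_nonneg fun _ => by positivity
  refine ⟨C * I + 2 * wn 0 P, by have := wn_nonneg 0 P; positivity, fun σ h hσ hh x => ?_⟩
  have hs : 0 < √σ := Real.sqrt_pos.2 hσ
  have hwn := wn_nonneg 0 P
  rcases le_total h σ with hle | hle
  · rw [min_eq_right ((div_le_one hσ).2 hle)]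
    have key : ∀ z : Eu d, |Ks j P (σ + h) z - Ks j P σ z| ≤
        (C * ((√σ) ^ (d + (j + 2)))⁻¹ * h) * Real.exp (-(1 / 16) * ‖z‖ ^ 2 / σ) := by
      intro z
      have := (convex_Icc σ (σ + h)).norm_image_sub_le_of_norm_hasDerivWithin_le
        (f := fun σ => Ks j P σ z)
        (f' := fun σ => Ks (j + 2) (lpg j P) σ z)
        (C := C * ((√σ) ^ (d + (j + 2)))⁻¹ * Real.exp (-(1 / 16) * ‖z‖ ^ 2 / σ))
        (fun s hs' => (hasDerivAt_Ks j P (hσ.trans_le hs'.1) z).hasDerivWithinAt)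
        (fun s hs' => by
          have h0 : 0 < s := hσ.trans_le hs'.1
          refine (hb s h0 z).trans ?_
          have e1 : √σ ≤ √s := Real.sqrt_le_sqrt hs'.1
          gcongr ?_ * ?_ * Real.exp ?_
          · gcongr
          · rw [neg_mul, neg_div, neg_div, neg_le_neg_iff, div_le_div_iff₀ hσ (by positivity)]
            nlinarith [sq_nonneg ‖z‖, hs'.2])
        (left_mem_Icc.2 (by linarith)) (right_mem_Icc.2 (by linarith))
      rw [Real.norm_eq_abs, Real.norm_eq_abs, add_sub_cancel_left, abs_of_nonneg hh] at this
      linarith [this]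
    calc _ ≤ ∫ y, (C * ((√σ) ^ (d + (j + 2)))⁻¹ * h) * Real.exp (-(1 / 16) * ‖x - y‖ ^ 2 / σ) := by
          refine integral_mono_of_nonneg (Eventually.of_forall fun y => abs_nonneg _)
            ((integrable_gauss_scale hσ (by norm_num) x).const_mul _)
            (Eventually.of_forall fun y => key _)
      _ = C * I * ((√σ) ^ j)⁻¹ * (h / σ) := by
          rw [integral_const_mul, integral_gauss_scale hσ, ← hI']
          simp only [pow_add, Real.sq_sqrt hσ.le]
          field_simp
      _ ≤ _ := by gcongr; linarith
  · rw [min_eq_left ((one_le_div hσ).2 hle)]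
    have i1 := (integrable_Ks j P (by linarith : 0 < σ + h) x).abs
    have i2 := (integrable_Ks j P hσ x).abs
    calc _ ≤ ∫ y, (|Ks j P (σ + h) (x - y)| + |Ks j P σ (x - y)|) := by
          refine integral_mono_of_nonneg (Eventually.of_forall fun y => abs_nonneg _) (i1.add i2)
            (Eventually.of_forall fun y => abs_sub _ _)
      _ = ((√(σ + h)) ^ j)⁻¹ * wn 0 P + ((√σ) ^ j)⁻¹ * wn 0 P := by
          rw [integral_add i1 i2, integral_abs_Ks j P (by linarith), integral_abs_Ks j P hσ]
      _ ≤ ((√σ) ^ j)⁻¹ * wn 0 P + ((√σ) ^ j)⁻¹ * wn 0 P := by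
          gcongr; linarith
      _ = 2 * wn 0 P * ((√σ) ^ j)⁻¹ := by ring
      _ ≤ _ := by
          rw [mul_one]; gcongr; nlinarith [mul_nonneg hC hI]

/-- `L¹` modulus of continuity of the kernels in space. -/
theorem exists_Ks_space_diff {d : ℕ} (j : ℕ) (P : MvPolynomial (Fin d) ℝ) :
    ∃ C : ℝ, 0 ≤ C ∧ ∀ σ : ℝ, 0 < σ → ∀ x x' : Eu d,
      ∫ y, |Ks j P σ (x' - y) - Ks j P σ (x - y)| ≤
        C * ((√σ) ^ j)⁻¹ * min 1 (‖x' - x‖ / √σ) := by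
  choose C hC hb using fun i => exists_Ks_bound (j + 1) (dpg (d := d) i P)
  obtain ⟨I, hI'⟩ : ∃ I : ℝ, I = ∫ w : Eu d, Real.exp (-(1 / 16) * ‖w‖ ^ 2) := ⟨_, rfl⟩
  have hI : 0 ≤ I := hI' ▸ integral_nonneg fun _ => by positivity
  have hS : 0 ≤ ∑ i, C i := Finset.sum_nonneg fun i _ => hC i
  refine ⟨(∑ i, C i) * Real.exp (1 / 8) * I + 2 * wn 0 P,
    by have := wn_nonneg 0 P; positivity, fun σ hσ x x' => ?_⟩
  have hs : 0 < √σ := Real.sqrt_pos.2 hσ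
  have hwn := wn_nonneg 0 P
  rcases le_total ‖x' - x‖ (√σ) with hle | hle
  · rw [min_eq_right ((div_le_one hs).2 hle)]
    have key : ∀ z e : Eu d, ‖e‖ ≤ √σ → |Ks j P σ (z + e) - Ks j P σ z| ≤
        ((∑ i, C i) * ((√σ) ^ (d + (j + 1)))⁻¹ * Real.exp (1 / 8) * ‖e‖) *
          Real.exp (-(1 / 16) * ‖z‖ ^ 2 / σ) := by
      intro z e he
      have := (convex_segment z (z + e)).norm_image_sub_le_of_norm_hasFDerivWithin_le
        (f := Ks j P σ)
        (f' := fun z => ∑ i, Ks (j + 1) (dpg i P) σ z • prj i)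
        (C := (∑ i, C i) * ((√σ) ^ (d + (j + 1)))⁻¹ * Real.exp (1 / 8) *
          Real.exp (-(1 / 16) * ‖z‖ ^ 2 / σ))
        (fun y _ => (hasFDerivAt_Ks j P hσ y).hasFDerivWithinAt)
        (fun y hy => by
          rw [segment_eq_image'] at hy
          obtain ⟨θ, hθ, rfl⟩ := hy
          simp only [add_sub_cancel_left]
          have hz : ‖z‖ ^ 2 ≤ 2 * ‖z + θ • e‖ ^ 2 + 2 * σ := by
            have h1 : ‖z‖ ≤ ‖z + θ • e‖ + √σ := by
              have h2 : ‖θ • e‖ ≤ √σ := by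
                rw [norm_smul, Real.norm_of_nonneg hθ.1]
                nlinarith [norm_nonneg e, hθ.2]
              have h3 := norm_sub_le (z + θ • e) (θ • e)
              rw [add_sub_cancel_right] at h3
              linarith
            have h4 := Real.sq_sqrt hσ.le
            nlinarith [norm_nonneg z, sq_nonneg (‖z + θ • e‖ - √σ)]
          refine (norm_sum_le _ _).trans ?_
          rw [Finset.sum_mul, Finset.sum_mul, Finset.sum_mul]
          refine Finset.sum_le_sum fun i _ => ?_
          rw [norm_smul, Real.norm_eq_abs]
          have hp : ‖prj (d := d) i‖ ≤ 1 :=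
            ContinuousLinearMap.opNorm_le_bound _ zero_le_one fun v => by
              simpa using PiLp.norm_apply_le v i
          calc _ ≤ |Ks (j + 1) (dpg i P) σ (z + θ • e)| * 1 := by gcongr
            _ ≤ C i * ((√σ) ^ (d + (j + 1)))⁻¹ * Real.exp (-‖z + θ • e‖ ^ 2 / (8 * σ)) := by
                rw [mul_one]; exact hb i σ hσ _
            _ ≤ C i * ((√σ) ^ (d + (j + 1)))⁻¹ *
                  Real.exp (1 / 8 + -(1 / 16) * ‖z‖ ^ 2 / σ) := by
                have := hC i
                gcongr
                rw [div_le_iff₀ (by positivity)]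
                have e1 : (1 / 8 + -(1 / 16) * ‖z‖ ^ 2 / σ) * (8 * σ) = σ - ‖z‖ ^ 2 / 2 := by
                  field_simp; ring
                rw [e1]; linarith
            _ = _ := by rw [Real.exp_add]; ring)
        (left_mem_segment ℝ _ _) (right_mem_segment ℝ _ _)
      rw [Real.norm_eq_abs, add_sub_cancel_left] at this
      linarith [this]
    have key2 : ∀ y, |Ks j P σ (x' - y) - Ks j P σ (x - y)| ≤
        ((∑ i, C i) * ((√σ) ^ (d + (j + 1)))⁻¹ * Real.exp (1 / 8) * ‖x' - x‖) *
          Real.exp (-(1 / 16) * ‖x - y‖ ^ 2 / σ) := fun y => by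
      have := key (x - y) (x' - x) hle
      rwa [show x - y + (x' - x) = x' - y by abel] at this
    calc _ ≤ ∫ y, ((∑ i, C i) * ((√σ) ^ (d + (j + 1)))⁻¹ * Real.exp (1 / 8) * ‖x' - x‖) *
          Real.exp (-(1 / 16) * ‖x - y‖ ^ 2 / σ) := by
          refine integral_mono_of_nonneg (Eventually.of_forall fun y => abs_nonneg _)
            ((integrable_gauss_scale hσ (by norm_num) x).const_mul _)
            (Eventually.of_forall key2)
      _ = (∑ i, C i) * Real.exp (1 / 8) * I * ((√σ) ^ j)⁻¹ * (‖x' - x‖ / √σ) := by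
          rw [integral_const_mul, integral_gauss_scale hσ, ← hI']
          simp only [pow_add, pow_one]
          field_simp
      _ ≤ _ := by gcongr; linarith
  · rw [min_eq_left ((one_le_div hs).2 hle)]
    have i1 := (integrable_Ks j P hσ x').abs
    have i2 := (integrable_Ks j P hσ x).abs
    calc _ ≤ ∫ y, (|Ks j P σ (x' - y)| + |Ks j P σ (x - y)|) := by
          refine integral_mono_of_nonneg (Eventually.of_forall fun y => abs_nonneg _) (i1.add i2)
            (Eventually.of_forall fun y => abs_sub _ _)
      _ = 2 * wn 0 P * ((√σ) ^ j)⁻¹ := by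
          rw [integral_add i1 i2, integral_abs_Ks j P hσ, integral_abs_Ks j P hσ]; ring
      _ ≤ _ := by
          rw [mul_one]; gcongr
          have : 0 ≤ (∑ i, C i) * Real.exp (1 / 8) * I := by positivity
          linarith

/-- The polynomial factor of the heat kernel. -/
noncomputable def hp0 (d : ℕ) : MvPolynomial (Fin d) ℝ :=
  MvPolynomial.C ((4 * Real.pi) ^ (-(d : ℝ) / 2))

theorem integral_pgk_hp0 (d : ℕ) : ∫ z : Eu d, pgk (hp0 d) z = 1 := by
  have h := GaussianFourier.integral_rexp_neg_mul_sq_norm (V := Eu d)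
    (b := 1 / 4) (by norm_num)
  have e : ∀ z : Eu d, pgk (hp0 d) z =
      (4 * Real.pi) ^ (-(d : ℝ) / 2) * Real.exp (-(1 / 4) * ‖z‖ ^ 2) := fun z => by
    simp only [pgk, hp0, MvPolynomial.eval_C]; ring_nf
  simp only [e]
  rw [integral_const_mul, h, finrank_euclideanSpace_fin,
    show Real.pi / (1 / 4) = 4 * Real.pi by ring, ← Real.rpow_add (by positivity)]
  rw [show -(d : ℝ) / 2 + (d : ℝ) / 2 = 0 by ring, Real.rpow_zero]

theorem lpg_hp0 (d : ℕ) : lpg 0 (hp0 d) = ∑ i, dpg i (dpg i (hp0 d)) := by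
  have h : ∀ i, dpg i (dpg i (hp0 d)) = MvPolynomial.C (-1 / 2) *
      (hp0 d + MvPolynomial.X i * dpg i (hp0 d)) := fun i => by
    simp only [dpg, hp0, MvPolynomial.pderiv_C, zero_sub, map_neg, Derivation.leibniz,
      smul_eq_mul, MvPolynomial.pderiv_X_self]
    have : (MvPolynomial.C (-1 / 2) : MvPolynomial (Fin d) ℝ) = - MvPolynomial.C (1 / 2) := by
      rw [← map_neg]; norm_num
    rw [this]; simp; ring
  simp only [h, lpg, add_zero]
  rw [← Finset.mul_sum, Finset.sum_add_distrib]
  simp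

/-- The Laplacian. -/
noncomputable def lap {d : ℕ} (f : Eu d → ℝ) (x : Eu d) : ℝ := ∑ i, pd i (pd i f) x

theorem pd_eq_of_hasFDerivAt {d : ℕ} {f : Eu d → ℝ} {x : Eu d} {g : Fin d → ℝ}
    (h : HasFDerivAt f (∑ i, g i • prj i) x) (i : Fin d) : pd i f x = g i := by
  rw [pd, h.fderiv]
  simp [PiLp.single_apply]

theorem contDiff_pd {d : ℕ} {f : Eu d → ℝ} (hf : ContDiff ℝ ∞ f) (i : Fin d) :
    ContDiff ℝ ∞ (pd i f) :=
  (hf.fderiv_right (m := ∞) (by simp)).clm_apply contDiff_const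

theorem contDiff_lap {d : ℕ} {f : Eu d → ℝ} (hf : ContDiff ℝ ∞ f) : ContDiff ℝ ∞ (lap f) :=
  ContDiff.sum fun i _ => contDiff_pd (contDiff_pd hf i) i

theorem tsupport_pd_subset {d : ℕ} (f : Eu d → ℝ) (i : Fin d) : tsupport (pd i f) ⊆ tsupport f :=
  tsupport_fderiv_apply_subset ℝ _

theorem tsupport_lap_subset {d : ℕ} (f : Eu d → ℝ) : tsupport (lap f) ⊆ tsupport f := by
  refine closure_minimal (fun x hx => ?_) (isClosed_tsupport f)
  by_contra hn
  refine hx (Finset.sum_eq_zero fun i _ => ?_)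
  exact image_eq_zero_of_notMem_tsupport fun h =>
    hn (tsupport_pd_subset f i (tsupport_pd_subset _ i h))

theorem pd_mul {d : ℕ} {f g : Eu d → ℝ} (hf : ContDiff ℝ ∞ f) (hg : ContDiff ℝ ∞ g) (i : Fin d) :
    pd i (fun y => f y * g y) = fun y => pd i f y * g y + f y * pd i g y := by
  funext y
  have h1 := (hf.differentiable (by simp)) y
  have h2 := (hg.differentiable (by simp)) y
  rw [pd, fderiv_fun_mul h1 h2]
  simp [pd]; ring

theorem pd_add {d : ℕ} {f g : Eu d → ℝ} (hf : Differentiable ℝ f) (hg : Differentiable ℝ g)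
    (i : Fin d) : pd i (fun y => f y + g y) = fun y => pd i f y + pd i g y := by
  funext y
  rw [pd, fderiv_fun_add (hf y) (hg y)]
  simp [pd]

theorem lap_mul {d : ℕ} {f g : Eu d → ℝ} (hf : ContDiff ℝ ∞ f) (hg : ContDiff ℝ ∞ g) (y : Eu d) :
    lap (fun y => f y * g y) y = lap f y * g y + 2 * ∑ i, pd i f y * pd i g y + f y * lap g y := by
  have h : ∀ i, pd i (pd i (fun y => f y * g y)) y =
      pd i (pd i f) y * g y + 2 * (pd i f y * pd i g y) + f y * pd i (pd i g) y := fun i => by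
    have hfi := contDiff_pd hf i
    have hgi := contDiff_pd hg i
    rw [pd_mul hf hg, pd_add ((hfi.mul hg).differentiable (by simp))
      ((hf.mul hgi).differentiable (by simp)), pd_mul hfi hg, pd_mul hf hgi]
    ring
  simp only [lap, h, Finset.sum_add_distrib, Finset.sum_mul, Finset.mul_sum]

theorem contDiff_pgk {d : ℕ} (P : MvPolynomial (Fin d) ℝ) : ContDiff ℝ ∞ (pgk P) := by
  have h1 : ContDiff ℝ ∞ fun z : Eu d => MvPolynomial.eval (fun i => z i) P := by
    induction P using MvPolynomial.induction_on with
    | C a => simpa using contDiff_const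
    | add p q hp hq => simpa using hp.add hq
    | mul_X p j hp =>
      simp only [map_mul, MvPolynomial.eval_X]
      exact hp.mul (prj (d := d) j).contDiff
  have h2 : ContDiff ℝ ∞ fun z : Eu d => Real.exp (-‖z‖ ^ 2 / 4) :=
    (((contDiff_id (𝕜 := ℝ) (E := Eu d)).norm_sq ℝ).neg.div_const 4).exp
  exact h1.mul h2

theorem contDiff_Ks_sub {d : ℕ} (j : ℕ) (P : MvPolynomial (Fin d) ℝ) (σ : ℝ) (x : Eu d) :
    ContDiff ℝ ∞ fun y => Ks j P σ (x - y) := by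
  unfold Ks
  have h : ContDiff ℝ ∞ fun y : Eu d => (√σ)⁻¹ • (x - y) := by fun_prop
  exact contDiff_const.mul ((contDiff_pgk P).comp h)

theorem pd_Ks_sub {d : ℕ} (j : ℕ) (P : MvPolynomial (Fin d) ℝ) {σ : ℝ} (hσ : 0 < σ) (x : Eu d)
    (i : Fin d) :
    pd i (fun y => Ks j P σ (x - y)) = fun y => -Ks (j + 1) (dpg i P) σ (x - y) := by
  funext y
  have h : HasFDerivAt (fun y => x - y) (-ContinuousLinearMap.id ℝ (Eu d)) y := by
    simpa using (hasFDerivAt_id y).const_sub x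
  have h2 := (hasFDerivAt_Ks j P hσ (x - y)).comp y h
  refine pd_eq_of_hasFDerivAt (g := fun i => -Ks (j + 1) (dpg i P) σ (x - y))
    (h2.congr_fderiv ?_) i
  ext v
  simp

theorem pgk_sum {d : ℕ} {ι : Type*} (s : Finset ι) (P : ι → MvPolynomial (Fin d) ℝ) (z : Eu d) :
    pgk (∑ i ∈ s, P i) z = ∑ i ∈ s, pgk (P i) z := by
  simp [pgk, Finset.sum_mul]

theorem lap_Ks_sub {d : ℕ} {σ : ℝ} (hσ : 0 < σ) (x y : Eu d) :
    lap (fun y => Ks 0 (hp0 d) σ (x - y)) y = Ks 2 (lpg 0 (hp0 d)) σ (x - y) := by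
  have h : ∀ i, pd i (pd i fun y => Ks 0 (hp0 d) σ (x - y)) y =
      Ks 2 (dpg i (dpg i (hp0 d))) σ (x - y) := fun i => by
    rw [pd_Ks_sub 0 _ hσ]
    have h1 := pd_Ks_sub 1 (dpg i (hp0 d)) hσ x i
    have h2 : pd i (fun y => -Ks (0 + 1) (dpg i (hp0 d)) σ (x - y)) y =
        -pd i (fun y => Ks 1 (dpg i (hp0 d)) σ (x - y)) y := by
      rw [pd, pd, fderiv_fun_neg]; simp
    rw [h2, h1]; simp
  simp only [lap, h]
  simp only [Ks, lpg_hp0, pgk_sum, Finset.mul_sum]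

/-- Jointly continuous functions of space and time whose spatial support is contained in a fixed
compact set. -/
structure CCS {d : ℕ} (f : Eu d → ℝ → ℝ) : Prop where
  cont : Continuous fun q : Eu d × ℝ => f q.1 q.2
  supp : ∃ K : Set (Eu d), IsCompact K ∧ ∀ y ∉ K, ∀ s, f y s = 0

theorem CCS.mul {d : ℕ} {u : Eu d → ℝ → ℝ} {ζ : Eu d → ℝ}
    (hu : Continuous fun q : Eu d × ℝ => u q.1 q.2) (hζ : Continuous ζ)
    (hs : HasCompactSupport ζ) : CCS fun y s => u y s * ζ y where
  cont := hu.mul (hζ.comp continuous_fst)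
  supp := ⟨tsupport ζ, hs, fun y hy s => by simp [image_eq_zero_of_notMem_tsupport hy]⟩

theorem CCS.add {d : ℕ} {f g : Eu d → ℝ → ℝ} (hf : CCS f) (hg : CCS g) :
    CCS fun y s => f y s + g y s where
  cont := hf.cont.add hg.cont
  supp := by
    obtain ⟨K, hK, h1⟩ := hf.supp
    obtain ⟨L, hL, h2⟩ := hg.supp
    refine ⟨K ∪ L, hK.union hL, fun y hy s => ?_⟩
    rw [h1 y (fun h => hy (Or.inl h)), h2 y (fun h => hy (Or.inr h)), add_zero]

theorem CCS.continuous_time {d : ℕ} {f : Eu d → ℝ → ℝ} (hf : CCS f) (y : Eu d) :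
    Continuous (f y) := hf.cont.comp (by fun_prop : Continuous fun s : ℝ => (y, s))

theorem CCS.continuous_space {d : ℕ} {f : Eu d → ℝ → ℝ} (hf : CCS f) (s : ℝ) :
    Continuous fun y => f y s := hf.cont.comp (by fun_prop : Continuous fun y : Eu d => (y, s))

theorem CCS.hasCompactSupport {d : ℕ} {f : Eu d → ℝ → ℝ} (hf : CCS f) (s : ℝ) :
    HasCompactSupport fun y => f y s := by
  obtain ⟨K, hK, h⟩ := hf.supp
  exact HasCompactSupport.intro hK fun y hy => h y hy s

theorem CCS.integrable {d : ℕ} {f : Eu d → ℝ → ℝ} (hf : CCS f) (s : ℝ) :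
    Integrable fun y => f y s :=
  (hf.continuous_space s).integrable_of_hasCompactSupport (hf.hasCompactSupport s)

theorem CCS.integrable_mul {d : ℕ} {f : Eu d → ℝ → ℝ} (hf : CCS f) (s : ℝ) {k : Eu d → ℝ}
    (hk : Continuous k) : Integrable fun y => k y * f y s :=
  (hk.mul (hf.continuous_space s)).integrable_of_hasCompactSupport
    ((hf.hasCompactSupport s).mul_left)

theorem CCS.continuous_integral {d : ℕ} {f : Eu d → ℝ → ℝ} (hf : CCS f) :
    Continuous fun s => ∫ y, f y s := by
  obtain ⟨K, hK, h⟩ := hf.supp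
  rw [← continuousOn_univ]
  refine continuousOn_integral_of_compact_support (f := fun s y => f y s) hK ?_
    (fun s y _ hy => h y hy s)
  exact (hf.cont.comp continuous_swap).continuousOn

/-- Convolution of the slice `f · s` with a rescaled kernel. -/
noncomputable def cv {d : ℕ} (j : ℕ) (P : MvPolynomial (Fin d) ℝ) (f : Eu d → ℝ → ℝ)
    (x : Eu d) (s σ : ℝ) : ℝ := ∫ y, Ks j P σ (x - y) * f y s

theorem continuousOn_cv {d : ℕ} (j : ℕ) (P : MvPolynomial (Fin d) ℝ) {f : Eu d → ℝ → ℝ}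
    (hf : CCS f) :
    ContinuousOn (fun q : Eu d × ℝ × ℝ => cv j P f q.1 q.2.1 q.2.2) {q | 0 < q.2.2} := by
  obtain ⟨K, hK, h⟩ := hf.supp
  refine continuousOn_integral_of_compact_support
    (f := fun (q : Eu d × ℝ × ℝ) y => Ks j P q.2.2 (q.1 - y) * f y q.2.1) hK ?_
    (fun q y _ hy => by rw [h y hy, mul_zero])
  refine ContinuousOn.mul ?_ (hf.cont.comp (by fun_prop :
    Continuous fun q : (Eu d × ℝ × ℝ) × Eu d => (q.2, q.1.2.1))).continuousOn
  exact (continuousOn_Ks j P).comp (f := fun q : (Eu d × ℝ × ℝ) × Eu d => (q.1.2.2, q.1.1 - q.2))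
    (by fun_prop) (fun q hq => ⟨hq.1, mem_univ _⟩)

theorem abs_cv_le {d : ℕ} (j : ℕ) (P : MvPolynomial (Fin d) ℝ) {f : Eu d → ℝ → ℝ}
    {σ κ M s : ℝ} (hσ : 0 < σ) (h0 : 0 ≤ κ) (h2 : κ ≤ 2) (x : Eu d)
    (hf : ∀ y, |f y s| ≤ M * ‖x - y‖ ^ κ) :
    |cv j P f x s σ| ≤ wn κ P * M * σ ^ ((κ - j) / 2) := by
  refine (abs_integral_Ks_mul_le j P hσ h0 h2 x _ hf).trans_eq ?_
  rw [mul_assoc]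
  congr 1
  rw [Real.sqrt_eq_rpow, ← Real.rpow_natCast, ← Real.rpow_mul hσ.le, ← Real.rpow_mul hσ.le,
    ← Real.rpow_neg hσ.le, ← Real.rpow_add hσ]
  congr 1; ring

theorem cv_eq_zero {d : ℕ} (j : ℕ) (P : MvPolynomial (Fin d) ℝ) {f : Eu d → ℝ → ℝ} {s : ℝ}
    (hf : ∀ y, f y s = 0) (x : Eu d) (σ : ℝ) : cv j P f x s σ = 0 := by
  simp [cv, hf]

theorem hasDerivAt_cv {d : ℕ} (j : ℕ) (P : MvPolynomial (Fin d) ℝ) {f : Eu d → ℝ → ℝ}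
    (hf : CCS f) (x : Eu d) (s : ℝ) {σ : ℝ} (hσ : 0 < σ) :
    HasDerivAt (cv j P f x s) (cv (j + 2) (lpg j P) f x s σ) σ := by
  obtain ⟨C, hC, hb⟩ := exists_Ks_bound (j + 2) (lpg j P)
  have hk : ∀ (j : ℕ) P (σ : ℝ), Continuous fun y => Ks j P σ (x - y) :=
    fun j P σ => (contDiff_Ks_sub j P σ x).continuous
  refine (hasDerivAt_integral_of_dominated_loc_of_deriv_le
    (F := fun σ y => Ks j P σ (x - y) * f y s)
    (F' := fun σ y => Ks (j + 2) (lpg j P) σ (x - y) * f y s)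
    (bound := fun y => C * ((√(σ / 2)) ^ (d + (j + 2)))⁻¹ * |f y s|)
    (s := Ioi (σ / 2)) (Ioi_mem_nhds (by linarith))
    (Eventually.of_forall fun σ' => (hf.integrable_mul s (hk j P σ')).aestronglyMeasurable)
    (hf.integrable_mul s (hk j P σ))
    (hf.integrable_mul s (hk (j + 2) _ σ)).aestronglyMeasurable
    (Eventually.of_forall fun y σ' hσ' => ?_) ((hf.integrable s).abs.const_mul _)
    (Eventually.of_forall fun y σ' hσ' => ?_)).2
  · have h1 : 0 < σ' := by have : σ / 2 < σ' := hσ'; linarith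
    rw [norm_mul, Real.norm_eq_abs, Real.norm_eq_abs]
    gcongr
    refine (hb σ' h1 _).trans ?_
    have h2 : √(σ / 2) ≤ √σ' := Real.sqrt_le_sqrt (le_of_lt hσ')
    have h3 : 0 < √(σ / 2) := Real.sqrt_pos.2 (by linarith)
    have h4 : Real.exp (-‖x - y‖ ^ 2 / (8 * σ')) ≤ 1 := by
      rw [Real.exp_le_one_iff, neg_div, neg_nonpos]; positivity
    calc _ ≤ C * ((√σ') ^ (d + (j + 2)))⁻¹ * 1 := by gcongr
      _ ≤ _ := by rw [mul_one]; gcongr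
  · have h1 : 0 < σ' := by have : σ / 2 < σ' := hσ'; linarith
    exact (hasDerivAt_Ks j P h1 _).mul_const _

/-- Derivative of a function of two variables along an antidiagonal. -/
theorem hasDerivAt_antidiagonal {W D : ℝ → ℝ → ℝ} {t σ c : ℝ} (hσ : 0 < σ)
    (h1 : HasDerivAt (fun s => W s σ) c (t - σ))
    (h2 : ∀ s σ', 0 < σ' → HasDerivAt (W s) (D s σ') σ')
    (h3 : ContinuousAt (fun q : ℝ × ℝ => D q.1 q.2) (t - σ, σ)) :
    HasDerivAt (fun σ => W (t - σ) σ) (D (t - σ) σ - c) σ := by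
  have e1 : HasDerivAt (fun τ => W (t - τ) σ) (-c) σ := by
    have : HasDerivAt (fun τ : ℝ => t - τ) (-1) σ := by simpa using (hasDerivAt_id σ).const_sub t
    simpa [Function.comp_def] using h1.comp σ this
  have e2 : HasDerivAt (fun τ => W (t - τ) τ - W (t - τ) σ) (D (t - σ) σ) σ := by
    rw [hasDerivAt_iff_isLittleO, Asymptotics.isLittleO_iff]
    intro ε hε
    have h4 : Tendsto (fun q : ℝ × ℝ => D q.1 q.2) (𝓝 (t - σ) ×ˢ 𝓝 σ) (𝓝 (D (t - σ) σ)) := by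
      rw [← nhds_prod_eq]; exact h3
    have h5 := h4.eventually (Metric.ball_mem_nhds _ hε)
    obtain ⟨p, hp, q, hq, hpq⟩ := Filter.eventually_prod_iff.1 h5
    obtain ⟨r, hr, hqr⟩ := Metric.eventually_nhds_iff_ball.1 (hq.and (Ioi_mem_nhds hσ))
    have hp' : ∀ᶠ τ in 𝓝 σ, p (t - τ) :=
      (show ContinuousAt (fun τ : ℝ => t - τ) σ by fun_prop).eventually hp
    filter_upwards [hp', Metric.ball_mem_nhds σ hr] with τ hτ hτr
    have := (convex_ball σ r).norm_image_sub_le_of_norm_hasDerivWithin_le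
      (f := fun τ' => W (t - τ) τ' - τ' * D (t - σ) σ)
      (f' := fun τ' => D (t - τ) τ' - 1 * D (t - σ) σ) (C := ε)
      (fun τ' hτ' => ((h2 (t - τ) τ' (hqr τ' hτ').2).sub
        ((hasDerivAt_id τ').mul_const _)).hasDerivWithinAt)
      (fun τ' hτ' => by
        have := hpq hτ (hqr τ' hτ').1
        rw [one_mul]; exact (mem_ball_iff_norm.1 this).le)
      (Metric.mem_ball_self hr) hτr
    refine le_trans (le_of_eq ?_) this
    simp only [smul_eq_mul, sub_self]
    congr 1; ring
  have := e2.add e1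
  refine (this.congr_deriv (by ring)).congr_of_eventuallyEq
    (Eventually.of_forall fun τ => ?_)
  simp

/-- `u` is a (time-integrated) weak solution on the whole space of `u_t = A Δu + g`, and `u`, `g`
vanish for nonpositive times. -/
structure IsWeak {d : ℕ} (A : Eu d → ℝ) (u g : Eu d → ℝ → ℝ) : Prop where
  cu : Continuous fun q : Eu d × ℝ => u q.1 q.2
  cg : Continuous fun q : Eu d × ℝ => g q.1 q.2
  u0 : ∀ y s, s ≤ 0 → u y s = 0
  g0 : ∀ y s, s ≤ 0 → g y s = 0
  weak : ∀ ρ : Eu d → ℝ, ContDiff ℝ ∞ ρ → HasCompactSupport ρ → ∀ t : ℝ,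
    ∫ y, u y t * (ρ y / A y) =
      ∫ s in (0 : ℝ)..t, ∫ y, (u y s * lap ρ y + g y s * (ρ y / A y))

theorem exists_bound_on_compact {d : ℕ} {f : Eu d → ℝ → ℝ}
    (hf : Continuous fun q : Eu d × ℝ => f q.1 q.2) (h0 : ∀ y s, s ≤ 0 → f y s = 0)
    {K : Set (Eu d)} (hK : IsCompact K) (t : ℝ) :
    ∃ M, 0 ≤ M ∧ ∀ y ∈ K, ∀ s, s ≤ t → |f y s| ≤ M := by
  obtain ⟨M, hM⟩ := (hK.prod (isCompact_Icc (a := 0) (b := t))).exists_bound_of_continuousOn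
    hf.continuousOn
  refine ⟨max M 0, le_max_right _ _, fun y hy s hs => ?_⟩
  rcases le_or_gt s 0 with hs0 | hs0
  · simp [h0 y s hs0]
  · exact (hM (y, s) ⟨hy, hs0.le, hs⟩).trans (le_max_left _ _)

theorem CCS.exists_bound {d : ℕ} {f : Eu d → ℝ → ℝ} (hf : CCS f)
    (h0 : ∀ y s, s ≤ 0 → f y s = 0) (t : ℝ) : ∃ M, 0 ≤ M ∧ ∀ y s, s ≤ t → |f y s| ≤ M := by
  obtain ⟨K, hK, h⟩ := hf.supp
  obtain ⟨M, hM0, hM⟩ := exists_bound_on_compact hf.cont h0 hK t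
  refine ⟨M, hM0, fun y s hs => ?_⟩
  by_cases hy : y ∈ K
  · exact hM y hy s hs
  · simpa [h y hy] using hM0

theorem continuousOn_cv_comp {d : ℕ} (j : ℕ) (P : MvPolynomial (Fin d) ℝ) {f : Eu d → ℝ → ℝ}
    (hf : CCS f) (x : Eu d) (t : ℝ) {a : ℝ} (ha : 0 < a) :
    ContinuousOn (fun σ => cv j P f x (t - σ) (a * σ)) (Ioi 0) :=
  (continuousOn_cv j P hf).comp (f := fun σ : ℝ => (x, t - σ, a * σ))
    (by fun_prop) (fun σ hσ => mul_pos ha hσ)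

theorem integrableOn_cv {d : ℕ} (j : ℕ) (P : MvPolynomial (Fin d) ℝ) {f : Eu d → ℝ → ℝ}
    (hf : CCS f) (h0 : ∀ y s, s ≤ 0 → f y s = 0) {x : Eu d} {t a κ M : ℝ} (ha : 0 < a)
    (hκ0 : 0 ≤ κ) (hκ2 : κ ≤ 2) (hj : j < κ + 2)
    (hb : ∀ y s, s ≤ t → |f y s| ≤ M * ‖x - y‖ ^ κ) :
    IntegrableOn (fun σ => cv j P f x (t - σ) (a * σ)) (Ioi 0) := by
  have hm : AEStronglyMeasurable (fun σ => cv j P f x (t - σ) (a * σ))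
      (volume.restrict (Ioi 0)) :=
    (continuousOn_cv_comp j P hf x t ha).aestronglyMeasurable measurableSet_Ioi
  rcases le_or_gt t 0 with ht | ht
  · refine (integrableOn_zero (ε' := ℝ)).congr_fun (fun σ hσ => ?_) measurableSet_Ioi
    have hσ : 0 < σ := hσ
    exact (cv_eq_zero j P (fun y => h0 y _ (by linarith)) x _).symm
  have h1 : IntegrableOn (fun σ : ℝ => wn κ P * M * a ^ ((κ - j) / 2) * σ ^ ((κ - j) / 2))
      (Ioc 0 t) := by
    refine ((intervalIntegral.intervalIntegrable_rpow' (a := 0) (b := t)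
      (r := (κ - j) / 2) (by linarith)).1).const_mul _
  have h2 : IntegrableOn (fun σ => cv j P f x (t - σ) (a * σ)) (Ioc 0 t) := by
    refine Integrable.mono' h1 (hm.mono_set (fun σ hσ => hσ.1)) ?_
    refine (ae_restrict_iff' measurableSet_Ioc).2 (Eventually.of_forall fun σ hσ => ?_)
    refine (abs_cv_le j P (mul_pos ha hσ.1) hκ0 hκ2 x
      (fun y => hb y (t - σ) (by linarith [hσ.1]))).trans_eq ?_
    rw [Real.mul_rpow ha.le hσ.1.le]; ring
  have h3 : IntegrableOn (fun σ => cv j P f x (t - σ) (a * σ)) (Ioi t) := by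
    refine (integrableOn_zero (ε' := ℝ)).congr_fun (fun σ hσ => ?_) measurableSet_Ioi
    have hσ : t < σ := hσ
    exact (cv_eq_zero j P (fun y => h0 y _ (by linarith)) x _).symm
  rw [← Ioc_union_Ioi_eq_Ioi ht.le]
  exact h2.union h3

/-- The convolution of a compactly supported function with the heat kernel is continuous up to
the initial time. -/
theorem tendsto_cv_zero {d : ℕ} {f : Eu d → ℝ → ℝ} (hf : CCS f)
    (h0 : ∀ y s, s ≤ 0 → f y s = 0) (x : Eu d) (t : ℝ) {a : ℝ} (ha : 0 < a) :
    Tendsto (fun σ => cv 0 (hp0 d) f x (t - σ) (a * σ)) (𝓝[>] 0) (𝓝 (f x t)) := by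
  obtain ⟨M, hM0, hM⟩ := hf.exists_bound h0 t
  have h1 : Tendsto (fun σ => ∫ w, pgk (hp0 d) w * f (x - √(a * σ) • w) (t - σ)) (𝓝[>] 0)
      (𝓝 (∫ w, pgk (hp0 d) w * f x t)) := by
    refine tendsto_integral_filter_of_dominated_convergence (fun w => |pgk (hp0 d) w| * M)
      (Eventually.of_forall fun σ => ?_) ?_ ((integrable_pgk _).abs.mul_const M)
      (Eventually.of_forall fun w => ?_)
    · refine Continuous.aestronglyMeasurable ?_
      exact (continuous_pgk _).mul (hf.cont.comp
        (by fun_prop : Continuous fun w : Eu d => (x - √(a * σ) • w, t - σ)))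
    · filter_upwards [self_mem_nhdsWithin] with σ hσ
      have hσ : 0 < σ := hσ
      refine Eventually.of_forall fun w => ?_
      rw [norm_mul, Real.norm_eq_abs, Real.norm_eq_abs]
      gcongr
      exact hM _ _ (by linarith)
    · have h2 : Continuous fun σ : ℝ => pgk (hp0 d) w * f (x - √(a * σ) • w) (t - σ) :=
        continuous_const.mul (hf.cont.comp
          (by fun_prop : Continuous fun σ : ℝ => (x - √(a * σ) • w, t - σ)))
      have h3 := (h2.tendsto 0).mono_left (nhdsWithin_le_nhds (s := Ioi 0))
      simpa using h3
  rw [integral_mul_const, integral_pgk_hp0, one_mul] at h1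
  refine h1.congr' ?_
  filter_upwards [self_mem_nhdsWithin] with σ hσ
  rw [cv, integral_Ks_mul 0 _ (mul_pos ha hσ)]
  simp

section
variable {d : ℕ} {A : Eu d → ℝ} {u g : Eu d → ℝ → ℝ}

theorem continuous_div_coeff (hA : Continuous A) (hpos : ∀ x, 0 < A x) {ζ : Eu d → ℝ}
    (hζ : Continuous ζ) : Continuous fun y => ζ y / A y :=
  hζ.div hA fun x => (hpos x).ne'

theorem hasCompactSupport_div {ζ : Eu d → ℝ} (hs : HasCompactSupport ζ) (B : Eu d → ℝ) :
    HasCompactSupport fun y => ζ y / B y :=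
  HasCompactSupport.intro hs fun y hy => by simp [image_eq_zero_of_notMem_tsupport hy]

theorem IsWeak.ccs_source (hw : IsWeak A u g) (hA : Continuous A) (hpos : ∀ x, 0 < A x)
    {ζ : Eu d → ℝ} (hζ : ContDiff ℝ ∞ ζ) (hs : HasCompactSupport ζ) :
    CCS fun y s => u y s * lap ζ y + g y s * (ζ y / A y) :=
  (CCS.mul hw.cu (contDiff_lap hζ).continuous
    (hs.mono' ((subset_tsupport _).trans (tsupport_lap_subset ζ)))).add
    (CCS.mul hw.cg (continuous_div_coeff hA hpos hζ.continuous) (hasCompactSupport_div hs A))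

/-- Time derivative of the pairing of a weak solution with a test function. -/
theorem IsWeak.hasDerivAt_pairing (hw : IsWeak A u g) (hA : Continuous A) (hpos : ∀ x, 0 < A x)
    {ρ : Eu d → ℝ} (hρ : ContDiff ℝ ∞ ρ) (hs : HasCompactSupport ρ) (t : ℝ) :
    HasDerivAt (fun t => ∫ y, u y t * (ρ y / A y))
      (∫ y, (u y t * lap ρ y + g y t * (ρ y / A y))) t := by
  have hc := (hw.ccs_source hA hpos hρ hs).continuous_integral
  have h1 : (fun t => ∫ y, u y t * (ρ y / A y)) =
      fun t => ∫ s in (0 : ℝ)..t, ∫ y, (u y s * lap ρ y + g y s * (ρ y / A y)) :=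
    funext fun t => hw.weak ρ hρ hs t
  rw [h1]
  exact intervalIntegral.integral_hasDerivAt_right (hc.intervalIntegrable _ _)
    hc.aestronglyMeasurable.stronglyMeasurableAtFilter hc.continuousAt

theorem cv_sum {d : ℕ} {ι : Type*} (s : Finset ι) (j : ℕ) (P : ι → MvPolynomial (Fin d) ℝ)
    (f : ι → Eu d → ℝ → ℝ) (hf : ∀ i, CCS (f i)) (x : Eu d) (t σ : ℝ) :
    ∑ i ∈ s, cv j (P i) (f i) x t σ = ∫ y, ∑ i ∈ s, Ks j (P i) σ (x - y) * f i y t := by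
  rw [integral_finsetSum]
  · rfl
  · exact fun i _ => (hf i).integrable_mul t (contDiff_Ks_sub j _ σ x).continuous

/-- The integrand of the representation formula. -/
noncomputable def repInt (A : Eu d → ℝ) (ζ : Eu d → ℝ) (u g : Eu d → ℝ → ℝ) (x : Eu d)
    (s σ : ℝ) : ℝ :=
  cv 2 (lpg 0 (hp0 d)) (fun y s => u y s * (ζ y * (1 - A x / A y))) x s σ
    + ∑ i, cv 1 (dpg i (hp0 d)) (fun y s => u y s * (-2 * pd i ζ y)) x s σ
    + cv 0 (hp0 d) (fun y s => u y s * lap ζ y + g y s * (ζ y / A y)) x s σ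

theorem ccs_pd (hu : Continuous fun q : Eu d × ℝ => u q.1 q.2)
    {ζ : Eu d → ℝ} (hζ : ContDiff ℝ ∞ ζ) (hs : HasCompactSupport ζ) (i : Fin d) :
    CCS fun y s => u y s * (-2 * pd i ζ y) :=
  CCS.mul hu (continuous_const.mul (contDiff_pd hζ i).continuous)
    (HasCompactSupport.mul_left
      (hs.mono' ((subset_tsupport _).trans (tsupport_pd_subset ζ i))))

theorem ccs_osc (hu : Continuous fun q : Eu d × ℝ => u q.1 q.2) (hA : Continuous A)
    (hpos : ∀ x, 0 < A x) {ζ : Eu d → ℝ} (hζ : Continuous ζ) (hs : HasCompactSupport ζ) (x : Eu d) :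
    CCS fun y s => u y s * (ζ y * (1 - A x / A y)) :=
  CCS.mul hu (hζ.mul (continuous_const.sub (continuous_const.div hA fun x => (hpos x).ne')))
    hs.mul_right

theorem IsWeak.hasDerivAt_cv_antidiagonal (hw : IsWeak A u g) (hA : Continuous A)
    (hpos : ∀ x, 0 < A x) {ζ : Eu d → ℝ} (hζ : ContDiff ℝ ∞ ζ) (hs : HasCompactSupport ζ)
    (x : Eu d) (t : ℝ) {σ : ℝ} (hσ : 0 < σ) :
    HasDerivAt (fun σ => cv 0 (hp0 d) (fun y s => u y s * (ζ y / A y)) x (t - σ) (A x * σ))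
      (-repInt A ζ u g x (t - σ) (A x * σ)) σ := by
  have hF : CCS fun y s => u y s * (ζ y / A y) :=
    CCS.mul hw.cu (continuous_div_coeff hA hpos hζ.continuous) (hasCompactSupport_div hs A)
  have ha := hpos x
  have haσ := mul_pos ha hσ
  obtain ⟨k, hk⟩ : ∃ k, k = fun y => Ks 0 (hp0 d) (A x * σ) (x - y) := ⟨_, rfl⟩
  have hks : ContDiff ℝ ∞ k := hk ▸ contDiff_Ks_sub 0 (hp0 d) (A x * σ) x
  have h1 := hw.hasDerivAt_pairing hA hpos (hζ.mul hks) (hs.mul_right (f' := k)) (t - σ)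
  have h1' : HasDerivAt (fun s => cv 0 (hp0 d) (fun y s => u y s * (ζ y / A y)) x s (A x * σ))
      (∫ y, (u y (t - σ) * lap (fun y => ζ y * k y) y + g y (t - σ) * (ζ y * k y / A y)))
      (t - σ) := by
    refine h1.congr_of_eventuallyEq (Eventually.of_forall fun s => ?_)
    refine integral_congr_ae (Eventually.of_forall fun y => ?_)
    simp only [hk]; ring
  have h2 : ∀ s σ', 0 < σ' → HasDerivAt
      (fun σ => cv 0 (hp0 d) (fun y s => u y s * (ζ y / A y)) x s (A x * σ))
      (A x * cv 2 (lpg 0 (hp0 d)) (fun y s => u y s * (ζ y / A y)) x s (A x * σ')) σ' := by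
    intro s σ' hσ'
    have := (hasDerivAt_cv 0 (hp0 d) hF x s (mul_pos ha hσ')).comp σ'
      ((hasDerivAt_id σ').const_mul (A x))
    refine this.congr_deriv ?_
    simp [mul_comm]
  have h3 : ContinuousAt (fun q : ℝ × ℝ =>
      A x * cv 2 (lpg 0 (hp0 d)) (fun y s => u y s * (ζ y / A y)) x q.1 (A x * q.2))
      (t - σ, σ) := by
    refine continuousAt_const.mul ?_
    have hU : {q : Eu d × ℝ × ℝ | 0 < q.2.2} ∈ 𝓝 (x, t - σ, A x * σ) :=
      (isOpen_lt continuous_const (by fun_prop)).mem_nhds haσ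
    exact ((continuousOn_cv 2 (lpg 0 (hp0 d)) hF).continuousAt hU).comp
      (f := fun q : ℝ × ℝ => (x, q.1, A x * q.2)) (x := (t - σ, σ))
      (Continuous.continuousAt (by fun_prop))
  refine (hasDerivAt_antidiagonal hσ h1' h2 h3).congr_deriv ?_
  have hkc : Continuous k := hks.continuous
  have e2 : ∀ y, Ks 2 (lpg 0 (hp0 d)) (A x * σ) (x - y) = lap k y := fun y => by
    rw [hk, lap_Ks_sub haσ]
  have e1 : ∀ i y, Ks 1 (dpg i (hp0 d)) (A x * σ) (x - y) = -pd i k y := fun i y => by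
    rw [hk, pd_Ks_sub 0 _ haσ]; simp
  have i2 := (ccs_osc hw.cu hA hpos hζ.continuous hs x).integrable_mul (t - σ)
    (contDiff_Ks_sub 2 (lpg 0 (hp0 d)) (A x * σ) x).continuous
  have i2' := hF.integrable_mul (t - σ)
    (contDiff_Ks_sub 2 (lpg 0 (hp0 d)) (A x * σ) x).continuous
  have i0 := (hw.ccs_source hA hpos hζ hs).integrable_mul (t - σ)
    (contDiff_Ks_sub 0 (hp0 d) (A x * σ) x).continuous
  have i1 : Integrable fun y => ∑ i, Ks 1 (dpg i (hp0 d)) (A x * σ) (x - y) *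
      (u y (t - σ) * (-2 * pd i ζ y)) :=
    integrable_finsetSum _ fun i _ => (ccs_pd hw.cu hζ hs i).integrable_mul (t - σ)
      (contDiff_Ks_sub 1 _ (A x * σ) x).continuous
  have i3 := (hw.ccs_source hA hpos (hζ.mul hks) (hs.mul_right (f' := k))).integrable (t - σ)
  rw [repInt, cv_sum _ _ _ _ (fun i => ccs_pd hw.cu hζ hs i)]
  simp only [cv]
  rw [← integral_add i2 i1, ← integral_add (by exact i2.add i1) i0, ← integral_const_mul,
    ← integral_sub (i2'.const_mul _) i3, ← integral_neg]
  refine integral_congr_ae (Eventually.of_forall fun y => ?_)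
  simp only [e1, e2]
  have e0 : Ks 0 (hp0 d) (A x * σ) (x - y) = k y := by rw [hk]
  rw [e0, lap_mul hζ hks]
  have hy := (hpos y).ne'
  have : ∑ i, -pd i k y * (u y (t - σ) * (-2 * pd i ζ y)) =
      u y (t - σ) * (2 * ∑ i, pd i ζ y * pd i k y) := by
    rw [Finset.mul_sum, Finset.mul_sum]
    exact Finset.sum_congr rfl fun i _ => by ring
  rw [this]
  field_simp
  ring

/-- Hölder bound for the oscillation of the coefficient at the centre `x`. -/
theorem LocHolder.exists_osc_bound (hA : LocHolder A) (hc : Continuous A) (hpos : ∀ x, 0 < A x)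
    {ζ : Eu d → ℝ} (hζ : Continuous ζ) (hs : HasCompactSupport ζ) {K : Set (Eu d)}
    (hK : IsCompact K) :
    ∃ κ C : ℝ, 0 < κ ∧ κ ≤ 1 ∧ 0 ≤ C ∧
      ∀ x ∈ K, ∀ y, |ζ y * (1 - A x / A y)| ≤ C * ‖x - y‖ ^ κ := by
  obtain ⟨κ, C, h0, h1, hC, h⟩ := hA (K ∪ tsupport ζ) (hK.union hs)
  have hs' : IsCompact (tsupport ζ) := hs
  obtain ⟨M, hM⟩ := hs'.exists_bound_of_continuousOn
    (continuous_div_coeff hc hpos hζ).continuousOn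
  refine ⟨κ, max M 0 * C, h0, h1, by positivity, fun x hx y => ?_⟩
  by_cases hy : y ∈ tsupport ζ
  · have e : ζ y * (1 - A x / A y) = ζ y / A y * (A y - A x) := by
      have := (hpos y).ne'; field_simp
    rw [e, abs_mul, mul_assoc]
    gcongr
    · exact (hM y hy).trans (le_max_left _ _)
    · rw [abs_sub_comm]; exact h x (Or.inl hx) y (Or.inr hy)
  · rw [image_eq_zero_of_notMem_tsupport hy]
    simp; positivity

theorem LocHolder.continuous (hA : LocHolder A) : Continuous A := by
  refine continuous_iff_continuousAt.2 fun x => ?_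
  obtain ⟨κ, C, h0, h1, hC, h⟩ := hA _ (isCompact_closedBall x 1)
  rw [ContinuousAt, tendsto_iff_norm_sub_tendsto_zero]
  refine squeeze_zero' (g := fun y => C * ‖y - x‖ ^ κ)
    (Eventually.of_forall fun _ => norm_nonneg _) ?_ ?_
  · filter_upwards [Metric.closedBall_mem_nhds x one_pos] with y hy
    exact h y hy x (Metric.mem_closedBall_self zero_le_one)
  · have : Continuous fun y => C * ‖y - x‖ ^ κ :=
      continuous_const.mul ((continuous_id.sub continuous_const).norm.rpow_const
        fun _ => Or.inr h0.le)
    simpa [h0.ne'] using this.tendsto x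

theorem IsWeak.repInt_eq_zero (hw : IsWeak A u g) (ζ : Eu d → ℝ) (x : Eu d) {s : ℝ} (hs : s ≤ 0)
    (σ : ℝ) : repInt A ζ u g x s σ = 0 := by
  have h1 := fun y => hw.u0 y s hs
  have h2 := fun y => hw.g0 y s hs
  simp [repInt, cv, h1, h2]

theorem IsWeak.integrableOn_terms (hw : IsWeak A u g) (hA : LocHolder A) (hpos : ∀ x, 0 < A x)
    {ζ : Eu d → ℝ} (hζ : ContDiff ℝ ∞ ζ) (hs : HasCompactSupport ζ) (x : Eu d) (t : ℝ) :
    IntegrableOn (fun σ => cv 2 (lpg 0 (hp0 d)) (fun y s => u y s * (ζ y * (1 - A x / A y))) x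
      (t - σ) (A x * σ)) (Ioi 0) ∧
    (∀ i, IntegrableOn (fun σ => cv 1 (dpg i (hp0 d)) (fun y s => u y s * (-2 * pd i ζ y)) x
      (t - σ) (A x * σ)) (Ioi 0)) ∧
    IntegrableOn (fun σ => cv 0 (hp0 d) (fun y s => u y s * lap ζ y + g y s * (ζ y / A y)) x
      (t - σ) (A x * σ)) (Ioi 0) := by
  have hc := hA.continuous
  refine ⟨?_, fun i => ?_, ?_⟩
  · obtain ⟨κ, C, h0, h1, hC, h⟩ := hA.exists_osc_bound hc hpos hζ.continuous hs
      (isCompact_singleton (x := x))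
    obtain ⟨M, hM0, hM⟩ := exists_bound_on_compact hw.cu hw.u0 (K := tsupport ζ) hs t
    refine integrableOn_cv 2 _ (ccs_osc hw.cu hc hpos hζ.continuous hs x)
      (fun y s hs => by simp [hw.u0 y s hs]) (κ := κ) (M := M * C) (hpos x) h0.le (by linarith)
      (by push_cast; linarith) (fun y s hst => ?_)
    by_cases hy : y ∈ tsupport ζ
    · have := hM y hy s hst
      rw [abs_mul, mul_assoc]
      gcongr
      exact h x rfl y
    · rw [image_eq_zero_of_notMem_tsupport hy]
      simp; positivity
  · have hf := ccs_pd hw.cu hζ hs i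
    have hf0 : ∀ y s, s ≤ 0 → u y s * (-2 * pd i ζ y) = 0 := fun y s hs => by
      simp [hw.u0 y s hs]
    obtain ⟨M, hM0, hM⟩ := hf.exists_bound hf0 t
    exact integrableOn_cv 1 _ hf hf0 (κ := 0) (M := M) (hpos x) le_rfl (by norm_num) (by norm_num)
      (fun y s hst => by simpa using hM y s hst)
  · have hf := hw.ccs_source hc hpos hζ hs
    have hf0 : ∀ y s, s ≤ 0 → u y s * lap ζ y + g y s * (ζ y / A y) = 0 := fun y s hs => by
      simp [hw.u0 y s hs, hw.g0 y s hs]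
    obtain ⟨M, hM0, hM⟩ := hf.exists_bound hf0 t
    exact integrableOn_cv 0 _ hf hf0 (κ := 0) (M := M) (hpos x) le_rfl (by norm_num) (by norm_num)
      (fun y s hst => by simpa using hM y s hst)

theorem IsWeak.integrableOn_repInt (hw : IsWeak A u g) (hA : LocHolder A) (hpos : ∀ x, 0 < A x)
    {ζ : Eu d → ℝ} (hζ : ContDiff ℝ ∞ ζ) (hs : HasCompactSupport ζ) (x : Eu d) (t : ℝ) :
    IntegrableOn (fun σ => repInt A ζ u g x (t - σ) (A x * σ)) (Ioi 0) := by
  obtain ⟨h2, h1, h0⟩ := hw.integrableOn_terms hA hpos hζ hs x t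
  exact (h2.add (integrable_finsetSum _ fun i _ => h1 i)).add h0

/-- Representation of a weak solution by the heat kernel with coefficient frozen at `x`. -/
theorem IsWeak.representation (hw : IsWeak A u g) (hA : LocHolder A) (hpos : ∀ x, 0 < A x)
    {ζ : Eu d → ℝ} (hζ : ContDiff ℝ ∞ ζ) (hs : HasCompactSupport ζ) (x : Eu d) (t : ℝ) :
    u x t * (ζ x / A x) = ∫ σ in Ioi (0 : ℝ), repInt A ζ u g x (t - σ) (A x * σ) := by
  have hc := hA.continuous
  have hF : CCS fun y s => u y s * (ζ y / A y) :=
    CCS.mul hw.cu (continuous_div_coeff hc hpos hζ.continuous) (hasCompactSupport_div hs A)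
  have hF0 : ∀ y s, s ≤ 0 → u y s * (ζ y / A y) = 0 := fun y s hs => by simp [hw.u0 y s hs]
  obtain ⟨m, hm⟩ : ∃ m : ℝ → ℝ, m = fun σ =>
    cv 0 (hp0 d) (fun y s => u y s * (ζ y / A y)) x (t - σ) (A x * σ) := ⟨_, rfl⟩
  have hu : ∀ σ, 0 < σ → Function.update m 0 (u x t * (ζ x / A x)) σ = m σ := fun σ hσ =>
    Function.update_of_ne hσ.ne' _ _
  have h1 := integral_Ioi_of_hasDerivAt_of_tendsto (a := 0) (m := 0)
    (f := Function.update m 0 (u x t * (ζ x / A x)))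
    (f' := fun σ => -repInt A ζ u g x (t - σ) (A x * σ)) ?_ (fun σ hσ => ?_)
    (hw.integrableOn_repInt hA hpos hζ hs x t).neg ?_
  · rw [integral_neg, Function.update_self] at h1
    linarith
  · rw [continuousWithinAt_update_same, Ici_sdiff_left, hm]
    exact tendsto_cv_zero hF hF0 x t (hpos x)
  · have hσ : 0 < σ := hσ
    refine (hm ▸ hw.hasDerivAt_cv_antidiagonal hc hpos hζ hs x t hσ).congr_of_eventuallyEq ?_
    filter_upwards [Ioi_mem_nhds hσ] with τ hτ using hu τ hτ
  · refine tendsto_const_nhds.congr' ?_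
    filter_upwards [Ioi_mem_atTop 0, Ioi_mem_atTop t] with τ h0 hτ
    have hτ : t < τ := hτ
    rw [hu τ h0, hm]
    exact (cv_eq_zero 0 _ (fun y => hF0 y _ (by linarith)) x _).symm
end

/-- `u` is a continuous very weak solution of `Δu = G`. -/
structure IsPoisson {d : ℕ} (u G : Eu d → ℝ) : Prop where
  cu : Continuous u
  cG : Continuous G
  weak : ∀ ρ : Eu d → ℝ, ContDiff ℝ ∞ ρ → HasCompactSupport ρ →
    ∫ y, u y * lap ρ y = ∫ y, G y * ρ y

section
variable {d : ℕ} {u G : Eu d → ℝ}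

theorem integral_two_mul_self (t c : ℝ) : ∫ s in (0 : ℝ)..t, 2 * s * c = t ^ 2 * c := by
  rw [intervalIntegral.integral_mul_const, intervalIntegral.integral_const_mul, integral_id]
  ring

theorem HasCompactSupport.lap {ρ : Eu d → ℝ} (hs : HasCompactSupport ρ) :
    HasCompactSupport (lap ρ) :=
  hs.mono' ((subset_tsupport _).trans (tsupport_lap_subset ρ))

/-- A solution of the Poisson equation, multiplied by `t²`, solves a heat equation. -/
theorem IsPoisson.isWeak (h : IsPoisson u G) :
    IsWeak (fun _ => 1) (fun y s => max s 0 ^ 2 * u y)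
      (fun y s => 2 * max s 0 * u y - max s 0 ^ 2 * G y) where
  cu := by have := h.cu; fun_prop
  cg := by have := h.cu; have := h.cG; fun_prop
  u0 y s hs := by simp [max_eq_right hs]
  g0 y s hs := by simp [max_eq_right hs]
  weak ρ hρ hs t := by
    have hu := h.cu
    have hG := h.cG
    have i1 : Integrable fun y => u y * lap ρ y :=
      (hu.mul (contDiff_lap hρ).continuous).integrable_of_hasCompactSupport hs.lap.mul_left
    have i2 : Integrable fun y => u y * ρ y :=
      (hu.mul hρ.continuous).integrable_of_hasCompactSupport hs.mul_left
    have i3 : Integrable fun y => G y * ρ y :=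
      (hG.mul hρ.continuous).integrable_of_hasCompactSupport hs.mul_left
    have e : ∀ s : ℝ, ∫ y, (max s 0 ^ 2 * u y * lap ρ y +
        (2 * max s 0 * u y - max s 0 ^ 2 * G y) * (ρ y / 1)) = 2 * max s 0 * ∫ y, u y * ρ y := by
      intro s
      have e1 : ∀ y, max s 0 ^ 2 * u y * lap ρ y +
        (2 * max s 0 * u y - max s 0 ^ 2 * G y) * (ρ y / 1) =
        (max s 0 ^ 2 * (u y * lap ρ y) + 2 * max s 0 * (u y * ρ y)) - max s 0 ^ 2 * (G y * ρ y) :=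
        fun y => by ring
      simp only [e1]
      rw [integral_sub (by exact (i1.const_mul _).add (i2.const_mul _)) (i3.const_mul _),
        integral_add (i1.const_mul _) (i2.const_mul _), integral_const_mul, integral_const_mul,
        integral_const_mul, h.weak ρ hρ hs]
      ring
    simp only [e]
    have e2 : ∫ y, max t 0 ^ 2 * u y * (ρ y / 1) = max t 0 ^ 2 * ∫ y, u y * ρ y := by
      rw [← integral_const_mul]; congr 1; ext y; ring
    rw [e2]
    rcases le_total t 0 with ht | ht
    · rw [max_eq_right ht, intervalIntegral.integral_congr (g := fun _ => 0)]
      · simp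
      · intro s hs
        rw [uIcc_of_ge ht] at hs
        simp [max_eq_right hs.2]
    · rw [max_eq_left ht, intervalIntegral.integral_congr
        (g := fun s => 2 * s * ∫ y, u y * ρ y), integral_two_mul_self]
      intro s hs
      rw [uIcc_of_le ht] at hs
      simp [max_eq_left hs.1]

/-- The heat potential of a source on the unit time interval. -/
noncomputable def pot (j : ℕ) (P : MvPolynomial (Fin d) ℝ) (b : Eu d → ℝ → ℝ) (x : Eu d) : ℝ :=
  ∫ σ in Ioo (0 : ℝ) 1, cv j P b x (1 - σ) σ

/-- The sources in the representation formula for the Poisson equation. -/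
noncomputable def poiF1 (u ζ : Eu d → ℝ) (i : Fin d) (y : Eu d) (s : ℝ) : ℝ :=
  max s 0 ^ 2 * u y * (-2 * pd i ζ y)

/-- The zeroth-order source in the representation formula for the Poisson equation. -/
noncomputable def poiF0 (u G ζ : Eu d → ℝ) (y : Eu d) (s : ℝ) : ℝ :=
  max s 0 ^ 2 * u y * lap ζ y + (2 * max s 0 * u y - max s 0 ^ 2 * G y) * (ζ y / 1)

theorem locHolder_const (c : ℝ) : LocHolder (fun _ : Eu d => c) :=
  fun K _ => ⟨1, 0, one_pos, le_rfl, le_rfl, by simp⟩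

theorem setIntegral_Ioi_eq_Ioo {f : ℝ → ℝ} {a b : ℝ} (hf : ∀ σ, b ≤ σ → f σ = 0) :
    ∫ σ in Ioi a, f σ = ∫ σ in Ioo a b, f σ :=
  setIntegral_eq_of_subset_of_forall_sdiff_eq_zero measurableSet_Ioi Ioo_subset_Ioi_self
    fun σ hσ => hf σ (le_of_not_gt fun h => hσ.2 ⟨hσ.1, h⟩)

theorem IsPoisson.representation (h : IsPoisson u G) {ζ : Eu d → ℝ} (hζ : ContDiff ℝ ∞ ζ)
    (hs : HasCompactSupport ζ) (x : Eu d) :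
    u x * ζ x = ∑ i, pot 1 (dpg i (hp0 d)) (poiF1 u ζ i) x + pot 0 (hp0 d) (poiF0 u G ζ) x := by
  have hw := h.isWeak
  have h1 := hw.representation (locHolder_const 1) (fun _ => one_pos) hζ hs x 1
  obtain ⟨-, i1, i0⟩ := hw.integrableOn_terms (locHolder_const 1) (fun _ => one_pos) hζ hs x 1
  simp only [div_one, zero_le_one, sup_of_le_left, one_pow, one_mul] at h1
  rw [h1, setIntegral_Ioi_eq_Ioo (b := 1)
    (fun σ hσ => hw.repInt_eq_zero ζ x (by linarith) _)]
  have e : ∀ s σ, cv 2 (lpg 0 (hp0 d)) (fun y s => max s 0 ^ 2 * u y *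
      (ζ y * (1 - (fun _ : Eu d => (1 : ℝ)) x / (fun _ => 1) y))) x s σ = 0 :=
    fun s σ => cv_eq_zero _ _ (fun y => by simp) _ _
  simp only [repInt, e, zero_add, one_mul] at i1 i0 ⊢
  rw [integral_add, integral_finsetSum]
  · rfl
  · exact fun i _ => (i1 i).mono_set Ioo_subset_Ioi_self
  · exact integrable_finsetSum _ fun i _ => (i1 i).mono_set Ioo_subset_Ioi_self
  · exact i0.mono_set Ioo_subset_Ioi_self
end

section
variable {d : ℕ}

theorem abs_integral_mul_le {k f : Eu d → ℝ} {M : ℝ} (hk : Integrable k) (hf : ∀ y, |f y| ≤ M) :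
    |∫ y, k y * f y| ≤ M * ∫ y, |k y| := by
  rw [← integral_const_mul, ← Real.norm_eq_abs]
  refine norm_integral_le_of_norm_le (hk.abs.const_mul M) (Eventually.of_forall fun y => ?_)
  rw [norm_mul, Real.norm_eq_abs, Real.norm_eq_abs, mul_comm]
  gcongr
  exact hf y

theorem integrable_Ks_sub (j : ℕ) (P : MvPolynomial (Fin d) ℝ) {σ : ℝ} (hσ : 0 < σ) (x : Eu d) :
    Integrable fun y => Ks j P σ (x - y) :=
  (integrable_Ks j P hσ x)

/-- Spatial increments of a kernel convolution. -/
theorem exists_cv_space_diff (j : ℕ) (P : MvPolynomial (Fin d) ℝ) :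
    ∃ C : ℝ, 0 ≤ C ∧ ∀ (b : Eu d → ℝ → ℝ) (M s σ : ℝ), CCS b → (∀ y, |b y s| ≤ M) → 0 < σ →
      ∀ x x', |cv j P b x' s σ - cv j P b x s σ| ≤
        M * (C * ((√σ) ^ j)⁻¹ * min 1 (‖x' - x‖ / √σ)) := by
  obtain ⟨C, hC, h⟩ := exists_Ks_space_diff j P
  refine ⟨C, hC, fun b M s σ hb hM hσ x x' => ?_⟩
  have hM0 : 0 ≤ M := (abs_nonneg _).trans (hM 0)
  rw [cv, cv, ← integral_sub (hb.integrable_mul s (contDiff_Ks_sub j P σ x').continuous)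
    (hb.integrable_mul s (contDiff_Ks_sub j P σ x).continuous)]
  simp only [← sub_mul]
  refine (abs_integral_mul_le ((integrable_Ks_sub j P hσ x').sub (integrable_Ks_sub j P hσ x))
    hM).trans ?_
  gcongr
  exact h σ hσ x x'

theorem integrableOn_rpow_Ioo {γ : ℝ} (hγ : -1 < γ) (t : ℝ) :
    IntegrableOn (fun σ : ℝ => σ ^ γ) (Ioo 0 t) :=
  (intervalIntegral.intervalIntegrable_rpow' (a := 0) (b := t) hγ).1.mono_set Ioo_subset_Ioc_self

theorem setIntegral_rpow_Ioo {γ : ℝ} (hγ : -1 < γ) {t : ℝ} (ht : 0 ≤ t) :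
    ∫ σ in Ioo 0 t, σ ^ γ = t ^ (γ + 1) / (γ + 1) := by
  rw [← integral_Ioc_eq_integral_Ioo, ← intervalIntegral.integral_of_le ht,
    integral_rpow (Or.inl hγ), Real.zero_rpow (by linarith), sub_zero]

theorem inv_sqrt_pow_mul_min_le {σ r θ : ℝ} (hσ : 0 < σ) (hr : 0 ≤ r) (h0 : 0 ≤ θ) (h1 : θ ≤ 1)
    (j : ℕ) : ((√σ) ^ j)⁻¹ * min 1 (r / √σ) ≤ σ ^ (-(j + θ) / 2) * r ^ θ := by
  have hs : 0 < √σ := Real.sqrt_pos.2 hσ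
  calc _ ≤ ((√σ) ^ j)⁻¹ * (r / √σ) ^ θ := by
        gcongr; exact min_one_le_rpow (by positivity) h0 h1
    _ = _ := by
        rw [Real.div_rpow hr hs.le, Real.sqrt_eq_rpow, ← Real.rpow_natCast, ← Real.rpow_mul hσ.le,
          ← Real.rpow_mul hσ.le, ← Real.rpow_neg hσ.le, div_eq_mul_inv (r ^ θ), ← Real.rpow_neg hσ.le,
          mul_left_comm, ← Real.rpow_add hσ, mul_comm]
        congr 2; ring

theorem integrableOn_cv_Ioo (j : ℕ) (hj : j ≤ 1) (P : MvPolynomial (Fin d) ℝ)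
    {b : Eu d → ℝ → ℝ} (hb : CCS b) (h0 : ∀ y s, s ≤ 0 → b y s = 0) (x : Eu d) :
    IntegrableOn (fun σ => cv j P b x (1 - σ) σ) (Ioo 0 1) := by
  obtain ⟨M, -, hM⟩ := hb.exists_bound h0 1
  have := integrableOn_cv j P hb h0 (x := x) (t := 1) (a := 1) (κ := 0) (M := M) one_pos le_rfl
    (by norm_num) (by
      have : (j : ℝ) ≤ 1 := by exact_mod_cast hj
      linarith) (fun y s hs => by simpa using hM y s hs)
  simp only [one_mul] at this
  exact this.mono_set Ioo_subset_Ioi_self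

/-- Hölder continuity of heat potentials of bounded sources. -/
theorem exists_pot_holder (j : ℕ) (hj : j ≤ 1) (P : MvPolynomial (Fin d) ℝ) :
    ∃ C : ℝ, 0 ≤ C ∧ ∀ (b : Eu d → ℝ → ℝ) (M : ℝ), CCS b → (∀ y s, s ≤ 0 → b y s = 0) →
      (∀ y s, s ≤ 1 → |b y s| ≤ M) →
      ∀ x x', |pot j P b x' - pot j P b x| ≤ C * M * ‖x' - x‖ ^ (1 / 2 : ℝ) := by
  obtain ⟨C, hC, h⟩ := exists_cv_space_diff j P
  have hj' : (j : ℝ) ≤ 1 := by exact_mod_cast hj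
  refine ⟨C * 4, by positivity, fun b M hb h0 hM x x' => ?_⟩
  have hM0 : 0 ≤ M := (abs_nonneg _).trans (hM 0 0 zero_le_one)
  rw [pot, pot, ← integral_sub (integrableOn_cv_Ioo j hj P hb h0 x')
    (integrableOn_cv_Ioo j hj P hb h0 x), ← Real.norm_eq_abs]
  have hi := (integrableOn_rpow_Ioo (γ := -3 / 4) (by norm_num) 1).const_mul
    (M * C * ‖x' - x‖ ^ (1 / 2 : ℝ))
  refine (norm_integral_le_of_norm_le hi
    ((ae_restrict_iff' measurableSet_Ioo).2 (Eventually.of_forall fun σ hσ => ?_))).trans_eq ?_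
  · refine (h b M (1 - σ) σ hb (fun y => hM y _ (by linarith [hσ.1])) hσ.1 x x').trans ?_
    have h2 := inv_sqrt_pow_mul_min_le hσ.1 (norm_nonneg (x' - x)) (θ := 1 / 2) (by norm_num)
      (by norm_num) j
    have h3 : σ ^ (-(j + 1 / 2) / 2 : ℝ) ≤ σ ^ (-3 / 4 : ℝ) :=
      Real.rpow_le_rpow_of_exponent_ge hσ.1 hσ.2.le (by linarith)
    calc _ = M * C * (((√σ) ^ j)⁻¹ * min 1 (‖x' - x‖ / √σ)) := by ring
      _ ≤ M * C * (σ ^ (-3 / 4 : ℝ) * ‖x' - x‖ ^ (1 / 2 : ℝ)) := by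
        exact mul_le_mul_of_nonneg_left (h2.trans (by gcongr)) (by positivity)
      _ = _ := by ring
  · rw [integral_const_mul, setIntegral_rpow_Ioo (by norm_num) zero_le_one]
    norm_num; ring

variable {u G : Eu d → ℝ}

theorem IsPoisson.ccs1 (h : IsPoisson u G) {ζ : Eu d → ℝ} (hζ : ContDiff ℝ ∞ ζ)
    (hs : HasCompactSupport ζ) (i : Fin d) : CCS (poiF1 u ζ i) :=
  ccs_pd h.isWeak.cu hζ hs i

theorem IsPoisson.ccs0 (h : IsPoisson u G) {ζ : Eu d → ℝ} (hζ : ContDiff ℝ ∞ ζ)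
    (hs : HasCompactSupport ζ) : CCS (poiF0 u G ζ) :=
  h.isWeak.ccs_source continuous_const (fun _ => one_pos) hζ hs

theorem poiF1_zero (u ζ : Eu d → ℝ) (i : Fin d) (y : Eu d) (s : ℝ) (hs : s ≤ 0) :
    poiF1 u ζ i y s = 0 := by simp [poiF1, max_eq_right hs]

theorem poiF0_zero (u G ζ : Eu d → ℝ) (y : Eu d) (s : ℝ) (hs : s ≤ 0) :
    poiF0 u G ζ y s = 0 := by simp [poiF0, max_eq_right hs]

theorem exists_bound_of_contDiff {f : Eu d → ℝ} (hf : Continuous f) (hs : HasCompactSupport f) :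
    ∃ Z, 0 ≤ Z ∧ ∀ y, |f y| ≤ Z := by
  obtain ⟨Z, hZ⟩ := hf.bounded_above_of_compact_support hs
  exact ⟨Z, (norm_nonneg _).trans (hZ 0), hZ⟩

theorem HasCompactSupport.pd {ρ : Eu d → ℝ} (hs : HasCompactSupport ρ) (i : Fin d) :
    HasCompactSupport (pd i ρ) :=
  hs.mono' ((subset_tsupport _).trans (tsupport_pd_subset ρ i))

/-- Interior Hölder-`1/2` estimate for the Poisson equation with bounded right-hand side. -/
theorem exists_poisson_holder {ζ : Eu d → ℝ} (hζ : ContDiff ℝ ∞ ζ) (hs : HasCompactSupport ζ) :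
    ∃ C : ℝ, 0 ≤ C ∧ ∀ (u G : Eu d → ℝ) (M : ℝ), IsPoisson u G →
      (∀ y ∈ tsupport ζ, |u y| ≤ M ∧ |G y| ≤ M) →
      0 ≤ M → ∀ x x', |u x' * ζ x' - u x * ζ x| ≤ C * M * ‖x' - x‖ ^ (1 / 2 : ℝ) := by
  choose C1 hC1 h1 using fun i => exists_pot_holder (d := d) 1 le_rfl (dpg i (hp0 d))
  obtain ⟨C0, hC0, h0⟩ := exists_pot_holder (d := d) 0 zero_le_one (hp0 d)
  choose Z1 hZ1 hz1 using fun i => exists_bound_of_contDiff (contDiff_pd hζ i).continuous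
    (hs.pd i)
  obtain ⟨Z0, hZ0, hz0⟩ := exists_bound_of_contDiff hζ.continuous hs
  obtain ⟨Z2, hZ2, hz2⟩ := exists_bound_of_contDiff (contDiff_lap hζ).continuous hs.lap
  refine ⟨∑ i, C1 i * (2 * Z1 i) + C0 * (Z2 + 3 * Z0),
    add_nonneg (Finset.sum_nonneg fun i _ => mul_nonneg (hC1 i) (by have := hZ1 i; positivity))
      (by positivity),
    fun u G M h hM hM0 x x' => ?_⟩
  have hms : ∀ s : ℝ, s ≤ 1 → |max s 0| ≤ 1 := fun s hs => by
    rw [abs_of_nonneg (le_max_right _ _)]; exact max_le hs zero_le_one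
  have b1 : ∀ i y s, s ≤ 1 → |poiF1 u ζ i y s| ≤ 2 * Z1 i * M := by
    intro i y s hs1
    by_cases hy : y ∈ tsupport ζ
    · rw [poiF1, abs_mul, abs_mul, abs_mul, abs_pow]
      calc _ ≤ 1 ^ 2 * M * (|(-2 : ℝ)| * Z1 i) := by
            gcongr
            exacts [hms s hs1, (hM y hy).1, hz1 i y]
        _ = _ := by norm_num; ring
    · rw [poiF1, image_eq_zero_of_notMem_tsupport fun h => hy (tsupport_pd_subset ζ i h)]
      have := hZ1 i
      simp; positivity
  have b0 : ∀ y s, s ≤ 1 → |poiF0 u G ζ y s| ≤ (Z2 + 3 * Z0) * M := by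
    intro y s hs1
    by_cases hy : y ∈ tsupport ζ
    · rw [poiF0, div_one]
      refine (abs_add_le _ _).trans ?_
      rw [abs_mul, abs_mul, abs_mul, abs_pow]
      have : |2 * max s 0 * u y - max s 0 ^ 2 * G y| ≤ 3 * M := by
        refine (abs_sub _ _).trans ?_
        rw [abs_mul, abs_mul, abs_mul, abs_pow]
        calc _ ≤ |(2 : ℝ)| * 1 * M + 1 ^ 2 * M := by
              gcongr
              exacts [hms s hs1, (hM y hy).1, hms s hs1, (hM y hy).2]
          _ = _ := by norm_num; ring
      calc _ ≤ 1 ^ 2 * M * Z2 + 3 * M * Z0 := by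
            gcongr
            exacts [hms s hs1, (hM y hy).1, hz2 y, hz0 y]
        _ = _ := by ring
    · rw [poiF0, image_eq_zero_of_notMem_tsupport hy,
        image_eq_zero_of_notMem_tsupport fun h => hy (tsupport_lap_subset ζ h)]
      simp; positivity
  rw [h.representation hζ hs x, h.representation hζ hs x', add_sub_add_comm,
    ← Finset.sum_sub_distrib]
  refine (abs_add_le _ _).trans ?_
  have e0 := h0 _ _ (h.ccs0 hζ hs) (poiF0_zero u G ζ) b0 x x'
  have e1 : |∑ i, (pot 1 (dpg i (hp0 d)) (poiF1 u ζ i) x' -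
      pot 1 (dpg i (hp0 d)) (poiF1 u ζ i) x)| ≤
      ∑ i, C1 i * (2 * Z1 i * M) * ‖x' - x‖ ^ (1 / 2 : ℝ) :=
    (Finset.abs_sum_le_sum_abs _ _).trans (Finset.sum_le_sum fun i _ =>
      h1 i _ _ (h.ccs1 hζ hs i) (poiF1_zero u ζ i) (b1 i) x x')
  refine (add_le_add e1 e0).trans_eq ?_
  rw [← Finset.sum_mul, ← add_mul, add_mul (∑ i, _) _ M, Finset.sum_mul]
  congr 2
  · exact Finset.sum_congr rfl fun i _ => by ring
  · ring
end

section
variable {d : ℕ}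

theorem rpow_le_mul_rpow {r D κ κ' : ℝ} (hr : 0 ≤ r) (hD : r ≤ D) (hκ' : 0 < κ') (h : κ' ≤ κ) :
    r ^ κ ≤ D ^ (κ - κ') * r ^ κ' := by
  rcases hr.eq_or_lt with rfl | hr0
  · rw [Real.zero_rpow (by linarith), Real.zero_rpow hκ'.ne', mul_zero]
  · calc r ^ κ = r ^ (κ - κ') * r ^ κ' := by rw [← Real.rpow_add hr0]; congr 1; ring
      _ ≤ _ := by gcongr

/-- Two locally Hölder functions admit a common Hölder exponent and constant on a compact set. -/
theorem LocHolder.exists_common {f g : Eu d → ℝ} (hf : LocHolder f) (hg : LocHolder g)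
    {K : Set (Eu d)} (hK : IsCompact K) : ∃ κ C : ℝ, 0 < κ ∧ κ ≤ 1 ∧ 0 ≤ C ∧
      ∀ x ∈ K, ∀ y ∈ K, |f x - f y| ≤ C * ‖x - y‖ ^ κ ∧ |g x - g y| ≤ C * ‖x - y‖ ^ κ := by
  obtain ⟨κ1, C1, h1, h1', hC1, hf⟩ := hf K hK
  obtain ⟨κ2, C2, h2, h2', hC2, hg⟩ := hg K hK
  obtain ⟨D, hD⟩ : ∃ D : ℝ, ∀ x ∈ K, ∀ y ∈ K, ‖x - y‖ ≤ D := by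
    obtain ⟨R, hR⟩ := hK.isBounded.exists_norm_le
    exact ⟨R + R, fun x hx y hy => (norm_sub_le _ _).trans (add_le_add (hR x hx) (hR y hy))⟩
  have hκ : 0 < min κ1 κ2 := lt_min h1 h2
  refine ⟨min κ1 κ2, C1 * |D ^ (κ1 - min κ1 κ2)| + C2 * |D ^ (κ2 - min κ1 κ2)|, hκ,
    (min_le_left _ _).trans h1', by positivity, fun x hx y hy => ⟨?_, ?_⟩⟩
  · refine (hf x hx y hy).trans ?_
    have := rpow_le_mul_rpow (norm_nonneg (x - y)) (hD x hx y hy) hκ (min_le_left κ1 κ2)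
    calc _ ≤ C1 * (|D ^ (κ1 - min κ1 κ2)| * ‖x - y‖ ^ min κ1 κ2) := by
          gcongr; exact this.trans (by gcongr; exact le_abs_self _)
      _ = C1 * |D ^ (κ1 - min κ1 κ2)| * ‖x - y‖ ^ min κ1 κ2 := by ring
      _ ≤ _ := by gcongr; exact le_add_of_nonneg_right (by positivity)
  · refine (hg x hx y hy).trans ?_
    have := rpow_le_mul_rpow (norm_nonneg (x - y)) (hD x hx y hy) hκ (min_le_right κ1 κ2)
    calc _ ≤ C2 * (|D ^ (κ2 - min κ1 κ2)| * ‖x - y‖ ^ min κ1 κ2) := by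
          gcongr; exact this.trans (by gcongr; exact le_abs_self _)
      _ = C2 * |D ^ (κ2 - min κ1 κ2)| * ‖x - y‖ ^ min κ1 κ2 := by ring
      _ ≤ _ := by gcongr; exact le_add_of_nonneg_left (by positivity)

theorem LocHolder.add {f g : Eu d → ℝ} (hf : LocHolder f) (hg : LocHolder g) :
    LocHolder fun x => f x + g x := by
  intro K hK
  obtain ⟨κ, C, h0, h1, hC, h⟩ := hf.exists_common hg hK
  refine ⟨κ, C + C, h0, h1, by positivity, fun x hx y hy => ?_⟩
  rw [add_sub_add_comm, add_mul]
  exact (abs_add_le _ _).trans (add_le_add (h x hx y hy).1 (h x hx y hy).2)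

/-- Composition of a pair of locally Hölder functions with a locally Lipschitz function. -/
theorem LocHolder.comp {f : Eu d → ℝ} (hf : LocHolder f) {φ : ℝ → ℝ}
    (hφ : ∀ M : ℝ, ∃ L : ℝ, ∀ a b : ℝ, |a| ≤ M → |b| ≤ M → |φ a - φ b| ≤ L * |a - b|) :
    LocHolder fun x => φ (f x) := by
  intro K hK
  obtain ⟨M, hM⟩ := hK.exists_bound_of_continuousOn hf.continuous.continuousOn
  obtain ⟨L, hL⟩ := hφ M
  obtain ⟨κ, C, h0, h1, hC, h⟩ := hf K hK
  refine ⟨κ, |L| * C, h0, h1, by positivity, fun x hx y hy => ?_⟩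
  refine (hL _ _ (hM x hx) (hM y hy)).trans ?_
  rw [mul_assoc]
  gcongr
  exacts [le_abs_self L, h x hx y hy]

theorem LocHolder.mul {f g : Eu d → ℝ} (hf : LocHolder f) (hg : LocHolder g) :
    LocHolder fun x => f x * g x := by
  intro K hK
  obtain ⟨M, hM⟩ := hK.exists_bound_of_continuousOn hf.continuous.continuousOn
  obtain ⟨N, hN⟩ := hK.exists_bound_of_continuousOn hg.continuous.continuousOn
  obtain ⟨κ, C, h0, h1, hC, h⟩ := hf.exists_common hg hK
  refine ⟨κ, |M| * C + |N| * C, h0, h1, by positivity, fun x hx y hy => ?_⟩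
  have e : f x * g x - f y * g y = f x * (g x - g y) + g y * (f x - f y) := by ring
  rw [e, add_mul]
  refine (abs_add_le _ _).trans ?_
  rw [abs_mul, abs_mul, mul_assoc, mul_assoc]
  exact add_le_add
    (mul_le_mul ((hM x hx).trans (le_abs_self _)) (h x hx y hy).2 (abs_nonneg _) (abs_nonneg _))
    (mul_le_mul ((hN y hy).trans (le_abs_self _)) (h x hx y hy).1 (abs_nonneg _) (abs_nonneg _))

theorem LocHolder.const_mul {f : Eu d → ℝ} (hf : LocHolder f) (c : ℝ) :
    LocHolder fun x => c * f x := (locHolder_const c).mul hf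

theorem LocHolder.sub {f g : Eu d → ℝ} (hf : LocHolder f) (hg : LocHolder g) :
    LocHolder fun x => f x - g x := by
  simpa [sub_eq_add_neg] using hf.add (hg.const_mul (-1))

theorem LocHolder.inv {f : Eu d → ℝ} (hf : LocHolder f) (hpos : ∀ x, 0 < f x) :
    LocHolder fun x => (f x)⁻¹ := by
  intro K hK
  obtain ⟨M, hM⟩ := hK.exists_bound_of_continuousOn
    (hf.continuous.inv₀ fun x => (hpos x).ne').continuousOn
  obtain ⟨κ, C, h0, h1, hC, h⟩ := hf K hK
  refine ⟨κ, |M| * |M| * C, h0, h1, by positivity, fun x hx y hy => ?_⟩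
  have e : (f x)⁻¹ - (f y)⁻¹ = -((f x)⁻¹ * (f y)⁻¹ * (f x - f y)) := by
    have := (hpos x).ne'; have := (hpos y).ne'; field_simp; ring
  rw [e, abs_neg, abs_mul, abs_mul, mul_assoc (|M| * |M|)]
  exact mul_le_mul (mul_le_mul ((hM x hx).trans (le_abs_self _))
    ((hM y hy).trans (le_abs_self _)) (abs_nonneg _) (abs_nonneg _)) (h x hx y hy)
    (abs_nonneg _) (by positivity)

theorem ContDiff.locHolder {f : Eu d → ℝ} (hf : ContDiff ℝ 1 f) : LocHolder f := by
  intro K hK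
  obtain ⟨R, hR⟩ := hK.isBounded.subset_closedBall 0
  obtain ⟨M, hM⟩ := (isCompact_closedBall (0 : Eu d) R).exists_bound_of_continuousOn
    (hf.continuous_fderiv (by simp)).continuousOn
  refine ⟨1, |M|, one_pos, le_rfl, abs_nonneg _, fun x hx y hy => ?_⟩
  rw [Real.rpow_one]
  exact (convex_closedBall (0 : Eu d) R).norm_image_sub_le_of_norm_fderiv_le
    (fun z _ => (hf.differentiable (by simp)) z) (fun z hz => (hM z hz).trans (le_abs_self _))
    (hR hy) (hR hx)

/-- A locally Hölder function with compact support satisfies a one-sided global Hölder bound. -/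
theorem LocHolder.exists_global {f g : Eu d → ℝ} (hf : LocHolder f) (hg : LocHolder g)
    (hfs : HasCompactSupport f) (hgs : HasCompactSupport g) {K : Set (Eu d)} (hK : IsCompact K) :
    ∃ κ C : ℝ, 0 < κ ∧ κ ≤ 1 ∧ 0 ≤ C ∧
      ∀ x ∈ K, ∀ y, |f y - f x| ≤ C * ‖x - y‖ ^ κ ∧ |g y - g x| ≤ C * ‖x - y‖ ^ κ := by
  have hK1 : IsCompact (K ∪ tsupport f ∪ tsupport g) := (hK.union hfs).union hgs
  obtain ⟨R, hR⟩ := hK1.isBounded.subset_closedBall 0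
  obtain ⟨κ, C, h0, h1, hC, h⟩ := hf.exists_common hg (isCompact_closedBall (0 : Eu d) (R + 1))
  obtain ⟨M, hM0, hM⟩ := exists_bound_of_contDiff hf.continuous hfs
  obtain ⟨N, hN0, hN⟩ := exists_bound_of_contDiff hg.continuous hgs
  refine ⟨κ, C + M + N, h0, h1, by positivity, fun x hx y => ?_⟩
  have hx' : ‖x‖ ≤ R := by simpa using hR (Or.inl (Or.inl hx))
  by_cases hy : y ∈ Metric.closedBall (0 : Eu d) (R + 1)
  · have hxy := h y hy x (by simpa using hx'.trans (by linarith))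
    rw [norm_sub_rev y x] at hxy
    constructor
    · refine hxy.1.trans ?_; gcongr; linarith
    · refine hxy.2.trans ?_; gcongr; linarith
  · have hy' : R + 1 < ‖y‖ := by simpa using hy
    have hyn : y ∉ K ∪ tsupport f ∪ tsupport g := fun hm => by
      have : ‖y‖ ≤ R := by simpa using hR hm
      linarith
    have hyf : f y = 0 := image_eq_zero_of_notMem_tsupport fun hm => hyn (Or.inl (Or.inr hm))
    have hyg : g y = 0 := image_eq_zero_of_notMem_tsupport fun hm => hyn (Or.inr hm)
    have h2 : 1 ≤ ‖x - y‖ ^ κ := by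
      refine Real.one_le_rpow ?_ h0.le
      have := norm_sub_norm_le y x
      rw [norm_sub_rev]; linarith
    rw [hyf, hyg, zero_sub, abs_neg, zero_sub, abs_neg]
    constructor
    · calc _ ≤ M * 1 := by rw [mul_one]; exact hM x
        _ ≤ _ := by gcongr; linarith
    · calc _ ≤ N * 1 := by rw [mul_one]; exact hN x
        _ ≤ _ := by gcongr; linarith

/-! ### Differentiation of heat potentials -/

/-- The kernel convolutions are dominated by an integrable power, uniformly on `U`. -/
def PotBound (j : ℕ) (P : MvPolynomial (Fin d) ℝ) (b : Eu d → ℝ → ℝ) (U : Set (Eu d)) : Prop :=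
  ∃ C γ : ℝ, -1 < γ ∧ ∀ x ∈ U, ∀ σ ∈ Ioo (0 : ℝ) 1, |cv j P b x (1 - σ) σ| ≤ C * σ ^ γ

theorem potBound_of_vanishing {j : ℕ} {P : MvPolynomial (Fin d) ℝ} {b : Eu d → ℝ → ℝ}
    {U : Set (Eu d)} {κ M : ℝ} (h0 : 0 ≤ κ) (h2 : κ ≤ 2) (hj : j < κ + 2)
    (hb : ∀ x ∈ U, ∀ y s, s ≤ 1 → |b y s| ≤ M * ‖x - y‖ ^ κ) : PotBound j P b U :=
  ⟨wn κ P * M, (κ - j) / 2, by linarith, fun x hx σ hσ =>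
    abs_cv_le j P hσ.1 h0 h2 x fun y => hb x hx y _ (by linarith [hσ.1])⟩

theorem potBound_of_holder {j : ℕ} {i : Fin d} {P : MvPolynomial (Fin d) ℝ} {b : Eu d → ℝ → ℝ}
    {U : Set (Eu d)} {κ M : ℝ} (hc : CCS b) (h0 : 0 ≤ κ) (h2 : κ ≤ 2) (hj : j < κ + 2)
    (hb : ∀ x ∈ U, ∀ y s, s ≤ 1 → |b y s - b x s| ≤ M * ‖x - y‖ ^ κ) :
    PotBound j (dpg i P) b U := by
  refine ⟨wn κ (dpg i P) * M, (κ - j) / 2, by linarith, fun x hx σ hσ => ?_⟩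
  have e : cv j (dpg i P) b x (1 - σ) σ =
      cv j (dpg i P) (fun y s => b y s - b x s) x (1 - σ) σ := by
    have hz : ∫ y, Ks j (dpg i P) σ (x - y) * b x (1 - σ) = 0 := by
      rw [integral_Ks_mul j _ hσ.1, integral_mul_const, integral_pgk_dpg]; simp
    rw [cv, cv]
    simp only [mul_sub]
    rw [integral_sub (hc.integrable_mul _ (contDiff_Ks_sub j _ σ x).continuous)
      ((integrable_Ks_sub j _ hσ.1 x).mul_const _), hz, sub_zero]
  rw [e]
  exact abs_cv_le j _ hσ.1 h0 h2 x fun y => hb x hx y _ (by linarith [hσ.1])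

theorem continuousOn_cv_Ioo (j : ℕ) (P : MvPolynomial (Fin d) ℝ) {b : Eu d → ℝ → ℝ} (hb : CCS b)
    (x : Eu d) : ContinuousOn (fun σ => cv j P b x (1 - σ) σ) (Ioo 0 1) := by
  have := continuousOn_cv_comp j P hb x 1 one_pos
  simp only [one_mul] at this
  exact this.mono Ioo_subset_Ioi_self

theorem PotBound.integrableOn {j : ℕ} {P : MvPolynomial (Fin d) ℝ} {b : Eu d → ℝ → ℝ}
    {U : Set (Eu d)} (h : PotBound j P b U) (hb : CCS b) {x : Eu d} (hx : x ∈ U) :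
    IntegrableOn (fun σ => cv j P b x (1 - σ) σ) (Ioo 0 1) := by
  obtain ⟨C, γ, hγ, h⟩ := h
  exact Integrable.mono' ((integrableOn_rpow_Ioo hγ 1).const_mul C)
    ((continuousOn_cv_Ioo j P hb x).aestronglyMeasurable measurableSet_Ioo)
    ((ae_restrict_iff' measurableSet_Ioo).2 (Eventually.of_forall fun σ hσ => h x hx σ hσ))

theorem PotBound.continuousOn {j : ℕ} {P : MvPolynomial (Fin d) ℝ} {b : Eu d → ℝ → ℝ}
    {U : Set (Eu d)} (h : PotBound j P b U) (hb : CCS b) : ContinuousOn (pot j P b) U := by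
  obtain ⟨C, γ, hγ, h⟩ := h
  refine continuousOn_of_dominated (bound := fun σ => C * σ ^ γ)
    (fun x _ => (continuousOn_cv_Ioo j P hb x).aestronglyMeasurable measurableSet_Ioo)
    (fun x hx => (ae_restrict_iff' measurableSet_Ioo).2
      (Eventually.of_forall fun σ hσ => h x hx σ hσ))
    ((integrableOn_rpow_Ioo hγ 1).const_mul C)
    ((ae_restrict_iff' measurableSet_Ioo).2 (Eventually.of_forall fun σ hσ => ?_))
  exact ((continuousOn_cv j P hb).comp (f := fun x : Eu d => (x, 1 - σ, σ)) (by fun_prop)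
    (fun x _ => hσ.1))

theorem integrable_sum_smul {ι α F : Type*} [Fintype ι] [MeasurableSpace α] {μ : Measure α}
    [NormedAddCommGroup F] [NormedSpace ℝ F] {f : ι → α → ℝ} (hf : ∀ i, Integrable (f i) μ)
    (v : ι → F) : Integrable (fun a => ∑ i, f i a • v i) μ :=
  integrable_finsetSum _ fun i _ => (hf i).smul_const _

theorem integral_sum_smul {ι α F : Type*} [Fintype ι] [MeasurableSpace α] {μ : Measure α}
    [NormedAddCommGroup F] [NormedSpace ℝ F] [CompleteSpace F] {f : ι → α → ℝ}
    (hf : ∀ i, Integrable (f i) μ) (v : ι → F) :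
    ∫ a, ∑ i, f i a • v i ∂μ = ∑ i, (∫ a, f i a ∂μ) • v i := by
  rw [integral_finsetSum _ fun i _ => (hf i).smul_const _]
  exact Finset.sum_congr rfl fun i _ => integral_smul_const _ _

theorem hasFDerivAt_cv (j : ℕ) (P : MvPolynomial (Fin d) ℝ) {b : Eu d → ℝ → ℝ} (hb : CCS b)
    (s : ℝ) {σ : ℝ} (hσ : 0 < σ) (x : Eu d) :
    HasFDerivAt (fun x => cv j P b x s σ) (∑ i, cv (j + 1) (dpg i P) b x s σ • prj i) x := by
  have hCC : ∃ C : Fin d → ℝ, ∀ i, 0 ≤ C i ∧ ∀ z, |Ks (j + 1) (dpg i P) σ z| ≤ C i := by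
    refine ⟨fun i => (exists_Ks_bound (j + 1) (dpg i P)).choose * ((√σ) ^ (d + (j + 1)))⁻¹,
      fun i => ?_⟩
    obtain ⟨h0, h⟩ := (exists_Ks_bound (j + 1) (dpg i P)).choose_spec
    refine ⟨mul_nonneg h0 (by positivity), fun z => (h σ hσ z).trans ?_⟩
    have h4 : Real.exp (-‖z‖ ^ 2 / (8 * σ)) ≤ 1 := by
      rw [Real.exp_le_one_iff, neg_div, neg_nonpos]; positivity
    exact mul_le_of_le_one_right (mul_nonneg h0 (by positivity)) h4
  obtain ⟨C, hC⟩ := hCC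
  have hk : ∀ (j : ℕ) P (x : Eu d), Continuous fun y => Ks j P σ (x - y) :=
    fun j P x => (contDiff_Ks_sub j P σ x).continuous
  obtain ⟨D, hD⟩ : ∃ D : Eu d → Eu d → Eu d →L[ℝ] ℝ, D = fun x y =>
    ∑ i, (Ks (j + 1) (dpg i P) σ (x - y) * b y s) • prj i := ⟨_, rfl⟩
  have hint : ∀ i, Integrable fun y => Ks (j + 1) (dpg i P) σ (x - y) * b y s :=
    fun i => hb.integrable_mul s (hk _ _ x)
  have hDi : Integrable (D x) := by
    rw [hD]; exact integrable_sum_smul hint _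
  have hDb : ∀ x' y, ‖D x' y‖ ≤ (∑ i, C i * ‖prj (d := d) i‖) * |b y s| := by
    intro x' y
    rw [hD, Finset.sum_mul]
    refine (norm_sum_le _ _).trans (Finset.sum_le_sum fun i _ => ?_)
    rw [norm_smul, norm_mul, Real.norm_eq_abs, Real.norm_eq_abs, mul_right_comm]
    exact mul_le_mul_of_nonneg_right (mul_le_mul_of_nonneg_right ((hC i).2 _) (norm_nonneg _))
      (abs_nonneg _)
  have hDd : ∀ x' y, HasFDerivAt (fun x => Ks j P σ (x - y) * b y s) (D x' y) x' := by
    intro x' y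
    have h1 := ((hasFDerivAt_Ks j P hσ (x' - y)).comp x'
      ((hasFDerivAt_id x').sub_const y)).mul_const (b y s)
    refine h1.congr_fderiv ?_
    rw [hD]
    ext v
    simp [Finset.mul_sum, mul_assoc, mul_left_comm]
  have hDI : ∫ y, D x y = ∑ i, cv (j + 1) (dpg i P) b x s σ • prj i := by
    rw [hD]; exact integral_sum_smul hint _
  rw [← hDI]
  exact hasFDerivAt_integral_of_dominated_of_fderiv_le univ_mem
    (Eventually.of_forall fun x' => (hb.integrable_mul s (hk j P x')).aestronglyMeasurable)
    (hb.integrable_mul s (hk j P x)) hDi.aestronglyMeasurable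
    (Eventually.of_forall fun y x' _ => hDb x' y) ((hb.integrable s).abs.const_mul _)
    (Eventually.of_forall fun y x' _ => hDd x' y)

theorem hasFDerivAt_pot {j : ℕ} {P : MvPolynomial (Fin d) ℝ} {b : Eu d → ℝ → ℝ} (hb : CCS b)
    {U : Set (Eu d)} (hU : IsOpen U) (h : PotBound j P b U)
    (h' : ∀ i, PotBound (j + 1) (dpg i P) b U) {x : Eu d} (hx : x ∈ U) :
    HasFDerivAt (pot j P b) (∑ i, pot (j + 1) (dpg i P) b x • prj i) x := by
  have hint : ∀ i, Integrable (fun σ => cv (j + 1) (dpg i P) b x (1 - σ) σ)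
      (volume.restrict (Ioo 0 1)) := fun i => (h' i).integrableOn hb hx
  choose C γ hγ hC using h'
  obtain ⟨D, hD⟩ : ∃ D : Eu d → ℝ → Eu d →L[ℝ] ℝ, D = fun x σ =>
    ∑ i, cv (j + 1) (dpg i P) b x (1 - σ) σ • prj i := ⟨_, rfl⟩
  have hDi : Integrable (D x) (volume.restrict (Ioo 0 1)) := by
    rw [hD]; exact integrable_sum_smul hint _
  have hDI : ∫ σ in Ioo 0 1, D x σ = ∑ i, pot (j + 1) (dpg i P) b x • prj i := by
    rw [hD]; exact integral_sum_smul hint _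
  have hDb : ∀ σ ∈ Ioo (0 : ℝ) 1, ∀ x' ∈ U,
      ‖D x' σ‖ ≤ ∑ i, C i * σ ^ γ i * ‖prj (d := d) i‖ := by
    intro σ hσ x' hx'
    rw [hD]
    refine (norm_sum_le _ _).trans (Finset.sum_le_sum fun i _ => ?_)
    rw [norm_smul]
    exact mul_le_mul_of_nonneg_right (hC i x' hx' σ hσ) (norm_nonneg _)
  have hBi : Integrable (fun σ => ∑ i, C i * σ ^ γ i * ‖prj (d := d) i‖)
      (volume.restrict (Ioo (0 : ℝ) 1)) := integrable_finsetSum _ fun i _ =>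
    Integrable.mul_const (Integrable.const_mul (integrableOn_rpow_Ioo (hγ i) 1) _) _
  have hDd : ∀ σ ∈ Ioo (0 : ℝ) 1, ∀ x' ∈ U,
      HasFDerivAt (fun x => cv j P b x (1 - σ) σ) (D x' σ) x' := by
    intro σ hσ x' _
    rw [hD]
    exact hasFDerivAt_cv j P hb _ hσ.1 x'
  rw [← hDI]
  exact hasFDerivAt_integral_of_dominated_of_fderiv_le (hU.mem_nhds hx)
    (Eventually.of_forall fun x' =>
      (continuousOn_cv_Ioo j P hb x').aestronglyMeasurable measurableSet_Ioo)
    (h.integrableOn hb hx) hDi.aestronglyMeasurable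
    ((ae_restrict_iff' measurableSet_Ioo).2 (Eventually.of_forall hDb)) hBi
    ((ae_restrict_iff' measurableSet_Ioo).2 (Eventually.of_forall hDd))

theorem contDiffOn_pot_zero {j : ℕ} {P : MvPolynomial (Fin d) ℝ} {b : Eu d → ℝ → ℝ} (hb : CCS b)
    {U : Set (Eu d)} (hU : IsOpen U) (h : PotBound j P b U)
    (h' : ∀ i, PotBound (j + 1) (dpg i P) b U) : ContDiffOn ℝ 1 (pot j P b) U := by
  rw [show (1 : WithTop ℕ∞) = 0 + 1 from (zero_add 1).symm,
    contDiffOn_succ_iff_hasFDerivWithinAt_of_uniqueDiffOn hU.uniqueDiffOn]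
  refine ⟨by simp, fun x => ∑ i, pot (j + 1) (dpg i P) b x • prj i, ?_, fun x hx =>
    (hasFDerivAt_pot hb hU h h' hx).hasFDerivWithinAt⟩
  rw [contDiffOn_zero]
  exact continuousOn_finsetSum _ fun i _ => ((h' i).continuousOn hb).smul continuousOn_const

theorem contDiffOn_pot {j : ℕ} {P : MvPolynomial (Fin d) ℝ} {b : Eu d → ℝ → ℝ} (hb : CCS b)
    {U : Set (Eu d)} (hU : IsOpen U) (h : PotBound j P b U)
    (h' : ∀ i, PotBound (j + 1) (dpg i P) b U)
    (h'' : ∀ i k, PotBound (j + 2) (dpg k (dpg i P)) b U) : ContDiffOn ℝ 2 (pot j P b) U := by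
  rw [show (2 : WithTop ℕ∞) = 1 + 1 from one_add_one_eq_two.symm,
    contDiffOn_succ_iff_hasFDerivWithinAt_of_uniqueDiffOn hU.uniqueDiffOn]
  refine ⟨by simp, fun x => ∑ i, pot (j + 1) (dpg i P) b x • prj i, ?_, fun x hx =>
    (hasFDerivAt_pot hb hU h h' hx).hasFDerivWithinAt⟩
  exact ContDiffOn.sum fun i _ =>
    (contDiffOn_pot_zero hb hU (h' i) (h'' i)).smul contDiffOn_const
end

section
variable {d : ℕ} {u G : Eu d → ℝ}

theorem IsPoisson.contDiff (h : IsPoisson u G) (hu : LocHolder u) (hG : LocHolder G) :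
    ContDiff ℝ 2 u := by
  rw [contDiff_iff_contDiffAt]
  intro x0
  obtain ⟨ζ, hζ⟩ : ∃ ζ : ContDiffBump x0, ζ.rIn = 2 := ⟨⟨2, 3, by norm_num, by norm_num⟩, rfl⟩
  have hζd : ContDiff ℝ ∞ ζ := ζ.contDiff
  have hs : HasCompactSupport ζ := ζ.hasCompactSupport
  obtain ⟨U, hU⟩ : ∃ U, U = Metric.ball x0 1 := ⟨_, rfl⟩
  have hUo : IsOpen U := hU ▸ Metric.isOpen_ball
  have hUx : x0 ∈ U := by rw [hU]; simp
  have h1 : ∀ y ∈ Metric.closedBall x0 2, ζ y = 1 := fun y hy =>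
    ζ.one_of_mem_closedBall (by rwa [hζ])
  have hpd : ∀ i, ∀ y ∈ Metric.ball x0 2, pd i ζ y = 0 := by
    intro i y hy
    have : (ζ : Eu d → ℝ) =ᶠ[𝓝 y] fun _ => 1 := by
      filter_upwards [Metric.isOpen_ball.mem_nhds hy] with z hz using
        h1 z (Metric.ball_subset_closedBall hz)
    rw [pd, this.fderiv_eq]; simp
  have hp1 : ∀ i (j : ℕ) (P : MvPolynomial (Fin d) ℝ), j ≤ 3 → PotBound j P (poiF1 u ζ i) U := by
    intro i j P hj
    obtain ⟨M, hM0, hM⟩ := (h.ccs1 hζd hs i).exists_bound (poiF1_zero u ζ i) 1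
    have hj' : (j : ℝ) ≤ 3 := by exact_mod_cast hj
    refine potBound_of_vanishing (κ := 2) (M := M) (by norm_num) le_rfl (by linarith)
      fun x hx y s hs1 => ?_
    by_cases hy : y ∈ Metric.ball x0 2
    · rw [poiF1, hpd i y hy]; simp; positivity
    · have hxy : 1 ≤ ‖x - y‖ := by
        rw [Metric.mem_ball, not_lt] at hy
        rw [hU, Metric.mem_ball] at hx
        have := dist_triangle y x x0
        rw [← dist_eq_norm, dist_comm]; linarith
      refine (hM y s hs1).trans (le_mul_of_one_le_right hM0 ?_)
      exact Real.one_le_rpow hxy (by norm_num)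
  have hc0 := h.ccs0 hζd hs
  have hp00 : PotBound 0 (hp0 d) (poiF0 u G ζ) U := by
    obtain ⟨M, hM0, hM⟩ := hc0.exists_bound (poiF0_zero u G ζ) 1
    exact potBound_of_vanishing (κ := 0) (M := M) le_rfl (by norm_num) (by norm_num)
      fun x _ y s hs1 => by rw [Real.rpow_zero, mul_one]; exact hM y s hs1
  obtain ⟨κ, C, hκ0, hκ1, hC0, hC⟩ := LocHolder.exists_global
    (f := fun y => u y * lap ζ y - G y * ζ y) (g := fun y => u y * ζ y)
    ((hu.mul (((contDiff_lap hζd).of_le (by norm_num)).locHolder)).sub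
      (hG.mul (hζd.of_le (by norm_num)).locHolder)) (hu.mul (hζd.of_le (by norm_num)).locHolder)
    ((HasCompactSupport.mul_left hs.lap).sub (HasCompactSupport.mul_left hs))
    (HasCompactSupport.mul_left hs)
    (isCompact_closedBall x0 1)
  have hH : ∀ x ∈ U, ∀ y s, s ≤ 1 → |poiF0 u G ζ y s - poiF0 u G ζ x s| ≤
      (3 * C) * ‖x - y‖ ^ κ := by
    intro x hx y s hs1
    obtain ⟨e1, e2⟩ := hC x (Metric.ball_subset_closedBall (hU ▸ hx)) y
    obtain ⟨c, hc⟩ : ∃ c, c = max s 0 := ⟨_, rfl⟩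
    have hc0 : 0 ≤ c := by rw [hc]; exact le_max_right _ _
    have hc1 : c ≤ 1 := by rw [hc]; exact max_le hs1 zero_le_one
    have e : poiF0 u G ζ y s - poiF0 u G ζ x s =
        c ^ 2 * ((u y * lap ζ y - G y * ζ y) - (u x * lap ζ x - G x * ζ x)) +
        2 * c * (u y * ζ y - u x * ζ x) := by
      rw [poiF0, poiF0, ← hc]; ring
    rw [e]
    refine (abs_add_le _ _).trans ?_
    rw [abs_mul, abs_mul, abs_of_nonneg (by positivity : 0 ≤ c ^ 2),
      abs_of_nonneg (by positivity : 0 ≤ 2 * c)]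
    have : c ^ 2 ≤ 1 := pow_le_one₀ hc0 hc1
    calc _ ≤ 1 * (C * ‖x - y‖ ^ κ) + 2 * (C * ‖x - y‖ ^ κ) :=
          add_le_add (mul_le_mul this e1 (abs_nonneg _) zero_le_one)
            (mul_le_mul (by linarith) e2 (abs_nonneg _) zero_le_two)
      _ = _ := by ring
  have hp01 : ∀ i, PotBound (0 + 1) (dpg i (hp0 d)) (poiF0 u G ζ) U := fun i =>
    potBound_of_holder hc0 hκ0.le (by linarith) (by push_cast; linarith) hH
  have hp02 : ∀ i k, PotBound (0 + 2) (dpg k (dpg i (hp0 d))) (poiF0 u G ζ) U := fun i k =>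
    potBound_of_holder hc0 hκ0.le (by linarith) (by push_cast; linarith) hH
  have hmain : ContDiffOn ℝ 2 (fun x => ∑ i, pot 1 (dpg i (hp0 d)) (poiF1 u ζ i) x +
      pot 0 (hp0 d) (poiF0 u G ζ) x) U := by
    refine (ContDiffOn.sum fun i _ => contDiffOn_pot (h.ccs1 hζd hs i) hUo (hp1 i _ _ ?_)
      (fun k => hp1 i _ _ ?_) fun k l => hp1 i _ _ ?_).add (contDiffOn_pot hc0 hUo hp00 hp01 hp02)
    all_goals norm_num
  refine (hmain.contDiffAt (hUo.mem_nhds hUx)).congr_of_eventuallyEq ?_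
  filter_upwards [hUo.mem_nhds hUx] with x hx
  rw [← h.representation hζd hs x, h1 x, mul_one]
  exact Metric.closedBall_subset_closedBall (by norm_num)
    (Metric.ball_subset_closedBall (hU ▸ hx))

theorem contDiff_pd_succ {n : ℕ} {f : Eu d → ℝ} (hf : ContDiff ℝ (n + 1) f) (i : Fin d) :
    ContDiff ℝ n (pd i f) :=
  (hf.fderiv_right le_rfl).clm_apply contDiff_const

theorem integral_mul_pd {f g : Eu d → ℝ} (hf : ContDiff ℝ 1 f) (hg : ContDiff ℝ 1 g)
    (hs : HasCompactSupport g) (i : Fin d) :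
    ∫ y, f y * pd i g y = -∫ y, pd i f y * g y := by
  have c1 : Continuous (pd i f) := (contDiff_pd_succ (n := 0) (by simpa using hf) i).continuous
  have c2 : Continuous (pd i g) := (contDiff_pd_succ (n := 0) (by simpa using hg) i).continuous
  exact integral_mul_fderiv_eq_neg_fderiv_mul_of_integrable
    ((c1.mul hg.continuous).integrable_of_hasCompactSupport (HasCompactSupport.mul_left hs))
    ((hf.continuous.mul c2).integrable_of_hasCompactSupport (HasCompactSupport.mul_left (hs.pd i)))
    ((hf.continuous.mul hg.continuous).integrable_of_hasCompactSupport
      (HasCompactSupport.mul_left hs))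
    (fun x _ => hf.differentiable (by simp) x) (fun x _ => hg.differentiable (by simp) x)

theorem continuous_lap_of_contDiff {f : Eu d → ℝ} (hf : ContDiff ℝ 2 f) : Continuous (lap f) :=
  continuous_finsetSum _ fun i _ => (contDiff_pd_succ (n := 0)
    (by simpa using contDiff_pd_succ (n := 1) (by simpa [one_add_one_eq_two] using hf) i) i).continuous

theorem integral_mul_lap {f ρ : Eu d → ℝ} (hf : ContDiff ℝ 2 f) (hρ : ContDiff ℝ ∞ ρ)
    (hs : HasCompactSupport ρ) : ∫ y, f y * lap ρ y = ∫ y, lap f y * ρ y := by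
  have hf1 : ∀ i, ContDiff ℝ 1 (pd i f) := fun i => by
    exact_mod_cast contDiff_pd_succ (n := 1) (by simpa [one_add_one_eq_two] using hf) i
  have hρ1 : ∀ i, ContDiff ℝ 1 (pd i ρ) := fun i => (contDiff_pd hρ i).of_le (by norm_num)
  have c : ∀ i, Continuous (pd i (pd i f)) := fun i =>
    (contDiff_pd_succ (n := 0) (by simpa using hf1 i) i).continuous
  have cρ : ∀ i, Continuous (pd i (pd i ρ)) := fun i =>
    (contDiff_pd_succ (n := 0) (by simpa using hρ1 i) i).continuous
  simp only [lap, Finset.mul_sum, Finset.sum_mul]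
  rw [integral_finsetSum, integral_finsetSum]
  · refine Finset.sum_congr rfl fun i _ => ?_
    rw [integral_mul_pd (hf.of_le (by norm_num)) (hρ1 i) (hs.pd i) i,
      integral_mul_pd (hf1 i) (hρ.of_le (by norm_num)) hs i, neg_neg]
  · exact fun i _ => ((c i).mul hρ.continuous).integrable_of_hasCompactSupport
      (HasCompactSupport.mul_left hs)
  · exact fun i _ => (hf.continuous.mul (cρ i)).integrable_of_hasCompactSupport
      (HasCompactSupport.mul_left ((hs.pd i).pd i))

theorem IsPoisson.lap_eq (h : IsPoisson u G) (hu : ContDiff ℝ 2 u) (x : Eu d) : lap u x = G x := by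
  have hc : Continuous fun y => lap u y - G y := (continuous_lap_of_contDiff hu).sub h.cG
  have h0 : ∀ᵐ y, lap u y - G y = 0 := by
    refine ae_eq_zero_of_integral_contDiff_smul_eq_zero hc.locallyIntegrable fun ρ hρ hs => ?_
    have := h.weak ρ hρ hs
    rw [integral_mul_lap hu hρ hs] at this
    simp only [smul_eq_mul, mul_sub]
    rw [integral_sub, sub_eq_zero]
    · simpa only [mul_comm] using this
    · exact (hρ.continuous.mul (continuous_lap_of_contDiff hu)).integrable_of_hasCompactSupport
        (HasCompactSupport.mul_right hs)
    · exact (hρ.continuous.mul h.cG).integrable_of_hasCompactSupport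
        (HasCompactSupport.mul_right hs)
  have := (hc.ae_eq_iff_eq volume continuous_const).1 h0
  exact sub_eq_zero.1 (congrFun this x)
end

section
variable {d : ℕ} {A : Eu d → ℝ} {u g : Eu d → ℝ → ℝ}

/-- The backward time difference of a function of space and time. -/
def tdiff (h : ℝ) (u : Eu d → ℝ → ℝ) (y : Eu d) (s : ℝ) : ℝ := u y s - u y (s - h)

theorem IsWeak.shift (hw : IsWeak A u g) (hA : Continuous A) (hpos : ∀ x, 0 < A x) {h : ℝ}
    (hh : 0 ≤ h) : IsWeak A (fun y s => u y (s - h)) (fun y s => g y (s - h)) where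
  cu := hw.cu.comp (f := fun q : Eu d × ℝ => (q.1, q.2 - h)) (by fun_prop)
  cg := hw.cg.comp (f := fun q : Eu d × ℝ => (q.1, q.2 - h)) (by fun_prop)
  u0 y s hs := hw.u0 y _ (by linarith)
  g0 y s hs := hw.g0 y _ (by linarith)
  weak ρ hρ hs t := by
    have hc := (hw.ccs_source hA hpos hρ hs).continuous_integral
    rw [hw.weak ρ hρ hs (t - h), intervalIntegral.integral_comp_sub_right
      (fun s => ∫ y, (u y s * _root_.lap ρ y + g y s * (ρ y / A y))) h,
      ← intervalIntegral.integral_add_adjacent_intervals (a := 0 - h) (b := 0) (hc.intervalIntegrable _ _)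
      (hc.intervalIntegrable _ _), right_eq_add]
    refine (intervalIntegral.integral_congr fun s hs' => ?_).trans intervalIntegral.integral_zero
    rw [uIcc_of_le (by linarith)] at hs'
    simp [hw.u0 _ s hs'.2, hw.g0 _ s hs'.2]

theorem IsWeak.sub {v k : Eu d → ℝ → ℝ} (hw : IsWeak A u g) (hv : IsWeak A v k)
    (hA : Continuous A) (hpos : ∀ x, 0 < A x) :
    IsWeak A (fun y s => u y s - v y s) (fun y s => g y s - k y s) where
  cu := hw.cu.sub hv.cu
  cg := hw.cg.sub hv.cg
  u0 y s hs := by rw [hw.u0 y s hs, hv.u0 y s hs, sub_zero]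
  g0 y s hs := by rw [hw.g0 y s hs, hv.g0 y s hs, sub_zero]
  weak ρ hρ hs t := by
    have h1 := hw.ccs_source hA hpos hρ hs
    have h2 := hv.ccs_source hA hpos hρ hs
    have c1 := CCS.mul hw.cu (continuous_div_coeff hA hpos hρ.continuous)
      (hasCompactSupport_div hs A)
    have c2 := CCS.mul hv.cu (continuous_div_coeff hA hpos hρ.continuous)
      (hasCompactSupport_div hs A)
    simp only [sub_mul]
    rw [integral_sub (c1.integrable t) (c2.integrable t), hw.weak ρ hρ hs, hv.weak ρ hρ hs,
      ← intervalIntegral.integral_sub (h1.continuous_integral.intervalIntegrable _ _)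
        (h2.continuous_integral.intervalIntegrable _ _)]
    congr 1
    funext s
    rw [← integral_sub (h1.integrable s) (h2.integrable s)]
    congr 1
    funext y
    ring

theorem IsWeak.tdiff (hw : IsWeak A u g) (hA : Continuous A) (hpos : ∀ x, 0 < A x) {h : ℝ}
    (hh : 0 ≤ h) : IsWeak A (tdiff h u) (tdiff h g) :=
  hw.sub (hw.shift hA hpos hh) hA hpos

theorem setIntegral_Ioi_shift (φ : ℝ → ℝ) (h : ℝ) :
    ∫ σ in Ioi 0, φ (σ + h) = ∫ σ in Ioi h, φ σ := by
  have := (measurePreserving_add_right (volume : Measure ℝ) h).setIntegral_preimage_emb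
    (measurableEmbedding_addRight h) φ (Ioi h)
  rw [← this]
  simp

theorem inv_sqrt_pow_eq {σ : ℝ} (hσ : 0 < σ) (j : ℕ) : ((√σ) ^ j)⁻¹ = σ ^ (-(j : ℝ) / 2) := by
  rw [Real.sqrt_eq_rpow, ← Real.rpow_natCast, ← Real.rpow_mul hσ.le, ← Real.rpow_neg hσ.le]
  congr 1; ring

/-- Time regularity of heat potentials with bounded sources. -/
theorem exists_time_diff (j : ℕ) (hj : j ≤ 1) (P : MvPolynomial (Fin d) ℝ) {a0 : ℝ} (ha0 : 0 < a0)
    (T : ℝ) :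
    ∃ C : ℝ, 0 ≤ C ∧ ∀ (F : Eu d → ℝ → ℝ) (M : ℝ), CCS F → (∀ y s, s ≤ 0 → F y s = 0) →
      0 ≤ M → (∀ y s, s ≤ T → |F y s| ≤ M) → ∀ x a t h, a0 ≤ a → t ≤ T → 0 ≤ h → h ≤ 1 →
      |∫ σ in Ioi (0 : ℝ), cv j P (tdiff h F) x (t - σ) (a * σ)| ≤
        C * M * h ^ (3 / 8 : ℝ) := by
  obtain ⟨C1, hC1, hK⟩ := exists_Ks_time_diff (d := d) j P
  have hjr : (j : ℝ) ≤ 1 := by exact_mod_cast hj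
  have hj0 : (0 : ℝ) ≤ j := Nat.cast_nonneg j
  obtain ⟨S, hS⟩ : ∃ S, S = max T 0 := ⟨_, rfl⟩
  have hS0 : 0 ≤ S := hS ▸ le_max_right _ _
  have hγ1 : -1 < -(j : ℝ) / 2 := by linarith
  have hγ2 : -1 < -(j : ℝ) / 2 - 3 / 8 := by linarith
  obtain ⟨I2, hI2⟩ : ∃ I, I = ∫ σ in Ioo 0 S, σ ^ (-(j : ℝ) / 2 - 3 / 8) := ⟨_, rfl⟩
  have hI20 : 0 ≤ I2 := hI2 ▸ setIntegral_nonneg measurableSet_Ioo fun σ hσ => by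
    have := hσ.1; positivity
  have hw := wn_nonneg (d := d) 0 P
  refine ⟨wn 0 P * a0 ^ (-(j : ℝ) / 2) * 2 + C1 * a0 ^ (-(j : ℝ) / 2) * I2, by positivity,
    fun F M hF h0 hM0 hM x a t h ha ht hh hh1 => ?_⟩
  have ha' : 0 < a := ha0.trans_le ha
  have hM' : ∀ s, s ≤ T → ∀ y, |F y s| ≤ M * ‖x - y‖ ^ (0 : ℝ) := fun s hs y => by
    rw [Real.rpow_zero, mul_one]; exact hM y s hs
  obtain ⟨φ, hφ⟩ : ∃ φ : ℝ → ℝ, φ = fun σ => cv j P F x (t - σ) (a * σ) := ⟨_, rfl⟩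
  obtain ⟨ψ, hψ⟩ : ∃ ψ : ℝ → ℝ, ψ = fun σ => cv j P F x (t - h - σ) (a * σ) := ⟨_, rfl⟩
  have hφi : IntegrableOn φ (Ioi 0) := hφ ▸ integrableOn_cv j P hF h0 ha' le_rfl zero_le_two
    (by linarith) fun y s hs => hM' s (hs.trans ht) y
  have hψi : IntegrableOn ψ (Ioi 0) := hψ ▸ integrableOn_cv j P hF h0 ha' le_rfl zero_le_two
    (by linarith) fun y s hs => hM' s (by linarith) y
  have hpow : ∀ σ, 0 < σ → (a * σ) ^ (-(j : ℝ) / 2) ≤ a0 ^ (-(j : ℝ) / 2) * σ ^ (-(j : ℝ) / 2) := by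
    intro σ hσ
    rw [Real.mul_rpow ha'.le hσ.le]
    exact mul_le_mul_of_nonneg_right (Real.rpow_le_rpow_of_nonpos ha0 ha (by linarith))
      (by positivity)
  have hsplit : ∀ σ ∈ Ioi (0 : ℝ), cv j P (_root_.tdiff h F) x (t - σ) (a * σ) = φ σ - ψ σ := by
    intro σ hσ
    rw [hφ, hψ]
    have e : t - h - σ = t - σ - h := by ring
    simp only [cv, _root_.tdiff, mul_sub, e]
    rw [integral_sub (hF.integrable_mul _ (contDiff_Ks_sub j _ _ x).continuous)
      (hF.integrable_mul _ (contDiff_Ks_sub j _ _ x).continuous)]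
  rw [setIntegral_congr_fun measurableSet_Ioi hsplit, integral_sub hφi hψi]
  have hφh : IntegrableOn φ (Ioi h) := hφi.mono_set (Ioi_subset_Ioi hh)
  have hφs : IntegrableOn (fun σ => φ (σ + h)) (Ioi 0) := by
    have := ((measurePreserving_add_right (volume : Measure ℝ) h).integrableOn_comp_preimage
      (measurableEmbedding_addRight h) (f := φ) (s := Ioi h)).2 hφh
    simpa [Function.comp_def] using this
  have h1 : ∫ σ in Ioi 0, φ σ = (∫ σ in Ioc 0 h, φ σ) + ∫ σ in Ioi 0, φ (σ + h) := by
    rw [setIntegral_Ioi_shift, ← setIntegral_union (Ioc_disjoint_Ioi le_rfl) measurableSet_Ioi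
      (hφi.mono_set Ioc_subset_Ioi_self) hφh, Ioc_union_Ioi_eq_Ioi hh]
  rw [h1, add_sub_assoc, ← integral_sub hφs hψi]
  have b1 : |∫ σ in Ioc 0 h, φ σ| ≤ wn 0 P * a0 ^ (-(j : ℝ) / 2) * 2 * M * h ^ (3 / 8 : ℝ) := by
    rw [integral_Ioc_eq_integral_Ioo]
    have hb : ∀ σ ∈ Ioo 0 h, ‖φ σ‖ ≤ wn 0 P * M * a0 ^ (-(j : ℝ) / 2) * σ ^ (-(j : ℝ) / 2) := by
      intro σ hσ
      rw [hφ, Real.norm_eq_abs]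
      refine (abs_cv_le j P (mul_pos ha' hσ.1) le_rfl zero_le_two x
        (hM' _ (by linarith [hσ.1]))).trans ?_
      rw [zero_sub, mul_assoc _ (a0 ^ _)]
      exact mul_le_mul_of_nonneg_left (hpow σ hσ.1) (by positivity)
    have := norm_integral_le_of_norm_le
      (Integrable.const_mul (integrableOn_rpow_Ioo hγ1 h) (wn 0 P * M * a0 ^ (-(j : ℝ) / 2)))
      ((ae_restrict_iff' measurableSet_Ioo).2 (Eventually.of_forall hb))
    rw [← Real.norm_eq_abs]
    refine this.trans ?_
    rw [integral_const_mul, setIntegral_rpow_Ioo hγ1 hh]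
    have e1 : h ^ (-(j : ℝ) / 2 + 1) / (-(j : ℝ) / 2 + 1) ≤ 2 * h ^ (3 / 8 : ℝ) := by
      have : h ^ (-(j : ℝ) / 2 + 1) ≤ h ^ (3 / 8 : ℝ) :=
        Real.rpow_le_rpow_of_exponent_ge_of_imp hh hh1 (by linarith) (fun _ _ => by linarith)
      rw [div_le_iff₀ (by linarith)]
      have : 0 ≤ h ^ (3 / 8 : ℝ) := by positivity
      nlinarith
    calc _ ≤ wn 0 P * M * a0 ^ (-(j : ℝ) / 2) * (2 * h ^ (3 / 8 : ℝ)) :=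
          mul_le_mul_of_nonneg_left e1 (by positivity)
      _ = _ := by ring
  have b2 : |∫ σ in Ioi 0, (φ (σ + h) - ψ σ)| ≤
      C1 * a0 ^ (-(j : ℝ) / 2) * I2 * M * h ^ (3 / 8 : ℝ) := by
    rw [setIntegral_Ioi_eq_Ioo (b := S)]
    · have hb : ∀ σ ∈ Ioo 0 S, ‖φ (σ + h) - ψ σ‖ ≤ M * (C1 * a0 ^ (-(j : ℝ) / 2)) *
          h ^ (3 / 8 : ℝ) * σ ^ (-(j : ℝ) / 2 - 3 / 8) := by
        intro σ hσ
        have hσ0 := hσ.1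
        have e : φ (σ + h) - ψ σ = ∫ y, (Ks j P (a * σ + a * h) (x - y) - Ks j P (a * σ) (x - y)) *
            F y (t - h - σ) := by
          rw [hφ, hψ]
          simp only [cv, sub_mul]
          rw [integral_sub (hF.integrable_mul _ (contDiff_Ks_sub j _ _ x).continuous)
            (hF.integrable_mul _ (contDiff_Ks_sub j _ _ x).continuous)]
          rw [mul_add, show t - (σ + h) = t - h - σ by ring]
        rw [e, Real.norm_eq_abs]
        have haσ : 0 < a * σ := by positivity
        refine (abs_integral_mul_le ((integrable_Ks_sub j P (by positivity) x).sub
          (integrable_Ks_sub j P haσ x)) fun y => hM y (t - h - σ) (by linarith)).trans ?_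
        refine (mul_le_mul_of_nonneg_left (hK (a * σ) (a * h) haσ (by positivity) x) hM0).trans ?_
        rw [show M * (C1 * a0 ^ (-(j : ℝ) / 2)) * h ^ (3 / 8 : ℝ) * σ ^ (-(j : ℝ) / 2 - 3 / 8) =
          M * (C1 * (a0 ^ (-(j : ℝ) / 2) * h ^ (3 / 8 : ℝ) * σ ^ (-(j : ℝ) / 2 - 3 / 8))) by ring,
          mul_assoc C1]
        refine mul_le_mul_of_nonneg_left (mul_le_mul_of_nonneg_left ?_ hC1) hM0
        rw [inv_sqrt_pow_eq haσ, mul_div_mul_left _ _ ha'.ne']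
        calc _ ≤ (a0 ^ (-(j : ℝ) / 2) * σ ^ (-(j : ℝ) / 2)) * (h / σ) ^ (3 / 8 : ℝ) :=
              mul_le_mul (hpow σ hσ0) (min_one_le_rpow (by positivity) (by norm_num) (by norm_num))
                (by positivity) (by positivity)
          _ = _ := by
            rw [Real.div_rpow hh hσ0.le, Real.rpow_sub hσ0]
            field_simp
      have := norm_integral_le_of_norm_le
        (Integrable.const_mul (integrableOn_rpow_Ioo hγ2 S)
          (M * (C1 * a0 ^ (-(j : ℝ) / 2)) * h ^ (3 / 8 : ℝ)))
        ((ae_restrict_iff' measurableSet_Ioo).2 (Eventually.of_forall hb))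
      rw [← Real.norm_eq_abs]
      refine this.trans_eq ?_
      rw [integral_const_mul, ← hI2]
      ring
    · intro σ hσ
      have : T ≤ S := hS ▸ le_max_left _ _
      rw [hφ, hψ]
      simp only
      rw [cv_eq_zero j P (fun y => h0 y _ (by linarith)),
        cv_eq_zero j P (fun y => h0 y _ (by linarith)), sub_zero]
  refine (abs_add_le _ _).trans ((add_le_add b1 b2).trans_eq ?_)
  ring
end

section
variable {d : ℕ} {A : Eu d → ℝ}

theorem exists_rpow_small {κ c : ℝ} (hκ : 0 < κ) (hc : 0 ≤ c) :
    ∃ l : ℝ, 0 < l ∧ c * ((1 / l) ^ (κ / 2) * Real.Gamma (κ / 2)) ≤ 1 / 2 := by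
  have hG : 0 < Real.Gamma (κ / 2) := Real.Gamma_pos_of_pos (by positivity)
  obtain ⟨q, hq⟩ : ∃ q, q = 2 * c * Real.Gamma (κ / 2) + 1 := ⟨_, rfl⟩
  have hq0 : 0 < q := by rw [hq]; positivity
  refine ⟨q ^ (2 / κ), by positivity, ?_⟩
  rw [one_div, Real.inv_rpow (by positivity), ← Real.rpow_mul hq0.le,
    show 2 / κ * (κ / 2) = 1 by field_simp, Real.rpow_one, ← mul_assoc, mul_right_comm,
    ← div_eq_mul_inv, div_le_iff₀ hq0]
  linarith

theorem exists_bounds_on_compact (hA : Continuous A) (hpos : ∀ x, 0 < A x) {K : Set (Eu d)}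
    (hK : IsCompact K) : ∃ a0 a1 : ℝ, 0 < a0 ∧ 0 < a1 ∧ ∀ x ∈ K, a0 ≤ A x ∧ A x ≤ a1 := by
  rcases K.eq_empty_or_nonempty with rfl | hne
  · exact ⟨1, 1, one_pos, one_pos, by simp⟩
  obtain ⟨x0, -, h0⟩ := hK.exists_isMinOn hne hA.continuousOn
  obtain ⟨x1, -, h1⟩ := hK.exists_isMaxOn hne hA.continuousOn
  exact ⟨A x0, A x1, hpos _, hpos _, fun x hx => ⟨h0 hx, h1 hx⟩⟩

theorem abs_integral_exp_rpow_le {φ : ℝ → ℝ} {κ l c t : ℝ} (hκ : 0 < κ) (hl : 0 < l)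
    (h : ∀ σ, 0 < σ → |φ σ| ≤ c * Real.exp (l * (t - σ)) * σ ^ ((κ - 2) / 2)) :
    |∫ σ in Ioi 0, φ σ| ≤ c * Real.exp (l * t) * ((1 / l) ^ (κ / 2) * Real.Gamma (κ / 2)) := by
  have hG : 0 < Real.Gamma (κ / 2) := Real.Gamma_pos_of_pos (by positivity)
  have hI := Real.integral_rpow_mul_exp_neg_mul_Ioi (a := κ / 2) (r := l) (by positivity) hl
  have hi : Integrable (fun σ : ℝ => σ ^ (κ / 2 - 1) * Real.exp (-(l * σ)))
      (volume.restrict (Ioi 0)) := Integrable.of_integral_ne_zero (by rw [hI]; positivity)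
  rw [← hI, ← integral_const_mul, ← Real.norm_eq_abs]
  refine norm_integral_le_of_norm_le (hi.const_mul _) ((ae_restrict_iff' measurableSet_Ioi).2
    (Eventually.of_forall fun σ hσ => (h σ hσ).trans_eq ?_))
  rw [mul_sub, sub_eq_add_neg, Real.exp_add, show (κ - 2) / 2 = κ / 2 - 1 by ring]
  ring

/-- Interior time regularity of weak solutions, with constants depending on the coefficient only
through its values on the support of the cut-off. -/
theorem exists_time_holder (hA : LocHolder A) (hpos : ∀ x, 0 < A x) {ζ : Eu d → ℝ}
    (hζ : ContDiff ℝ ∞ ζ) (hs : HasCompactSupport ζ) (T : ℝ) :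
    ∃ C : ℝ, 0 ≤ C ∧ ∀ (A' : Eu d → ℝ) (u g : Eu d → ℝ → ℝ) (M : ℝ), LocHolder A' →
      (∀ x, 0 < A' x) → (∀ y ∈ tsupport ζ, A' y = A y) → IsWeak A' u g → 0 ≤ M →
      (∀ y ∈ tsupport ζ, ∀ s, s ≤ T → |u y s| ≤ M ∧ |g y s| ≤ M) →
      ∀ x t h, t ≤ T → 0 ≤ h → h ≤ 1 → |tdiff h u x t * ζ x| ≤ C * M * h ^ (3 / 8 : ℝ) := by
  obtain ⟨a0, a1, ha0, ha1, ha⟩ := exists_bounds_on_compact hA.continuous hpos hs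
  obtain ⟨κ, H, hκ0, hκ1, hH0, hH⟩ := hA _ hs
  choose C1 hC1 h1 using fun i => exists_time_diff (d := d) 1 le_rfl (dpg i (hp0 d)) ha0 T
  obtain ⟨C0, hC0, h0⟩ := exists_time_diff (d := d) 0 zero_le_one (hp0 d) ha0 T
  choose Z1 hZ1 hz1 using fun i => exists_bound_of_contDiff (contDiff_pd hζ i).continuous
    (hs.pd i)
  obtain ⟨Z0, hZ0, hz0⟩ := exists_bound_of_contDiff hζ.continuous hs
  obtain ⟨Z2, hZ2, hz2⟩ := exists_bound_of_contDiff (contDiff_lap hζ).continuous hs.lap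
  obtain ⟨C2, hC2⟩ : ∃ c, c = wn κ (lpg 0 (hp0 d)) * (H / a0) * a0 ^ ((κ - 2) / 2) := ⟨_, rfl⟩
  have hC20 : 0 ≤ C2 := by
    rw [hC2]; have := wn_nonneg κ (lpg 0 (hp0 d)); positivity
  obtain ⟨l, hl, hlc⟩ := exists_rpow_small hκ0 (mul_nonneg ha1.le hC20)
  obtain ⟨C3, hC3⟩ : ∃ c, c = ∑ i, C1 i * (2 * Z1 i) + C0 * (Z2 + Z0 / a0) := ⟨_, rfl⟩
  have hC30 : 0 ≤ C3 := by
    rw [hC3]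
    exact add_nonneg (Finset.sum_nonneg fun i _ => mul_nonneg (hC1 i) (by have := hZ1 i; positivity))
      (by positivity)
  refine ⟨2 * (a1 * C3) * Real.exp (l * |T|), by positivity,
    fun A' u g M hA' hpos' heq hw hM0 hM x t h ht hh hh1 => ?_⟩
  have hAc := hA'.continuous
  have hv := hw.tdiff hAc hpos' hh
  obtain ⟨v, hvd⟩ : ∃ v, v = tdiff h u := ⟨_, rfl⟩
  obtain ⟨e0, he0⟩ : ∃ e, e = a1 * (C3 * M * h ^ (3 / 8 : ℝ)) := ⟨_, rfl⟩
  have he00 : 0 ≤ e0 := by rw [he0]; positivity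
  have key : ∀ N : ℝ, 0 ≤ N → (∀ x t, t ≤ T → |v x t * ζ x| ≤ N * Real.exp (l * t)) →
      ∀ x t, t ≤ T → |v x t * ζ x| ≤ (N / 2 + e0) * Real.exp (l * t) := by
    intro N hN0 hN x t ht
    by_cases hx : x ∈ tsupport ζ
    swap
    · rw [image_eq_zero_of_notMem_tsupport hx]; simp; positivity
    rcases le_or_gt t 0 with ht0 | ht0
    · rw [hvd, hv.u0 x t ht0]; simp; positivity
    have hx1 := ha x hx
    have hAx : A' x = A x := heq x hx
    have hrep := hv.representation hA' hpos' hζ hs x t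
    obtain ⟨i2, i1, i0⟩ := hv.integrableOn_terms hA' hpos' hζ hs x t
    have hI : ∫ σ in Ioi (0 : ℝ), repInt A' ζ (tdiff h u) (tdiff h g) x (t - σ) (A' x * σ) =
        (∫ σ in Ioi (0 : ℝ), cv 2 (lpg 0 (hp0 d))
          (fun y s => tdiff h u y s * (ζ y * (1 - A' x / A' y))) x (t - σ) (A' x * σ)) +
        (∑ i, ∫ σ in Ioi (0 : ℝ), cv 1 (dpg i (hp0 d))
          (fun y s => tdiff h u y s * (-2 * pd i ζ y)) x (t - σ) (A' x * σ)) +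
        ∫ σ in Ioi (0 : ℝ), cv 0 (hp0 d) (fun y s => tdiff h u y s * lap ζ y +
          tdiff h g y s * (ζ y / A' y)) x (t - σ) (A' x * σ) := by
      simp only [repInt]
      rw [integral_add _ i0, integral_add i2, integral_finsetSum _ fun i _ => i1 i]
      · exact integrable_finsetSum _ fun i _ => i1 i
      · exact i2.add (integrable_finsetSum _ fun i _ => i1 i)
    have b2 : |∫ σ in Ioi (0 : ℝ), cv 2 (lpg 0 (hp0 d))
        (fun y s => tdiff h u y s * (ζ y * (1 - A' x / A' y))) x (t - σ) (A' x * σ)| ≤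
        C2 * N * Real.exp (l * t) * ((1 / l) ^ (κ / 2) * Real.Gamma (κ / 2)) := by
      refine abs_integral_exp_rpow_le hκ0 hl fun σ hσ => ?_
      have hb : ∀ y, |tdiff h u y (t - σ) * (ζ y * (1 - A' x / A' y))| ≤
          N * Real.exp (l * (t - σ)) * (H / a0) * ‖x - y‖ ^ κ := by
        intro y
        by_cases hy : y ∈ tsupport ζ
        · rw [← mul_assoc, abs_mul, mul_assoc _ (H / a0)]
          refine mul_le_mul (hvd ▸ hN y (t - σ) (by linarith)) ?_ (abs_nonneg _) (by positivity)
          have hy1 := ha y hy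
          have hAy := hpos y
          rw [hAx, heq y hy, one_sub_div hAy.ne', abs_div, abs_of_pos hAy, div_mul_eq_mul_div]
          refine div_le_div₀ (by positivity) ?_ ha0 hy1.1
          rw [norm_sub_rev]
          exact hH y hy x hx
        · rw [image_eq_zero_of_notMem_tsupport hy]; simp; positivity
      refine (abs_cv_le 2 _ (by have := hpos' x; positivity) hκ0.le (by linarith) x hb).trans ?_
      rw [Real.mul_rpow (hpos' x).le hσ.le, hC2, hAx]
      have : A x ^ ((κ - (2 : ℕ)) / 2) ≤ a0 ^ ((κ - 2) / 2) := by
        push_cast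
        exact Real.rpow_le_rpow_of_nonpos ha0 hx1.1 (by linarith)
      have hwn := wn_nonneg κ (lpg 0 (hp0 d))
      calc _ ≤ wn κ (lpg 0 (hp0 d)) * (N * Real.exp (l * (t - σ)) * (H / a0)) *
            (a0 ^ ((κ - 2) / 2) * σ ^ ((κ - (2 : ℕ)) / 2)) :=
          mul_le_mul_of_nonneg_left (mul_le_mul_of_nonneg_right this (by positivity))
            (by positivity)
        _ = _ := by push_cast; ring
    have b1 : ∀ i, |∫ σ in Ioi (0 : ℝ), cv 1 (dpg i (hp0 d))
        (fun y s => tdiff h u y s * (-2 * pd i ζ y)) x (t - σ) (A' x * σ)| ≤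
        C1 i * (2 * Z1 i * M) * h ^ (3 / 8 : ℝ) := by
      intro i
      have e : (fun y s => tdiff h u y s * (-2 * pd i ζ y)) =
          tdiff h (fun y s => u y s * (-2 * pd i ζ y)) := by
        funext y s; simp only [tdiff]; ring
      have hZ := hZ1 i
      rw [e]
      refine h1 i _ _ (ccs_pd hw.cu hζ hs i) (fun y s hs => by rw [hw.u0 y s hs, zero_mul])
        (by positivity) (fun y s hs1 => ?_) x _ t h (hAx ▸ hx1.1) ht hh hh1
      by_cases hy : y ∈ tsupport ζ
      · rw [abs_mul, abs_mul, mul_comm (2 * Z1 i)]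
        refine mul_le_mul (hM y hy s hs1).1 ?_ (by positivity) hM0
        norm_num
        exact hz1 i y
      · rw [image_eq_zero_of_notMem_tsupport fun h => hy (tsupport_pd_subset ζ i h)]
        simp; positivity
    have b0 : |∫ σ in Ioi (0 : ℝ), cv 0 (hp0 d) (fun y s => tdiff h u y s * lap ζ y +
          tdiff h g y s * (ζ y / A' y)) x (t - σ) (A' x * σ)| ≤
        C0 * ((Z2 + Z0 / a0) * M) * h ^ (3 / 8 : ℝ) := by
      have e : (fun y s => tdiff h u y s * lap ζ y + tdiff h g y s * (ζ y / A' y)) =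
          tdiff h (fun y s => u y s * lap ζ y + g y s * (ζ y / A' y)) := by
        funext y s; simp only [tdiff]; ring
      rw [e]
      refine h0 _ _ (hw.ccs_source hAc hpos' hζ hs)
        (fun y s hs => by rw [hw.u0 y s hs, hw.g0 y s hs, zero_mul, zero_mul, zero_add])
        (by positivity) (fun y s hs1 => ?_) x _ t h (hAx ▸ hx1.1) ht hh hh1
      by_cases hy : y ∈ tsupport ζ
      · refine (abs_add_le _ _).trans ?_
        rw [abs_mul, abs_mul, abs_div, heq y hy, abs_of_pos (hpos y), add_mul, mul_comm Z2,
          mul_comm (Z0 / a0)]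
        exact add_le_add (mul_le_mul (hM y hy s hs1).1 (hz2 y) (abs_nonneg _) hM0)
          (mul_le_mul (hM y hy s hs1).2 (div_le_div₀ hZ0 (hz0 y) ha0 (ha y hy).1)
            (div_nonneg (abs_nonneg _) (hpos y).le) hM0)
      · rw [image_eq_zero_of_notMem_tsupport hy,
          image_eq_zero_of_notMem_tsupport fun h => hy (tsupport_lap_subset ζ h)]
        simp; positivity
    have hE : 1 ≤ Real.exp (l * t) := Real.one_le_exp (by positivity)
    have hvA : v x t * ζ x = A x * (tdiff h u x t * (ζ x / A' x)) := by
      rw [hvd, hAx]; have := (hpos x).ne'; field_simp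
    rw [hvA, hrep, hI, abs_mul, abs_of_pos (hpos x)]
    have b3 : |∑ i, ∫ σ in Ioi (0 : ℝ), cv 1 (dpg i (hp0 d))
          (fun y s => tdiff h u y s * (-2 * pd i ζ y)) x (t - σ) (A' x * σ)| ≤
        (∑ i, C1 i * (2 * Z1 i)) * M * h ^ (3 / 8 : ℝ) := by
      refine (Finset.abs_sum_le_sum_abs _ _).trans ?_
      rw [Finset.sum_mul, Finset.sum_mul]
      exact Finset.sum_le_sum fun i _ => (b1 i).trans_eq (by ring)
    have b4 := (abs_add_le _ _).trans (add_le_add ((abs_add_le _ _).trans (add_le_add b2 b3)) b0)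
    refine (mul_le_mul hx1.2 b4 (abs_nonneg _) ha1.le).trans ?_
    calc _ = (a1 * C2 * ((1 / l) ^ (κ / 2) * Real.Gamma (κ / 2))) * (N * Real.exp (l * t)) +
          e0 * 1 := by rw [he0, hC3]; ring
      _ ≤ 1 / 2 * (N * Real.exp (l * t)) + e0 * Real.exp (l * t) :=
          add_le_add (mul_le_mul_of_nonneg_right hlc (by positivity))
            (mul_le_mul_of_nonneg_left hE he00)
      _ = _ := by ring
  obtain ⟨N, hN0, hN⟩ := (CCS.mul hv.cu hζ.continuous hs).exists_bound
    (fun y s hs => by rw [hv.u0 y s hs, zero_mul]) T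
  have hind : ∀ n : ℕ, ∀ x t, t ≤ T → |v x t * ζ x| ≤ (N / 2 ^ n + 2 * e0) * Real.exp (l * t) := by
    intro n
    induction n with
    | zero =>
      intro x t ht
      rcases le_or_gt t 0 with ht0 | ht0
      · rw [hvd, hv.u0 x t ht0]; simp; positivity
      have hE : 1 ≤ Real.exp (l * t) := Real.one_le_exp (by positivity)
      rw [hvd]
      refine (hN x t ht).trans ?_
      calc N ≤ N / 2 ^ 0 + 2 * e0 := by rw [pow_zero, div_one]; linarith
        _ ≤ _ := le_mul_of_one_le_right (by positivity) hE
    | succ n ih =>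
      intro x t ht
      refine (key _ (by positivity) ih x t ht).trans_eq ?_
      rw [pow_succ]; ring
  have hlim : Tendsto (fun n : ℕ => (N / 2 ^ n + 2 * e0) * Real.exp (l * t)) atTop
      (𝓝 ((0 + 2 * e0) * Real.exp (l * t))) := by
    refine Tendsto.mul_const _ (Tendsto.add_const _ ?_)
    have := (tendsto_pow_atTop_nhds_zero_of_lt_one (r := (1 / 2 : ℝ)) (by norm_num)
      (by norm_num)).const_mul N
    simpa [div_eq_mul_inv] using this
  have hfin := ge_of_tendsto' hlim fun n => hind n x t ht
  rw [← hvd]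
  refine hfin.trans ?_
  have hE : Real.exp (l * t) ≤ Real.exp (l * |T|) :=
    Real.exp_le_exp.2 (mul_le_mul_of_nonneg_left (ht.trans (le_abs_self T)) hl.le)
  calc _ ≤ (0 + 2 * e0) * Real.exp (l * |T|) := mul_le_mul_of_nonneg_left hE (by positivity)
    _ = _ := by rw [he0]; ring
end

section
variable {d : ℕ} {A : Eu d → ℝ} {u g : Eu d → ℝ → ℝ}

theorem exists_cutoff (d : ℕ) (R : ℝ) : ∃ ζ : Eu d → ℝ, ContDiff ℝ ∞ ζ ∧ HasCompactSupport ζ ∧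
    (∀ x, 0 ≤ ζ x ∧ ζ x ≤ 1) ∧ (∀ x ∈ Metric.closedBall (0 : Eu d) R, ζ x = 1) ∧
    tsupport ζ ⊆ Metric.closedBall 0 (|R| + 2) := by
  let b : ContDiffBump (0 : Eu d) := ⟨|R| + 1, |R| + 2, by positivity, by linarith⟩
  refine ⟨b, b.contDiff, b.hasCompactSupport, fun x => ⟨b.nonneg, b.le_one⟩, fun x hx => ?_, ?_⟩
  · refine b.one_of_mem_closedBall (Metric.closedBall_subset_closedBall ?_ hx)
    change R ≤ |R| + 1
    linarith [le_abs_self R]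
  · rw [b.tsupport_eq]

theorem exists_time_holder_ball (hA : LocHolder A) (hpos : ∀ x, 0 < A x) (R T : ℝ) :
    ∃ C : ℝ, 0 ≤ C ∧ ∀ (A' : Eu d → ℝ) (u g : Eu d → ℝ → ℝ) (M : ℝ), LocHolder A' →
      (∀ x, 0 < A' x) → (∀ y ∈ Metric.closedBall 0 (|R| + 2), A' y = A y) → IsWeak A' u g →
      0 ≤ M →
      (∀ y ∈ Metric.closedBall 0 (|R| + 2), ∀ s, s ≤ T → |u y s| ≤ M ∧ |g y s| ≤ M) →
      ∀ x ∈ Metric.closedBall 0 R, ∀ t h, t ≤ T → 0 ≤ h → h ≤ 1 →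
      |tdiff h u x t| ≤ C * M * h ^ (3 / 8 : ℝ) := by
  obtain ⟨ζ, hζ, hs, -, h1, hsub⟩ := exists_cutoff d R
  obtain ⟨C, hC, h⟩ := exists_time_holder hA hpos hζ hs T
  refine ⟨C, hC, fun A' u g M hA' hp he hw hM0 hM x hx t k ht hk hk1 => ?_⟩
  have := h A' u g M hA' hp (fun y hy => he y (hsub hy)) hw hM0 (fun y hy => hM y (hsub hy))
    x t k ht hk hk1
  rwa [h1 x hx, mul_one] at this

def TimeHolder (γ : ℝ) (u : Eu d → ℝ → ℝ) : Prop :=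
  ∀ R T : ℝ, ∃ C : ℝ, 0 ≤ C ∧ ∀ x ∈ Metric.closedBall 0 R, ∀ t h, t ≤ T → 0 ≤ h → h ≤ 1 →
    |tdiff h u x t| ≤ C * h ^ γ

def TimeLip (u g : Eu d → ℝ → ℝ) : Prop :=
  ∀ R T : ℝ, ∃ L : ℝ, 0 ≤ L ∧ ∀ x ∈ Metric.closedBall 0 R, ∀ t h, t ≤ T → 0 ≤ h → h ≤ 1 →
    |tdiff h g x t| ≤ L * (|tdiff h u x t| + h)

theorem exists_bound_ball {f : Eu d → ℝ → ℝ}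
    (hf : Continuous fun q : Eu d × ℝ => f q.1 q.2) (h0 : ∀ y s, s ≤ 0 → f y s = 0) (R T : ℝ) :
    ∃ M, 0 ≤ M ∧ ∀ y ∈ Metric.closedBall 0 R, ∀ s, s ≤ T → |f y s| ≤ M :=
  exists_bound_on_compact hf h0 (isCompact_closedBall 0 R) T

theorem IsWeak.timeHolder (hw : IsWeak A u g) (hA : LocHolder A) (hpos : ∀ x, 0 < A x) :
    TimeHolder (3 / 8) u := by
  intro R T
  obtain ⟨C, hC, h⟩ := exists_time_holder_ball hA hpos R T
  obtain ⟨M1, hM1, b1⟩ := exists_bound_ball hw.cu hw.u0 (|R| + 2) T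
  obtain ⟨M2, hM2, b2⟩ := exists_bound_ball hw.cg hw.g0 (|R| + 2) T
  exact ⟨C * (M1 + M2), by positivity, h A u g (M1 + M2) hA hpos (fun _ _ => rfl) hw (by positivity)
    fun y hy s hs => ⟨(b1 y hy s hs).trans (by linarith), (b2 y hy s hs).trans (by linarith)⟩⟩

theorem IsWeak.second_difference (hw : IsWeak A u g) (hA : LocHolder A) (hpos : ∀ x, 0 < A x)
    (hg : TimeLip u g) {γ : ℝ} (hγ1 : γ ≤ 1) (hu : TimeHolder γ u) (R T : ℝ) :
    ∃ C : ℝ, 0 ≤ C ∧ ∀ x ∈ Metric.closedBall 0 R, ∀ t h, t ≤ T → 0 < h → h ≤ 1 →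
      |_root_.tdiff h (_root_.tdiff h u) x t| ≤ C * h ^ (γ + 3 / 8) := by
  obtain ⟨C, hC, h⟩ := exists_time_holder_ball hA hpos R T
  obtain ⟨B, hB, hub⟩ := hu (|R| + 2) T
  obtain ⟨L, hL, hgb⟩ := hg (|R| + 2) T
  refine ⟨C * ((1 + L) * (B + 1)), by positivity, fun x hx t k ht hk hk1 => ?_⟩
  have hle : k ≤ k ^ γ := by
    have := Real.rpow_le_rpow_of_exponent_ge hk hk1 hγ1
    rwa [Real.rpow_one] at this
  have hkp : 0 < k ^ γ := by positivity
  refine (h A _ _ ((1 + L) * (B + 1) * k ^ γ) hA hpos (fun _ _ => rfl)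
    (hw.tdiff hA.continuous hpos hk.le) (by positivity) (fun y hy s hs => ?_) x hx t k ht hk.le
    hk1).trans_eq ?_
  · have h1 := hub y hy s k hs hk.le hk1
    have h2 := hgb y hy s k hs hk.le hk1
    have h3 : L * (|_root_.tdiff k u y s| + k) ≤ L * (B * k ^ γ + k ^ γ) :=
      mul_le_mul_of_nonneg_left (by linarith) hL
    have h4 : 0 ≤ L * (B * k ^ γ) := by positivity
    have h5 : 0 ≤ L * k ^ γ := by positivity
    have h6 : 0 ≤ B * k ^ γ := by positivity
    constructor
    · nlinarith
    · nlinarith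
  · rw [Real.rpow_add hk]; ring

theorem tdiff_tdiff (h : ℝ) (x : Eu d) (t : ℝ) :
    tdiff h (tdiff h u) x t = 2 * tdiff h u x t - tdiff (2 * h) u x t := by
  simp only [tdiff]
  rw [show t - h - h = t - 2 * h by ring]; ring

theorem marchaud {D : ℝ → ℝ} {C C0 : ℝ} (hC : 0 ≤ C) (hC0 : 0 ≤ C0)
    (h0 : ∀ h, 0 < h → h ≤ 1 → |D h| ≤ C0)
    (h2 : ∀ h, 0 < h → h ≤ 1 → |2 * D h - D (2 * h)| ≤ C * h ^ (3 / 4 : ℝ)) {h : ℝ}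
    (hh : 0 < h) (hh1 : h ≤ 1) : |D h| ≤ (2 * C0 + 4 * C) * h ^ (3 / 4 : ℝ) := by
  have q : (2 : ℝ) ^ (3 / 4 : ℝ) ≤ 7 / 4 := by
    have : ((2 : ℝ) ^ (3 / 4 : ℝ)) ^ (4 : ℕ) = 8 := by
      rw [← Real.rpow_natCast, ← Real.rpow_mul (by norm_num)]; norm_num
    refine le_of_pow_le_pow_left₀ (n := 4) (by norm_num) (by norm_num) ?_
    rw [this]; norm_num
  have main : ∀ n : ℕ, ∀ h : ℝ, (1 / 2) ^ (n + 1) < h → h ≤ 1 →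
      |D h| ≤ (2 * C0 + 4 * C) * h ^ (3 / 4 : ℝ) := by
    have base : ∀ h : ℝ, 1 / 2 < h → h ≤ 1 → |D h| ≤ (2 * C0 + 4 * C) * h ^ (3 / 4 : ℝ) := by
      intro h hn hh1
      have hh : 0 < h := by linarith
      have := Real.rpow_le_rpow_of_exponent_ge hh hh1 (show (3 / 4 : ℝ) ≤ 1 by norm_num)
      rw [Real.rpow_one] at this
      have := h0 h hh hh1
      nlinarith
    intro n
    induction n with
    | zero => intro h hn; exact base h (by simpa using hn)
    | succ n ih =>
      intro h hn hh1
      rcases lt_or_ge (1 / 2) h with hb | hb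
      · exact base h hb hh1
      have hh : 0 < h := lt_trans (by positivity) hn
      have h3 := ih (2 * h) (by rw [pow_succ] at hn; linarith) (by linarith)
      have h4 := h2 h hh hh1
      rw [Real.mul_rpow (by norm_num) hh.le] at h3
      have hp : 0 < h ^ (3 / 4 : ℝ) := by positivity
      have h5 : |2 * D h| ≤ |2 * D h - D (2 * h)| + |D (2 * h)| := by
        simpa using abs_add_le (2 * D h - D (2 * h)) (D (2 * h))
      rw [abs_mul, abs_of_pos (show (0 : ℝ) < 2 by norm_num)] at h5
      have h6 : (2 * C0 + 4 * C) * (2 ^ (3 / 4 : ℝ) * h ^ (3 / 4 : ℝ)) ≤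
          (2 * C0 + 4 * C) * (7 / 4 * h ^ (3 / 4 : ℝ)) := by gcongr
      have : 0 ≤ C0 * h ^ (3 / 4 : ℝ) := by positivity
      nlinarith
  obtain ⟨n, hn⟩ := exists_pow_lt_of_lt_one hh (show (1 / 2 : ℝ) < 1 by norm_num)
  refine main n h (lt_of_le_of_lt ?_ hn) hh1
  exact pow_le_pow_of_le_one (by norm_num) (by norm_num) (Nat.le_succ n)

theorem IsWeak.timeHolder_succ (hw : IsWeak A u g) (hA : LocHolder A) (hpos : ∀ x, 0 < A x)
    (hg : TimeLip u g) : TimeHolder (3 / 4) u := by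
  intro R T
  obtain ⟨C, hC, h⟩ := hw.second_difference hA hpos hg (by norm_num) (hw.timeHolder hA hpos) R T
  obtain ⟨M, hM, b⟩ := exists_bound_ball hw.cu hw.u0 R T
  refine ⟨2 * (2 * M) + 4 * C, by positivity, fun x hx t k ht hk hk1 => ?_⟩
  rcases hk.eq_or_lt with rfl | hk
  · simp [_root_.tdiff]
  refine marchaud (D := fun k => _root_.tdiff k u x t) hC (by positivity) (fun k hk hk1 => ?_)
    (fun k hk hk1 => ?_) hk hk1
  · have h1 := b x hx t ht
    have h2 := b x hx (t - k) (by linarith)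
    refine (abs_sub _ _).trans ?_
    linarith
  · have := h x hx t k ht hk hk1
    rw [tdiff_tdiff] at this
    norm_num at this ⊢
    exact this

theorem dyadic_ratio : 0 < (2 : ℝ) ^ (-(1 / 8) : ℝ) ∧ (2 : ℝ) ^ (-(1 / 8) : ℝ) < 1 :=
  ⟨by positivity, Real.rpow_lt_one_of_one_lt_of_neg (by norm_num) (by norm_num)⟩

noncomputable def dyadicQuot (u : Eu d → ℝ → ℝ) (k : ℕ) (x : Eu d) (t : ℝ) : ℝ :=
  2 ^ k * tdiff ((1 / 2) ^ k) u x t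

theorem IsWeak.dyadic_step (hw : IsWeak A u g) (hA : LocHolder A) (hpos : ∀ x, 0 < A x)
    (hg : TimeLip u g) (R T : ℝ) :
    ∃ C : ℝ, 0 ≤ C ∧ ∀ x ∈ Metric.closedBall 0 R, ∀ t, t ≤ T → ∀ k,
      |dyadicQuot u (k + 1) x t - dyadicQuot u k x t| ≤ C * ((2 : ℝ) ^ (-(1 / 8) : ℝ)) ^ k := by
  obtain ⟨C, hC, h⟩ := hw.second_difference hA hpos hg (by norm_num)
    (hw.timeHolder_succ hA hpos hg) R T
  refine ⟨C, hC, fun x hx t ht k => ?_⟩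
  have h1 := h x hx t ((1 / 2) ^ (k + 1)) ht (by positivity) (pow_le_one₀ (by norm_num) (by norm_num))
  have e : dyadicQuot u (k + 1) x t - dyadicQuot u k x t =
      2 ^ k * _root_.tdiff ((1 / 2) ^ (k + 1)) (_root_.tdiff ((1 / 2) ^ (k + 1)) u) x t := by
    rw [tdiff_tdiff, dyadicQuot, dyadicQuot, show 2 * (1 / 2 : ℝ) ^ (k + 1) = (1 / 2) ^ k by
      rw [pow_succ]; ring]
    ring
  rw [e, abs_mul, abs_of_pos (by positivity : (0 : ℝ) < 2 ^ k)]
  refine (mul_le_mul_of_nonneg_left h1 (by positivity)).trans ?_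
  have : (2 : ℝ) ^ k * ((1 / 2) ^ (k + 1)) ^ (3 / 4 + 3 / 8 : ℝ) ≤ ((2 : ℝ) ^ (-(1 / 8) : ℝ)) ^ k := by
    have e1 : (1 / 2 : ℝ) ^ (k + 1) = 2 ^ (-((k : ℝ) + 1)) := by
      rw [Real.rpow_neg (by norm_num), ← Nat.cast_succ, Real.rpow_natCast]; simp
    rw [e1, ← Real.rpow_natCast, ← Real.rpow_natCast, ← Real.rpow_mul (by norm_num),
      ← Real.rpow_mul (by norm_num), ← Real.rpow_add (by norm_num)]
    exact Real.rpow_le_rpow_of_exponent_le (by norm_num) (by nlinarith)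
  calc _ = C * (2 ^ k * ((1 / 2) ^ (k + 1)) ^ (3 / 4 + 3 / 8 : ℝ)) := by ring
    _ ≤ _ := mul_le_mul_of_nonneg_left this hC

theorem continuous_tdiff (hu : Continuous fun q : Eu d × ℝ => u q.1 q.2) (h : ℝ) :
    Continuous fun q : Eu d × ℝ => tdiff h u q.1 q.2 := by
  unfold tdiff
  exact hu.sub (hu.comp (continuous_fst.prodMk (continuous_snd.sub continuous_const)))

/-- Time derivative, with uniform rate of convergence of dyadic difference quotients. -/
theorem IsWeak.exists_time_deriv (hw : IsWeak A u g) (hA : LocHolder A) (hpos : ∀ x, 0 < A x)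
    (hg : TimeLip u g) :
    ∃ w : Eu d → ℝ → ℝ, (Continuous fun q : Eu d × ℝ => w q.1 q.2) ∧
      (∀ x t, HasDerivAt (u x) (w x t) t) ∧
      ∀ R T : ℝ, ∃ C : ℝ, 0 ≤ C ∧ ∀ x ∈ Metric.closedBall 0 R, ∀ t, t ≤ T → ∀ k,
        |dyadicQuot u k x t - w x t| ≤ C * ((2 : ℝ) ^ (-(1 / 8) : ℝ)) ^ k := by
  obtain ⟨hr0, hr1⟩ := dyadic_ratio
  obtain ⟨r, hr⟩ : ∃ r, r = (2 : ℝ) ^ (-(1 / 8) : ℝ) := ⟨_, rfl⟩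
  have hstep := hw.dyadic_step hA hpos hg
  rw [← hr] at hr0 hr1 hstep ⊢
  have hconv : ∀ x t, ∃ w, Tendsto (fun k => dyadicQuot u k x t) atTop (𝓝 w) := by
    intro x t
    obtain ⟨C, hC, h⟩ := hstep ‖x‖ t
    refine cauchySeq_tendsto_of_complete (cauchySeq_of_le_geometric r C hr1 fun k => ?_)
    rw [dist_comm, Real.dist_eq]
    exact h x (by simp) t le_rfl k
  choose w hwl using hconv
  have hrate : ∀ R T : ℝ, ∃ C : ℝ, 0 ≤ C ∧ ∀ x ∈ Metric.closedBall 0 R, ∀ t, t ≤ T → ∀ k,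
        |dyadicQuot u k x t - w x t| ≤ C * r ^ k := by
    intro R T
    obtain ⟨C, hC, h⟩ := hstep R T
    refine ⟨C / (1 - r), div_nonneg hC (by linarith), fun x hx t ht k => ?_⟩
    have := dist_le_of_le_geometric_of_tendsto r C hr1
      (fun k => by rw [dist_comm, Real.dist_eq]; exact h x hx t ht k) (hwl x t) k
    rw [Real.dist_eq] at this
    exact this.trans_eq (by ring)
  have hunif : ∀ R T : ℝ, TendstoUniformlyOn (fun k (q : Eu d × ℝ) => dyadicQuot u k q.1 q.2)
      (fun q => w q.1 q.2) atTop (Metric.closedBall 0 R ×ˢ Iic T) := by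
    intro R T
    obtain ⟨C, hC, h⟩ := hrate R T
    rw [Metric.tendstoUniformlyOn_iff]
    intro e he
    have : Tendsto (fun k => C * r ^ k) atTop (𝓝 (C * 0)) :=
      (tendsto_pow_atTop_nhds_zero_of_lt_one hr0.le hr1).const_mul C
    rw [mul_zero] at this
    filter_upwards [this.eventually (gt_mem_nhds he)] with k hk q hq
    rw [dist_comm, Real.dist_eq]
    exact (h q.1 hq.1 q.2 hq.2 k).trans_lt hk
  have hcq : ∀ k, Continuous fun q : Eu d × ℝ => dyadicQuot u k q.1 q.2 := fun k =>
    continuous_const.mul (continuous_tdiff hw.cu _)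
  refine ⟨w, ?_, fun x t => ?_, hrate⟩
  · rw [continuous_iff_continuousAt]
    intro q
    have hnhds : Metric.closedBall (0 : Eu d) (‖q.1‖ + 1) ×ˢ Iic (q.2 + 1) ∈ 𝓝 q := by
      refine prod_mem_nhds ?_ (Iic_mem_nhds (by linarith))
      exact Filter.mem_of_superset (Metric.isOpen_ball.mem_nhds (by simp)) Metric.ball_subset_closedBall
    exact ((hunif (‖q.1‖ + 1) (q.2 + 1)).continuousOn
      (Frequently.of_forall fun k => (hcq k).continuousOn)).continuousAt hnhds
  · have hux : Continuous (u x) := hw.cu.comp (Continuous.prodMk_right x)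
    have hF : ∀ s, ∀ k : ℕ, HasDerivAt (fun t => 2 ^ k * ((∫ s in (0 : ℝ)..t, u x s) -
        ∫ s in (0 : ℝ)..(t - (1 / 2) ^ k), u x s)) (dyadicQuot u k x s) s := by
      intro s k
      refine HasDerivAt.const_mul _ (HasDerivAt.sub ?_ ?_)
      · exact hux.integral_hasStrictDerivAt 0 s |>.hasDerivAt
      · have := (hux.integral_hasStrictDerivAt 0 (s - (1 / 2) ^ k)).hasDerivAt.comp s
          ((hasDerivAt_id s).sub_const ((1 / 2) ^ k))
        rw [mul_one] at this
        exact this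
    have hlim : ∀ s, Tendsto (fun k : ℕ => 2 ^ k * ((∫ s in (0 : ℝ)..s, u x s) -
        ∫ s in (0 : ℝ)..(s - (1 / 2) ^ k), u x s)) atTop (𝓝 (u x s)) := by
      intro s
      have h1 := (hux.integral_hasStrictDerivAt 0 s).hasDerivAt.tendsto_slope
      have h2 : Tendsto (fun k : ℕ => s - (1 / 2 : ℝ) ^ k) atTop (𝓝[≠] s) := by
        refine tendsto_nhdsWithin_iff.2 ⟨?_, Eventually.of_forall fun k => ?_⟩
        · simpa using (tendsto_pow_atTop_nhds_zero_of_lt_one (r := (1 / 2 : ℝ)) (by norm_num)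
            (by norm_num)).const_sub s
        · have : (0 : ℝ) < (1 / 2) ^ k := by positivity
          simp
      refine (h1.comp h2).congr fun k => ?_
      simp only [Function.comp, slope_def_field]
      rw [sub_sub_cancel_left, div_neg, ← neg_div, neg_sub, one_div, inv_pow, div_inv_eq_mul, mul_comm]
    refine hasDerivAt_of_tendstoUniformlyOn (s := Iio (t + 1)) (f := fun k t => 2 ^ k *
      ((∫ s in (0 : ℝ)..t, u x s) - ∫ s in (0 : ℝ)..(t - (1 / 2) ^ k), u x s))
      (f' := fun k s => dyadicQuot u k x s) (l := atTop) isOpen_Iio ?_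
      (Eventually.of_forall fun k s _ => hF s k) (fun s _ => hlim s) (by simp)
    have := hunif ‖x‖ (t + 1)
    rw [Metric.tendstoUniformlyOn_iff] at this ⊢
    intro e he
    filter_upwards [this e he] with k hk s hs
    exact hk (x, s) ⟨by simp, le_of_lt (mem_Iio.1 hs)⟩
end

section
variable {d : ℕ} {A : Eu d → ℝ} {u g : Eu d → ℝ → ℝ}

theorem CCS.integral_swap {f : Eu d → ℝ → ℝ} (hf : CCS f) (a b : ℝ) :
    ∫ s in a..b, ∫ y, f y s = ∫ y, ∫ s in a..b, f y s := by
  refine intervalIntegral_integral_swap (f := fun s y => f y s) ?_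
  obtain ⟨K, hK, h0⟩ := hf.supp
  have hc : Continuous (Function.uncurry fun (s : ℝ) (y : Eu d) => f y s) :=
    hf.cont.comp continuous_swap
  rw [← Measure.restrict_univ (μ := (volume : Measure (Eu d))), Measure.prod_restrict]
  have h1 : IntegrableOn (Function.uncurry fun (s : ℝ) (y : Eu d) => f y s) (uIcc a b ×ˢ K)
      (volume.prod volume) := hc.continuousOn.integrableOn_compact (isCompact_uIcc.prod hK)
  have h2 : IntegrableOn (Function.uncurry fun (s : ℝ) (y : Eu d) => f y s) (uIoc a b ×ˢ K)
      (volume.prod volume) := h1.mono_set (prod_mono uIoc_subset_uIcc le_rfl)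
  refine h2.of_forall_sdiff_eq_zero (measurableSet_uIoc.prod MeasurableSet.univ) ?_
  rintro ⟨s, y⟩ ⟨⟨hs, -⟩, hn⟩
  exact h0 y (fun hy => hn ⟨hs, hy⟩) s

noncomputable def timeInt (f : Eu d → ℝ → ℝ) (t : ℝ) (y : Eu d) : ℝ := ∫ s in (0 : ℝ)..t, f y s

theorem continuous_timeInt {f : Eu d → ℝ → ℝ} (hf : Continuous fun q : Eu d × ℝ => f q.1 q.2)
    (t : ℝ) : Continuous (timeInt f t) := by
  refine intervalIntegral.continuous_parametric_intervalIntegral_of_continuous' ?_ 0 t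
  exact hf

theorem abs_timeInt_le {f : Eu d → ℝ → ℝ} (h0 : ∀ y s, s ≤ 0 → f y s = 0) {T M : ℝ} (hM0 : 0 ≤ M)
    {y : Eu d} (hM : ∀ s, s ≤ T → |f y s| ≤ M) {t : ℝ} (ht : t ≤ T) :
    |timeInt f t y| ≤ M * |T| := by
  rcases le_or_gt t 0 with h | h
  · have : timeInt f t y = 0 := by
      rw [timeInt, intervalIntegral.integral_symm]
      rw [intervalIntegral.integral_zero_ae, neg_zero]
      filter_upwards with s hs
      rw [uIoc_of_le h] at hs
      exact h0 y s hs.2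
    rw [this, abs_zero]; positivity
  · have := intervalIntegral.norm_integral_le_of_norm_le_const (a := 0) (b := t) (f := f y) (C := M)
      fun s hs => by
        rw [uIoc_of_le h.le] at hs
        exact hM s (hs.2.trans ht)
    rw [Real.norm_eq_abs, sub_zero, abs_of_pos h] at this
    exact this.trans (mul_le_mul_of_nonneg_left (ht.trans (le_abs_self T)) hM0)

theorem IsWeak.isPoisson_timeInt (hw : IsWeak A u g) (hA : Continuous A) (hpos : ∀ x, 0 < A x)
    (t : ℝ) : IsPoisson (timeInt u t) (fun y => (u y t - timeInt g t y) / A y) where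
  cu := continuous_timeInt hw.cu t
  cG := ((hw.cu.comp (by fun_prop : Continuous fun y : Eu d => (y, t))).sub
    (continuous_timeInt hw.cg t)).div hA fun y => (hpos y).ne'
  weak ρ hρ hs := by
    have hk := hw.weak ρ hρ hs t
    have c2 : CCS fun y s => g y s * (ρ y / A y) :=
      CCS.mul hw.cg (continuous_div_coeff hA hpos hρ.continuous) (hasCompactSupport_div hs A)
    have c1 : CCS fun y s => u y s * lap ρ y :=
      CCS.mul hw.cu (contDiff_lap hρ).continuous hs.lap
    have hcl : Continuous (lap ρ) := (contDiff_lap hρ).continuous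
    rw [(hw.ccs_source hA hpos hρ hs).integral_swap] at hk
    have e : ∀ y, ∫ s in (0 : ℝ)..t, (u y s * lap ρ y + g y s * (ρ y / A y)) =
        timeInt u t y * lap ρ y + timeInt g t y * (ρ y / A y) := by
      intro y
      rw [intervalIntegral.integral_add ((c1.continuous_time y).intervalIntegrable _ _)
        ((c2.continuous_time y).intervalIntegrable _ _), intervalIntegral.integral_mul_const,
        intervalIntegral.integral_mul_const]
      rfl
    simp only [e] at hk
    have hcd := continuous_div_coeff hA hpos hρ.continuous
    have hsd := hasCompactSupport_div hs A
    have j1 : Integrable fun y => timeInt u t y * lap ρ y :=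
      ((continuous_timeInt hw.cu t).mul hcl).integrable_of_hasCompactSupport hs.lap.mul_left
    have j2 : Integrable fun y => timeInt g t y * (ρ y / A y) :=
      ((continuous_timeInt hw.cg t).mul hcd).integrable_of_hasCompactSupport hsd.mul_left
    have j3 : Integrable fun y => u y t * (ρ y / A y) :=
      ((hw.cu.comp (by fun_prop : Continuous fun y : Eu d => (y, t))).mul
        hcd).integrable_of_hasCompactSupport hsd.mul_left
    rw [integral_add j1 j2, ← sub_eq_iff_eq_add] at hk
    rw [← hk, ← integral_sub j3 j2]
    refine integral_congr_ae (Eventually.of_forall fun y => ?_)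
    simp only
    ring

theorem exists_poisson_holder_ball (d : ℕ) (R : ℝ) :
    ∃ C : ℝ, 0 ≤ C ∧ ∀ (u G : Eu d → ℝ) (M : ℝ), IsPoisson u G →
      (∀ y ∈ Metric.closedBall 0 (|R| + 2), |u y| ≤ M ∧ |G y| ≤ M) →
      0 ≤ M → ∀ x ∈ Metric.closedBall 0 R, ∀ x' ∈ Metric.closedBall 0 R,
      |u x' - u x| ≤ C * M * ‖x' - x‖ ^ (1 / 2 : ℝ) := by
  obtain ⟨ζ, hζ, hs, -, h1, hsub⟩ := exists_cutoff d R
  obtain ⟨C, hC, h⟩ := exists_poisson_holder hζ hs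
  refine ⟨C, hC, fun u G M hu hM hM0 x hx x' hx' => ?_⟩
  have := h u G M hu (fun y hy => hM y (hsub hy)) hM0 x x'
  rwa [h1 x hx, h1 x' hx', mul_one, mul_one] at this

theorem exists_space_holder_ball (hA : LocHolder A) (hpos : ∀ x, 0 < A x) (R T : ℝ) :
    ∃ C : ℝ, 0 ≤ C ∧ ∀ (A' : Eu d → ℝ) (u g : Eu d → ℝ → ℝ) (M : ℝ), LocHolder A' →
      (∀ x, 0 < A' x) → (∀ y ∈ Metric.closedBall 0 (|R| + 2), A' y = A y) → IsWeak A' u g →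
      0 ≤ M →
      (∀ y ∈ Metric.closedBall 0 (|R| + 2), ∀ s, s ≤ T → |u y s| ≤ M ∧ |g y s| ≤ M) →
      ∀ x ∈ Metric.closedBall 0 R, ∀ x' ∈ Metric.closedBall 0 R, ∀ t, t ≤ T →
      |u x' t - u x t| ≤ C * M * ‖x' - x‖ ^ (3 / 32 : ℝ) := by
  obtain ⟨C1, hC1, h1⟩ := exists_time_holder_ball hA hpos R T
  obtain ⟨C2, hC2, h2⟩ := exists_poisson_holder_ball d R
  obtain ⟨a0, a1, ha0, -, ha⟩ := exists_bounds_on_compact hA.continuous hpos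
    (isCompact_closedBall (0 : Eu d) (|R| + 2))
  obtain ⟨N, hN⟩ : ∃ N, N = |T| + (1 + |T|) / a0 := ⟨_, rfl⟩
  have hN0 : 0 ≤ N := by rw [hN]; positivity
  refine ⟨2 * C1 + 2 * (C2 * N) + 2, by positivity,
    fun A' u g M hA' hpos' he hw hM0 hM x hx x' hx' t ht => ?_⟩
  obtain ⟨r, hr⟩ : ∃ r, r = ‖x' - x‖ := ⟨_, rfl⟩
  rw [← hr]
  have hr0 : 0 ≤ r := hr ▸ norm_nonneg _
  have hball : Metric.closedBall (0 : Eu d) R ⊆ Metric.closedBall 0 (|R| + 2) :=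
    Metric.closedBall_subset_closedBall (by linarith [le_abs_self R])
  rcases hr0.eq_or_lt with h0 | h0
  · have : x' = x := sub_eq_zero.1 (norm_eq_zero.1 (by rw [← hr, ← h0]))
    rw [this, sub_self, abs_zero]; positivity
  have hCM : 0 ≤ C1 * M := by positivity
  have hCM2 : 0 ≤ C2 * N * M := by positivity
  rcases le_or_gt 1 r with hr1 | hr1
  · have := (hM x (hball hx) t ht).1
    have := (hM x' (hball hx') t ht).1
    have h3 : |u x' t - u x t| ≤ 2 * M := (abs_sub _ _).trans (by linarith)
    have h4 : (1 : ℝ) ≤ r ^ (3 / 32 : ℝ) := Real.one_le_rpow hr1 (by norm_num)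
    nlinarith
  obtain ⟨h, hh⟩ : ∃ h, h = r ^ (1 / 4 : ℝ) := ⟨_, rfl⟩
  have hh0 : 0 < h := by rw [hh]; positivity
  have hh1 : h ≤ 1 := by rw [hh]; exact Real.rpow_le_one hr0 hr1.le (by norm_num)
  have hU : ∀ s, s ≤ T → |timeInt u s x' - timeInt u s x| ≤ C2 * (N * M) * r ^ (1 / 2 : ℝ) := by
    intro s hs
    rw [hr]
    refine h2 _ _ (N * M) (hw.isPoisson_timeInt hA'.continuous hpos' s) (fun y hy => ?_)
      (by positivity) x hx x' hx'
    have b1 := abs_timeInt_le hw.u0 hM0 (fun s hs => (hM y hy s hs).1) hs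
    have b2 := abs_timeInt_le hw.g0 hM0 (fun s hs => (hM y hy s hs).2) hs
    have b3 : 0 ≤ (1 + |T|) / a0 * M := by positivity
    constructor
    · rw [hN]; nlinarith
    · rw [abs_div, he y hy, abs_of_pos (hpos y)]
      have b4 : |u y s - timeInt g s y| ≤ M * (1 + |T|) :=
        (abs_sub _ _).trans (by linarith [(hM y hy s hs).1])
      have b5 : 0 ≤ |T| * M := by positivity
      calc _ ≤ M * (1 + |T|) / a0 := div_le_div₀ (by positivity) b4 ha0 (ha y hy).1
        _ = (1 + |T|) / a0 * M := by ring
        _ ≤ _ := by rw [hN]; linarith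
  have hav : ∀ y ∈ Metric.closedBall (0 : Eu d) R,
      |h * u y t - (timeInt u t y - timeInt u (t - h) y)| ≤ C1 * M * h ^ (3 / 8 : ℝ) * h := by
    intro y hy
    have huy : Continuous (u y) := hw.cu.comp (Continuous.prodMk_right y)
    have e : h * u y t - (timeInt u t y - timeInt u (t - h) y) =
        ∫ s in (t - h)..t, (u y t - u y s) := by
      rw [timeInt, timeInt, intervalIntegral.integral_interval_sub_left
        (huy.intervalIntegrable _ _) (huy.intervalIntegrable _ _),
        intervalIntegral.integral_sub (by simp) (huy.intervalIntegrable _ _)]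
      simp
    rw [e]
    have := intervalIntegral.norm_integral_le_of_norm_le_const (a := t - h) (b := t)
      (f := fun s => u y t - u y s) (C := C1 * M * h ^ (3 / 8 : ℝ)) fun s hs => by
        rw [uIoc_of_le (by linarith)] at hs
        have := h1 A' u g M hA' hpos' he hw hM0 hM y hy t (t - s) ht (by linarith [hs.2])
          (by linarith [hs.1])
        rw [tdiff, sub_sub_cancel] at this
        refine this.trans (mul_le_mul_of_nonneg_left ?_ hCM)
        exact Real.rpow_le_rpow (by linarith [hs.2]) (by linarith [hs.1]) (by norm_num)
    rwa [Real.norm_eq_abs, sub_sub_cancel, abs_of_pos hh0] at this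
  have k1 := abs_le.1 (hav x hx)
  have k2 := abs_le.1 (hav x' hx')
  have k3 := abs_le.1 (hU t ht)
  have k4 := abs_le.1 (hU (t - h) (by linarith))
  have key : |h * (u x' t - u x t)| ≤
      2 * (C1 * M * h ^ (3 / 8 : ℝ) * h) + 2 * (C2 * (N * M) * r ^ (1 / 2 : ℝ)) := by
    rw [abs_le]; constructor <;> nlinarith
  have e1 : h ^ (3 / 8 : ℝ) = r ^ (3 / 32 : ℝ) := by
    rw [hh, ← Real.rpow_mul hr0]; norm_num
  have e2 : r ^ (1 / 2 : ℝ) ≤ r ^ (3 / 32 : ℝ) * h := by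
    rw [hh, ← Real.rpow_add h0]
    exact Real.rpow_le_rpow_of_exponent_ge h0 hr1.le (by norm_num)
  rw [e1, abs_mul, abs_of_pos hh0] at key
  have hp : 0 < r ^ (3 / 32 : ℝ) := by positivity
  have e3 := mul_le_mul_of_nonneg_left e2 hCM2
  refine le_of_mul_le_mul_left (key.trans ?_) hh0
  have : 0 ≤ M * r ^ (3 / 32 : ℝ) * h := by positivity
  nlinarith
end

section
variable {d : ℕ} {A : Eu d → ℝ} {u g w : Eu d → ℝ → ℝ}

theorem locHolder_of_closedBall {f : Eu d → ℝ} (h : ∀ R : ℝ, ∃ κ C : ℝ, 0 < κ ∧ κ ≤ 1 ∧ 0 ≤ C ∧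
    ∀ x ∈ Metric.closedBall (0 : Eu d) R, ∀ y ∈ Metric.closedBall (0 : Eu d) R,
      |f x - f y| ≤ C * ‖x - y‖ ^ κ) : LocHolder f := by
  intro K hK
  obtain ⟨R, hR⟩ := hK.isBounded.subset_closedBall 0
  obtain ⟨κ, C, h0, h1, h2, h3⟩ := h R
  exact ⟨κ, C, h0, h1, h2, fun x hx y hy => h3 x (hR hx) y (hR hy)⟩

theorem IsWeak.space_holder (hw : IsWeak A u g) (hA : LocHolder A) (hpos : ∀ x, 0 < A x)
    (R T : ℝ) : ∃ C : ℝ, 0 ≤ C ∧ ∀ x ∈ Metric.closedBall 0 R, ∀ x' ∈ Metric.closedBall 0 R,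
      ∀ t, t ≤ T → |u x' t - u x t| ≤ C * ‖x' - x‖ ^ (3 / 32 : ℝ) := by
  obtain ⟨C, hC, h⟩ := exists_space_holder_ball hA hpos R T
  obtain ⟨M1, hM1, b1⟩ := exists_bound_ball hw.cu hw.u0 (|R| + 2) T
  obtain ⟨M2, hM2, b2⟩ := exists_bound_ball hw.cg hw.g0 (|R| + 2) T
  exact ⟨C * (M1 + M2), by positivity, h A u g (M1 + M2) hA hpos (fun _ _ => rfl) hw (by positivity)
    fun y hy s hs => ⟨(b1 y hy s hs).trans (by linarith), (b2 y hy s hs).trans (by linarith)⟩⟩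

theorem IsWeak.locHolder (hw : IsWeak A u g) (hA : LocHolder A) (hpos : ∀ x, 0 < A x) (t : ℝ) :
    LocHolder fun x => u x t := by
  refine locHolder_of_closedBall fun R => ?_
  obtain ⟨C, hC, h⟩ := hw.space_holder hA hpos R t
  exact ⟨3 / 32, C, by norm_num, by norm_num, hC, fun x hx y hy => h y hy x hx t le_rfl⟩

theorem IsWeak.locHolder_deriv (hw : IsWeak A u g) (hA : LocHolder A) (hpos : ∀ x, 0 < A x)
    (hwc : Continuous fun q : Eu d × ℝ => w q.1 q.2)
    (hr : ∀ R T : ℝ, ∃ C : ℝ, 0 ≤ C ∧ ∀ x ∈ Metric.closedBall 0 R, ∀ t, t ≤ T → ∀ k,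
        |dyadicQuot u k x t - w x t| ≤ C * ((2 : ℝ) ^ (-(1 / 8) : ℝ)) ^ k) (t : ℝ) :
    LocHolder fun x => w x t := by
  refine locHolder_of_closedBall fun R => ?_
  obtain ⟨B, hB, h1⟩ := hw.space_holder hA hpos R t
  obtain ⟨C, hC, h2⟩ := hr R t
  obtain ⟨Z, hZ⟩ := (isCompact_closedBall (0 : Eu d) R).exists_bound_of_continuousOn
    (hwc.comp (by fun_prop : Continuous fun y : Eu d => (y, t))).continuousOn
  refine ⟨3 / 512, 2 * |Z| + 4 * C + 2 * B, by norm_num, by norm_num, by positivity,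
    fun x hx y hy => ?_⟩
  obtain ⟨r, hrr⟩ : ∃ r, r = ‖x - y‖ := ⟨_, rfl⟩
  rw [← hrr]
  have hr0 : 0 ≤ r := hrr ▸ norm_nonneg _
  rcases hr0.eq_or_lt with h0 | h0
  · have : x = y := sub_eq_zero.1 (norm_eq_zero.1 (by rw [← hrr, ← h0]))
    rw [this, sub_self, abs_zero]; positivity
  rcases le_or_gt 1 r with hr1 | hr1
  · have a1 : |w x t| ≤ |Z| := (hZ x hx).trans (le_abs_self Z)
    have a2 : |w y t| ≤ |Z| := (hZ y hy).trans (le_abs_self Z)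
    have h3 : |w x t - w y t| ≤ 2 * |Z| := (abs_sub _ _).trans (by linarith)
    have h4 : (1 : ℝ) ≤ r ^ (3 / 512 : ℝ) := Real.one_le_rpow hr1 (by norm_num)
    refine h3.trans ((?_ : 2 * |Z| ≤ 2 * |Z| + 4 * C + 2 * B).trans
      (le_mul_of_one_le_right (by positivity) h4))
    linarith
  obtain ⟨s, hs⟩ : ∃ s, s = r ^ (3 / 64 : ℝ) := ⟨_, rfl⟩
  have hs0 : 0 < s := by rw [hs]; positivity
  have hs1 : s ≤ 1 := by rw [hs]; exact Real.rpow_le_one hr0 hr1.le (by norm_num)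
  obtain ⟨k, hk1, hk2⟩ := exists_nat_pow_near_of_lt_one hs0 hs1 (show (0 : ℝ) < 1 / 2 by norm_num)
    (by norm_num)
  have p1 : ((2 : ℝ) ^ (-(1 / 8) : ℝ)) ^ k ≤ 2 * r ^ (3 / 512 : ℝ) := by
    have e : ((2 : ℝ) ^ (-(1 / 8) : ℝ)) ^ k = ((1 / 2 : ℝ) ^ k) ^ (1 / 8 : ℝ) := by
      have e1 : (1 / 2 : ℝ) ^ k = 2 ^ (-(k : ℝ)) := by
        rw [Real.rpow_neg (by norm_num), Real.rpow_natCast]; simp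
      rw [e1, ← Real.rpow_natCast, ← Real.rpow_mul (by norm_num), ← Real.rpow_mul (by norm_num)]
      congr 1; ring
    rw [e]
    have : (1 / 2 : ℝ) ^ k ≤ 2 * s := by rw [pow_succ] at hk1; linarith
    refine (Real.rpow_le_rpow (by positivity) this (by norm_num)).trans ?_
    rw [Real.mul_rpow (by norm_num) hs0.le, hs, ← Real.rpow_mul hr0]
    norm_num
    refine mul_le_mul_of_nonneg_right ?_ (by positivity)
    simpa using Real.rpow_le_rpow_of_exponent_le (show (1 : ℝ) ≤ 2 by norm_num)
      (show (1 / 8 : ℝ) ≤ 1 by norm_num)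
  have p2 : 2 ^ k * (2 * (B * r ^ (3 / 32 : ℝ))) ≤ 2 * B * r ^ (3 / 512 : ℝ) := by
    have e1 : (2 : ℝ) ^ k * s ≤ 1 := by
      have := mul_le_mul_of_nonneg_left hk2 (show (0 : ℝ) ≤ 2 ^ k by positivity)
      rwa [← mul_pow, show (2 : ℝ) * (1 / 2) = 1 by norm_num, one_pow] at this
    have e2 : r ^ (3 / 32 : ℝ) = s * s := by
      rw [hs, ← Real.rpow_add h0]; norm_num
    have e3 : s ≤ r ^ (3 / 512 : ℝ) := by
      rw [hs]; exact Real.rpow_le_rpow_of_exponent_ge h0 hr1.le (by norm_num)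
    rw [e2]
    calc _ = 2 * B * ((2 ^ k * s) * s) := by ring
      _ ≤ 2 * B * (1 * r ^ (3 / 512 : ℝ)) := by gcongr
      _ = _ := by ring
  have q1 := h2 x hx t le_rfl k
  have q2 := h2 y hy t le_rfl k
  have q3 : |dyadicQuot u k x t - dyadicQuot u k y t| ≤ 2 ^ k * (2 * (B * r ^ (3 / 32 : ℝ))) := by
    have g1 := h1 y hy x hx t le_rfl
    have g2 := h1 y hy x hx (t - (1 / 2) ^ k) (sub_le_self _ (by positivity))
    rw [← hrr] at g1 g2
    rw [dyadicQuot, dyadicQuot, ← mul_sub, abs_mul, abs_of_pos (by positivity : (0 : ℝ) < 2 ^ k)]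
    refine mul_le_mul_of_nonneg_left ?_ (by positivity)
    rw [abs_le] at g1 g2 ⊢
    simp only [_root_.tdiff]
    constructor <;> linarith
  have q4 := mul_le_mul_of_nonneg_left p1 hC
  have q5 : 0 ≤ 2 * |Z| * r ^ (3 / 512 : ℝ) := by positivity
  rw [abs_le] at q1 q2 q3 ⊢
  constructor <;> linarith

theorem IsWeak.isPoisson (hw : IsWeak A u g) (hA : Continuous A) (hpos : ∀ x, 0 < A x)
    (hwc : Continuous fun q : Eu d × ℝ => w q.1 q.2) (hd : ∀ x t, HasDerivAt (u x) (w x t) t)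
    (t : ℝ) : IsPoisson (fun y => u y t) (fun y => (w y t - g y t) / A y) where
  cu := hw.cu.comp (by fun_prop : Continuous fun y : Eu d => (y, t))
  cG := ((hwc.comp (by fun_prop : Continuous fun y : Eu d => (y, t))).sub
    (hw.cg.comp (by fun_prop : Continuous fun y : Eu d => (y, t)))).div hA fun y => (hpos y).ne'
  weak ρ hρ hs := by
    have hk := hw.hasDerivAt_pairing hA hpos hρ hs t
    have hcd := continuous_div_coeff hA hpos hρ.continuous
    have hsd := hasCompactSupport_div hs A
    have cw : CCS fun y s => w y s * (ρ y / A y) := CCS.mul hwc hcd hsd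
    have cu : CCS fun y s => u y s * (ρ y / A y) := CCS.mul hw.cu hcd hsd
    have cg : CCS fun y s => g y s * (ρ y / A y) := CCS.mul hw.cg hcd hsd
    have c1 : CCS fun y s => u y s * lap ρ y := CCS.mul hw.cu (contDiff_lap hρ).continuous hs.lap
    obtain ⟨K, hK, h0⟩ := cw.supp
    obtain ⟨Z, hZ⟩ := (hK.prod (isCompact_Icc (a := t - 1) (b := t + 1))).exists_bound_of_continuousOn
      cw.cont.continuousOn
    have hD := (hasDerivAt_integral_of_dominated_loc_of_deriv_le (μ := volume)
      (F := fun s y => u y s * (ρ y / A y)) (F' := fun s y => w y s * (ρ y / A y)) (x₀ := t)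
      (s := Ioo (t - 1) (t + 1)) (bound := K.indicator fun _ => Z)
      (Ioo_mem_nhds (by linarith) (by linarith))
      (Eventually.of_forall fun s => (cu.continuous_space s).aestronglyMeasurable)
      (cu.integrable t) (cw.continuous_space t).aestronglyMeasurable
      (Eventually.of_forall fun y s hs => ?_) ?_
      (Eventually.of_forall fun y s hs => (hd y s).mul_const _)).2
    · have heq := hD.unique hk
      rw [integral_add (c1.integrable t) (cg.integrable t), ← sub_eq_iff_eq_add,
        ← integral_sub (cw.integrable t) (cg.integrable t)] at heq
      rw [← heq]
      refine integral_congr_ae (Eventually.of_forall fun y => ?_)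
      simp only
      ring
    · by_cases hy : y ∈ K
      · rw [indicator_of_mem hy]
        exact hZ (y, s) ⟨hy, hs.1.le, hs.2.le⟩
      · rw [indicator_of_notMem hy, h0 y hy s, norm_zero]
    · exact (integrable_indicator_iff hK.measurableSet).2 (integrableOn_const hK.measure_lt_top.ne)

/-- Weak solutions with a source that depends on the solution in a Lipschitz way are classical. -/
theorem IsWeak.classical (hw : IsWeak A u g) (hA : LocHolder A) (hpos : ∀ x, 0 < A x)
    (hg : TimeLip u g) (hgH : ∀ t, LocHolder fun x => g x t) :
    ∃ w : Eu d → ℝ → ℝ, (Continuous fun q : Eu d × ℝ => w q.1 q.2) ∧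
      (∀ x t, HasDerivAt (u x) (w x t) t) ∧ (∀ t, ContDiff ℝ 2 fun x => u x t) ∧
      ∀ x t, w x t = A x * lap (fun y => u y t) x + g x t := by
  obtain ⟨w, hwc, hd, hr⟩ := hw.exists_time_deriv hA hpos hg
  have hP := hw.isPoisson hA.continuous hpos hwc hd
  have hC : ∀ t, ContDiff ℝ 2 fun x => u x t := fun t =>
    (hP t).contDiff (hw.locHolder hA hpos t) (by
      simpa only [div_eq_mul_inv] using
        ((hw.locHolder_deriv hA hpos hwc hr t).sub (hgH t)).mul (hA.inv hpos))
  refine ⟨w, hwc, hd, hC, fun x t => ?_⟩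
  rw [(hP t).lap_eq (hC t) x, mul_div_cancel₀ _ (hpos x).ne']
  ring
end

section
variable {d : ℕ}

/-- Lebesgue measure on positive times, times Lebesgue measure on space. -/
noncomputable def halfVol (d : ℕ) : Measure (ℝ × Eu d) := (volume.restrict (Ioi 0)).prod volume

instance : SFinite (halfVol d) := by unfold halfVol; infer_instance

theorem ae_halfVol : ∀ᵐ θ ∂(halfVol d), 0 < θ.1 := by
  have h : ∀ᵐ σ ∂(volume.restrict (Ioi (0 : ℝ))), 0 < σ := ae_restrict_mem measurableSet_Ioi
  exact Measure.quasiMeasurePreserving_fst.ae h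

theorem halfVol_eq_restrict : halfVol d = (volume.prod volume).restrict (Ioi 0 ×ˢ univ) := by
  rw [halfVol, ← Measure.prod_restrict, Measure.restrict_univ]

/-- The Gaussian majorant of the parametrix kernels. -/
noncomputable def gmaj (d : ℕ) (κ c : ℝ) (θ : ℝ × Eu d) : ℝ :=
  (1 + θ.1 ^ (κ / 2 - 1)) * (((√θ.1) ^ d)⁻¹ * Real.exp (-c * ‖θ.2‖ ^ 2 / θ.1))

theorem gmaj_nonneg {κ c : ℝ} {θ : ℝ × Eu d} (h : 0 < θ.1) : 0 ≤ gmaj d κ c θ := by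
  unfold gmaj; positivity

theorem continuousOn_gmaj (κ c : ℝ) : ContinuousOn (gmaj d κ c) (Ioi 0 ×ˢ univ) := by
  intro θ hθ
  have h0 : 0 < θ.1 := hθ.1
  have h1 : ((√θ.1) ^ d) ≠ 0 := by positivity
  apply ContinuousAt.continuousWithinAt
  unfold gmaj
  have h2 : ContinuousAt (fun θ : ℝ × Eu d => θ.1 ^ (κ / 2 - 1)) θ :=
    continuousAt_fst.rpow_const (Or.inl h0.ne')
  have h3 : ContinuousAt (fun θ : ℝ × Eu d => ((√θ.1) ^ d)⁻¹) θ :=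
    ((Real.continuous_sqrt.continuousAt.comp continuousAt_fst).pow d).inv₀ h1
  have h4 : ContinuousAt (fun θ : ℝ × Eu d => Real.exp (-c * ‖θ.2‖ ^ 2 / θ.1)) θ := by
    apply Real.continuous_exp.continuousAt.comp
    exact ContinuousAt.div (by fun_prop) continuousAt_fst h0.ne'
  exact (continuousAt_const.add h2).mul (h3.mul h4)

theorem aestronglyMeasurable_halfVol {f : ℝ × Eu d → ℝ} (hf : ContinuousOn f (Ioi 0 ×ˢ univ)) :
    AEStronglyMeasurable f (halfVol d) := by
  rw [halfVol_eq_restrict]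
  exact hf.aestronglyMeasurable (measurableSet_Ioi.prod MeasurableSet.univ)

theorem integrable_gmaj {κ c l : ℝ} (hκ : 0 < κ) (hc : 0 < c) (hl : 0 < l) :
    Integrable (fun θ => gmaj d κ c θ * Real.exp (-l * θ.1)) (halfVol d) := by
  have hm : AEStronglyMeasurable (fun θ : ℝ × Eu d => gmaj d κ c θ * Real.exp (-l * θ.1))
      (halfVol d) :=
    aestronglyMeasurable_halfVol ((continuousOn_gmaj κ c).mul (by fun_prop))
  have hint : ∀ σ : ℝ, 0 < σ → Integrable fun z : Eu d => Real.exp (-c * ‖z‖ ^ 2 / σ) := by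
    intro σ hσ
    simpa using integrable_gauss_scale (d := d) hσ hc 0
  unfold halfVol at hm ⊢
  rw [integrable_prod_iff hm]
  refine ⟨?_, ?_⟩
  · filter_upwards [ae_restrict_mem measurableSet_Ioi] with σ hσ
    have h0 := (((hint σ hσ).const_mul ((√σ) ^ d)⁻¹).const_mul (1 + σ ^ (κ / 2 - 1))).mul_const
      (Real.exp (-l * σ))
    exact h0
  · have h1 : Integrable (fun σ : ℝ => (Real.exp (-l * σ) + σ ^ (κ / 2 - 1) * Real.exp (-l * σ)) *
        ∫ w : Eu d, Real.exp (-c * ‖w‖ ^ 2)) (volume.restrict (Ioi 0)) := by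
      apply Integrable.mul_const
      refine Integrable.add ?_ ?_
      · exact integrableOn_exp_mul_Ioi (neg_lt_zero.2 hl) 0
      · have := integrableOn_rpow_mul_exp_neg_mul_rpow (p := 1) (s := κ / 2 - 1) (by linarith)
          zero_lt_one hl
        simp only [Real.rpow_one] at this
        exact this
    refine h1.congr ?_
    filter_upwards [ae_restrict_mem measurableSet_Ioi] with σ hσ
    have hσ : 0 < σ := hσ
    have h2 := integral_gauss_scale (d := d) (b := c) hσ 0
    simp only [zero_sub, norm_neg] at h2
    have h3 : ∀ z : Eu d, ‖gmaj d κ c (σ, z) * Real.exp (-l * σ)‖ =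
        ((1 + σ ^ (κ / 2 - 1)) * ((√σ) ^ d)⁻¹ * Real.exp (-l * σ)) *
          Real.exp (-c * ‖z‖ ^ 2 / σ) := by
      intro z
      rw [Real.norm_of_nonneg (mul_nonneg (gmaj_nonneg hσ) (Real.exp_nonneg _))]
      unfold gmaj; ring
    simp only [h3]
    rw [integral_const_mul, h2]
    have h4 : ((√σ) ^ d) ≠ 0 := by positivity
    field_simp

/-- The exponentially weighted mass of the majorant. -/
noncomputable def gmass (d : ℕ) (κ c l : ℝ) : ℝ :=
  ∫ θ, gmaj d κ c θ * Real.exp (-l * θ.1) ∂(halfVol d)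

theorem tendsto_gmass {κ c : ℝ} (hκ : 0 < κ) (hc : 0 < c) :
    Tendsto (gmass d κ c) atTop (𝓝 0) := by
  have h : Tendsto (gmass d κ c) atTop (𝓝 (∫ θ : ℝ × Eu d, (0 : ℝ) ∂(halfVol d))) := by
    refine tendsto_integral_filter_of_dominated_convergence
      (fun θ => gmaj d κ c θ * Real.exp (-1 * θ.1)) ?_ ?_ (integrable_gmaj hκ hc one_pos) ?_
    · filter_upwards [eventually_gt_atTop 0] with l hl
      exact (integrable_gmaj hκ hc hl).aestronglyMeasurable
    · filter_upwards [eventually_ge_atTop 1] with l hl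
      filter_upwards [ae_halfVol] with θ hθ
      rw [Real.norm_of_nonneg (mul_nonneg (gmaj_nonneg hθ) (Real.exp_nonneg _))]
      refine mul_le_mul_of_nonneg_left (Real.exp_le_exp.2 ?_) (gmaj_nonneg hθ)
      nlinarith
    · filter_upwards [ae_halfVol] with θ hθ
      have h1 : Tendsto (fun l : ℝ => Real.exp (-l * θ.1)) atTop (𝓝 0) := by
        apply Real.tendsto_exp_atBot.comp
        have := (tendsto_id (α := ℝ) (x := atTop)).atTop_mul_const hθ
        exact (tendsto_neg_atTop_atBot.comp this).congr fun l => by simp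
      simpa using h1.const_mul (gmaj d κ c θ)
  simpa using h

/-- A kernel dominated by a multiple of the Gaussian majorant. -/
structure IsKer (κ c C : ℝ) (k : Eu d → ℝ × Eu d → ℝ) : Prop where
  cont : ContinuousOn (fun q : Eu d × ℝ × Eu d => k q.1 q.2) (univ ×ˢ Ioi 0 ×ˢ univ)
  bound : ∀ x θ, 0 < θ.1 → |k x θ| ≤ C * gmaj d κ c θ

/-- Continuous functions with exponential growth in time, vanishing at nonpositive times. -/
structure ExpBdd (l B : ℝ) (f : Eu d → ℝ → ℝ) : Prop where
  cont : Continuous fun q : Eu d × ℝ => f q.1 q.2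
  zero : ∀ y s, s ≤ 0 → f y s = 0
  bound : ∀ y s, |f y s| ≤ B * Real.exp (l * s)

/-- The space-time potential with kernel `k`. -/
noncomputable def op (k : Eu d → ℝ × Eu d → ℝ) (f : Eu d → ℝ → ℝ) (x : Eu d) (t : ℝ) : ℝ :=
  ∫ θ, k x θ * f (x + θ.2) (t - θ.1) ∂(halfVol d)

variable {κ c C l B : ℝ} {k : Eu d → ℝ × Eu d → ℝ} {f : Eu d → ℝ → ℝ}

theorem IsKer.continuousOn_right (hk : IsKer κ c C k) (x : Eu d) :
    ContinuousOn (k x) (Ioi 0 ×ˢ univ) :=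
  hk.cont.comp (f := fun θ : ℝ × Eu d => (x, θ)) (by fun_prop) fun θ hθ => ⟨mem_univ _, hθ⟩

theorem IsKer.const_nonneg (hk : IsKer κ c C k) : 0 ≤ C := by
  have h := (abs_nonneg _).trans (hk.bound 0 (1, 0) one_pos)
  refine nonneg_of_mul_nonneg_left h ?_
  simp [gmaj]

theorem ExpBdd.const_nonneg (hf : ExpBdd l B f) : 0 ≤ B := by
  have := (abs_nonneg _).trans (hf.bound 0 0)
  simpa using this

theorem integrand_bound (hk : IsKer κ c C k) (hf : ExpBdd l B f) (x : Eu d) (t : ℝ)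
    {θ : ℝ × Eu d} (hθ : 0 < θ.1) (w : Eu d) :
    |k x θ * f w (t - θ.1)| ≤ C * B * Real.exp (l * t) * (gmaj d κ c θ * Real.exp (-l * θ.1)) := by
  rw [abs_mul]
  have h := mul_le_mul (hk.bound x θ hθ) (hf.bound w (t - θ.1)) (abs_nonneg _)
    (mul_nonneg hk.const_nonneg (gmaj_nonneg hθ))
  refine h.trans (le_of_eq ?_)
  rw [show l * (t - θ.1) = l * t + -l * θ.1 by ring, Real.exp_add]
  ring

theorem aestronglyMeasurable_integrand (hk : IsKer κ c C k)
    (hf : Continuous fun q : Eu d × ℝ => f q.1 q.2) (x : Eu d) (t : ℝ) :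
    AEStronglyMeasurable (fun θ : ℝ × Eu d => k x θ * f (x + θ.2) (t - θ.1)) (halfVol d) :=
  aestronglyMeasurable_halfVol ((hk.continuousOn_right x).mul
    (hf.comp (f := fun θ : ℝ × Eu d => (x + θ.2, t - θ.1)) (by fun_prop)).continuousOn)

theorem integrable_integrand (hκ : 0 < κ) (hc : 0 < c) (hl : 0 < l) (hk : IsKer κ c C k)
    (hf : ExpBdd l B f) (x : Eu d) (t : ℝ) :
    Integrable (fun θ : ℝ × Eu d => k x θ * f (x + θ.2) (t - θ.1)) (halfVol d) := by
  refine ((integrable_gmaj (d := d) hκ hc hl).const_mul (C * B * Real.exp (l * t))).mono'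
    (aestronglyMeasurable_integrand hk hf.cont x t) ?_
  filter_upwards [ae_halfVol] with θ hθ
  exact integrand_bound hk hf x t hθ _

theorem op_eq_zero (h0 : ∀ y s, s ≤ 0 → f y s = 0) (x : Eu d) {t : ℝ} (ht : t ≤ 0) :
    op k f x t = 0 := by
  unfold op
  rw [← integral_zero (ℝ × Eu d) ℝ (μ := halfVol d)]
  apply integral_congr_ae
  filter_upwards [ae_halfVol] with θ hθ
  rw [h0 _ _ (by linarith), mul_zero]

theorem abs_op_le (hκ : 0 < κ) (hc : 0 < c) (hl : 0 < l) (hk : IsKer κ c C k)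
    (hf : ExpBdd l B f) (x : Eu d) (t : ℝ) :
    |op k f x t| ≤ C * gmass d κ c l * B * Real.exp (l * t) := by
  have h : |op k f x t| ≤ ∫ θ, C * B * Real.exp (l * t) *
      (gmaj d κ c θ * Real.exp (-l * θ.1)) ∂(halfVol d) := by
    rw [← Real.norm_eq_abs]
    refine norm_integral_le_of_norm_le
      ((integrable_gmaj (d := d) hκ hc hl).const_mul (C * B * Real.exp (l * t))) ?_
    filter_upwards [ae_halfVol] with θ hθ
    exact integrand_bound hk hf x t hθ _
  rw [integral_const_mul] at h
  refine h.trans (le_of_eq ?_)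
  unfold gmass; ring

theorem continuous_op (hκ : 0 < κ) (hc : 0 < c) (hl : 0 < l) (hk : IsKer κ c C k)
    (hf : ExpBdd l B f) : Continuous fun q : Eu d × ℝ => op k f q.1 q.2 := by
  rw [continuous_iff_continuousAt]
  rintro ⟨x, t⟩
  unfold op
  refine continuousAt_of_dominated (bound := fun θ => C * B * Real.exp (l * (t + 1)) *
    (gmaj d κ c θ * Real.exp (-l * θ.1))) ?_ ?_ ((integrable_gmaj hκ hc hl).const_mul _) ?_
  · exact Eventually.of_forall fun q => aestronglyMeasurable_integrand hk hf.cont q.1 q.2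
  · have : ∀ᶠ q : Eu d × ℝ in 𝓝 (x, t), q.2 < t + 1 :=
      continuousAt_snd.eventually_lt continuousAt_const (by simp)
    filter_upwards [this] with q hq
    filter_upwards [ae_halfVol] with θ hθ
    refine (integrand_bound hk hf q.1 q.2 hθ _).trans ?_
    refine mul_le_mul_of_nonneg_right ?_ (mul_nonneg (gmaj_nonneg hθ) (Real.exp_nonneg _))
    refine mul_le_mul_of_nonneg_left (Real.exp_le_exp.2 ?_)
      (mul_nonneg hk.const_nonneg hf.const_nonneg)
    exact mul_le_mul_of_nonneg_left hq.le hl.le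
  · filter_upwards [ae_halfVol] with θ hθ
    refine ContinuousAt.mul ?_ ?_
    · have h1 : ContinuousAt (fun q : Eu d × ℝ × Eu d => k q.1 q.2) (x, θ) :=
        hk.cont.continuousAt ((isOpen_univ.prod (isOpen_Ioi.prod isOpen_univ)).mem_nhds
          ⟨mem_univ _, hθ, mem_univ _⟩)
      exact h1.comp (f := fun q : Eu d × ℝ => (q.1, θ)) (x := (x, t)) (by fun_prop)
    · exact (hf.cont.comp (f := fun q : Eu d × ℝ => (q.1 + θ.2, q.2 - θ.1))
        (by fun_prop)).continuousAt

theorem ExpBdd.op (hκ : 0 < κ) (hc : 0 < c) (hl : 0 < l) (hk : IsKer κ c C k)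
    (hf : ExpBdd l B f) : ExpBdd l (C * gmass d κ c l * B) (_root_.op k f) :=
  ⟨continuous_op hκ hc hl hk hf, fun x _ ht => op_eq_zero hf.zero x ht,
    fun x t => abs_op_le hκ hc hl hk hf x t⟩

theorem op_sub {B' : ℝ} {f' : Eu d → ℝ → ℝ} (hκ : 0 < κ) (hc : 0 < c) (hl : 0 < l)
    (hk : IsKer κ c C k) (hf : ExpBdd l B f) (hf' : ExpBdd l B' f') (x : Eu d) (t : ℝ) :
    op k (fun y s => f y s - f' y s) x t = op k f x t - op k f' x t := by
  unfold op
  rw [← integral_sub (integrable_integrand hκ hc hl hk hf x t)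
    (integrable_integrand hκ hc hl hk hf' x t)]
  simp only [mul_sub]

theorem ExpBdd.timeInt (hl : 0 < l) (hf : ExpBdd l B f) :
    ExpBdd l (B / l) fun y t => _root_.timeInt f t y := by
  have hz : ∀ y t, t ≤ 0 → _root_.timeInt f t y = 0 := by
    intro y t ht
    unfold _root_.timeInt
    rw [intervalIntegral.integral_congr (g := fun _ => (0 : ℝ)), intervalIntegral.integral_zero]
    intro s hs
    rw [uIcc_of_ge ht] at hs
    exact hf.zero y s hs.2
  refine ⟨?_, hz, fun y t => ?_⟩
  · unfold _root_.timeInt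
    exact intervalIntegral.continuous_parametric_intervalIntegral_of_continuous
      (f := fun (q : Eu d × ℝ) s => f q.1 s)
      (hf.cont.comp (f := fun p : (Eu d × ℝ) × ℝ => (p.1.1, p.2)) (by fun_prop)) continuous_snd
  · have hB := hf.const_nonneg
    rcases le_total t 0 with ht | ht
    · rw [hz y t ht, abs_zero]; positivity
    · have h1 : |_root_.timeInt f t y| ≤ ∫ s in (0 : ℝ)..t, B * Real.exp (l * s) := by
        rw [← Real.norm_eq_abs]
        exact intervalIntegral.norm_integral_le_of_norm_le ht
          (Eventually.of_forall fun s _ => hf.bound y s)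
          (Continuous.intervalIntegrable (by fun_prop) _ _)
      have h2 : ∫ s in (0 : ℝ)..t, B * Real.exp (l * s) = B / l * (Real.exp (l * t) - 1) := by
        rw [intervalIntegral.integral_const_mul, intervalIntegral.integral_comp_mul_left _ hl.ne',
          integral_exp]
        simp; field_simp
      rw [h2] at h1
      refine h1.trans (mul_le_mul_of_nonneg_left (by linarith) (by positivity))

theorem timeInt_op (hκ : 0 < κ) (hc : 0 < c) (hl : 0 < l) (hk : IsKer κ c C k)
    (hf : ExpBdd l B f) (x : Eu d) (t : ℝ) :
    timeInt (op k f) t x = op k (fun y t => timeInt f t y) x t := by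
  rcases le_total t 0 with ht | ht
  · rw [(ExpBdd.timeInt hl (hf.op hκ hc hl hk)).zero x t ht,
      op_eq_zero (hf.timeInt hl).zero x ht]
  · have hg := (integrable_gmaj (d := d) hκ hc hl).const_mul (C * B * Real.exp (l * t))
    have hi : Integrable (fun p : ℝ × ℝ × Eu d => k x p.2 * f (x + p.2.2) (p.1 - p.2.1))
        ((volume.restrict (Ioc 0 t)).prod (halfVol d)) := by
      have hone : Integrable (fun _ : ℝ => (1 : ℝ)) (volume.restrict (Ioc 0 t)) :=
        integrable_const _
      refine (hone.mul_prod hg).mono' ?_ ?_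
      · refine AEStronglyMeasurable.mul ?_ ?_
        · exact (aestronglyMeasurable_halfVol (hk.continuousOn_right x)).comp_snd
        · exact (hf.cont.comp (f := fun p : ℝ × ℝ × Eu d => (x + p.2.2, p.1 - p.2.1))
            (by fun_prop)).aestronglyMeasurable
      · have h1 : ∀ᵐ p ∂((volume.restrict (Ioc 0 t)).prod (halfVol d)), p.1 ∈ Ioc 0 t :=
          Measure.quasiMeasurePreserving_fst.ae (ae_restrict_mem measurableSet_Ioc)
        have h2 : ∀ᵐ p ∂((volume.restrict (Ioc 0 t)).prod (halfVol d)), 0 < p.2.1 :=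
          Measure.quasiMeasurePreserving_snd.ae ae_halfVol
        filter_upwards [h1, h2] with p hp1 hp2
        rw [one_mul]
        refine (integrand_bound hk hf x p.1 hp2 _).trans ?_
        refine mul_le_mul_of_nonneg_right ?_ (mul_nonneg (gmaj_nonneg hp2) (Real.exp_nonneg _))
        refine mul_le_mul_of_nonneg_left (Real.exp_le_exp.2 ?_)
          (mul_nonneg hk.const_nonneg hf.const_nonneg)
        exact mul_le_mul_of_nonneg_left hp1.2 hl.le
    have hsw := integral_integral_swap (f := fun (s : ℝ) (θ : ℝ × Eu d) =>
      k x θ * f (x + θ.2) (s - θ.1)) hi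
    unfold timeInt op
    rw [intervalIntegral.integral_of_le ht]
    refine hsw.trans ?_
    apply integral_congr_ae
    filter_upwards [ae_halfVol] with θ hθ
    rw [integral_const_mul, ← intervalIntegral.integral_of_le ht,
      intervalIntegral.integral_comp_sub_right (fun s => f (x + θ.2) s), zero_sub]
    congr 1
    have hci : ∀ a b, IntervalIntegrable (f (x + θ.2)) volume a b := fun a b =>
      (hf.cont.comp (f := fun s : ℝ => (x + θ.2, s)) (by fun_prop)).intervalIntegrable a b
    rw [← intervalIntegral.integral_add_adjacent_intervals (hci (-θ.1) 0) (hci 0 _)]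
    rw [intervalIntegral.integral_congr (g := fun _ => (0 : ℝ)) (a := -θ.1),
      intervalIntegral.integral_zero, zero_add]
    intro s hs
    rw [uIcc_of_le (by linarith)] at hs
    exact hf.zero _ s hs.2
end

section
variable {d : ℕ} {κ c C l B : ℝ} {k : Eu d → ℝ × Eu d → ℝ} {f : Eu d → ℝ → ℝ}

theorem measurePreserving_shear_right (x : Eu d) :
    MeasurePreserving (fun θ : ℝ × Eu d => (θ.1, θ.2 - x)) (halfVol d) (halfVol d) := by
  unfold halfVol
  exact (MeasurePreserving.id _).prod (measurePreserving_sub_right volume x)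

theorem measurePreserving_shear :
    MeasurePreserving (fun p : Eu d × ℝ × Eu d => (p.1, p.2.1, p.2.2 - p.1))
      (volume.prod (halfVol d)) (volume.prod (halfVol d)) :=
  (MeasurePreserving.id _).skew_product (g := fun x (θ : ℝ × Eu d) => (θ.1, θ.2 - x))
    (Continuous.measurable (by fun_prop))
    (Eventually.of_forall fun x => (measurePreserving_shear_right x).map_eq)

theorem integral_op (hκ : 0 < κ) (hc : 0 < c) (hl : 0 < l) (hk : IsKer κ c C k)
    (hf : ExpBdd l B f) {b : Eu d → ℝ} (hb : Continuous b) (hs : HasCompactSupport b) (t : ℝ) :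
    Integrable (fun θ : ℝ × Eu d => f θ.2 (t - θ.1) * ∫ x, b x * k x (θ.1, θ.2 - x)) (halfVol d) ∧
    ∫ x, b x * op k f x t =
      ∫ θ : ℝ × Eu d, f θ.2 (t - θ.1) * (∫ x, b x * k x (θ.1, θ.2 - x)) ∂(halfVol d) := by
  obtain ⟨H, hH⟩ : ∃ H : Eu d × ℝ × Eu d → ℝ,
    H = fun p => b p.1 * (k p.1 p.2 * f (p.1 + p.2.2) (t - p.2.1)) := ⟨_, rfl⟩
  have hi : Integrable H (volume.prod (halfVol d)) := by
    have hg := (integrable_gmaj (d := d) hκ hc hl).const_mul (C * B * Real.exp (l * t))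
    refine ((hb.integrable_of_hasCompactSupport hs).norm.mul_prod hg).mono' ?_ ?_
    · rw [halfVol_eq_restrict, ← Measure.restrict_univ (μ := (volume : Measure (Eu d))),
        Measure.prod_restrict]
      refine ContinuousOn.aestronglyMeasurable ?_
        (MeasurableSet.univ.prod (measurableSet_Ioi.prod MeasurableSet.univ))
      rw [hH]
      exact (hb.comp continuous_fst).continuousOn.mul (hk.cont.mul (hf.cont.comp
        (f := fun p : Eu d × ℝ × Eu d => (p.1 + p.2.2, t - p.2.1)) (by fun_prop)).continuousOn)
    · have h2 : ∀ᵐ p ∂((volume : Measure (Eu d)).prod (halfVol d)), 0 < p.2.1 :=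
        Measure.quasiMeasurePreserving_snd.ae ae_halfVol
      filter_upwards [h2] with p hp
      rw [hH, norm_mul]
      exact mul_le_mul_of_nonneg_left (integrand_bound hk hf p.1 t hp _) (norm_nonneg _)
  have hT := measurePreserving_shear (d := d)
  have hi2 := hT.integrable_comp_of_integrable hi
  have e2 : ∀ p : Eu d × ℝ × Eu d, (H ∘ fun p => (p.1, p.2.1, p.2.2 - p.1)) p =
      b p.1 * (k p.1 (p.2.1, p.2.2 - p.1) * f p.2.2 (t - p.2.1)) := by
    intro p; simp [hH]
  have e3 : ∀ θ : ℝ × Eu d, ∫ x, (H ∘ fun p => (p.1, p.2.1, p.2.2 - p.1)) (x, θ) =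
      f θ.2 (t - θ.1) * ∫ x, b x * k x (θ.1, θ.2 - x) := by
    intro θ
    rw [← integral_const_mul]
    refine integral_congr_ae (Eventually.of_forall fun x => ?_)
    simp only [e2]; ring
  constructor
  · exact hi2.integral_prod_right.congr (Eventually.of_forall e3)
  · have h1 : ∫ x, b x * op k f x t = ∫ p, H p ∂(volume.prod (halfVol d)) := by
      rw [integral_prod _ hi]
      refine integral_congr_ae (Eventually.of_forall fun x => ?_)
      simp only [op, hH]
      rw [integral_const_mul]
    have h2 : ∫ p, H p ∂(volume.prod (halfVol d)) =
        ∫ p, (H ∘ fun p => (p.1, p.2.1, p.2.2 - p.1)) p ∂(volume.prod (halfVol d)) := by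
      have := integral_map (μ := volume.prod (halfVol d)) hT.measurable.aemeasurable
        (f := H) (by rw [hT.map_eq]; exact hi.aestronglyMeasurable)
      rw [hT.map_eq] at this
      exact this
    rw [h1, h2, integral_prod_symm _ hi2]
    exact integral_congr_ae (Eventually.of_forall e3)

/-- The principal parametrix kernel. -/
noncomputable def pker (A : Eu d → ℝ) (x : Eu d) (θ : ℝ × Eu d) : ℝ :=
  Ks 0 (hp0 d) (A (x + θ.2) * θ.1) θ.2

/-- The error kernel of the parametrix. -/
noncomputable def eker (A : Eu d → ℝ) (x : Eu d) (θ : ℝ × Eu d) : ℝ :=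
  (A (x + θ.2) - A x) * Ks 2 (lpg 0 (hp0 d)) (A (x + θ.2) * θ.1) θ.2

theorem continuousOn_scaled_Ks (j : ℕ) (P : MvPolynomial (Fin d) ℝ) {A : Eu d → ℝ}
    (hA : Continuous A) (hpos : ∀ x, 0 < A x) :
    ContinuousOn (fun q : Eu d × ℝ × Eu d => Ks j P (A (q.1 + q.2.2) * q.2.1) q.2.2)
      (univ ×ˢ Ioi 0 ×ˢ univ) := by
  refine (continuousOn_Ks j P).comp
    (f := fun q : Eu d × ℝ × Eu d => (A (q.1 + q.2.2) * q.2.1, q.2.2))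
    (Continuous.continuousOn ?_) fun q hq => ⟨?_, mem_univ _⟩
  · exact ((hA.comp (by fun_prop)).mul (by fun_prop)).prodMk (by fun_prop)
  · exact mul_pos (hpos _) hq.2.1

theorem Ks_scaled_bound (j : ℕ) (P : MvPolynomial (Fin d) ℝ) {a0 a1 : ℝ} (h0 : 0 < a0)
    (h1 : 0 < a1) : ∃ C : ℝ, 0 ≤ C ∧ ∀ a σ : ℝ, a0 ≤ a → a ≤ a1 → 0 < σ → ∀ z : Eu d,
      |Ks j P (a * σ) z| ≤
        C * ((√σ) ^ (d + j))⁻¹ * Real.exp (-(1 / (8 * a1)) * ‖z‖ ^ 2 / σ) := by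
  obtain ⟨C, hC, hb⟩ := exists_Ks_bound j P
  refine ⟨C * ((√a0) ^ (d + j))⁻¹, by positivity, fun a σ ha0 ha1 hσ z => ?_⟩
  have ha : 0 < a := h0.trans_le ha0
  refine (hb (a * σ) (by positivity) z).trans ?_
  have e1 : (√(a * σ)) ^ (d + j) = (√a) ^ (d + j) * (√σ) ^ (d + j) := by
    rw [Real.sqrt_mul ha.le, mul_pow]
  rw [e1, mul_inv, ← mul_assoc C]
  have hs0 : 0 < √a0 := Real.sqrt_pos.2 h0
  refine mul_le_mul ?_ ?_ (Real.exp_nonneg _) (by positivity)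
  · refine mul_le_mul_of_nonneg_right (mul_le_mul_of_nonneg_left ?_ hC) (by positivity)
    exact inv_anti₀ (by positivity) (pow_le_pow_left₀ hs0.le (Real.sqrt_le_sqrt ha0) _)
  · apply Real.exp_le_exp.2
    rw [neg_div, neg_mul, neg_div]
    apply neg_le_neg
    rw [one_div, ← div_eq_inv_mul, div_div]
    apply div_le_div_of_nonneg_left (by positivity) (by positivity)
    nlinarith

theorem exists_isKer_pker {A : Eu d → ℝ} (hA : Continuous A) {a0 a1 : ℝ} (h0 : 0 < a0)
    (hA0 : ∀ x, a0 ≤ A x) (hA1 : ∀ x, A x ≤ a1) (κ : ℝ) :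
    ∃ C, IsKer κ (1 / (16 * a1)) C (pker A) := by
  have ha1 : 0 < a1 := h0.trans_le ((hA0 0).trans (hA1 0))
  obtain ⟨C, hC, hb⟩ := Ks_scaled_bound 0 (hp0 d) h0 ha1
  refine ⟨C, ⟨continuousOn_scaled_Ks 0 (hp0 d) hA fun x => h0.trans_le (hA0 x), ?_⟩⟩
  rintro x ⟨σ, z⟩ (hσ : 0 < σ)
  refine (hb _ σ (hA0 _) (hA1 _) hσ z).trans ?_
  unfold gmaj
  simp only
  rw [mul_assoc, add_zero]
  refine mul_le_mul_of_nonneg_left ?_ hC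
  have h2 : 0 ≤ σ ^ (κ / 2 - 1) := by positivity
  have h3 : Real.exp (-(1 / (8 * a1)) * ‖z‖ ^ 2 / σ) ≤
      Real.exp (-(1 / (16 * a1)) * ‖z‖ ^ 2 / σ) := by
    apply Real.exp_le_exp.2
    apply div_le_div_of_nonneg_right _ hσ.le
    apply mul_le_mul_of_nonneg_right _ (by positivity)
    apply neg_le_neg
    apply one_div_le_one_div_of_le (by positivity)
    linarith
  calc ((√σ) ^ d)⁻¹ * Real.exp (-(1 / (8 * a1)) * ‖z‖ ^ 2 / σ)
      ≤ 1 * (((√σ) ^ d)⁻¹ * Real.exp (-(1 / (16 * a1)) * ‖z‖ ^ 2 / σ)) := by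
        rw [one_mul]; exact mul_le_mul_of_nonneg_left h3 (by positivity)
    _ ≤ _ := mul_le_mul_of_nonneg_right (by linarith) (by positivity)

theorem exists_isKer_eker {A : Eu d → ℝ} (hA : Continuous A) {a0 a1 κ H : ℝ} (h0 : 0 < a0)
    (hA0 : ∀ x, a0 ≤ A x) (hA1 : ∀ x, A x ≤ a1) (hκ : 0 < κ) (hκ1 : κ ≤ 1) (hH : 0 ≤ H)
    (hol : ∀ x y, |A y - A x| ≤ H * ‖x - y‖ ^ κ) :
    ∃ C, IsKer κ (1 / (16 * a1)) C (eker A) := by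
  have ha1 : 0 < a1 := h0.trans_le ((hA0 0).trans (hA1 0))
  obtain ⟨C, hC, hb⟩ := Ks_scaled_bound 2 (lpg 0 (hp0 d)) h0 ha1
  obtain ⟨D, hD, hd⟩ := exists_pow_le_exp_sq 2 (1 / (16 * a1)) (by positivity)
  refine ⟨H * D * C, ⟨?_, ?_⟩⟩
  · refine ContinuousOn.mul (Continuous.continuousOn ?_)
      (continuousOn_scaled_Ks 2 _ hA fun x => h0.trans_le (hA0 x))
    exact (hA.comp (by fun_prop)).sub (hA.comp continuous_fst)
  rintro x ⟨σ, z⟩ (hσ : 0 < σ)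
  have hs : 0 < √σ := Real.sqrt_pos.2 hσ
  have hz : ‖z‖ ^ κ ≤ D * σ ^ (κ / 2) * Real.exp (1 / (16 * a1) * ‖z‖ ^ 2 / σ) := by
    have hr : 0 ≤ ‖z‖ / √σ := by positivity
    have h1 := (rpow_le_one_add_sq hr hκ.le (by linarith)).trans (hd _ hr)
    rw [Real.div_rpow (norm_nonneg _) hs.le, div_le_iff₀ (by positivity), div_pow,
      Real.sq_sqrt hσ.le] at h1
    have h2 : (√σ) ^ κ = σ ^ (κ / 2) := by
      rw [Real.sqrt_eq_rpow, ← Real.rpow_mul hσ.le]; congr 1; ring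
    rw [h2] at h1
    refine h1.trans (le_of_eq ?_)
    rw [mul_div_assoc]; ring
  have hx : |A (x + z) - A x| ≤ H * ‖z‖ ^ κ := by simpa using hol x (x + z)
  simp only [eker]
  rw [abs_mul]
  calc |A (x + z) - A x| * |Ks 2 (lpg 0 (hp0 d)) (A (x + z) * σ) z|
      ≤ (H * (D * σ ^ (κ / 2) * Real.exp (1 / (16 * a1) * ‖z‖ ^ 2 / σ))) *
        (C * ((√σ) ^ (d + 2))⁻¹ * Real.exp (-(1 / (8 * a1)) * ‖z‖ ^ 2 / σ)) :=
        mul_le_mul (hx.trans (mul_le_mul_of_nonneg_left hz hH)) (hb _ σ (hA0 _) (hA1 _) hσ z)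
          (abs_nonneg _) (by positivity)
    _ = H * D * C * (σ ^ (κ / 2 - 1) *
          (((√σ) ^ d)⁻¹ * Real.exp (-(1 / (16 * a1)) * ‖z‖ ^ 2 / σ))) := by
        have e1 : Real.exp (-(1 / (16 * a1)) * ‖z‖ ^ 2 / σ) =
            Real.exp (1 / (16 * a1) * ‖z‖ ^ 2 / σ) *
              Real.exp (-(1 / (8 * a1)) * ‖z‖ ^ 2 / σ) := by
          rw [← Real.exp_add]; congr 1; field_simp; ring
        have e2 : σ ^ (κ / 2 - 1) = σ ^ (κ / 2) * σ⁻¹ := by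
          rw [Real.rpow_sub hσ, Real.rpow_one, div_eq_mul_inv]
        have e3 : ((√σ) ^ (d + 2))⁻¹ = ((√σ) ^ d)⁻¹ * σ⁻¹ := by
          rw [pow_add, mul_inv, Real.sq_sqrt hσ.le]
        rw [e1, e2, e3]; ring
    _ ≤ _ := by
        unfold gmaj
        refine mul_le_mul_of_nonneg_left ?_ (by positivity)
        exact mul_le_mul_of_nonneg_right (by simp) (by positivity)
end

section
variable {d : ℕ} {κ c l B C₁ C₂ : ℝ} {A : Eu d → ℝ} {f : Eu d → ℝ → ℝ}

theorem hasDerivAt_timeInt (hf : Continuous fun q : Eu d × ℝ => f q.1 q.2) (y : Eu d) (t : ℝ) :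
    HasDerivAt (fun t => timeInt f t y) (f y t) t := by
  have hc : Continuous (f y) := hf.comp (f := fun s : ℝ => (y, s)) (by fun_prop)
  exact intervalIntegral.integral_hasDerivAt_right (hc.intervalIntegrable _ _)
    (hc.stronglyMeasurableAtFilter _ _) hc.continuousAt

theorem ccs_const {b : Eu d → ℝ} (hb : Continuous b) (hs : HasCompactSupport b) :
    CCS fun y (_ : ℝ) => b y := by
  simpa using CCS.mul (u := fun _ _ => 1) continuous_const hb hs

/-- The fundamental theorem of calculus for the heat kernel with coefficient frozen at `y`. -/
theorem integral_frozen_heat (hpos : 0 < A y) (hl : 0 < l) (hf : ExpBdd l B f) {b : Eu d → ℝ}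
    (hb : Continuous b) (hs : HasCompactSupport b) (t : ℝ)
    (hi : Integrable (fun σ => timeInt f (t - σ) y *
      (A y * cv 2 (lpg 0 (hp0 d)) (fun z _ => b z) y 0 (A y * σ)) -
      f y (t - σ) * cv 0 (hp0 d) (fun z _ => b z) y 0 (A y * σ)) (volume.restrict (Ioi 0))) :
    ∫ σ in Ioi (0 : ℝ), (timeInt f (t - σ) y *
      (A y * cv 2 (lpg 0 (hp0 d)) (fun z _ => b z) y 0 (A y * σ)) -
      f y (t - σ) * cv 0 (hp0 d) (fun z _ => b z) y 0 (A y * σ)) = -(b y * timeInt f t y) := by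
  have hF := hf.timeInt hl
  have hbc : CCS fun y (_ : ℝ) => b y := ccs_const hb hs
  obtain ⟨m, hm⟩ : ∃ m : ℝ → ℝ, m = fun σ =>
    timeInt f (t - σ) y * cv 0 (hp0 d) (fun z _ => b z) y 0 (A y * σ) := ⟨_, rfl⟩
  have hu : ∀ σ, 0 < σ → Function.update m 0 (b y * timeInt f t y) σ = m σ := fun σ hσ =>
    Function.update_of_ne hσ.ne' _ _
  have h1 := integral_Ioi_of_hasDerivAt_of_tendsto (a := 0) (m := 0)
    (f := Function.update m 0 (b y * timeInt f t y)) ?_ (fun σ hσ => ?_) hi ?_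
  · rw [h1, Function.update_self, zero_sub]
  · rw [continuousWithinAt_update_same, Ici_sdiff_left, hm]
    have hc : Continuous fun s => timeInt f s y :=
      hF.cont.comp (f := fun s : ℝ => (y, s)) (by fun_prop)
    have hG : CCS fun z s => timeInt f s y * b z :=
      CCS.mul (u := fun _ s => timeInt f s y) (hc.comp continuous_snd) hb hs
    have hG0 : ∀ (z : Eu d) s, s ≤ 0 → timeInt f s y * b z = 0 := fun z s h => by
      rw [hF.zero y s h, zero_mul]
    have := tendsto_cv_zero hG hG0 y t hpos
    rw [mul_comm (b y)]
    refine this.congr fun σ => ?_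
    unfold cv
    rw [← integral_const_mul]
    congr 1; ext z; ring
  · have hσ : 0 < σ := hσ
    have e1 : HasDerivAt (fun σ => timeInt f (t - σ) y) (-f y (t - σ)) σ := by
      have := (hasDerivAt_timeInt hf.cont y (t - σ)).comp σ ((hasDerivAt_id σ).const_sub t)
      exact this.congr_deriv (by simp)
    have e2 : HasDerivAt (fun σ => cv 0 (hp0 d) (fun z _ => b z) y 0 (A y * σ))
        (A y * cv 2 (lpg 0 (hp0 d)) (fun z _ => b z) y 0 (A y * σ)) σ := by
      have := (hasDerivAt_cv 0 (hp0 d) hbc y 0 (mul_pos hpos hσ)).comp σ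
        ((hasDerivAt_id σ).const_mul (A y))
      exact this.congr_deriv (by simp [mul_comm])
    have e3 := e1.mul e2
    rw [show ((fun σ => timeInt f (t - σ) y) * fun σ =>
      cv 0 (hp0 d) (fun z _ => b z) y 0 (A y * σ)) = m from hm.symm] at e3
    have e4 := e3.congr_of_eventuallyEq (f₁ := Function.update m 0 (b y * timeInt f t y)) (by
      filter_upwards [Ioi_mem_nhds hσ] with τ hτ using hu τ hτ)
    exact e4.congr_deriv (by ring)
  · refine tendsto_const_nhds.congr' ?_
    filter_upwards [Ioi_mem_atTop 0, Ioi_mem_atTop t] with τ h0 hτ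
    rw [hu τ h0, hm]
    simp only
    rw [hF.zero y _ (by linarith [show t < τ from hτ]), zero_mul]

theorem integral_mul_pker (b : Eu d → ℝ) (y : Eu d) (σ : ℝ) :
    ∫ x, b x * pker A x (σ, y - x) = cv 0 (hp0 d) (fun z _ => b z) y 0 (A y * σ) := by
  unfold cv pker
  congr 1; ext x
  simp [mul_comm]

theorem integral_mul_eker (hA : Continuous A) (hpos : ∀ x, 0 < A x) {ρ : Eu d → ℝ}
    (hρ : ContDiff ℝ ∞ ρ) (hs : HasCompactSupport ρ) (y : Eu d) {σ : ℝ} (hσ : 0 < σ) :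
    (∫ x, lap ρ x * pker A x (σ, y - x)) + ∫ x, (ρ x / A x) * eker A x (σ, y - x) =
      A y * cv 2 (lpg 0 (hp0 d)) (fun z _ => ρ z / A z) y 0 (A y * σ) := by
  have hy : 0 < A y * σ := mul_pos (hpos y) hσ
  have h1 : ∫ x, lap ρ x * pker A x (σ, y - x) =
      ∫ x, Ks 2 (lpg 0 (hp0 d)) (A y * σ) (y - x) * ρ x := by
    have := integral_mul_lap (f := fun x => Ks 0 (hp0 d) (A y * σ) (y - x))
      (contDiff_infty.1 (contDiff_Ks_sub 0 (hp0 d) (A y * σ) y) 2) hρ hs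
    simp only [lap_Ks_sub hy] at this
    rw [← this]
    unfold pker
    congr 1; ext x
    simp [mul_comm]
  have hK : Continuous fun x => Ks 2 (lpg 0 (hp0 d)) (A y * σ) (y - x) :=
    (contDiff_Ks_sub 2 _ (A y * σ) y).continuous
  have i1 : Integrable fun x => Ks 2 (lpg 0 (hp0 d)) (A y * σ) (y - x) * ρ x :=
    (ccs_const hρ.continuous hs).integrable_mul 0 hK
  have i2 : Integrable fun x => (ρ x / A x) * eker A x (σ, y - x) := by
    have h := (ccs_const (continuous_div_coeff hA hpos hρ.continuous)
      (hasCompactSupport_div hs A)).integrable_mul 0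
      (k := fun x => (A y - A x) * Ks 2 (lpg 0 (hp0 d)) (A y * σ) (y - x))
      ((continuous_const.sub hA).mul hK)
    refine h.congr (Eventually.of_forall fun x => ?_)
    simp [eker, mul_comm]
  rw [h1, ← integral_add i1 i2]
  unfold cv
  rw [← integral_const_mul]
  congr 1; ext x
  have := (hpos x).ne'
  simp only [eker, add_sub_cancel]
  field_simp
  ring

/-- The parametrix potential is a weak solution. -/
theorem isWeak_op (hA : Continuous A) (hpos : ∀ x, 0 < A x) (hκ : 0 < κ) (hc : 0 < c) (hl : 0 < l)
    (hk1 : IsKer κ c C₁ (pker A)) (hk2 : IsKer κ c C₂ (eker A)) (hf : ExpBdd l B f) :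
    IsWeak A (op (pker A) f) fun x t => f x t + op (eker A) f x t := by
  have o1 := hf.op hκ hc hl hk1
  have o2 := hf.op hκ hc hl hk2
  have hF := hf.timeInt hl
  have cg : Continuous fun q : Eu d × ℝ => f q.1 q.2 + op (eker A) f q.1 q.2 :=
    hf.cont.add o2.cont
  refine ⟨o1.cont, cg, o1.zero, fun y s h => by simp [hf.zero y s h, o2.zero y s h],
    fun ρ hρ hs t => ?_⟩
  have hb := continuous_div_coeff hA hpos hρ.continuous
  have hbs := hasCompactSupport_div hs A
  have hlap : Continuous (lap ρ) := (contDiff_lap hρ).continuous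
  have hls : HasCompactSupport (lap ρ) := hs.of_isClosed_subset (isClosed_tsupport _)
    (tsupport_lap_subset ρ)
  obtain ⟨j1, e1⟩ := integral_op hκ hc hl hk1 hF hlap hls t
  obtain ⟨j2, e2⟩ := integral_op hκ hc hl hk2 hF hb hbs t
  obtain ⟨j3, e3⟩ := integral_op hκ hc hl hk1 hf hb hbs t
  have key : ((∫ x, lap ρ x * op (pker A) (fun y t => timeInt f t y) x t) +
      ∫ x, (ρ x / A x) * op (eker A) (fun y t => timeInt f t y) x t) -
      ∫ x, (ρ x / A x) * op (pker A) f x t = ∫ y, -((ρ y / A y) * timeInt f t y) := by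
    have j := (j1.add j2).sub j3
    rw [e1, e2, e3, ← integral_add' j1 j2, ← integral_sub' (j1.add j2) j3]
    unfold halfVol at j ⊢
    rw [integral_prod_symm _ j]
    apply integral_congr_ae
    filter_upwards [j.prod_left_ae] with y hy
    have hcongr : ∀ σ ∈ Ioi (0 : ℝ),
        timeInt f (t - σ) y * (∫ x, lap ρ x * pker A x (σ, y - x)) +
          timeInt f (t - σ) y * (∫ x, (ρ x / A x) * eker A x (σ, y - x)) -
          f y (t - σ) * (∫ x, (ρ x / A x) * pker A x (σ, y - x)) =
        timeInt f (t - σ) y *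
          (A y * cv 2 (lpg 0 (hp0 d)) (fun z _ => ρ z / A z) y 0 (A y * σ)) -
          f y (t - σ) * cv 0 (hp0 d) (fun z _ => ρ z / A z) y 0 (A y * σ) := by
      intro σ hσ
      rw [← mul_add, integral_mul_eker hA hpos hρ hs y hσ, integral_mul_pker]
    refine (setIntegral_congr_fun measurableSet_Ioi hcongr).trans ?_
    refine integral_frozen_heat (hpos y) hl hf hb hbs t (hy.congr ?_)
    filter_upwards [ae_restrict_mem measurableSet_Ioi] with σ hσ
    exact hcongr σ hσ
  have s1 : CCS fun y s => op (pker A) f y s * lap ρ y := CCS.mul o1.cont hlap hls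
  have s2 : CCS fun y s => (f y s + op (eker A) f y s) * (ρ y / A y) := CCS.mul cg hb hbs
  rw [(s1.add s2).integral_swap]
  have hci : ∀ {h : Eu d → ℝ → ℝ}, (Continuous fun q : Eu d × ℝ => h q.1 q.2) → ∀ y,
      IntervalIntegrable (h y) volume 0 t := fun hh y =>
    (hh.comp (f := fun s : ℝ => (y, s)) (by fun_prop)).intervalIntegrable _ _
  have hin : ∀ y, ∫ s in (0 : ℝ)..t, (op (pker A) f y s * lap ρ y +
      (f y s + op (eker A) f y s) * (ρ y / A y)) =
      lap ρ y * op (pker A) (fun y t => timeInt f t y) y t +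
        (ρ y / A y) * op (eker A) (fun y t => timeInt f t y) y t +
        (ρ y / A y) * timeInt f t y := by
    intro y
    rw [intervalIntegral.integral_add ((hci o1.cont y).mul_const _) ((hci (h := fun y s => f y s + op (eker A) f y s) cg y).mul_const _),
      intervalIntegral.integral_mul_const, intervalIntegral.integral_mul_const,
      intervalIntegral.integral_add (hci hf.cont y) (hci o2.cont y),
      ← timeInt_op hκ hc hl hk1 hf, ← timeInt_op hκ hc hl hk2 hf]
    unfold timeInt
    ring
  simp only [hin]
  have q1 : Integrable fun y => lap ρ y * op (pker A) (fun y t => timeInt f t y) y t :=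
    ((CCS.mul (hF.op hκ hc hl hk1).cont hlap hls).integrable t).congr
      (Eventually.of_forall fun y => mul_comm _ _)
  have q2 : Integrable fun y => (ρ y / A y) * op (eker A) (fun y t => timeInt f t y) y t :=
    ((CCS.mul (hF.op hκ hc hl hk2).cont hb hbs).integrable t).congr
      (Eventually.of_forall fun y => mul_comm _ _)
  have q3 : Integrable fun y => (ρ y / A y) * timeInt f t y :=
    ((CCS.mul (u := fun y t => timeInt f t y) hF.cont hb hbs).integrable t).congr (Eventually.of_forall fun y => mul_comm _ _)
  have q12 : Integrable fun y => lap ρ y * op (pker A) (fun y t => timeInt f t y) y t +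
      (ρ y / A y) * op (eker A) (fun y t => timeInt f t y) y t := q1.add q2
  rw [integral_add q12 q3, integral_add q1 q2]
  rw [integral_neg] at key
  simp only [mul_comm (op (pker A) f _ t)]
  linarith
end

section
variable {d : ℕ} {κ c l B N Λ C₁ C₂ : ℝ} {A : Eu d → ℝ} {f : Eu d → ℝ → ℝ}
  {k₁ k₂ : Eu d → ℝ × Eu d → ℝ} {F : Eu d → ℝ → ℝ}

/-- Bounded continuous functions on space-time vanishing at nonpositive times. -/
def causal (d : ℕ) : Set (BoundedContinuousFunction (Eu d × ℝ) ℝ) :=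
  {Ψ | ∀ y s, s ≤ 0 → Ψ (y, s) = 0}

theorem isClosed_causal : IsClosed (causal d) := by
  have : causal d = ⋂ (y : Eu d) (s : ℝ) (_ : s ≤ 0), {Ψ | Ψ (y, s) = 0} := by
    ext Ψ; simp [causal]
  rw [this]
  refine isClosed_iInter fun y => isClosed_iInter fun s => isClosed_iInter fun _ => ?_
  exact isClosed_eq (continuous_eval_const (F := BoundedContinuousFunction (Eu d × ℝ) ℝ) (y, s))
    continuous_const

theorem expBdd_weight (l : ℝ) (Ψ : causal d) :
    ExpBdd l ‖Ψ.1‖ fun y s => Real.exp (l * s) * Ψ.1 (y, s) where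
  cont := by
    have := Ψ.1.continuous
    fun_prop
  zero y s h := by simp [Ψ.2 y s h]
  bound y s := by
    rw [abs_mul, Real.abs_exp, mul_comm]
    exact mul_le_mul_of_nonneg_right (Ψ.1.norm_coe_le_norm (y, s)) (Real.exp_nonneg _)

theorem expBdd_weight_sub (l : ℝ) (Ψ Ψ' : causal d) :
    ExpBdd l (dist Ψ Ψ') fun y s =>
      Real.exp (l * s) * Ψ.1 (y, s) - Real.exp (l * s) * Ψ'.1 (y, s) where
  cont := (expBdd_weight l Ψ).cont.sub (expBdd_weight l Ψ').cont
  zero y s h := by simp [Ψ.2 y s h, Ψ'.2 y s h]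
  bound y s := by
    rw [← mul_sub, abs_mul, Real.abs_exp, mul_comm]
    exact mul_le_mul_of_nonneg_right (BoundedContinuousFunction.dist_coe_le_dist (f := Ψ.1)
      (g := Ψ'.1) (y, s)) (Real.exp_nonneg _)

theorem exists_causal_of_expBdd (hf : ExpBdd l B f) :
    ∃ Ψ : causal d, ∀ y s, Ψ.1 (y, s) = Real.exp (-l * s) * f y s := by
  refine ⟨⟨BoundedContinuousFunction.ofNormedAddCommGroup
    (fun q : Eu d × ℝ => Real.exp (-l * q.2) * f q.1 q.2) ?_ B fun q => ?_, fun y s h => ?_⟩,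
    fun y s => rfl⟩
  · have := hf.cont
    fun_prop
  · rw [norm_mul, Real.norm_eq_abs, Real.norm_eq_abs, Real.abs_exp]
    refine (mul_le_mul_of_nonneg_left (hf.bound q.1 q.2) (Real.exp_nonneg _)).trans (le_of_eq ?_)
    rw [mul_left_comm, ← Real.exp_add]
    simp
  · simp [hf.zero y s h]

theorem expBdd_source (hl : 0 < l) (hN : 0 ≤ N) (hf : Continuous fun q : Eu d × ℝ => f q.1 q.2)
    (h0 : ∀ y s, s ≤ 0 → f y s = 0) (hb : ∀ y s, |f y s| ≤ N) : ExpBdd l N f := by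
  refine ⟨hf, h0, fun y s => ?_⟩
  rcases le_total s 0 with h | h
  · rw [h0 y s h, abs_zero]; positivity
  · have : 1 ≤ Real.exp (l * s) := Real.one_le_exp (by positivity)
    nlinarith [hb y s]

theorem expBdd_comp (hΛ : 0 ≤ Λ) (hF : Continuous fun q : Eu d × ℝ => F q.1 q.2)
    (hF0 : ∀ x, F x 0 = 0) (hL : ∀ x a b, |F x a - F x b| ≤ Λ * |a - b|) (hf : ExpBdd l B f) :
    ExpBdd l (Λ * B) fun x t => F x (f x t) where
  cont := hF.comp (f := fun q : Eu d × ℝ => (q.1, f q.1 q.2)) (continuous_fst.prodMk hf.cont)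
  zero y s h := by simp only [hf.zero y s h, hF0]
  bound y s := by
    have := hL y (f y s) 0
    rw [hF0, sub_zero, sub_zero] at this
    refine this.trans ?_
    rw [mul_assoc]
    exact mul_le_mul_of_nonneg_left (hf.bound y s) hΛ

theorem ExpBdd.add {B' : ℝ} {f' : Eu d → ℝ → ℝ} (hf : ExpBdd l B f) (hf' : ExpBdd l B' f') :
    ExpBdd l (B + B') fun y s => f y s + f' y s where
  cont := hf.cont.add hf'.cont
  zero y s h := by simp [hf.zero y s h, hf'.zero y s h]
  bound y s := (abs_add_le _ _).trans (by linarith [hf.bound y s, hf'.bound y s])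

theorem ExpBdd.sub {B' : ℝ} {f' : Eu d → ℝ → ℝ} (hf : ExpBdd l B f) (hf' : ExpBdd l B' f') :
    ExpBdd l (B + B') fun y s => f y s - f' y s where
  cont := hf.cont.sub hf'.cont
  zero y s h := by simp [hf.zero y s h, hf'.zero y s h]
  bound y s := (abs_sub _ _).trans (by linarith [hf.bound y s, hf'.bound y s])

/-- Solvability of the parametrix equation by contraction. -/
theorem exists_parametrix_density (hκ : 0 < κ) (hc : 0 < c) (hl : 0 < l) (hΛ : 0 ≤ Λ)
    (hk1 : IsKer κ c C₁ k₁) (hk2 : IsKer κ c C₂ k₂)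
    (hsmall : (Λ * C₁ + C₂) * gmass d κ c l ≤ 1 / 2)
    (hF : Continuous fun q : Eu d × ℝ => F q.1 q.2) (hF0 : ∀ x, F x 0 = 0)
    (hL : ∀ x a b, |F x a - F x b| ≤ Λ * |a - b|) (hf : ExpBdd l N f) :
    ∃ (Φ : Eu d → ℝ → ℝ) (B : ℝ), ExpBdd l B Φ ∧
      ∀ x t, Φ x t = f x t + F x (op k₁ Φ x t) - op k₂ Φ x t := by
  obtain ⟨E, hE⟩ : ∃ E : causal d → Eu d → ℝ → ℝ,
    E = fun Ψ y s => Real.exp (l * s) * Ψ.1 (y, s) := ⟨_, rfl⟩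
  have hEb : ∀ Ψ, ExpBdd l ‖Ψ.1‖ (E Ψ) := fun Ψ => hE ▸ expBdd_weight l Ψ
  have hEs : ∀ Ψ Ψ', ExpBdd l (dist Ψ Ψ') (fun y s => E Ψ y s - E Ψ' y s) :=
    fun Ψ Ψ' => hE ▸ expBdd_weight_sub l Ψ Ψ'
  have hex : ∀ Ψ : causal d, ∃ Ψ' : causal d, ∀ y s, Ψ'.1 (y, s) = Real.exp (-l * s) *
      (f y s + F y (op k₁ (E Ψ) y s) - op k₂ (E Ψ) y s) := fun Ψ =>
    exists_causal_of_expBdd ((hf.add (expBdd_comp hΛ hF hF0 hL ((hEb Ψ).op hκ hc hl hk1))).sub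
      ((hEb Ψ).op hκ hc hl hk2))
  choose T hT using hex
  have hcon : ContractingWith (1 / 2) T := by
    refine ⟨by norm_num, LipschitzWith.of_dist_le_mul fun Ψ Ψ' => ?_⟩
    rw [Subtype.dist_eq]
    refine (BoundedContinuousFunction.dist_le (by positivity)).2 ?_
    rintro ⟨y, s⟩
    rw [Real.dist_eq, hT, hT, ← mul_sub, abs_mul, Real.abs_exp]
    have b1 := abs_op_le hκ hc hl hk1 (hEs Ψ Ψ') y s
    have b2 := abs_op_le hκ hc hl hk2 (hEs Ψ Ψ') y s
    rw [op_sub hκ hc hl hk1 (hEb Ψ) (hEb Ψ')] at b1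
    rw [op_sub hκ hc hl hk2 (hEb Ψ) (hEb Ψ')] at b2
    have b3 : |f y s + F y (op k₁ (E Ψ) y s) - op k₂ (E Ψ) y s -
        (f y s + F y (op k₁ (E Ψ') y s) - op k₂ (E Ψ') y s)| ≤
        (1 / 2 * dist Ψ Ψ') * Real.exp (l * s) := by
      have e : f y s + F y (op k₁ (E Ψ) y s) - op k₂ (E Ψ) y s -
          (f y s + F y (op k₁ (E Ψ') y s) - op k₂ (E Ψ') y s) =
          (F y (op k₁ (E Ψ) y s) - F y (op k₁ (E Ψ') y s)) -
            (op k₂ (E Ψ) y s - op k₂ (E Ψ') y s) := by ring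
      rw [e]
      have b4 := (hL y (op k₁ (E Ψ) y s) (op k₁ (E Ψ') y s)).trans
        (mul_le_mul_of_nonneg_left b1 hΛ)
      have b5 : (Λ * C₁ + C₂) * gmass d κ c l * (dist Ψ Ψ' * Real.exp (l * s)) ≤
          1 / 2 * (dist Ψ Ψ' * Real.exp (l * s)) :=
        mul_le_mul_of_nonneg_right hsmall (by positivity)
      refine (abs_sub _ _).trans ?_
      linarith
    calc _ ≤ Real.exp (-l * s) * ((1 / 2 * dist Ψ Ψ') * Real.exp (l * s)) :=
          mul_le_mul_of_nonneg_left b3 (Real.exp_nonneg _)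
      _ = _ := by
          rw [mul_left_comm, ← Real.exp_add]; simp
  have : CompleteSpace (causal d) := isClosed_causal.completeSpace_coe
  have : Nonempty (causal d) := ⟨⟨0, fun _ _ _ => rfl⟩⟩
  obtain ⟨Ψ, hΨ⟩ : ∃ Ψ, T Ψ = Ψ := ⟨_, hcon.fixedPoint_isFixedPt⟩
  refine ⟨E Ψ, _, hEb Ψ, fun x t => ?_⟩
  have h1 := hT Ψ x t
  rw [hΨ] at h1
  have h2 : E Ψ x t = Real.exp (l * t) * Ψ.1 (x, t) := by rw [hE]
  rw [h2, h1, ← mul_assoc, ← Real.exp_add]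
  simp

/-- Existence of weak solutions of semilinear equations with Lipschitz nonlinearity. -/
theorem exists_isWeak_semilinear {a0 a1 H : ℝ} (h0 : 0 < a0) (hA0 : ∀ x, a0 ≤ A x)
    (hA1 : ∀ x, A x ≤ a1) (hκ : 0 < κ) (hκ1 : κ ≤ 1) (hH : 0 ≤ H) (hA : Continuous A)
    (hol : ∀ x y, |A y - A x| ≤ H * ‖x - y‖ ^ κ) (hΛ : 0 ≤ Λ)
    (hF : Continuous fun q : Eu d × ℝ => F q.1 q.2) (hF0 : ∀ x, F x 0 = 0)
    (hL : ∀ x a b, |F x a - F x b| ≤ Λ * |a - b|) (hN : 0 ≤ N)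
    (hf : Continuous fun q : Eu d × ℝ => f q.1 q.2) (hf0 : ∀ y s, s ≤ 0 → f y s = 0)
    (hfN : ∀ y s, |f y s| ≤ N) :
    ∃ u : Eu d → ℝ → ℝ, IsWeak A u (fun x t => f x t + F x (u x t)) ∧
      ∃ B l : ℝ, 0 < l ∧ ExpBdd l B u := by
  have ha1 : 0 < a1 := h0.trans_le ((hA0 0).trans (hA1 0))
  have hpos : ∀ x, 0 < A x := fun x => h0.trans_le (hA0 x)
  obtain ⟨C₁, hk1⟩ := exists_isKer_pker hA h0 hA0 hA1 κ
  obtain ⟨C₂, hk2⟩ := exists_isKer_eker hA h0 hA0 hA1 hκ hκ1 hH hol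
  have hc : 0 < 1 / (16 * a1) := by positivity
  have ht := (tendsto_gmass (d := d) hκ hc).const_mul (Λ * C₁ + C₂)
  rw [mul_zero] at ht
  obtain ⟨l, hl1, hl⟩ := ((ht.eventually (Iic_mem_nhds (show (0 : ℝ) < 1 / 2 by norm_num))).and
    (eventually_gt_atTop 0)).exists
  obtain ⟨Φ, B, hΦ, he⟩ := exists_parametrix_density hκ hc hl hΛ hk1 hk2 hl1 hF hF0 hL
    (expBdd_source hl hN hf hf0 hfN)
  have hw := isWeak_op hA hpos hκ hc hl hk1 hk2 hΦ
  refine ⟨op (pker A) Φ, ?_, _, l, hl, hΦ.op hκ hc hl hk1⟩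
  have e : (fun x t => Φ x t + op (eker A) Φ x t) =
      fun x t => f x t + F x (op (pker A) Φ x t) := by
    funext x t
    have := he x t
    linarith
  rwa [e] at hw
end

section
variable {d : ℕ} {f g : Eu d → ℝ} {x : Eu d} {a : Eu d → ℝ} {D : Eu d → ℝ → ℝ} {M R T t₀ t₁ : ℝ}

theorem eventually_differentiableAt (hf : ContDiffAt ℝ 2 f x) :
    ∀ᶠ y in 𝓝 x, DifferentiableAt ℝ f y := by
  filter_upwards [hf.eventually (by simp)] with y hy using hy.differentiableAt (by simp)

theorem differentiableAt_pd (hf : ContDiffAt ℝ 2 f x) (i : Fin d) :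
    DifferentiableAt ℝ (pd i f) x := by
  have h : ContDiffAt ℝ 1 (fderiv ℝ f) x := hf.fderiv_right (by norm_num)
  exact (h.differentiableAt (by simp)).clm_apply (differentiableAt_const _)

theorem pd_sub_apply (hf : DifferentiableAt ℝ f x) (hg : DifferentiableAt ℝ g x) (i : Fin d) :
    pd i (fun y => f y - g y) x = pd i f x - pd i g x := by
  unfold pd
  rw [fderiv_fun_sub hf hg]; rfl

theorem lap_sub (hf : ContDiffAt ℝ 2 f x) (hg : ContDiffAt ℝ 2 g x) :
    lap (fun y => f y - g y) x = lap f x - lap g x := by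
  unfold lap
  rw [← Finset.sum_sub_distrib]
  refine Finset.sum_congr rfl fun i _ => ?_
  have h : pd i (fun y => f y - g y) =ᶠ[𝓝 x] fun y => pd i f y - pd i g y := by
    filter_upwards [eventually_differentiableAt hf, eventually_differentiableAt hg] with y h1 h2
    exact pd_sub_apply h1 h2 i
  have h2 : pd i (pd i (fun y => f y - g y)) x = pd i (fun y => pd i f y - pd i g y) x := by
    unfold pd at h ⊢
    rw [h.fderiv_eq]
  rw [h2]
  exact pd_sub_apply (differentiableAt_pd hf i) (differentiableAt_pd hg i) i

theorem pd_pd_nonpos_of_isLocalMax (hf : ContDiffAt ℝ 2 f x) (hm : IsLocalMax f x) (i : Fin d) :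
    pd i (pd i f) x ≤ 0 := by
  by_contra! hpos
  set e : Eu d := EuclideanSpace.single i 1
  set ℓ : ℝ → Eu d := fun s => x + s • e
  have hℓ : ∀ s, HasDerivAt ℓ e s := fun s => by
    have := ((hasDerivAt_id s).smul_const e).const_add x
    rw [one_smul] at this
    exact this
  have hℓ0 : ℓ 0 = x := by simp [ℓ]
  have hℓt : Tendsto ℓ (𝓝 0) (𝓝 x) := by
    have := (hℓ 0).continuousAt.tendsto
    rwa [hℓ0] at this
  have hd1 : deriv (f ∘ ℓ) =ᶠ[𝓝 0] fun s => pd i f (ℓ s) := by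
    filter_upwards [hℓt.eventually (eventually_differentiableAt hf)] with s hs
    exact (hs.hasFDerivAt.comp_hasDerivAt s (hℓ s)).deriv
  have hd2 : deriv (deriv (f ∘ ℓ)) 0 = pd i (pd i f) x := by
    rw [hd1.deriv_eq]
    have h := differentiableAt_pd hf i
    rw [← hℓ0] at h
    have := (h.hasFDerivAt.comp_hasDerivAt 0 (hℓ 0)).deriv
    rw [hℓ0] at this
    exact this
  have hmax : IsLocalMax (f ∘ ℓ) 0 := by
    rw [← hℓ0] at hm hℓt
    exact hℓt.eventually hm
  have hmin : IsLocalMin (f ∘ ℓ) 0 := by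
    refine isLocalMin_of_deriv_deriv_pos (hd2 ▸ hpos) hmax.deriv_eq_zero ?_
    exact ContinuousAt.comp (by rw [hℓ0]; exact hf.continuousAt) (hℓ 0).continuousAt
  have hconst : f ∘ ℓ =ᶠ[𝓝 0] fun _ => (f ∘ ℓ) 0 := by
    filter_upwards [hmax, hmin] with s h1 h2 using le_antisymm h1 h2
  have h0 : deriv (f ∘ ℓ) =ᶠ[𝓝 0] fun _ => 0 := by
    filter_upwards [hconst.eventuallyEq_nhds] with s hs
    rw [hs.deriv_eq]; simp
  rw [h0.deriv_eq] at hd2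
  simp at hd2
  linarith

theorem lap_nonpos_of_isLocalMax (hf : ContDiffAt ℝ 2 f x) (hm : IsLocalMax f x) :
    lap f x ≤ 0 :=
  Finset.sum_nonpos fun i _ => pd_pd_nonpos_of_isLocalMax hf hm i

theorem deriv_nonneg_of_left_max {V : ℝ → ℝ} {c t : ℝ} (h : HasDerivAt V c t) (ht : t₀ < t)
    (hm : ∀ s ∈ Ioo t₀ t, V s ≤ V t) : 0 ≤ c := by
  have h1 := (hasDerivAt_iff_tendsto_slope.1 h).mono_left
    (nhdsWithin_mono t (fun s (hs : s < t) => ne_of_lt hs) : 𝓝[<] t ≤ 𝓝[≠] t)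
  refine ge_of_tendsto h1 ?_
  filter_upwards [Ioo_mem_nhdsLT ht] with s hs
  rw [slope_def_field]
  exact div_nonneg_of_nonpos (by linarith [hm s hs]) (by linarith [hs.2])

/-- The weak maximum principle on a cylinder. -/
theorem nonpos_of_subsolution_ball (ha : ∀ x, 0 ≤ a x)
    (hc : ContinuousOn (fun q : Eu d × ℝ => D q.1 q.2) (Metric.closedBall 0 R ×ˢ Icc t₀ t₁))
    (h0 : ∀ x ∈ Metric.closedBall 0 R, D x t₀ ≤ 0)
    (hb : ∀ x, ‖x‖ = R → ∀ t ∈ Icc t₀ t₁, D x t ≤ 0)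
    (hD : ∀ x, ‖x‖ < R → ∀ t ∈ Ioc t₀ t₁, 0 < D x t →
      ∃ c, HasDerivAt (D x) c t ∧ ContDiffAt ℝ 2 (fun y => D y t) x ∧
        c ≤ a x * lap (fun y => D y t) x + M * D x t) {x : Eu d} (hx : ‖x‖ ≤ R) {t : ℝ}
    (ht : t ∈ Icc t₀ t₁) : D x t ≤ 0 := by
  by_contra! hpos
  have hxm : x ∈ Metric.closedBall (0 : Eu d) R := by simpa using hx
  obtain ⟨⟨y, s⟩, ⟨hy, hs⟩, hmax⟩ :=
    ((isCompact_closedBall (0 : Eu d) R).prod (isCompact_Icc (a := t₀) (b := t₁))).exists_isMaxOn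
      ⟨(x, t), hxm, ht⟩
      (f := fun q : Eu d × ℝ => Real.exp (-(M + 1) * q.2) * D q.1 q.2)
      (ContinuousOn.mul (by fun_prop) hc)
  have hmax' : ∀ z, ‖z‖ ≤ R → ∀ r ∈ Icc t₀ t₁, Real.exp (-(M + 1) * r) * D z r ≤
      Real.exp (-(M + 1) * s) * D y s := fun z hz r hr =>
    hmax (show (z, r) ∈ _ from ⟨by simpa using hz, hr⟩)
  have hDpos : 0 < D y s := by
    have h1 : 0 < Real.exp (-(M + 1) * s) * D y s :=
      (mul_pos (Real.exp_pos _) hpos).trans_le (hmax' x hx t ht)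
    exact pos_of_mul_pos_right h1 (Real.exp_pos _).le
  have hy' : ‖y‖ ≤ R := by simpa using hy
  have hyR : ‖y‖ < R := lt_of_le_of_ne hy' fun h => absurd (hb y h s hs) (not_le.2 hDpos)
  have hst : t₀ < s := lt_of_le_of_ne hs.1 fun h => absurd (h0 y hy) (not_le.2 (by
    rw [h]; exact hDpos))
  obtain ⟨c, h1, h2, h3⟩ := hD y hyR s ⟨hst, hs.2⟩ hDpos
  have hlap : lap (fun z => D z s) y ≤ 0 := by
    refine lap_nonpos_of_isLocalMax h2 ?_
    have : ∀ᶠ z in 𝓝 y, ‖z‖ < R := continuous_norm.tendsto y |>.eventually (gt_mem_nhds hyR)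
    filter_upwards [this] with z hz
    exact le_of_mul_le_mul_left (hmax' z hz.le s hs) (Real.exp_pos _)
  have hder : HasDerivAt (fun r => Real.exp (-(M + 1) * r) * D y r)
      (Real.exp (-(M + 1) * s) * (c - (M + 1) * D y s)) s := by
    have he : HasDerivAt (fun r => Real.exp (-(M + 1) * r))
        (Real.exp (-(M + 1) * s) * (-(M + 1))) s := by
      simpa using ((hasDerivAt_id s).const_mul (-(M + 1))).exp
    exact (he.mul h1).congr_deriv (by ring)
  have hge := deriv_nonneg_of_left_max hder hst fun r hr =>
    hmax' y hy' r ⟨hr.1.le, hr.2.le.trans hs.2⟩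
  have hge' : 0 ≤ c - (M + 1) * D y s := nonneg_of_mul_nonneg_right hge (Real.exp_pos _)
  nlinarith [mul_nonpos_of_nonneg_of_nonpos (ha y) hlap]
end

section
variable {d : ℕ} {x : Eu d} {a : Eu d → ℝ} {D : Eu d → ℝ → ℝ} {M B T : ℝ}

theorem hasFDerivAt_radial {ϕ : ℝ → ℝ} {c : ℝ} (h : HasDerivAt ϕ c (‖x‖ ^ 2)) :
    HasFDerivAt (fun y : Eu d => ϕ (‖y‖ ^ 2)) (c • (2 • innerSL ℝ x)) x :=
  h.comp_hasFDerivAt x (hasStrictFDerivAt_norm_sq x).hasFDerivAt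

theorem pd_radial {ϕ : ℝ → ℝ} {c : ℝ} (h : HasDerivAt ϕ c (‖x‖ ^ 2)) (i : Fin d) :
    pd i (fun y : Eu d => ϕ (‖y‖ ^ 2)) x = c * (2 * x i) := by
  unfold pd
  rw [(hasFDerivAt_radial h).fderiv]
  simp [EuclideanSpace.inner_single_right]

theorem lap_radial {ϕ ϕ₁ : ℝ → ℝ} {c : ℝ}
    (h1 : ∀ᶠ s in 𝓝 (‖x‖ ^ 2), HasDerivAt ϕ (ϕ₁ s) s) (h2 : HasDerivAt ϕ₁ c (‖x‖ ^ 2)) :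
    lap (fun y : Eu d => ϕ (‖y‖ ^ 2)) x = 2 * d * ϕ₁ (‖x‖ ^ 2) + 4 * ‖x‖ ^ 2 * c := by
  have hp : ∀ i, pd i (pd i fun y : Eu d => ϕ (‖y‖ ^ 2)) x =
      2 * ϕ₁ (‖x‖ ^ 2) + 4 * c * x i ^ 2 := by
    intro i
    have he : pd i (fun y : Eu d => ϕ (‖y‖ ^ 2)) =ᶠ[𝓝 x] fun y => ϕ₁ (‖y‖ ^ 2) * (2 * y i) := by
      have ht : Tendsto (fun y : Eu d => ‖y‖ ^ 2) (𝓝 x) (𝓝 (‖x‖ ^ 2)) :=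
        (continuous_norm.pow 2).tendsto x
      filter_upwards [ht.eventually h1] with y hy using pd_radial hy i
    have hi : HasFDerivAt (fun y : Eu d => 2 * y i) ((2 : ℝ) • EuclideanSpace.proj i) x :=
      (EuclideanSpace.proj i : Eu d →L[ℝ] ℝ).hasFDerivAt.const_mul 2
    have hf := (hasFDerivAt_radial h2).mul hi
    conv_lhs => rw [pd]
    erw [he.fderiv_eq, hf.fderiv]
    simp [EuclideanSpace.inner_single_right]
    ring
  unfold lap
  simp_rw [hp]
  rw [Finset.sum_add_distrib, ← Finset.mul_sum, ← Finset.mul_sum, ← EuclideanSpace.real_norm_sq_eq]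
  simp
  ring

theorem contDiff_one_add_norm_sq : ContDiff ℝ ∞ fun x : Eu d => 1 + ‖x‖ ^ 2 :=
  contDiff_const.add (contDiff_norm_sq ℝ)

/-- The maximum principle on the whole space for bounded subsolutions. -/
theorem nonpos_of_subsolution {a₁ : ℝ} (ha : ∀ x, 0 ≤ a x) (ha1 : ∀ x, a x ≤ a₁) (hM : 0 ≤ M)
    (hc : Continuous fun q : Eu d × ℝ => D q.1 q.2) (h0 : ∀ x, D x 0 ≤ 0)
    (hB : ∀ x, ∀ t ∈ Icc 0 T, D x t ≤ B)
    (hD : ∀ x, ∀ t ∈ Ioc 0 T, 0 < D x t →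
      ∃ c, HasDerivAt (D x) c t ∧ ContDiffAt ℝ 2 (fun y => D y t) x ∧
        c ≤ a x * lap (fun y => D y t) x + M * D x t) (x : Eu d) {t : ℝ}
    (ht : t ∈ Icc 0 T) : D x t ≤ 0 := by
  have ha10 : 0 ≤ a₁ := (ha x).trans (ha1 x)
  set K : ℝ := M + 2 * d * a₁ with hK
  have hK0 : 0 ≤ K := by positivity
  have key : ∀ κ : ℝ, 0 < κ → D x t ≤ κ * ((1 + ‖x‖ ^ 2) * Real.exp (K * t)) := by
    intro κ hκ
    obtain ⟨R, hR1, hR2, hR3⟩ : ∃ R : ℝ, ‖x‖ ≤ R ∧ |B| / κ ≤ R ∧ 1 ≤ R :=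
      ⟨max (max ‖x‖ (|B| / κ)) 1, by simp, by simp, by simp⟩
    have := nonpos_of_subsolution_ball (a := a) (M := M) (R := R) (t₀ := 0) (t₁ := T)
      (D := fun x t => D x t - κ * ((1 + ‖x‖ ^ 2) * Real.exp (K * t))) ha
      (Continuous.continuousOn (hc.sub (by fun_prop)))
      (fun y _ => sub_nonpos.2 ((h0 y).trans (by positivity)))
      (fun y hy s hs => ?_) (fun y _ s hs hpos => ?_) hR1 ht
    · exact sub_nonpos.1 this
    · refine sub_nonpos.2 ((hB y s hs).trans ?_)
      have h1 : |B| ≤ κ * R := by rw [div_le_iff₀ hκ] at hR2; linarith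
      have h2 : (1 : ℝ) ≤ Real.exp (K * s) := Real.one_le_exp (mul_nonneg hK0 hs.1)
      rw [hy]
      have h3 : R ≤ (1 + R ^ 2) * Real.exp (K * s) := by nlinarith
      nlinarith [le_abs_self B, mul_le_mul_of_nonneg_left h3 hκ.le]
    · have hDp : 0 < D y s := hpos.trans_le (sub_le_self _ (by positivity))
      obtain ⟨c, h1, h2, h3⟩ := hD y s hs hDp
      have hcd : ContDiff ℝ 2 fun z : Eu d => κ * ((1 + ‖z‖ ^ 2) * Real.exp (K * s)) :=
        contDiff_const.mul ((contDiff_infty.1 contDiff_one_add_norm_sq 2).mul contDiff_const)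
      have hl : lap (fun z : Eu d => κ * ((1 + ‖z‖ ^ 2) * Real.exp (K * s))) y =
          2 * d * (κ * Real.exp (K * s)) := by
        have := lap_radial (x := y) (ϕ := fun r => κ * ((1 + r) * Real.exp (K * s)))
          (ϕ₁ := fun _ => κ * Real.exp (K * s)) (c := 0)
          (Eventually.of_forall fun r => by
            simpa using (((hasDerivAt_id r).const_add 1).mul_const (Real.exp (K * s))).const_mul κ)
          (hasDerivAt_const _ _)
        rw [this]; ring
      have he : HasDerivAt (fun r => κ * ((1 + ‖y‖ ^ 2) * Real.exp (K * r)))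
          (κ * ((1 + ‖y‖ ^ 2) * (Real.exp (K * s) * K))) s := by
        have := ((((hasDerivAt_id s).const_mul K).exp).const_mul (1 + ‖y‖ ^ 2)).const_mul κ
        simpa using this
      refine ⟨_, h1.sub he, h2.sub hcd.contDiffAt, ?_⟩
      rw [lap_sub h2 hcd.contDiffAt, hl]
      have hE : 0 < κ * Real.exp (K * s) := by positivity
      have e1 : a y * (2 * d * (κ * Real.exp (K * s))) ≤ 2 * d * a₁ * (κ * Real.exp (K * s)) := by
        have := mul_le_mul_of_nonneg_right (ha1 y)
          (show 0 ≤ 2 * d * (κ * Real.exp (K * s)) by positivity)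
        linarith
      have e2 : 2 * d * a₁ * (κ * Real.exp (K * s)) ≤
          2 * d * a₁ * (κ * Real.exp (K * s)) * (1 + ‖y‖ ^ 2) :=
        le_mul_of_one_le_right (by positivity) (by nlinarith [sq_nonneg ‖y‖])
      rw [hK]
      rw [hK] at e1 e2
      nlinarith
  have hlim : Tendsto (fun κ : ℝ => κ * ((1 + ‖x‖ ^ 2) * Real.exp (K * t))) (𝓝[>] 0) (𝓝 0) := by
    have : Tendsto (fun κ : ℝ => κ * ((1 + ‖x‖ ^ 2) * Real.exp (K * t))) (𝓝 0)
        (𝓝 (0 * ((1 + ‖x‖ ^ 2) * Real.exp (K * t)))) := (continuous_id.mul continuous_const).tendsto 0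
    rw [zero_mul] at this
    exact this.mono_left nhdsWithin_le_nhds
  exact ge_of_tendsto hlim (by filter_upwards [self_mem_nhdsWithin] with κ hκ using key κ hκ)
end

section
variable {d : ℕ} {x : Eu d} {θ b q L m a ε p t : ℝ}

/-- The profile `exp (θ (1 + |x|²) ^ b)`. -/
noncomputable def expPow (θ b : ℝ) (x : Eu d) : ℝ := Real.exp (θ * (1 + ‖x‖ ^ 2) ^ b)

theorem one_le_one_add_norm_sq (x : Eu d) : 1 ≤ 1 + ‖x‖ ^ 2 := by nlinarith [sq_nonneg ‖x‖]

theorem contDiff_expPow (θ b : ℝ) : ContDiff ℝ ∞ (expPow (d := d) θ b) :=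
  (contDiff_const.mul (contDiff_one_add_norm_sq.rpow_const_of_ne fun x =>
    (zero_lt_one.trans_le (one_le_one_add_norm_sq x)).ne')).exp

theorem lap_expPow (θ b : ℝ) (x : Eu d) :
    lap (expPow θ b) x = expPow θ b x * (2 * d * (θ * b * (1 + ‖x‖ ^ 2) ^ (b - 1)) +
      4 * ‖x‖ ^ 2 * ((θ * b * (1 + ‖x‖ ^ 2) ^ (b - 1)) ^ 2 +
        θ * b * ((b - 1) * (1 + ‖x‖ ^ 2) ^ (b - 1 - 1)))) := by
  have hr : ∀ (e : ℝ) (r : ℝ), -1 < r →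
      HasDerivAt (fun r : ℝ => (1 + r) ^ e) (e * (1 + r) ^ (e - 1)) r := fun e r hr => by
    have := ((hasDerivAt_id r).const_add 1).rpow_const (p := e)
      (Or.inl (by simp only [id]; linarith))
    simpa using this
  have h1 : ∀ r : ℝ, -1 < r → HasDerivAt (fun r : ℝ => Real.exp (θ * (1 + r) ^ b))
      (Real.exp (θ * (1 + r) ^ b) * (θ * b * (1 + r) ^ (b - 1))) r := fun r h =>
    ((hr b r h).const_mul θ).exp.congr_deriv (by ring)
  have hx : -1 < ‖x‖ ^ 2 := by nlinarith [sq_nonneg ‖x‖]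
  have h2 := (h1 _ hx).mul ((hr (b - 1) _ hx).const_mul (θ * b))
  refine (lap_radial (x := x) (ϕ := fun r : ℝ => Real.exp (θ * (1 + r) ^ b))
    (ϕ₁ := fun r => Real.exp (θ * (1 + r) ^ b) * (θ * b * (1 + r) ^ (b - 1)))
    (by filter_upwards [lt_mem_nhds hx] with r h using h1 r h) h2).trans ?_
  unfold expPow
  ring

theorem le_lap_expPow (hθ : 0 ≤ θ) (hb : 0 ≤ b) (hx : 2 ≤ 1 + ‖x‖ ^ 2) :
    expPow θ b x * (2 * (θ * b) ^ 2 * (1 + ‖x‖ ^ 2) ^ (2 * b - 1) -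
      4 * (θ * b) * (1 + ‖x‖ ^ 2) ^ (b - 1)) ≤ lap (expPow θ b) x := by
  rw [lap_expPow]
  refine mul_le_mul_of_nonneg_left ?_ (Real.exp_nonneg _)
  obtain ⟨s, hs⟩ : ∃ s, s = 1 + ‖x‖ ^ 2 := ⟨_, rfl⟩
  have hr : ‖x‖ ^ 2 = s - 1 := by rw [hs]; ring
  rw [← hs] at hx ⊢
  rw [hr]
  have hs0 : 0 < s := by linarith
  have e1 : s ^ (2 * b - 1) = s * (s ^ (b - 1)) ^ 2 := by
    rw [← Real.rpow_natCast, ← Real.rpow_mul hs0.le]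
    nth_rewrite 2 [← Real.rpow_one s]
    rw [← Real.rpow_add hs0]
    congr 1; push_cast; ring
  have e2 : s ^ (b - 1) = s * s ^ (b - 1 - 1) := by
    nth_rewrite 2 [← Real.rpow_one s]
    rw [← Real.rpow_add hs0]
    congr 1; ring
  rw [e1]
  have h3 : 0 ≤ s ^ (b - 1 - 1) := Real.rpow_nonneg hs0.le _
  have h4 : 0 ≤ s ^ (b - 1) := Real.rpow_nonneg hs0.le _
  have hc : 0 ≤ θ * b := mul_nonneg hθ hb
  have i1 : 0 ≤ 2 * d * (θ * b * s ^ (b - 1)) := by positivity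
  have i2 : 2 * (θ * b) ^ 2 * (s * (s ^ (b - 1)) ^ 2) ≤
      4 * (s - 1) * (θ * b * s ^ (b - 1)) ^ 2 := by
    nlinarith [mul_nonneg (sub_nonneg.2 hx) (sq_nonneg (θ * b * s ^ (b - 1)))]
  have i3 : -(4 * (θ * b) * s ^ (b - 1)) ≤
      4 * (s - 1) * (θ * b * ((b - 1) * s ^ (b - 1 - 1))) := by
    rw [e2]
    have : 0 ≤ (θ * b) * s ^ (b - 1 - 1) * (s + (s - 1) * (b - 1)) :=
      mul_nonneg (mul_nonneg hc h3) (by nlinarith)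
    nlinarith
  nlinarith

theorem eventually_mul_rpow_le {K c e h : ℝ} (hc : 0 < c) (he : e < h) :
    ∀ᶠ s : ℝ in atTop, K * s ^ e ≤ c * s ^ h := by
  have ht : Tendsto (fun s : ℝ => K * s ^ (-(h - e))) atTop (𝓝 (K * 0)) :=
    (tendsto_rpow_neg_atTop (sub_pos.2 he)).const_mul K
  rw [mul_zero] at ht
  filter_upwards [ht.eventually (gt_mem_nhds hc), eventually_gt_atTop 0] with s hs h0
  have : s ^ e = s ^ (-(h - e)) * s ^ h := by rw [← Real.rpow_add h0]; congr 1; ring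
  rw [this, ← mul_assoc]
  exact mul_le_mul_of_nonneg_right hs.le (Real.rpow_nonneg h0.le _)

theorem rpow_half_le {r e : ℝ} (hr : 0 ≤ r) (he : 0 ≤ e) :
    (1 + r ^ 2) ^ (e / 2) ≤ (1 + r) ^ e ∧ (1 + r) ^ e ≤ 2 ^ (e / 2) * (1 + r ^ 2) ^ (e / 2) := by
  have h : (1 + r) ^ e = ((1 + r) ^ 2) ^ (e / 2) := by
    rw [← Real.rpow_natCast, ← Real.rpow_mul (by positivity)]
    congr 1; push_cast; ring
  rw [h, ← Real.mul_rpow (by norm_num) (by positivity)]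
  exact ⟨Real.rpow_le_rpow (by positivity) (by nlinarith) (by positivity),
    Real.rpow_le_rpow (by positivity) (by nlinarith [sq_nonneg (1 - r)]) (by positivity)⟩

theorem scaled_rpow_le {r : ℝ} (hr : 0 ≤ r) (ha : 0 ≤ a) :
    (2 : ℝ) ^ (-(a / 2)) * (1 + r ^ 2) ^ (a / 2) ≤ r ^ a + 1 := by
  have h1 : (2 : ℝ) ^ (-(a / 2)) * (1 + r ^ 2) ^ (a / 2) = ((1 + r ^ 2) / 2) ^ (a / 2) := by
    rw [Real.div_rpow (by positivity) (by norm_num), Real.rpow_neg (by norm_num)]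
    field_simp
  rw [h1]
  rcases le_total 1 r with h | h
  · have : r ^ a = (r ^ 2) ^ (a / 2) := by
      rw [← Real.rpow_natCast, ← Real.rpow_mul hr]
      congr 1; push_cast; ring
    rw [this]
    have := Real.rpow_le_rpow (z := a / 2) (x := (1 + r ^ 2) / 2) (y := r ^ 2) (by positivity)
      (by nlinarith) (by positivity)
    linarith
  · have := Real.rpow_le_one (z := a / 2) (x := (1 + r ^ 2) / 2) (by positivity)
      (by nlinarith) (by positivity)
    linarith [Real.rpow_nonneg hr a]

/-- Decay rate of the time factor against a power of the profile. -/
theorem time_rate_le {s ε : ℝ} (hε : 0 < ε) (hb : 0 < b) (hs : 0 < s) (hL : 0 < L) (ht : 0 < t)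
    (hle : L * t ^ (-(2 * b / ε)) ≤ s ^ b) :
    L * (2 * b / ε * t ^ (-(2 * b / ε) - 1)) ≤
      2 * b / ε * L ^ (-(ε / (2 * b))) * s ^ (b + ε / 2) := by
  obtain ⟨Λ, hΛ⟩ : ∃ Λ, Λ = L * t ^ (-(2 * b / ε)) := ⟨_, rfl⟩
  have hΛ0 : 0 < Λ := by rw [hΛ]; positivity
  have e1 : t ^ (-(2 * b / ε) - 1) = t ^ (-(2 * b / ε)) * t ^ (-1 : ℝ) := by
    rw [← Real.rpow_add ht]; congr 1
  have e2 : t ^ (-1 : ℝ) = L ^ (-(ε / (2 * b))) * Λ ^ (ε / (2 * b)) := by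
    rw [hΛ, Real.mul_rpow hL.le (by positivity), ← mul_assoc, ← Real.rpow_add hL,
      ← Real.rpow_mul ht.le]
    have : -(2 * b / ε) * (ε / (2 * b)) = -1 := by field_simp
    rw [this]; simp
  have e3 : s ^ (b + ε / 2) = s ^ b * (s ^ b) ^ (ε / (2 * b)) := by
    rw [← Real.rpow_mul hs.le, ← Real.rpow_add hs]
    congr 1; field_simp
  rw [← hΛ] at hle
  have h2 : Λ ^ (ε / (2 * b)) ≤ (s ^ b) ^ (ε / (2 * b)) :=
    Real.rpow_le_rpow hΛ0.le hle (by positivity)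
  have h3 : Λ * Λ ^ (ε / (2 * b)) ≤ s ^ b * (s ^ b) ^ (ε / (2 * b)) :=
    mul_le_mul hle h2 (by positivity) (by positivity)
  rw [e1, e2, e3]
  calc L * (2 * b / ε * (t ^ (-(2 * b / ε)) * (L ^ (-(ε / (2 * b))) * Λ ^ (ε / (2 * b)))))
      = 2 * b / ε * L ^ (-(ε / (2 * b))) * (Λ * Λ ^ (ε / (2 * b))) := by
        linear_combination
          (-(2 * b / ε * L ^ (-(ε / (2 * b))) * Λ ^ (ε / (2 * b)))) * hΛ
    _ ≤ _ := mul_le_mul_of_nonneg_left h3 (by positivity)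
end

section
variable {d : ℕ} {A α β : Eu d → ℝ} {m p C₀ C ε δ : ℝ}

theorem exists_growth_threshold (c K₁ K₂ K₃ : ℝ) {e₁ e₂ h : ℝ} (hc : 0 < c) (h1 : e₁ < h)
    (h2 : e₂ < h) (h0 : 0 < h) :
    ∃ S : ℝ, 2 ≤ S ∧ ∀ s, S ≤ s → K₁ * s ^ e₁ + K₂ * s ^ e₂ + K₃ ≤ c * s ^ h := by
  have hc3 : 0 < c / 3 := by positivity
  obtain ⟨S, hS⟩ := eventually_atTop.1 ((eventually_mul_rpow_le (K := K₁) hc3 h1).and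
    ((eventually_mul_rpow_le (K := K₂) hc3 h2).and (eventually_mul_rpow_le (K := K₃) hc3 h0)))
  refine ⟨max S 2, le_max_right _ _, fun s hs => ?_⟩
  obtain ⟨i1, i2, i3⟩ := hS s ((le_max_left _ _).trans hs)
  rw [Real.rpow_zero] at i3
  linarith

theorem exists_time_constant (c K : ℝ) {e : ℝ} (hc : 0 < c) (he : 0 < e) (B : ℝ) :
    ∃ L : ℝ, 1 ≤ L ∧ B ≤ L ∧ K * L ^ (-e) ≤ c := by
  have ht : Tendsto (fun s : ℝ => K * s ^ (-e)) atTop (𝓝 (K * 0)) :=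
    (tendsto_rpow_neg_atTop he).const_mul K
  rw [mul_zero] at ht
  obtain ⟨L, h⟩ := ((ht.eventually (gt_mem_nhds hc)).and
    ((eventually_ge_atTop 1).and (eventually_ge_atTop B))).exists
  exact ⟨L, h.2.1, h.2.2, h.1.le⟩

theorem absorption_le {α₀ Z p B : ℝ} (hp1 : 1 < p) (hp2 : p ≤ 2) (hα : 0 ≤ α₀) (hZ : 1 < Z)
    (hB : α₀ * Z ≤ B) : α₀ * (Z - 1) ^ p ≤ Z * B := by
  have h1 : (Z - 1) ^ p ≤ Z ^ (2 : ℝ) :=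
    (Real.rpow_le_rpow (by linarith) (by linarith) (by linarith)).trans
      (Real.rpow_le_rpow_of_exponent_le hZ.le hp2)
  rw [Real.rpow_two] at h1
  calc α₀ * (Z - 1) ^ p ≤ α₀ * Z ^ 2 := mul_le_mul_of_nonneg_left h1 hα
    _ = Z * (α₀ * Z) := by ring
    _ ≤ _ := mul_le_mul_of_nonneg_left hB (by linarith)

theorem exists_norm_eq_of_one_le (hd : 1 ≤ d) {R : ℝ} (hR : 0 ≤ R) : ∃ x : Eu d, ‖x‖ = R :=
  ⟨EuclideanSpace.single ⟨0, hd⟩ R, by simp [abs_of_nonneg hR]⟩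

/-- A separated exponential is a subsolution wherever it exceeds `1`, with vanishing trace at
time `0`. -/
theorem exists_subsolution (hd : 1 ≤ d) (hp1 : 1 < p) (hp2 : p ≤ 2) (hm0 : 0 ≤ m) (hm2 : m ≤ 2)
    (hC₀ : 0 < C₀) (hA : ∀ x, C₀⁻¹ * (1 + ‖x‖) ^ m ≤ A x ∧ A x ≤ C₀ * (1 + ‖x‖) ^ m)
    (hα0 : ∀ x, 0 < α x) (hC : 0 < C) (hε : 0 < ε) (hδ0 : 0 ≤ δ) (hδ : δ < ε)
    (hα : ∀ x, α x ≤ C * Real.exp (-(‖x‖ ^ (2 - m + ε))))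
    (hβ : ∀ x, -C * (1 + ‖x‖) ^ (2 - m + 2 * δ) ≤ β x) :
    ∃ (P : Eu d → ℝ) (E E' : ℝ → ℝ), ContDiff ℝ ∞ P ∧ (∀ x, 0 < P x) ∧
      (∀ t, 0 < t → 0 < E t ∧ HasDerivAt E (E' t) t) ∧ ContinuousOn E' (Ioi 0) ∧
      Tendsto E (𝓝[>] 0) (𝓝 0) ∧ (∃ x, 1 < P x * E 1) ∧
      ∀ x t, 0 < t → t ≤ 1 → 1 < P x * E t →
        P x * E' t ≤ A x * (E t * lap P x) + β x * (P x * E t - 1) -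
          α x * (P x * E t - 1) ^ p := by
  obtain ⟨b, hb⟩ : ∃ b, b = (2 - m + ε) / 2 := ⟨_, rfl⟩
  have hb0 : 0 < b := by rw [hb]; linarith
  obtain ⟨θ, hθ⟩ : ∃ θ : ℝ, θ = 2 ^ (-b) := ⟨_, rfl⟩
  have hθ0 : 0 < θ := by rw [hθ]; positivity
  have hθ1 : θ ≤ 1 := by
    rw [hθ]; exact Real.rpow_le_one_of_one_le_of_nonpos (by norm_num) (by linarith)
  obtain ⟨c, hc⟩ : ∃ c, c = C₀⁻¹ * (2 * (θ * b) ^ 2) := ⟨_, rfl⟩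
  have hc0 : 0 < c := by rw [hc]; positivity
  obtain ⟨K₁, hK₁⟩ : ∃ K₁ : ℝ, K₁ = C₀ * 2 ^ (m / 2) * (4 * (θ * b)) := ⟨_, rfl⟩
  obtain ⟨K₂, hK₂⟩ : ∃ K₂ : ℝ, K₂ = C * 2 ^ ((2 - m + 2 * δ) / 2) := ⟨_, rfl⟩
  obtain ⟨S, hS2, hS⟩ := exists_growth_threshold (c / 2) K₁ K₂ (C * Real.exp 1)
    (e₁ := ε / 2) (e₂ := (2 - m + 2 * δ) / 2) (h := b + ε / 2) (by positivity) (by linarith)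
    (by linarith) (by linarith)
  obtain ⟨L, hL1, hLS, hLc⟩ := exists_time_constant (c / 2) (2 * b / ε) (e := ε / (2 * b))
    (by positivity) (by positivity) (S ^ b)
  have hL0 : 0 < L := by linarith
  have hE : ∀ t, 0 < t → HasDerivAt (fun t : ℝ => Real.exp (-(L * t ^ (-(2 * b / ε)))))
      (Real.exp (-(L * t ^ (-(2 * b / ε)))) * (L * (2 * b / ε * t ^ (-(2 * b / ε) - 1)))) t :=
    fun t ht => by
      have := (((Real.hasDerivAt_rpow_const (p := -(2 * b / ε)) (Or.inl ht.ne')).const_mul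
        L).neg).exp
      exact this.congr_deriv (by simp only [Pi.neg_apply]; ring)
  refine ⟨expPow θ b, fun t => Real.exp (-(L * t ^ (-(2 * b / ε)))), fun t =>
    Real.exp (-(L * t ^ (-(2 * b / ε)))) * (L * (2 * b / ε * t ^ (-(2 * b / ε) - 1))),
    contDiff_expPow θ b, fun x => Real.exp_pos _, fun t ht => ⟨Real.exp_pos _, hE t ht⟩,
    ?_, ?_, ?_, ?_⟩
  · have hr : ∀ e : ℝ, ContinuousOn (fun t : ℝ => t ^ e) (Ioi 0) := fun e =>
      continuousOn_id.rpow_const fun t ht => Or.inl (ne_of_gt ht)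
    have h1 := hr (-(2 * b / ε))
    have h2 := hr (-(2 * b / ε) - 1)
    fun_prop
  · refine Real.tendsto_exp_atBot.comp (tendsto_neg_atTop_atBot.comp ?_)
    exact (tendsto_rpow_neg_nhdsGT_zero (by rw [neg_lt_zero]; positivity)).const_mul_atTop hL0
  · have ht : Tendsto (fun r : ℝ => θ * (1 + r ^ 2) ^ b) atTop atTop :=
      ((tendsto_rpow_atTop hb0).comp (tendsto_atTop_add_const_left _ _
        (tendsto_pow_atTop (by norm_num)))).const_mul_atTop hθ0
    obtain ⟨r, hr1, hr0⟩ := ((ht.eventually (eventually_gt_atTop L)).and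
      (eventually_ge_atTop 0)).exists
    obtain ⟨x, hx⟩ := exists_norm_eq_of_one_le hd hr0
    refine ⟨x, ?_⟩
    rw [expPow, ← Real.exp_add, hx]
    refine Real.one_lt_exp_iff.2 ?_
    rw [Real.one_rpow]
    linarith
  · intro x t ht ht1 hZ
    obtain ⟨s, hs⟩ : ∃ s, s = 1 + ‖x‖ ^ 2 := ⟨_, rfl⟩
    have hs1 : 1 ≤ s := by rw [hs]; exact one_le_one_add_norm_sq x
    have hs0 : 0 < s := by linarith
    have hdom : L * t ^ (-(2 * b / ε)) < θ * s ^ b := by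
      rw [expPow, ← Real.exp_add, Real.one_lt_exp_iff, ← hs] at hZ
      linarith
    have hθs : θ * s ^ b ≤ s ^ b := mul_le_of_le_one_left (by positivity) hθ1
    have hLt : L ≤ L * t ^ (-(2 * b / ε)) := le_mul_of_one_le_right hL0.le
      (Real.one_le_rpow_of_pos_of_le_one_of_nonpos ht ht1 (by
        rw [Left.neg_nonpos_iff]; positivity))
    have hSs : S ≤ s := by
      refine (Real.rpow_le_rpow_iff (by linarith) hs0.le hb0).1 ?_
      linarith
    have hrate := time_rate_le hε hb0 hs0 hL0 ht (hdom.le.trans hθs)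
    have hgrow := hS s hSs
    have hlap := le_lap_expPow (x := x) (θ := θ) (b := b) hθ0.le hb0.le (by rw [← hs]; linarith)
    rw [← hs] at hlap
    obtain ⟨Et, hEt⟩ : ∃ Et, Et = Real.exp (-(L * t ^ (-(2 * b / ε)))) := ⟨_, rfl⟩
    have hEt0 : 0 < Et := by rw [hEt]; exact Real.exp_pos _
    have hEt1 : Et ≤ 1 := by
      rw [hEt]; exact Real.exp_le_one_iff.2 (by rw [Left.neg_nonpos_iff]; positivity)
    have hP0 : 0 < expPow θ b x := Real.exp_pos _
    beta_reduce at hZ ⊢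
    rw [← hEt] at hZ ⊢
    obtain ⟨Z, hZd⟩ : ∃ Z, Z = expPow θ b x * Et := ⟨_, rfl⟩
    rw [← hZd] at hZ ⊢
    have hZ0 : 0 < Z := by linarith
    have hαZ : α x * Z ≤ C * Real.exp 1 := by
      have h1 : α x * Z ≤ C * Real.exp (-(‖x‖ ^ (2 - m + ε))) * expPow θ b x :=
        mul_le_mul (hα x) (by rw [hZd]; exact mul_le_of_le_one_right hP0.le hEt1) hZ0.le
          (by positivity)
      refine h1.trans ?_
      rw [expPow, mul_assoc, ← Real.exp_add]
      refine mul_le_mul_of_nonneg_left (Real.exp_le_exp.2 ?_) hC.le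
      have := scaled_rpow_le (a := 2 - m + ε) (norm_nonneg x) (by linarith)
      rw [← hb, ← hθ] at this
      linarith
    have habs := absorption_le hp1 hp2 (hα0 x).le hZ hαZ
    have hβZ : -(Z * (K₂ * s ^ ((2 - m + 2 * δ) / 2))) ≤ β x * (Z - 1) := by
      have h1 := (rpow_half_le (norm_nonneg x) (e := 2 - m + 2 * δ) (by linarith)).2
      rw [← hs] at h1
      have h2 : -(K₂ * s ^ ((2 - m + 2 * δ) / 2)) ≤ β x := by
        refine le_trans ?_ (hβ x)
        rw [hK₂]
        have := mul_le_mul_of_nonneg_left h1 hC.le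
        linarith
      have h3 : 0 ≤ K₂ * s ^ ((2 - m + 2 * δ) / 2) := by rw [hK₂]; positivity
      nlinarith
    have hA1 : Z * (c * s ^ (b + ε / 2) - K₁ * s ^ (ε / 2)) ≤
        A x * (Et * lap (expPow θ b) x) := by
      have hm := rpow_half_le (norm_nonneg x) hm0
      rw [← hs] at hm
      have hAlo : C₀⁻¹ * s ^ (m / 2) ≤ A x :=
        (mul_le_mul_of_nonneg_left hm.1 (by positivity)).trans (hA x).1
      have hAhi : A x ≤ C₀ * 2 ^ (m / 2) * s ^ (m / 2) := by
        have := mul_le_mul_of_nonneg_left hm.2 hC₀.le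
        linarith [(hA x).2]
      have hA0 : 0 ≤ A x := le_trans (by positivity) hAlo
      have e1 : s ^ (b + ε / 2) = s ^ (m / 2) * s ^ (2 * b - 1) := by
        rw [← Real.rpow_add hs0]; congr 1; rw [hb]; ring
      have e2 : s ^ (ε / 2) = s ^ (m / 2) * s ^ (b - 1) := by
        rw [← Real.rpow_add hs0]; congr 1; rw [hb]; ring
      have i1 : c * s ^ (b + ε / 2) ≤ A x * (2 * (θ * b) ^ 2 * s ^ (2 * b - 1)) := by
        rw [e1, hc]
        have := mul_le_mul_of_nonneg_right hAlo
          (show 0 ≤ 2 * (θ * b) ^ 2 * s ^ (2 * b - 1) by positivity)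
        linarith
      have i2 : A x * (4 * (θ * b) * s ^ (b - 1)) ≤ K₁ * s ^ (ε / 2) := by
        rw [e2, hK₁]
        have := mul_le_mul_of_nonneg_right hAhi
          (show 0 ≤ 4 * (θ * b) * s ^ (b - 1) by positivity)
        linarith
      have i3 := mul_le_mul_of_nonneg_left hlap (mul_nonneg hA0 hEt0.le)
      have i4 := mul_le_mul_of_nonneg_left (sub_le_sub i1 i2) hZ0.le
      refine i4.trans ?_
      rw [hZd]
      linarith
    have hE1 : expPow θ b x * (Et * (L * (2 * b / ε * t ^ (-(2 * b / ε) - 1)))) ≤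
        Z * (c / 2 * s ^ (b + ε / 2)) := by
      rw [← mul_assoc, ← hZd]
      refine mul_le_mul_of_nonneg_left (hrate.trans ?_) hZ0.le
      exact mul_le_mul_of_nonneg_right hLc (by positivity)
    have hfin := mul_le_mul_of_nonneg_left hgrow hZ0.le
    linarith
end

section
variable {d : ℕ} {A α : Eu d → ℝ} {p R M : ℝ}

/-- The blow-up profile `κ (R² - |x|²) ^ (-q)`. -/
noncomputable def blowup (R κ q : ℝ) (x : Eu d) : ℝ := κ * (R ^ 2 - ‖x‖ ^ 2) ^ (-q)

theorem lap_blowup (R κ q : ℝ) {x : Eu d} (hx : ‖x‖ ^ 2 < R ^ 2) :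
    lap (blowup R κ q) x = κ * (2 * d * (q * (R ^ 2 - ‖x‖ ^ 2) ^ (-q - 1)) +
      4 * ‖x‖ ^ 2 * (q * ((q + 1) * (R ^ 2 - ‖x‖ ^ 2) ^ (-q - 1 - 1)))) := by
  have hr : ∀ (e : ℝ) (r : ℝ), r < R ^ 2 →
      HasDerivAt (fun r : ℝ => (R ^ 2 - r) ^ e) (-e * (R ^ 2 - r) ^ (e - 1)) r := fun e r hr => by
    have := ((hasDerivAt_id r).const_sub (R ^ 2)).rpow_const (p := e)
      (Or.inl (by simp only [id]; linarith))
    simpa using this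
  refine (lap_radial (x := x) (ϕ := fun r : ℝ => κ * (R ^ 2 - r) ^ (-q))
    (ϕ₁ := fun r => κ * q * (R ^ 2 - r) ^ (-q - 1))
    (c := κ * q * ((q + 1) * (R ^ 2 - ‖x‖ ^ 2) ^ (-q - 1 - 1))) ?_ ?_).trans (by ring)
  · filter_upwards [gt_mem_nhds hx] with r h
    exact ((hr (-q) r h).const_mul κ).congr_deriv (by ring)
  · exact ((hr (-q - 1) _ hx).const_mul (κ * q)).congr_deriv (by ring)

theorem contDiffAt_blowup (R κ q : ℝ) {x : Eu d} (hx : ‖x‖ ^ 2 < R ^ 2) :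
    ContDiffAt ℝ 2 (blowup R κ q) x :=
  contDiffAt_const.mul ((contDiffAt_const.sub (contDiff_norm_sq ℝ).contDiffAt).rpow_const_of_ne
    (sub_pos.2 hx).ne')

theorem le_blowup_near_sphere {κ q : ℝ} (hR : 0 < R) (hκ : 0 < κ) (hq : 0 < q) (N : ℝ) :
    ∃ R', 0 ≤ R' ∧ R' < R ∧ ∀ x : Eu d, R' ≤ ‖x‖ → ‖x‖ < R → N ≤ blowup R κ q x := by
  have ht : Tendsto (fun z : ℝ => κ * z ^ (-q)) (𝓝[>] 0) atTop :=
    (tendsto_rpow_neg_nhdsGT_zero (by linarith)).const_mul_atTop hκ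
  obtain ⟨η, hη, h⟩ := mem_nhdsGT_iff_exists_Ioo_subset.1 (ht.eventually (eventually_ge_atTop N))
  have hη0 : 0 < η := hη
  refine ⟨max 0 (R - η / (4 * R)), le_max_left _ _, max_lt hR (by
    have : 0 < η / (4 * R) := by positivity
    linarith), fun x h1 h2 => h ⟨?_, ?_⟩⟩
  · nlinarith [norm_nonneg x]
  · have h3 : R - ‖x‖ ≤ η / (4 * R) := by linarith [le_max_right 0 (R - η / (4 * R))]
    rw [le_div_iff₀ (by positivity)] at h3
    nlinarith [norm_nonneg x]

theorem exists_blowup_supersolution (hp : 1 < p) (hA : Continuous A) (hA0 : ∀ x, 0 ≤ A x)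
    (hα : Continuous α) (hα0 : ∀ x, 0 < α x) (hR : 0 < R) (hM : 0 ≤ M) :
    ∃ κ q, 0 < κ ∧ 0 < q ∧ ∀ x : Eu d, ‖x‖ < R →
      A x * lap (blowup R κ q) x + M * blowup R κ q x ≤ α x * blowup R κ q x ^ p := by
  have hK := isCompact_closedBall (0 : Eu d) R
  have hne : (Metric.closedBall (0 : Eu d) R).Nonempty := ⟨0, by simpa using hR.le⟩
  obtain ⟨y, -, hy⟩ := hK.exists_isMaxOn hne hA.continuousOn
  obtain ⟨z, -, hz⟩ := hK.exists_isMinOn hne hα.continuousOn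
  obtain ⟨q, hq⟩ : ∃ q, q = 2 / (p - 1) := ⟨_, rfl⟩
  have hp0 : 0 < p - 1 := by linarith
  have hq0 : 0 < q := by rw [hq]; positivity
  have hqp : -q * p = -q - 2 := by rw [hq]; field_simp; ring
  obtain ⟨B, hB⟩ : ∃ B, B = A y * (2 * d * q * R ^ 2 + 4 * R ^ 2 * (q * (q + 1))) + M * R ^ 4 :=
    ⟨_, rfl⟩
  obtain ⟨κ, hκB, hκ⟩ := ((((tendsto_rpow_atTop hp0).const_mul_atTop (hα0 z)).eventually
    (eventually_ge_atTop B)).and (eventually_gt_atTop 0)).exists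
  refine ⟨κ, q, hκ, hq0, fun x hx => ?_⟩
  have hxm : x ∈ Metric.closedBall (0 : Eu d) R := by simpa using hx.le
  have hx2 : ‖x‖ ^ 2 < R ^ 2 := by nlinarith [norm_nonneg x]
  rw [lap_blowup R κ q hx2, blowup]
  obtain ⟨ζ, hζ⟩ : ∃ ζ, ζ = R ^ 2 - ‖x‖ ^ 2 := ⟨_, rfl⟩
  have hζ0 : 0 < ζ := by linarith
  have hζR : ζ ≤ R ^ 2 := by nlinarith [sq_nonneg ‖x‖]
  rw [← hζ, Real.mul_rpow hκ.le (by positivity), ← Real.rpow_mul hζ0.le, hqp]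
  have e0 : -q - 1 - 1 = -q - 2 := by ring
  obtain ⟨W, hW⟩ : ∃ W, W = ζ ^ (-q - 2) := ⟨_, rfl⟩
  have hW0 : 0 < W := by rw [hW]; positivity
  have e1 : ζ ^ (-q - 1) = ζ * W := by
    rw [hW]; nth_rewrite 2 [← Real.rpow_one ζ]; rw [← Real.rpow_add hζ0]; congr 1; ring
  have e2 : ζ ^ (-q) = ζ ^ 2 * W := by
    rw [hW, ← Real.rpow_two, ← Real.rpow_add hζ0]; congr 1; ring
  have e3 : κ ^ p = κ * κ ^ (p - 1) := by
    nth_rewrite 2 [← Real.rpow_one κ]; rw [← Real.rpow_add hκ]; congr 1; ring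
  rw [e0, ← hW, e1, e2, e3]
  have hAy : A x ≤ A y := hy hxm
  have hAy0 := hA0 y
  have hαz : α z ≤ α x := hz hxm
  have hd0 : (0 : ℝ) ≤ d := Nat.cast_nonneg d
  have i1 : 2 * d * (q * (ζ * W)) + 4 * ‖x‖ ^ 2 * (q * ((q + 1) * W)) ≤
      (2 * d * q * R ^ 2 + 4 * R ^ 2 * (q * (q + 1))) * W := by
    have j1 := mul_le_mul_of_nonneg_left hζR (show 0 ≤ 2 * d * q * W by positivity)
    have j2 := mul_le_mul_of_nonneg_left hx2.le (show 0 ≤ 4 * q * (q + 1) * W by positivity)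
    linarith
  have i2 : ζ ^ 2 ≤ R ^ 4 := by
    have := pow_le_pow_left₀ hζ0.le hζR 2
    calc ζ ^ 2 ≤ (R ^ 2) ^ 2 := this
      _ = _ := by ring
  have i3 := mul_le_mul hAy i1 (by positivity) hAy0
  have i4 := mul_le_mul_of_nonneg_left i2 (mul_nonneg hM hW0.le)
  have i5 : B ≤ α x * κ ^ (p - 1) :=
    hκB.trans (mul_le_mul_of_nonneg_right hαz (by positivity))
  have i6 := mul_le_mul_of_nonneg_right i5 (mul_pos hκ hW0).le
  have i7 := mul_le_mul_of_nonneg_left (add_le_add i3 i4) hκ.le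
  rw [hB] at i6
  linarith

/-- Local upper bound for subsolutions of the absorption equation, independent of their size. -/
theorem exists_local_bound (hp : 1 < p) (hA : Continuous A) (hA0 : ∀ x, 0 ≤ A x)
    (hα : Continuous α) (hα0 : ∀ x, 0 < α x) (hR : 0 < R) (hM : 0 ≤ M) :
    ∃ B : ℝ, ∀ (u : Eu d → ℝ → ℝ) (T N : ℝ), (Continuous fun q : Eu d × ℝ => u q.1 q.2) →
      (∀ x, u x 0 ≤ 0) → (∀ x, ∀ t ∈ Icc 0 T, u x t ≤ N) →
      (∀ x, ‖x‖ < R → ∀ t ∈ Ioc 0 T, 0 < u x t → ∃ c, HasDerivAt (u x) c t ∧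
        ContDiffAt ℝ 2 (fun y => u y t) x ∧
        c ≤ A x * lap (fun y => u y t) x + M * u x t - α x * u x t ^ p) →
      ∀ x, ‖x‖ ≤ R / 2 → ∀ t ∈ Icc 0 T, u x t ≤ B := by
  obtain ⟨κ, q, hκ, hq, hw⟩ := exists_blowup_supersolution hp hA hA0 hα hα0 hR hM
  refine ⟨κ * (3 / 4 * R ^ 2) ^ (-q), fun u T N hu h0 hN hD x hx t ht => ?_⟩
  obtain ⟨R₁, hR10, hR1, hRN⟩ := le_blowup_near_sphere (d := d) hR hκ hq N
  obtain ⟨R', hR', h1, h2⟩ : ∃ R', R' < R ∧ R₁ ≤ R' ∧ R / 2 ≤ R' :=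
    ⟨max R₁ (R / 2), max_lt hR1 (by linarith), le_max_left _ _, le_max_right _ _⟩
  have hsq : ∀ y : Eu d, ‖y‖ ≤ R' → ‖y‖ ^ 2 < R ^ 2 := fun y hy => by
    nlinarith [norm_nonneg y]
  have hpos : ∀ y : Eu d, ‖y‖ ≤ R' → 0 < blowup R κ q y := fun y hy => by
    have := sub_pos.2 (hsq y hy)
    unfold blowup; positivity
  have hcmp := nonpos_of_subsolution_ball (a := A) (M := M) (R := R') (t₀ := 0) (t₁ := T)
    (D := fun x t => u x t - blowup R κ q x) hA0
    (hu.continuousOn.sub fun y hy => ?_)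
    (fun y hy => by
      have := hpos y (by simpa using hy)
      linarith [h0 y])
    (fun y hy s hs => sub_nonpos.2 ((hN y s hs).trans (hRN y (by linarith) (by linarith))))
    (fun y hy s hs hys => ?_) (hx.trans h2) ht
  · refine (sub_nonpos.1 hcmp).trans ?_
    refine mul_le_mul_of_nonneg_left ?_ hκ.le
    exact Real.rpow_le_rpow_of_nonpos (by positivity) (by nlinarith [norm_nonneg x])
      (by linarith)
  · have hyR : ‖y.1‖ ≤ R' := by simpa using hy.1
    exact ((contDiffAt_blowup R κ q (hsq _ hyR)).continuousAt.comp
      continuousAt_fst).continuousWithinAt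
  · have hw0 := hpos y hy.le
    obtain ⟨c, e1, e2, e3⟩ := hD y (hy.trans hR') s hs (by linarith)
    have e4 := contDiffAt_blowup R κ q (hsq y hy.le)
    refine ⟨c, e1.sub_const _, e2.sub e4, ?_⟩
    rw [lap_sub e2 e4]
    have e5 := hw y (hy.trans hR')
    have e6 : blowup R κ q y ^ p ≤ u y s ^ p :=
      Real.rpow_le_rpow hw0.le (by linarith) (by linarith)
    have e7 := mul_le_mul_of_nonneg_left e6 (hα0 y).le
    linarith
end

section
variable {d : ℕ} {A α β : Eu d → ℝ}

theorem LocHolder.exists_global_of_hasCompactSupport {f : Eu d → ℝ} (hf : LocHolder f)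
    (hfs : HasCompactSupport f) :
    ∃ κ C : ℝ, 0 < κ ∧ κ ≤ 1 ∧ 0 ≤ C ∧ ∀ x y, |f y - f x| ≤ C * ‖x - y‖ ^ κ := by
  obtain ⟨κ, C, h1, h2, h3, h⟩ := hf.exists_global hf hfs hfs hfs
  refine ⟨κ, C, h1, h2, h3, fun x y => ?_⟩
  by_cases hx : x ∈ tsupport f
  · exact (h x hx y).1
  by_cases hy : y ∈ tsupport f
  · rw [abs_sub_comm, norm_sub_rev]
    exact (h y hy x).1
  · rw [image_eq_zero_of_notMem_tsupport hx, image_eq_zero_of_notMem_tsupport hy]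
    simp only [sub_zero, abs_zero]
    positivity

/-- A positive locally Hölder coefficient, modified outside a ball to be uniformly elliptic and
globally Hölder. -/
theorem exists_cutoff_coeff (hA : LocHolder A) (hpos : ∀ x, 0 < A x) (S : ℝ) :
    ∃ (A' : Eu d → ℝ) (a₀ a₁ κ H : ℝ), 0 < a₀ ∧ (∀ x, a₀ ≤ A' x) ∧ (∀ x, A' x ≤ a₁) ∧ 0 < κ ∧
      κ ≤ 1 ∧ 0 ≤ H ∧ (∀ x y, |A' y - A' x| ≤ H * ‖x - y‖ ^ κ) ∧ LocHolder A' ∧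
      ∀ x ∈ Metric.closedBall 0 S, A' x = A x := by
  obtain ⟨χ, hχ, hχs, hχ01, hχ1, -⟩ := exists_cutoff d S
  have hf : LocHolder fun x => χ x * (A x - 1) :=
    (hχ.of_le (by simp)).locHolder.mul (hA.sub (locHolder_const 1))
  have hfs : HasCompactSupport fun x => χ x * (A x - 1) := hχs.mul_right
  have hA' : LocHolder fun x => 1 + χ x * (A x - 1) := (locHolder_const 1).add hf
  have hA'0 : ∀ x, 0 < 1 + χ x * (A x - 1) := fun x => by
    have h1 := hχ01 x
    have h2 := mul_nonneg h1.1 (hpos x).le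
    rcases h1.2.lt_or_eq with h | h
    · nlinarith
    · rw [h]; linarith [hpos x]
  obtain ⟨κ, H, h1, h2, h3, h4⟩ := hf.exists_global_of_hasCompactSupport hfs
  obtain ⟨C, hC⟩ := hf.continuous.bounded_above_of_compact_support hfs
  have hi : HasCompactSupport fun x => (1 + χ x * (A x - 1))⁻¹ - 1 := by
    refine hfs.comp_left (g := fun r : ℝ => (1 + r)⁻¹ - 1) (by simp)
  obtain ⟨C', hC'⟩ := ((hA'.inv hA'0).sub (locHolder_const 1)).continuous.bounded_above_of_compact_support hi
  have hC'0 : 0 ≤ C' := (norm_nonneg _).trans (hC' 0)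
  refine ⟨fun x => 1 + χ x * (A x - 1), (1 + C')⁻¹, 1 + C, κ, H, by positivity, fun x => ?_,
    fun x => ?_, h1, h2, h3, fun x y => ?_, hA', fun x hx => ?_⟩
  · have := (abs_le.1 (hC' x)).2
    exact inv_le_of_inv_le₀ (hA'0 x) (by linarith)
  · have := (abs_le.1 (hC x)).2
    linarith
  · have := h4 x y
    beta_reduce
    rwa [add_sub_add_left_eq_sub]
  · simp [hχ1 x hx]

theorem abs_rpow_sub_rpow_le {p N a b : ℝ} (hp : 1 ≤ p) (ha : 0 ≤ a) (haN : a ≤ N) (hb : 0 ≤ b)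
    (hbN : b ≤ N) : |a ^ p - b ^ p| ≤ p * N ^ (p - 1) * |a - b| := by
  have h := (convex_Icc (0 : ℝ) N).norm_image_sub_le_of_norm_hasDerivWithin_le
    (f := fun x : ℝ => x ^ p) (f' := fun x => p * x ^ (p - 1)) (C := p * N ^ (p - 1))
    (fun x _ => (Real.hasDerivAt_rpow_const (Or.inr hp)).hasDerivWithinAt)
    (fun x hx => ?_) ⟨hb, hbN⟩ ⟨ha, haN⟩
  · simpa [Real.norm_eq_abs] using h
  · rw [Real.norm_of_nonneg (mul_nonneg (by linarith) (Real.rpow_nonneg hx.1 _))]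
    exact mul_le_mul_of_nonneg_left (Real.rpow_le_rpow hx.1 hx.2 (by linarith)) (by linarith)

theorem lap_const (c : ℝ) (x : Eu d) : lap (fun _ => c) x = 0 := by
  have h : ∀ i : Fin d, pd i (fun _ : Eu d => c) = fun _ => 0 := fun i => by
    funext y; simp [pd]
  refine Finset.sum_eq_zero fun i _ => ?_
  rw [h]
  simp [pd]

/-- The power `a ^ p`, truncated to `0 ≤ a ≤ N`. -/
noncomputable def truncPow (p N a : ℝ) : ℝ := max 0 (min a N) ^ p

theorem abs_truncPow_sub_le {p N : ℝ} (hp : 1 ≤ p) (hN : 0 ≤ N) (a b : ℝ) :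
    |truncPow p N a - truncPow p N b| ≤ p * N ^ (p - 1) * |a - b| := by
  refine (abs_rpow_sub_rpow_le hp (le_max_left _ _) (max_le hN (min_le_right _ _))
    (le_max_left _ _) (max_le hN (min_le_right _ _))).trans
    (mul_le_mul_of_nonneg_left ?_ (by positivity))
  refine (abs_max_sub_max_le_max 0 (min a N) 0 (min b N)).trans ?_
  simp only [sub_self, abs_zero]
  refine max_le (abs_nonneg _) ((abs_min_sub_min_le_max a N b N).trans ?_)
  simp

theorem truncPow_nonneg (p N a : ℝ) : 0 ≤ truncPow p N a := Real.rpow_nonneg (le_max_left _ _) _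

theorem truncPow_of_nonpos {p N a : ℝ} (hp : 0 < p) (ha : a ≤ 0) : truncPow p N a = 0 := by
  rw [truncPow, max_eq_left ((min_le_left _ _).trans ha), Real.zero_rpow hp.ne']

theorem truncPow_of_mem {p N a : ℝ} (ha : 0 ≤ a) (haN : a ≤ N) : truncPow p N a = a ^ p := by
  rw [truncPow, min_eq_left haN, max_eq_right ha]

theorem continuous_truncPow {p N : ℝ} (hp : 0 ≤ p) : Continuous (truncPow p N) := by
  unfold truncPow
  exact Continuous.rpow_const (by fun_prop) fun _ => Or.inr hp

/-- Solutions of the absorption equation with source `f` on a ball and up to time `T`. -/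
theorem exists_approximant {p M S T N L : ℝ} (hp : 1 < p) (hA : LocHolder A)
    (hpos : ∀ x, 0 < A x)
    (hα : LocHolder α) (hα0 : ∀ x, 0 ≤ α x) (hβ : LocHolder β) (hM : 0 ≤ M)
    (hβM : ∀ x, β x ≤ M) {f : Eu d → ℝ → ℝ}
    (hf : Continuous fun q : Eu d × ℝ => f q.1 q.2) (hf0 : ∀ y s, s ≤ 0 → f y s = 0)
    (hfn : ∀ y s, 0 ≤ f y s) (hN : 0 ≤ N) (hfN : ∀ y s, f y s ≤ N) (hL : 0 ≤ L)
    (hfL : ∀ y s s', |f y s - f y s'| ≤ L * |s - s'|) (hfH : ∀ s, LocHolder fun y => f y s) :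
    ∃ (A' : Eu d → ℝ) (u g : Eu d → ℝ → ℝ) (N' : ℝ), LocHolder A' ∧ (∀ x, 0 < A' x) ∧
      (∀ x ∈ Metric.closedBall 0 S, A' x = A x) ∧ IsWeak A' u g ∧ (∀ x t, 0 ≤ u x t) ∧
      (∀ x, ∀ t ≤ T, u x t ≤ N') ∧ (∀ t, ContDiff ℝ 2 fun x => u x t) ∧
      (∀ x t, HasDerivAt (u x) (A' x * lap (fun y => u y t) x + g x t) t) ∧
      ∀ x ∈ Metric.closedBall 0 S, ∀ t ≤ T,
        g x t = f x t + (β x * u x t - α x * u x t ^ p) := by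
  obtain ⟨A', a₀, a₁, κ, H, ha0, hA0, hA1, hκ, hκ1, hH, hol, hA', hAA⟩ :=
    exists_cutoff_coeff hA hpos S
  have hA'0 : ∀ x, 0 < A' x := fun x => ha0.trans_le (hA0 x)
  obtain ⟨χ, hχ, hχs, hχ01, hχ1, -⟩ := exists_cutoff d S
  have hχH : LocHolder χ := (hχ.of_le (by simp)).locHolder
  obtain ⟨N', hN'⟩ : ∃ N', N' = N * Real.exp ((M + 1) * |T|) := ⟨_, rfl⟩
  have hN'0 : 0 ≤ N' := by rw [hN']; positivity
  have hbH : LocHolder fun x => χ x * β x := hχH.mul hβ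
  have haH : LocHolder fun x => χ x * α x := hχH.mul hα
  obtain ⟨Cb, hCb⟩ := hbH.continuous.bounded_above_of_compact_support hχs.mul_right
  obtain ⟨Ca, hCa⟩ := haH.continuous.bounded_above_of_compact_support hχs.mul_right
  have hCb0 : 0 ≤ Cb := (norm_nonneg _).trans (hCb 0)
  have hCa0 : 0 ≤ Ca := (norm_nonneg _).trans (hCa 0)
  obtain ⟨F, hF⟩ : ∃ F : Eu d → ℝ → ℝ,
      F = fun x a => χ x * β x * a - χ x * α x * truncPow p N' a := ⟨_, rfl⟩
  obtain ⟨Λ, hΛ⟩ : ∃ Λ, Λ = Cb + Ca * (p * N' ^ (p - 1)) := ⟨_, rfl⟩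
  have hΛ0 : 0 ≤ Λ := by rw [hΛ]; positivity
  have hFL : ∀ x a b, |F x a - F x b| ≤ Λ * |a - b| := fun x a b => by
    have e : F x a - F x b = χ x * β x * (a - b)
        - χ x * α x * (truncPow p N' a - truncPow p N' b) := by rw [hF]; ring
    rw [e, hΛ, add_mul]
    refine (abs_sub _ _).trans (add_le_add ?_ ?_)
    · rw [abs_mul]
      exact mul_le_mul_of_nonneg_right (hCb x) (abs_nonneg _)
    · rw [abs_mul, mul_assoc Ca]
      exact mul_le_mul (hCa x) (abs_truncPow_sub_le hp.le hN'0 a b) (abs_nonneg _) hCa0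
  have hFc : Continuous fun q : Eu d × ℝ => F q.1 q.2 := by
    rw [hF]
    exact ((hbH.continuous.comp continuous_fst).mul continuous_snd).sub
      ((haH.continuous.comp continuous_fst).mul
        ((continuous_truncPow (by linarith)).comp continuous_snd))
  obtain ⟨u, hw, B, l, hl, hu⟩ := exists_isWeak_semilinear ha0 hA0 hA1 hκ hκ1 hH hA'.continuous
    hol hΛ0 hFc (fun x => by simp [hF, truncPow_of_nonpos (show 0 < p by linarith)]) hFL hN hf
    hf0 (fun y s => by rw [abs_of_nonneg (hfn y s)]; exact hfN y s)
  have huH : ∀ t, LocHolder fun x => u x t := fun t => hw.locHolder hA' hA'0 t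
  have hgT : TimeLip u (fun x t => f x t + F x (u x t)) := fun R T => by
    refine ⟨Λ + L, by positivity, fun x _ t h _ h0 _ => ?_⟩
    have e : tdiff h (fun x t => f x t + F x (u x t)) x t
        = (f x t - f x (t - h)) + (F x (u x t) - F x (u x (t - h))) := by
      unfold tdiff; ring
    rw [e]
    have e1 := hfL x t (t - h)
    rw [sub_sub_cancel, abs_of_nonneg h0] at e1
    have e2 := hFL x (u x t) (u x (t - h))
    have e3 : (0 : ℝ) ≤ L * |tdiff h u x t| := by positivity
    have e4 : (0 : ℝ) ≤ Λ * h := by positivity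
    have := abs_add_le (f x t - f x (t - h)) (F x (u x t) - F x (u x (t - h)))
    rw [show u x t - u x (t - h) = tdiff h u x t from rfl] at e2
    nlinarith
  have hgH : ∀ t, LocHolder fun x => f x t + F x (u x t) := fun t => by
    rw [hF]
    refine (hfH t).add ((hbH.mul (huH t)).sub (haH.mul ((huH t).comp fun _ => ?_)))
    exact ⟨p * N' ^ (p - 1), fun a b _ _ => abs_truncPow_sub_le hp.le hN'0 a b⟩
  obtain ⟨w, hwc, hwd, hu2, hweq⟩ := hw.classical hA' hA'0 hgT hgH
  have hder : ∀ x t, HasDerivAt (u x)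
      (A' x * lap (fun y => u y t) x + (f x t + F x (u x t))) t := fun x t => by
    rw [← hweq]; exact hwd x t
  have hbd : ∀ x t, t ≤ |T| → |u x t| ≤ |B| * Real.exp (l * |T|) := fun x t ht =>
    (hu.bound x t).trans (mul_le_mul (le_abs_self B)
      (Real.exp_le_exp.2 (mul_le_mul_of_nonneg_left ht hl.le)) (Real.exp_pos _).le
      (abs_nonneg B))
  have hχM : ∀ x, χ x * β x ≤ M := fun x =>
    (mul_le_mul_of_nonneg_left (hβM x) (hχ01 x).1).trans (mul_le_of_le_one_left hM (hχ01 x).2)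
  have hlap : ∀ (c : ℝ) x t, lap (fun y => c - u y t) x = - lap (fun y => u y t) x :=
    fun c x t => by
      rw [lap_sub contDiffAt_const (hu2 t).contDiffAt, lap_const, zero_sub]
  have hu0 : ∀ x t, 0 ≤ u x t := fun x t => by
    rcases le_or_gt t 0 with ht | ht
    · exact (hw.u0 x t ht).ge
    have h := nonpos_of_subsolution (a := A') (a₁ := a₁) (M := M) (T := t)
      (B := |B| * Real.exp (l * t)) (D := fun x t => 0 - u x t) (fun x => (hA'0 x).le) hA1 hM
      (continuous_const.sub hw.cu) (fun x => by simp [hw.u0 x 0 le_rfl]) (fun x s hs => ?_)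
      (fun x s hs hpos => ?_) x (right_mem_Icc.2 ht.le)
    · linarith
    · have h1 := (abs_le.1 (hu.bound x s)).1
      have h2 : B * Real.exp (l * s) ≤ |B| * Real.exp (l * t) := mul_le_mul (le_abs_self B)
        (Real.exp_le_exp.2 (mul_le_mul_of_nonneg_left hs.2 hl.le)) (Real.exp_pos _).le
        (abs_nonneg B)
      linarith
    · refine ⟨_, (hder x s).const_sub 0, contDiffAt_const.sub (hu2 s).contDiffAt, ?_⟩
      rw [hlap]
      simp only [zero_sub] at hpos ⊢
      have h1 := mul_le_mul_of_nonneg_right (hχM x) hpos.le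
      have h2 : F x (u x s) = χ x * β x * u x s := by
        simp only [hF, truncPow_of_nonpos (show 0 < p by linarith) (show u x s ≤ 0 by linarith)]
        ring
      rw [h2]
      linarith [hfn x s]
  have huN : ∀ x, ∀ t ≤ T, u x t ≤ N' := fun x t ht => by
    rcases le_or_gt t 0 with ht0 | ht0
    · rw [hw.u0 x t ht0]; exact hN'0
    have hT : T = |T| := (abs_of_pos (ht0.trans_le ht)).symm
    have hexp : ∀ s, HasDerivAt (fun s => N * Real.exp ((M + 1) * s))
        (N * (Real.exp ((M + 1) * s) * (M + 1))) s := fun s => by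
      have := (((hasDerivAt_id s).const_mul (M + 1)).exp).const_mul N
      simpa using this
    have h := nonpos_of_subsolution (a := A') (a₁ := a₁) (M := M) (T := T)
      (B := |B| * Real.exp (l * |T|)) (D := fun x t => u x t - N * Real.exp ((M + 1) * t))
      (fun x => (hA'0 x).le) hA1 hM (hw.cu.sub (by fun_prop))
      (fun x => by simpa [hw.u0 x 0 le_rfl] using hN) (fun x s hs => ?_)
      (fun x s hs hpos => ?_) x ⟨ht0.le, ht⟩
    · refine (sub_nonpos.1 h).trans ?_
      rw [hN', ← hT]
      exact mul_le_mul_of_nonneg_left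
        (Real.exp_le_exp.2 (mul_le_mul_of_nonneg_left ht (by linarith))) hN
    · have h1 := (abs_le.1 (hbd x s (hs.2.trans hT.le))).2
      have h2 : 0 ≤ N * Real.exp ((M + 1) * s) := by positivity
      linarith
    · refine ⟨_, (hder x s).sub (hexp s), (hu2 s).contDiffAt.sub contDiffAt_const, ?_⟩
      rw [lap_sub (hu2 s).contDiffAt contDiffAt_const, lap_const, sub_zero]
      have h1 := mul_le_mul_of_nonneg_right (hχM x) (hu0 x s)
      have h2 : F x (u x s) ≤ χ x * β x * u x s := by
        rw [hF]
        have := mul_nonneg (mul_nonneg (hχ01 x).1 (hα0 x)) (truncPow_nonneg p N' (u x s))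
        beta_reduce; linarith
      have h3 : N ≤ N * Real.exp ((M + 1) * s) :=
        le_mul_of_one_le_right hN (Real.one_le_exp (mul_nonneg (by linarith) hs.1.le))
      linarith [hfN x s]
  refine ⟨A', u, _, N', hA', hA'0, hAA, hw, hu0, huN, hu2, hder, fun x hx t ht => ?_⟩
  simp only [hF, hχ1 x hx, one_mul, truncPow_of_mem (hu0 x t) (huN x t ht)]
end

section
variable {d : ℕ} {A α β : Eu d → ℝ}

theorem locHolder_of_lipschitz {f : Eu d → ℝ} {L : ℝ} (hL : 0 ≤ L)
    (hf : ∀ x y, |f x - f y| ≤ L * ‖x - y‖) : LocHolder f := fun _ _ =>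
  ⟨1, L, one_pos, le_rfl, hL, fun x _ y _ => by rw [Real.rpow_one]; exact hf x y⟩

/-- The truncation of a real number to the unit interval. -/
def clamp (r : ℝ) : ℝ := max 0 (min r 1)

theorem clamp_nonneg (r : ℝ) : 0 ≤ clamp r := le_max_left _ _

theorem clamp_le_one (r : ℝ) : clamp r ≤ 1 := max_le zero_le_one (min_le_right _ _)

theorem clamp_of_nonpos {r : ℝ} (h : r ≤ 0) : clamp r = 0 :=
  max_eq_left ((min_le_left _ _).trans h)

theorem clamp_of_one_le {r : ℝ} (h : 1 ≤ r) : clamp r = 1 := by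
  rw [clamp, min_eq_right h, max_eq_right zero_le_one]

theorem abs_clamp_sub_le (a b : ℝ) : |clamp a - clamp b| ≤ |a - b| := by
  refine (abs_max_sub_max_le_max 0 (min a 1) 0 (min b 1)).trans ?_
  simp only [sub_self, abs_zero]
  refine max_le (abs_nonneg _) ((abs_min_sub_min_le_max a 1 b 1).trans ?_)
  simp

theorem continuous_clamp : Continuous clamp := by unfold clamp; fun_prop

theorem lap_congr_of_eventuallyEq {f g : Eu d → ℝ} {x : Eu d} (h : f =ᶠ[𝓝 x] g) :
    lap f x = lap g x := by
  refine Finset.sum_congr rfl fun i _ => ?_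
  have h1 : pd i f =ᶠ[𝓝 x] pd i g := by
    filter_upwards [h.eventuallyEq_nhds] with y hy
    unfold pd; rw [hy.fderiv_eq]
  have h2 := h1.fderiv_eq (𝕜 := ℝ)
  show fderiv ℝ (pd i f) x _ = fderiv ℝ (pd i g) x _
  rw [h2]

theorem lap_mul_const {f : Eu d → ℝ} (hf : ContDiff ℝ ∞ f) (c : ℝ) (x : Eu d) :
    lap (fun y => f y * c) x = lap f x * c := by
  have h1 : ∀ {g : Eu d → ℝ} {y : Eu d}, DifferentiableAt ℝ g y → ∀ i,
      pd i (fun y => g y * c) y = pd i g y * c := fun {g y} hg i => by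
    unfold pd
    rw [fderiv_mul_const hg]
    simp [mul_comm]
  unfold lap
  rw [Finset.sum_mul]
  refine Finset.sum_congr rfl fun i _ => ?_
  have h2 : pd i (fun y => f y * c) = fun y => pd i f y * c :=
    funext fun y => h1 (hf.differentiable (by simp) y) i
  rw [h2]
  exact h1 (differentiableAt_pd (contDiff_infty.1 hf 2).contDiffAt i) i

/-- Solutions with a source far away that dominate a given subsolution on a ball. -/
theorem exists_approximant_ge {p M : ℝ} (hp : 1 < p) (hA : LocHolder A)
    (hpos : ∀ x, 0 < A x) (hα : LocHolder α) (hα0 : ∀ x, 0 ≤ α x) (hβ : LocHolder β)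
    (hM : 0 ≤ M) (hβM : ∀ x, β x ≤ M) {P : Eu d → ℝ} {E E' : ℝ → ℝ} (hP : ContDiff ℝ ∞ P)
    (hP0 : ∀ x, 0 < P x) (hE : ∀ t, 0 < t → 0 < E t ∧ HasDerivAt E (E' t) t)
    (hE' : ContinuousOn E' (Ioi 0)) (hE0 : Tendsto E (𝓝[>] 0) (𝓝 0))
    (hsub : ∀ x t, 0 < t → t ≤ 1 → 1 < P x * E t → P x * E' t ≤
      A x * (E t * lap P x) + β x * (P x * E t - 1) - α x * (P x * E t - 1) ^ p) (n : ℕ) :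
    ∃ (A' : Eu d → ℝ) (u g : Eu d → ℝ → ℝ) (N : ℝ), LocHolder A' ∧ (∀ x, 0 < A' x) ∧
      (∀ x ∈ Metric.closedBall 0 (n : ℝ), A' x = A x) ∧ IsWeak A' u g ∧ (∀ x t, 0 ≤ u x t) ∧
      (∀ x, ∀ t ≤ (n : ℝ) + 1, u x t ≤ N) ∧ (∀ t, ContDiff ℝ 2 fun x => u x t) ∧
      (∀ x t, HasDerivAt (u x) (A' x * lap (fun y => u y t) x + g x t) t) ∧
      (∀ x ∈ Metric.closedBall 0 (n : ℝ), ∀ t ≤ (n : ℝ) + 1,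
        g x t = β x * u x t - α x * u x t ^ p) ∧
      ∀ x ∈ Metric.closedBall 0 (n : ℝ), P x * E 1 - 1 ≤ u x 1 := by
  have hn0 : (0 : ℝ) ≤ n := n.cast_nonneg
  obtain ⟨η, hη, hηs, hη01, hη1, hηt⟩ := exists_cutoff d ((n : ℝ) + 1)
  rw [abs_of_nonneg (by linarith)] at hηt
  have hηz : ∀ x : Eu d, (n : ℝ) + 3 < ‖x‖ → η x = 0 := fun x hx => by
    refine image_eq_zero_of_notMem_tsupport fun h => ?_
    have := hηt h
    rw [mem_closedBall_zero_iff] at this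
    linarith
  have hEc : ContinuousOn E (Ioi 0) := fun t ht => (hE t ht).2.continuousAt.continuousWithinAt
  obtain ⟨τ, hτ0, hτ1, hτP⟩ : ∃ τ, 0 < τ ∧ τ < 1 ∧
      ∀ x ∈ Metric.closedBall (0 : Eu d) ((n : ℝ) + 4), P x * E τ ≤ 1 := by
    obtain ⟨B, hB⟩ := (isCompact_closedBall (0 : Eu d) ((n : ℝ) + 4)).exists_bound_of_continuousOn
      hP.continuous.continuousOn
    have h1 : Tendsto (fun t => B * E t) (𝓝[>] 0) (𝓝 0) := by
      simpa using hE0.const_mul B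
    have h2 : Ioo (0 : ℝ) 1 ∈ 𝓝[>] (0 : ℝ) := Ioo_mem_nhdsGT one_pos
    obtain ⟨τ, h3, h4⟩ := ((h1.eventually (gt_mem_nhds one_pos)).and h2).exists
    refine ⟨τ, h4.1, h4.2, fun x hx => (mul_le_mul_of_nonneg_right ?_ (hE τ h4.1).1.le).trans h3.le⟩
    exact (le_abs_self _).trans (hB x hx)
  have hQ : ContDiff ℝ ∞ fun x => η x * P x := hη.mul hP
  obtain ⟨Q, hQe⟩ : ∃ Q, Q = fun x => η x * P x := ⟨_, rfl⟩
  rw [← hQe] at hQ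
  obtain ⟨res, hres⟩ : ∃ res : Eu d × ℝ → ℝ, res = fun q => Q q.1 * E' q.2
      - A q.1 * (lap Q q.1 * E q.2) - β q.1 * (Q q.1 * E q.2 - 1)
      + α q.1 * (Q q.1 * E q.2 - 1) ^ p := ⟨_, rfl⟩
  have hsubs : Metric.closedBall (0 : Eu d) ((n : ℝ) + 4) ×ˢ Icc τ 1 ⊆ univ ×ˢ Ioi (0 : ℝ) :=
    fun q hq => ⟨trivial, hτ0.trans_le hq.2.1⟩
  have cE : ContinuousOn (fun q : Eu d × ℝ => E q.2)
      (Metric.closedBall (0 : Eu d) ((n : ℝ) + 4) ×ˢ Icc τ 1) :=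
    hEc.comp continuousOn_snd fun q hq => (hsubs hq).2
  have cE' : ContinuousOn (fun q : Eu d × ℝ => E' q.2)
      (Metric.closedBall (0 : Eu d) ((n : ℝ) + 4) ×ˢ Icc τ 1) :=
    hE'.comp continuousOn_snd fun q hq => (hsubs hq).2
  have cf : ∀ {h : Eu d → ℝ}, Continuous h → ContinuousOn (fun q : Eu d × ℝ => h q.1)
      (Metric.closedBall (0 : Eu d) ((n : ℝ) + 4) ×ˢ Icc τ 1) :=
    fun hh => (hh.comp continuous_fst).continuousOn
  have cY := ((cf hQ.continuous).mul cE).sub (continuousOn_const (c := (1 : ℝ)))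
  have hresc : ContinuousOn res (Metric.closedBall (0 : Eu d) ((n : ℝ) + 4) ×ˢ Icc τ 1) := by
    rw [hres]
    exact ((((cf hQ.continuous).mul cE').sub ((cf hA.continuous).mul
      ((cf (contDiff_lap hQ).continuous).mul cE))).sub ((cf hβ.continuous).mul cY)).add
      ((cf hα.continuous).mul (cY.rpow_const fun _ _ => Or.inr (by linarith)))
  obtain ⟨N₀, hN₀⟩ := ((isCompact_closedBall (0 : Eu d) ((n : ℝ) + 4)).prod
    (isCompact_Icc (a := τ) (b := 1))).exists_bound_of_continuousOn hresc
  obtain ⟨N, hN, hNres⟩ : ∃ N, 0 ≤ N ∧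
      ∀ x ∈ Metric.closedBall (0 : Eu d) ((n : ℝ) + 4), ∀ t ∈ Icc τ 1, res (x, t) ≤ N :=
    ⟨max N₀ 0, le_max_right _ _, fun x hx t ht =>
      ((le_abs_self _).trans (hN₀ (x, t) ⟨hx, ht⟩)).trans (le_max_left _ _)⟩
  obtain ⟨f, hf⟩ : ∃ f : Eu d → ℝ → ℝ,
      f = fun x t => N * clamp (‖x‖ - n) * clamp (t / τ) := ⟨_, rfl⟩
  have hf0 : ∀ x t, 0 ≤ f x t := fun x t => by
    rw [hf]; exact mul_nonneg (mul_nonneg hN (clamp_nonneg _)) (clamp_nonneg _)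
  have hfc : Continuous fun q : Eu d × ℝ => f q.1 q.2 := by
    rw [hf]
    exact (continuous_const.mul (continuous_clamp.comp (by fun_prop))).mul
      (continuous_clamp.comp (by fun_prop))
  have hfz : ∀ y s, s ≤ 0 → f y s = 0 := by
    intro y s hs
    simp [hf, clamp_of_nonpos (div_nonpos_of_nonpos_of_nonneg hs hτ0.le)]
  have hfN : ∀ y s, f y s ≤ N := by
    intro y s
    simp only [hf]
    exact mul_le_of_le_one_right (mul_nonneg hN (clamp_nonneg _)) (clamp_le_one _) |>.trans
      (mul_le_of_le_one_right hN (clamp_le_one _))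
  have hfL : ∀ y s s', |f y s - f y s'| ≤ N / τ * |s - s'| := by
    intro y s s'
    have h1 := abs_clamp_sub_le (s / τ) (s' / τ)
    rw [← sub_div, abs_div, abs_of_pos hτ0] at h1
    have e : f y s - f y s' = N * clamp (‖y‖ - n) * (clamp (s / τ) - clamp (s' / τ)) := by
      rw [hf]; ring
    rw [e, abs_mul, abs_of_nonneg (mul_nonneg hN (clamp_nonneg _)), div_mul_eq_mul_div,
      mul_div_assoc]
    exact mul_le_mul (mul_le_of_le_one_right hN (clamp_le_one _)) h1 (abs_nonneg _) hN
  have hfH : ∀ s, LocHolder fun y => f y s := by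
    intro s
    refine locHolder_of_lipschitz hN fun x y => ?_
    have h1 := abs_clamp_sub_le (‖x‖ - n) (‖y‖ - n)
    rw [sub_sub_sub_cancel_right] at h1
    replace h1 := h1.trans (abs_norm_sub_norm_le x y)
    have e : f x s - f y s = N * clamp (s / τ) * (clamp (‖x‖ - n) - clamp (‖y‖ - n)) := by
      rw [hf]; ring
    rw [e, abs_mul, abs_of_nonneg (mul_nonneg hN (clamp_nonneg _))]
    exact mul_le_mul (mul_le_of_le_one_right hN (clamp_le_one _)) h1 (abs_nonneg _) hN
  obtain ⟨A', u, g, N', hA', hA'0, hAA, hw, hu0, huN, hu2, hder, hg⟩ :=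
    exists_approximant (S := (n : ℝ) + 4) (T := (n : ℝ) + 1) (N := N) (L := N / τ) hp hA hpos hα
      hα0 hβ hM hβM (f := f) hfc hfz hf0 hN hfN (by positivity)
      hfL hfH
  refine ⟨A', u, g, N', hA', hA'0, fun x hx => hAA x ?_, hw, hu0, huN, hu2, hder,
    fun x hx t ht => ?_, fun x hx => ?_⟩
  · exact Metric.closedBall_subset_closedBall (by linarith) hx
  · rw [hg x (Metric.closedBall_subset_closedBall (by linarith) hx) t ht, hf]
    rw [mem_closedBall_zero_iff] at hx
    simp [clamp_of_nonpos (sub_nonpos.2 hx)]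
  · rw [mem_closedBall_zero_iff] at hx
    have h := nonpos_of_subsolution_ball (a := A') (M := M) (R := (n : ℝ) + 4) (t₀ := τ)
      (t₁ := 1) (D := fun x t => Q x * E t - 1 - u x t) (fun x => (hA'0 x).le)
      (cY.sub hw.cu.continuousOn) (fun y hy => ?_) (fun y hy s hs => ?_)
      (fun y hy s hs hys => ?_) (show ‖x‖ ≤ (n : ℝ) + 4 by linarith) (right_mem_Icc.2 hτ1.le)
    · have := hη1 x (by rw [mem_closedBall_zero_iff]; linarith)
      simp only [hQe, this, one_mul] at h
      linarith
    · have h1 := mul_le_mul_of_nonneg_right (hη01 y).2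
        (mul_pos (hP0 y) (hE τ hτ0).1).le
      have h2 := hτP y hy
      have h3 := hu0 y τ
      simp only [hQe]
      linarith
    · have := hu0 y s
      simp only [hQe, hηz y (by linarith)]
      linarith
    · have hs0 : 0 < s := hτ0.trans hs.1
      have hyb : y ∈ Metric.closedBall (0 : Eu d) ((n : ℝ) + 4) := by
        rw [mem_closedBall_zero_iff]; exact hy.le
      have hY : 0 < Q y * E s - 1 := by have := hu0 y s; linarith
      have hcQ : ContDiffAt ℝ 2 (fun y => Q y * E s - 1) y :=
        (((contDiff_infty.1 hQ 2).mul contDiff_const).sub contDiff_const).contDiffAt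
      refine ⟨_, (((hE s hs0).2.const_mul (Q y)).sub_const 1).sub (hder y s),
        hcQ.sub (hu2 s).contDiffAt, ?_⟩
      rw [lap_sub hcQ (hu2 s).contDiffAt,
        lap_sub (((contDiff_infty.1 hQ 2).mul contDiff_const).contDiffAt) contDiffAt_const,
        lap_const, lap_mul_const hQ, sub_zero, hAA y hyb, hg y hyb s (by linarith [hs.2])]
      have key : res (y, s) ≤ f y s := by
        rcases lt_or_ge ‖y‖ ((n : ℝ) + 1) with hyn | hyn
        · refine le_trans ?_ (hf0 y s)
          have hev : Q =ᶠ[𝓝 y] P := by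
            filter_upwards [(isOpen_lt continuous_norm continuous_const).mem_nhds hyn] with z hz
            have : ‖z‖ < (n : ℝ) + 1 := hz
            simp [hQe, hη1 z (by rw [mem_closedBall_zero_iff]; linarith)]
          have h1 := hev.eq_of_nhds
          simp only [hres, h1, lap_congr_of_eventuallyEq hev]
          rw [h1] at hY
          have := hsub y s hs0 hs.2 (by linarith)
          linarith
        · refine (hNres y hyb s ⟨hs.1.le, hs.2⟩).trans (le_of_eq ?_)
          simp only [hf]
          rw [clamp_of_one_le (by linarith), clamp_of_one_le ((one_le_div hτ0).2 hs.1.le)]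
          ring
      have h1 : u y s ^ p ≤ (Q y * E s - 1) ^ p :=
        Real.rpow_le_rpow (hu0 y s) (by linarith) (by linarith)
      have h2 := mul_le_mul_of_nonneg_left h1 (hα0 y)
      have h3 := mul_le_mul_of_nonneg_right (hβM y) hys.le
      simp only [hres] at key
      linarith
end

section
variable {d : ℕ} {A α β : Eu d → ℝ}

/-- A sequential Arzelà–Ascoli theorem: pointwise eventually bounded, eventually equicontinuous
sequences have pointwise convergent subsequences with continuous limit. -/
theorem exists_subseq_tendsto_of_equicontinuous {X : Type*} [PseudoMetricSpace X]
    [TopologicalSpace.SeparableSpace X] [Nonempty X] {f : ℕ → X → ℝ}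
    (hb : ∀ x, ∃ B, ∀ᶠ n in atTop, |f n x| ≤ B)
    (he : ∀ x, ∀ ε > 0, ∃ δ > 0, ∀ᶠ n in atTop, ∀ y, dist y x < δ → |f n y - f n x| ≤ ε) :
    ∃ (φ : ℕ → ℕ) (g : X → ℝ), StrictMono φ ∧ Continuous g ∧
      ∀ x, Tendsto (fun n => f (φ n) x) atTop (𝓝 (g x)) := by
  have hb' : ∀ x, ∃ B, ∀ n, |f n x| ≤ B := fun x => by
    obtain ⟨B, hB⟩ := hb x
    have h : BddAbove (range fun n => |f n x|) :=
      IsBoundedUnder.bddAbove_range ⟨B, by simpa using hB⟩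
    exact ⟨_, fun n => h.choose_spec ⟨n, rfl⟩⟩
  choose B hB using hb'
  let q := TopologicalSpace.denseSeq X
  have hK : IsCompact (Set.pi univ fun k => Icc (-B (q k)) (B (q k))) :=
    isCompact_univ_pi fun k => isCompact_Icc
  obtain ⟨a, -, φ, hφ, ha⟩ := hK.tendsto_subseq (x := fun n k => f n (q k))
    fun n k _ => abs_le.1 (hB (q k) n)
  rw [tendsto_pi_nhds] at ha
  have hcau : ∀ x, CauchySeq fun n => f (φ n) x := fun x => by
    refine Metric.cauchySeq_iff.2 fun ε hε => ?_
    obtain ⟨δ, hδ, h⟩ := he x (ε / 4) (by positivity)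
    obtain ⟨k, hk⟩ := (TopologicalSpace.denseRange_denseSeq X).exists_dist_lt x hδ
    rw [dist_comm] at hk
    have h1 := hφ.tendsto_atTop.eventually h
    obtain ⟨N₁, hN₁⟩ := eventually_atTop.1 h1
    obtain ⟨N₂, hN₂⟩ := Metric.cauchySeq_iff.1 (ha k).cauchySeq (ε / 4) (by positivity)
    refine ⟨max N₁ N₂, fun m hm n hn => ?_⟩
    have e1 := abs_le.1 (hN₁ m ((le_max_left _ _).trans hm) _ hk)
    have e2 := abs_le.1 (hN₁ n ((le_max_left _ _).trans hn) _ hk)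
    have e3 := hN₂ m ((le_max_right _ _).trans hm) n ((le_max_right _ _).trans hn)
    rw [Real.dist_eq, abs_lt] at e3 ⊢
    simp only [Function.comp_apply] at e3
    constructor <;> linarith [e1.1, e1.2, e2.1, e2.2, e3.1, e3.2]
  choose g hg using fun x => cauchySeq_tendsto_of_complete (hcau x)
  refine ⟨φ, g, hφ, Metric.continuous_iff.2 fun x ε hε => ?_, hg⟩
  obtain ⟨δ, hδ, h⟩ := he x (ε / 2) (by positivity)
  refine ⟨δ, hδ, fun y hy => ?_⟩
  have h1 : |g y - g x| ≤ ε / 2 := le_of_tendsto ((hg y).sub (hg x)).abs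
    ((hφ.tendsto_atTop.eventually h).mono fun n hn => hn y hy)
  rw [Real.dist_eq]
  linarith

/-- Weak solutions bounded locally uniformly are equicontinuous. -/
theorem eventually_equicontinuous_of_isWeak (hA : LocHolder A) (hpos : ∀ x, 0 < A x)
    {A' : ℕ → Eu d → ℝ} {u g : ℕ → Eu d → ℝ → ℝ} (hA' : ∀ n, LocHolder (A' n))
    (hA'0 : ∀ n x, 0 < A' n x) (hAA : ∀ n : ℕ, ∀ x ∈ Metric.closedBall 0 (n : ℝ), A' n x = A x)
    (hw : ∀ n, IsWeak (A' n) (u n) (g n))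
    (hbd : ∀ R T : ℝ, ∃ B, ∀ᶠ n in atTop, ∀ y ∈ Metric.closedBall 0 R, ∀ s ≤ T,
      |u n y s| ≤ B ∧ |g n y s| ≤ B) (q : Eu d × ℝ) {ε : ℝ} (hε : 0 < ε) :
    ∃ δ > 0, ∀ᶠ n in atTop, ∀ r : Eu d × ℝ, dist r q < δ →
      |u n r.1 r.2 - u n q.1 q.2| ≤ ε := by
  obtain ⟨R, hR⟩ : ∃ R, R = ‖q.1‖ + 1 := ⟨_, rfl⟩
  have hR0 : 0 ≤ R := by rw [hR]; positivity
  obtain ⟨C₁, hC₁, h1⟩ := exists_time_holder_ball hA hpos R (q.2 + 1)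
  obtain ⟨C₂, hC₂, h2⟩ := exists_space_holder_ball hA hpos R (q.2 + 1)
  obtain ⟨B, hB⟩ := hbd (|R| + 2) (q.2 + 1)
  have ht : Tendsto (fun δ : ℝ => C₂ * |B| * δ ^ (3 / 32 : ℝ) + C₁ * |B| * δ ^ (3 / 8 : ℝ))
      (𝓝[>] 0) (𝓝 0) := by
    have : Continuous fun δ : ℝ => C₂ * |B| * δ ^ (3 / 32 : ℝ) + C₁ * |B| * δ ^ (3 / 8 : ℝ) :=
      (continuous_const.mul (Real.continuous_rpow_const (by norm_num))).add
        (continuous_const.mul (Real.continuous_rpow_const (by norm_num)))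
    have h := this.tendsto 0
    rw [Real.zero_rpow (by norm_num), Real.zero_rpow (by norm_num)] at h
    simpa using h.mono_left nhdsWithin_le_nhds
  have hI : Ioo (0 : ℝ) 1 ∈ 𝓝[>] (0 : ℝ) := Ioo_mem_nhdsGT one_pos
  obtain ⟨δ, hδε, hδ⟩ := ((ht.eventually (gt_mem_nhds hε)).and hI).exists
  refine ⟨δ, hδ.1, ?_⟩
  filter_upwards [hB, eventually_ge_atTop ⌈|R| + 2⌉₊] with n hn hnR r hr
  have hnR' : |R| + 2 ≤ n := Nat.ceil_le.1 hnR
  have hAn : ∀ y ∈ Metric.closedBall (0 : Eu d) (|R| + 2), A' n y = A y := fun y hy =>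
    hAA n y (Metric.closedBall_subset_closedBall hnR' hy)
  have hn' : ∀ y ∈ Metric.closedBall (0 : Eu d) (|R| + 2), ∀ s, s ≤ q.2 + 1 →
      |u n y s| ≤ |B| ∧ |g n y s| ≤ |B| := fun y hy s hs =>
    ⟨(hn y hy s hs).1.trans (le_abs_self B), (hn y hy s hs).2.trans (le_abs_self B)⟩
  rw [Prod.dist_eq, max_lt_iff, dist_eq_norm, Real.dist_eq] at hr
  have hr2 := abs_lt.1 hr.2
  have hq1 : q.1 ∈ Metric.closedBall (0 : Eu d) R := by
    rw [mem_closedBall_zero_iff, hR]; linarith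
  have hr1 : r.1 ∈ Metric.closedBall (0 : Eu d) R := by
    rw [mem_closedBall_zero_iff, hR]
    have := norm_sub_norm_le r.1 q.1
    linarith [hδ.2, hr.1]
  have e1 := h2 (A' n) (u n) (g n) |B| (hA' n) (hA'0 n) hAn (hw n) (abs_nonneg B) hn' q.1 hq1
    r.1 hr1 r.2 (by linarith [hδ.2])
  have e2 : |u n q.1 r.2 - u n q.1 q.2| ≤ C₁ * |B| * δ ^ (3 / 8 : ℝ) := by
    have key := h1 (A' n) (u n) (g n) |B| (hA' n) (hA'0 n) hAn (hw n) (abs_nonneg B) hn' q.1 hq1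
    have hmono : ∀ h : ℝ, 0 ≤ h → h ≤ δ →
        C₁ * |B| * h ^ (3 / 8 : ℝ) ≤ C₁ * |B| * δ ^ (3 / 8 : ℝ) := fun h h0 hh =>
      mul_le_mul_of_nonneg_left (Real.rpow_le_rpow h0 hh (by norm_num)) (by positivity)
    rcases le_total r.2 q.2 with h | h
    · have := key q.2 (q.2 - r.2) (by linarith) (by linarith) (by linarith [hδ.2])
      rw [tdiff, sub_sub_cancel] at this
      rw [abs_sub_comm]
      exact this.trans (hmono _ (by linarith) (by linarith))
    · have := key r.2 (r.2 - q.2) (by linarith [hδ.2]) (by linarith) (by linarith [hδ.2])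
      rw [tdiff, sub_sub_cancel] at this
      exact this.trans (hmono _ (by linarith) (by linarith))
  have e3 : C₂ * |B| * ‖r.1 - q.1‖ ^ (3 / 32 : ℝ) ≤ C₂ * |B| * δ ^ (3 / 32 : ℝ) :=
    mul_le_mul_of_nonneg_left (Real.rpow_le_rpow (norm_nonneg _) hr.1.le (by norm_num))
      (by positivity)
  have e4 := abs_sub_le (u n r.1 r.2) (u n q.1 r.2) (u n q.1 q.2)
  linarith

/-- Pointwise limits of weak solutions with locally bounded data are weak solutions. -/
theorem isWeak_of_tendsto (hA : Continuous A) (hpos : ∀ x, 0 < A x)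
    {A' : ℕ → Eu d → ℝ} {u g : ℕ → Eu d → ℝ → ℝ} {v w : Eu d → ℝ → ℝ}
    (hAA : ∀ R : ℝ, ∀ᶠ n in atTop, ∀ x ∈ Metric.closedBall 0 R, A' n x = A x)
    (hw : ∀ n, IsWeak (A' n) (u n) (g n))
    (hbd : ∀ R T : ℝ, ∃ B, ∀ᶠ n in atTop, ∀ y ∈ Metric.closedBall 0 R, ∀ s ≤ T,
      |u n y s| ≤ B ∧ |g n y s| ≤ B)
    (hv : Continuous fun q : Eu d × ℝ => v q.1 q.2) (hwc : Continuous fun q : Eu d × ℝ => w q.1 q.2)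
    (huv : ∀ x t, Tendsto (fun n => u n x t) atTop (𝓝 (v x t)))
    (hgw : ∀ x t, Tendsto (fun n => g n x t) atTop (𝓝 (w x t))) : IsWeak A v w where
  cu := hv
  cg := hwc
  u0 y s hs := tendsto_nhds_unique (huv y s) (by simp [(hw _).u0 y s hs])
  g0 y s hs := tendsto_nhds_unique (hgw y s) (by simp [(hw _).g0 y s hs])
  weak ρ hρ hρs t := by
    obtain ⟨R, hR⟩ : ∃ R, tsupport ρ ⊆ Metric.closedBall 0 R :=
      (hρs.isCompact.isBounded).subset_closedBall 0
    have hρ0 : ∀ y, y ∉ Metric.closedBall (0 : Eu d) R → ρ y = 0 := fun y hy =>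
      image_eq_zero_of_notMem_tsupport fun h => hy (hR h)
    have hl0 : ∀ y, y ∉ Metric.closedBall (0 : Eu d) R → lap ρ y = 0 := fun y hy =>
      image_eq_zero_of_notMem_tsupport fun h => hy (hR (tsupport_lap_subset ρ h))
    have hls : HasCompactSupport (lap ρ) :=
      hρs.isCompact.of_isClosed_subset (isClosed_tsupport _) (tsupport_lap_subset ρ)
    have hlc : Continuous (lap ρ) := (contDiff_lap hρ).continuous
    have hdc : Continuous fun y => ρ y / A y := hρ.continuous.div hA fun y => (hpos y).ne'
    have hds : HasCompactSupport fun y => ρ y / A y := by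
      simp_rw [div_eq_mul_inv]; exact hρs.mul_right
    obtain ⟨B, hB⟩ := hbd R (max 0 t)
    have hwn : ∀ᶠ n in atTop, ∫ y, u n y t * (ρ y / A y) =
        ∫ s in (0 : ℝ)..t, ∫ y, (u n y s * lap ρ y + g n y s * (ρ y / A y)) := by
      filter_upwards [hAA R] with n hn
      have h : ∀ y, ρ y / A' n y = ρ y / A y := fun y => by
        by_cases hy : y ∈ Metric.closedBall (0 : Eu d) R
        · rw [hn y hy]
        · simp [hρ0 y hy]
      simpa only [h] using (hw n).weak ρ hρ hρs t
    have hbu : ∀ᶠ n in atTop, ∀ y s, s ≤ max 0 t → |u n y s * (ρ y / A y)| ≤ B * |ρ y / A y| := by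
      filter_upwards [hB] with n hn y s hs
      rw [abs_mul]
      by_cases hy : y ∈ Metric.closedBall (0 : Eu d) R
      · exact mul_le_mul_of_nonneg_right (hn y hy s hs).1 (abs_nonneg _)
      · simp [hρ0 y hy]
    have hbr : ∀ᶠ n in atTop, ∀ y s, s ≤ max 0 t →
        |u n y s * lap ρ y + g n y s * (ρ y / A y)| ≤ B * (|lap ρ y| + |ρ y / A y|) := by
      filter_upwards [hB] with n hn y s hs
      refine (abs_add_le _ _).trans ?_
      rw [abs_mul, abs_mul, mul_add]
      by_cases hy : y ∈ Metric.closedBall (0 : Eu d) R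
      · exact add_le_add (mul_le_mul_of_nonneg_right (hn y hy s hs).1 (abs_nonneg _))
          (mul_le_mul_of_nonneg_right (hn y hy s hs).2 (abs_nonneg _))
      · simp [hρ0 y hy, hl0 y hy]
    have hi1 : Integrable fun y => |ρ y / A y| := (hdc.integrable_of_hasCompactSupport hds).abs
    have hi2 : Integrable fun y => |lap ρ y| := (hlc.integrable_of_hasCompactSupport hls).abs
    have cs : ∀ {f : Eu d → ℝ → ℝ}, (Continuous fun q : Eu d × ℝ => f q.1 q.2) → ∀ s,
        Continuous fun y => f y s := fun hf s => hf.comp (by fun_prop : Continuous fun y => (y, s))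
    have lhs : Tendsto (fun n => ∫ y, u n y t * (ρ y / A y)) atTop
        (𝓝 (∫ y, v y t * (ρ y / A y))) := by
      refine tendsto_integral_filter_of_dominated_convergence (fun y => B * |ρ y / A y|)
        (Eventually.of_forall fun n => ((cs (hw n).cu t).mul hdc).aestronglyMeasurable) ?_
        (hi1.const_mul B) (Eventually.of_forall fun y => (huv y t).mul_const _)
      filter_upwards [hbu] with n hn
      exact Eventually.of_forall fun y => hn y t (le_max_right _ _)
    have inner : ∀ s, s ≤ max 0 t →
        Tendsto (fun n => ∫ y, (u n y s * lap ρ y + g n y s * (ρ y / A y))) atTop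
          (𝓝 (∫ y, (v y s * lap ρ y + w y s * (ρ y / A y)))) := fun s hs => by
      refine tendsto_integral_filter_of_dominated_convergence
        (fun y => B * (|lap ρ y| + |ρ y / A y|))
        (Eventually.of_forall fun n => (((cs (hw n).cu s).mul hlc).add
          ((cs (hw n).cg s).mul hdc)).aestronglyMeasurable) ?_
        ((hi2.add hi1).const_mul B)
        (Eventually.of_forall fun y => ((huv y s).mul_const _).add ((hgw y s).mul_const _))
      filter_upwards [hbr] with n hn
      exact Eventually.of_forall fun y => hn y s hs
    have hmem : ∀ s ∈ uIoc 0 t, s ≤ max 0 t := fun s hs => hs.2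
    have rhs : Tendsto
        (fun n => ∫ s in (0 : ℝ)..t, ∫ y, (u n y s * lap ρ y + g n y s * (ρ y / A y))) atTop
        (𝓝 (∫ s in (0 : ℝ)..t, ∫ y, (v y s * lap ρ y + w y s * (ρ y / A y)))) := by
      refine intervalIntegral.tendsto_integral_filter_of_dominated_convergence
        (fun _ => ∫ y, B * (|lap ρ y| + |ρ y / A y|)) (Eventually.of_forall fun n => ?_) ?_
        intervalIntegrable_const (Eventually.of_forall fun s hs => inner s (hmem s hs))
      · have hc : Continuous fun q : ℝ × Eu d =>
            u n q.2 q.1 * lap ρ q.2 + g n q.2 q.1 * (ρ q.2 / A q.2) :=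
          (((hw n).cu.comp continuous_swap).mul (hlc.comp continuous_snd)).add
            (((hw n).cg.comp continuous_swap).mul (hdc.comp continuous_snd))
        exact (hc.stronglyMeasurable.integral_prod_right' (ν := volume)).aestronglyMeasurable
      · filter_upwards [hbr] with n hn
        refine Eventually.of_forall fun s hs => ?_
        exact norm_integral_le_of_norm_le ((hi2.add hi1).const_mul B)
          (Eventually.of_forall fun y => hn y s (hmem s hs))
    exact tendsto_nhds_unique (lhs.congr' hwn) rhs
end

section
variable {d : ℕ} {A α β : Eu d → ℝ}

/-- A weak solution of the absorption equation is classical. -/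
theorem IsWeak.classical_absorption {u : Eu d → ℝ → ℝ} {p : ℝ} (hp : 1 < p)
    (hw : IsWeak A u fun x t => β x * u x t - α x * u x t ^ p) (hA : LocHolder A)
    (hpos : ∀ x, 0 < A x) (hα : LocHolder α) (hβ : LocHolder β) (hu0 : ∀ x t, 0 ≤ u x t) :
    ∃ w : Eu d → ℝ → ℝ, (Continuous fun q : Eu d × ℝ => w q.1 q.2) ∧
      (∀ x t, HasDerivAt (u x) (w x t) t) ∧ (∀ t, ContDiff ℝ 2 fun x => u x t) ∧
      ∀ x t, w x t = A x * lap (fun y => u y t) x + (β x * u x t - α x * u x t ^ p) := by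
  refine hw.classical hA hpos (fun R T => ?_) fun t => ?_
  · obtain ⟨B, hB0, hB⟩ := exists_bound_ball hw.cu hw.u0 R T
    obtain ⟨b, hb⟩ := (isCompact_closedBall (0 : Eu d) R).exists_bound_of_continuousOn
      hβ.continuous.continuousOn
    obtain ⟨a, ha⟩ := (isCompact_closedBall (0 : Eu d) R).exists_bound_of_continuousOn
      hα.continuous.continuousOn
    refine ⟨|b| + |a| * (p * B ^ (p - 1)), by positivity, fun x hx t h ht h0 _ => ?_⟩
    have e : _root_.tdiff h (fun x t => β x * u x t - α x * u x t ^ p) x t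
        = β x * _root_.tdiff h u x t - α x * (u x t ^ p - u x (t - h) ^ p) := by
      unfold _root_.tdiff; ring
    have e1 := abs_rpow_sub_rpow_le hp.le (hu0 x t) ((le_abs_self _).trans (hB x hx t ht))
      (hu0 x (t - h)) ((le_abs_self _).trans (hB x hx (t - h) (by linarith)))
    have e2 := mul_le_mul_of_nonneg_right ((hb x hx).trans (le_abs_self b))
      (abs_nonneg (_root_.tdiff h u x t))
    have e3 := mul_le_mul ((ha x hx).trans (le_abs_self a)) e1 (abs_nonneg _) (abs_nonneg a)
    have e4 := abs_sub (β x * _root_.tdiff h u x t) (α x * (u x t ^ p - u x (t - h) ^ p))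
    have e5 : 0 ≤ (|b| + |a| * (p * B ^ (p - 1))) * h := by positivity
    rw [abs_mul, abs_mul] at e4
    rw [show u x t - u x (t - h) = _root_.tdiff h u x t from rfl] at e3
    rw [Real.norm_eq_abs] at e2 e3
    rw [e]
    linarith
  · have h1 := hw.locHolder hA hpos t
    have h2 : LocHolder fun x => (fun r : ℝ => max 0 r ^ p) (u x t) := by
      refine LocHolder.comp (φ := fun r : ℝ => max 0 r ^ p) h1 fun M => ⟨p * |M| ^ (p - 1), fun a b ha hb => ?_⟩
      have hm : ∀ {r : ℝ}, |r| ≤ M → max 0 r ≤ |M| := fun hr =>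
        max_le (abs_nonneg _) ((le_abs_self _).trans (hr.trans (le_abs_self _)))
      refine (abs_rpow_sub_rpow_le hp.le (le_max_left _ _) (hm ha) (le_max_left _ _)
        (hm hb)).trans (mul_le_mul_of_nonneg_left ?_ (by positivity))
      refine (abs_max_sub_max_le_max 0 a 0 b).trans ?_
      simp
    simp only [max_eq_right (hu0 _ t)] at h2
    exact (hβ.mul h1).sub (hα.mul h2)

/-- Existence of a solution with zero initial data above a singular subsolution. -/
theorem exists_solution_ge {p M : ℝ} (hp : 1 < p) (hA : LocHolder A)
    (hpos : ∀ x, 0 < A x) (hα : LocHolder α) (hα0 : ∀ x, 0 < α x) (hβ : LocHolder β)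
    (hM : 0 ≤ M) (hβM : ∀ x, β x ≤ M) {P : Eu d → ℝ} {E E' : ℝ → ℝ} (hP : ContDiff ℝ ∞ P)
    (hP0 : ∀ x, 0 < P x) (hE : ∀ t, 0 < t → 0 < E t ∧ HasDerivAt E (E' t) t)
    (hE' : ContinuousOn E' (Ioi 0)) (hE0 : Tendsto E (𝓝[>] 0) (𝓝 0))
    (hsub : ∀ x t, 0 < t → t ≤ 1 → 1 < P x * E t → P x * E' t ≤
      A x * (E t * lap P x) + β x * (P x * E t - 1) - α x * (P x * E t - 1) ^ p) :
    ∃ u : Eu d → ℝ → ℝ, IsWeak A u (fun x t => β x * u x t - α x * u x t ^ p) ∧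
      (∀ x t, 0 ≤ u x t) ∧ ∀ x, P x * E 1 - 1 ≤ u x 1 := by
  choose A' u g N hA' hA'0 hAA hw hu0 huN hu2 hder hg hge using
    exists_approximant_ge hp hA hpos hα (fun x => (hα0 x).le) hβ hM hβM hP hP0 hE hE' hE0 hsub
  have hlarge : ∀ R T : ℝ, ∀ᶠ n : ℕ in atTop, R ≤ n ∧ T ≤ (n : ℝ) + 1 := fun R T => by
    filter_upwards [eventually_ge_atTop ⌈R⌉₊, eventually_ge_atTop ⌈T⌉₊] with n h1 h2
    exact ⟨Nat.ceil_le.1 h1, (Nat.ceil_le.1 h2).trans (by linarith)⟩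
  have hball : ∀ {R : ℝ} {n : ℕ} {x : Eu d}, R ≤ n → ‖x‖ ≤ R →
      x ∈ Metric.closedBall (0 : Eu d) (n : ℝ) := fun h1 h2 => by
    rw [mem_closedBall_zero_iff]; exact h2.trans h1
  have hbd : ∀ R T : ℝ, ∃ B, ∀ᶠ n in atTop, ∀ y ∈ Metric.closedBall 0 R, ∀ s ≤ T,
      |u n y s| ≤ B ∧ |g n y s| ≤ B := fun R T => by
    obtain ⟨R₁, hR1, hRR⟩ : ∃ R₁ : ℝ, 0 < R₁ ∧ R ≤ R₁ / 2 :=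
      ⟨2 * max R 1, by positivity, by linarith [le_max_left R 1]⟩
    obtain ⟨B, hB⟩ := exists_local_bound (A := A) (α := α) hp hA.continuous
      (fun x => (hpos x).le) hα.continuous hα0 hR1 hM
    obtain ⟨b, hb⟩ := (isCompact_closedBall (0 : Eu d) R).exists_bound_of_continuousOn
      hβ.continuous.continuousOn
    obtain ⟨a, ha⟩ := (isCompact_closedBall (0 : Eu d) R).exists_bound_of_continuousOn
      hα.continuous.continuousOn
    refine ⟨max (max B 0) (|b| * max B 0 + |a| * max B 0 ^ p), ?_⟩
    filter_upwards [hlarge R₁ T] with n hn y hy s hs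
    have hyR := mem_closedBall_zero_iff.1 hy
    have e1 : u n y s ≤ max B 0 := by
      rcases le_or_gt s 0 with h | h
      · rw [(hw n).u0 y s h]; exact le_max_right _ _
      refine (hB (u n) T (N n) (hw n).cu (fun x => ((hw n).u0 x 0 le_rfl).le)
        (fun x t ht => huN n x t (ht.2.trans hn.2)) (fun x hx t ht _ => ?_) y
        (hyR.trans hRR) s ⟨h.le, hs⟩).trans (le_max_left _ _)
      have hx' := hball hn.1 hx.le
      refine ⟨_, hder n x t, (hu2 n t).contDiffAt, ?_⟩
      rw [hAA n x hx', hg n x hx' t (ht.2.trans hn.2)]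
      have := mul_le_mul_of_nonneg_right (hβM x) (hu0 n x t)
      linarith
    have e2 : |u n y s| ≤ max B 0 := by rwa [abs_of_nonneg (hu0 n y s)]
    refine ⟨e2.trans (le_max_left _ _), le_trans ?_ (le_max_right _ _)⟩
    rw [hg n y (hball hn.1 (hyR.trans (hRR.trans (by linarith)))) s (hs.trans hn.2)]
    refine (abs_sub _ _).trans (add_le_add ?_ ?_)
    · rw [abs_mul]
      exact mul_le_mul ((hb y hy).trans (le_abs_self b)) e2 (abs_nonneg _) (abs_nonneg _)
    · rw [abs_mul, abs_of_nonneg (Real.rpow_nonneg (hu0 n y s) p)]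
      exact mul_le_mul ((ha y hy).trans (le_abs_self a))
        (Real.rpow_le_rpow (hu0 n y s) e1 (by linarith)) (Real.rpow_nonneg (hu0 n y s) p)
        (abs_nonneg _)
  obtain ⟨φ, v, hφ, hv, hlim⟩ := exists_subseq_tendsto_of_equicontinuous
    (f := fun n (q : Eu d × ℝ) => u n q.1 q.2)
    (fun q => by
      obtain ⟨B, hB⟩ := hbd ‖q.1‖ q.2
      exact ⟨B, hB.mono fun n hn => (hn q.1 (by simp) q.2 le_rfl).1⟩)
    (fun q ε hε => eventually_equicontinuous_of_isWeak hA hpos hA' hA'0 hAA hw hbd q hε)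
  have huv : ∀ x t, Tendsto (fun n => u (φ n) x t) atTop (𝓝 (v (x, t))) := fun x t => hlim (x, t)
  have hv0 : ∀ x t, 0 ≤ v (x, t) := fun x t =>
    ge_of_tendsto' (huv x t) fun n => hu0 (φ n) x t
  have hev : ∀ R T : ℝ, ∀ᶠ n in atTop, R ≤ φ n ∧ T ≤ (φ n : ℝ) + 1 := fun R T =>
    hφ.tendsto_atTop.eventually (hlarge R T)
  refine ⟨fun x t => v (x, t), ?_, hv0, fun x => ?_⟩
  · refine isWeak_of_tendsto (A' := fun n => A' (φ n)) (u := fun n => u (φ n))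
      (g := fun n => g (φ n)) hA.continuous hpos (fun R => ?_) (fun n => hw (φ n))
      (fun R T => ?_) hv ?_ huv fun x t => ?_
    · filter_upwards [hev R 0] with n hn x hx
      exact hAA (φ n) x (hball hn.1 (mem_closedBall_zero_iff.1 hx))
    · obtain ⟨B, hB⟩ := hbd R T
      exact ⟨B, hφ.tendsto_atTop.eventually hB⟩
    · exact ((hβ.continuous.comp continuous_fst).mul hv).sub
        ((hα.continuous.comp continuous_fst).mul (hv.rpow_const fun _ => Or.inr (by linarith)))
    · refine Tendsto.congr' ?_ (((huv x t).const_mul (β x)).sub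
        (((huv x t).rpow_const (Or.inr (by linarith))).const_mul (α x)))
      filter_upwards [hev ‖x‖ t] with n hn
      exact (hg (φ n) x (hball hn.1 le_rfl) t hn.2).symm
  · refine ge_of_tendsto (huv x 1) ?_
    filter_upwards [hev ‖x‖ 0] with n hn
    exact hge (φ n) x (hball hn.1 le_rfl)
end

/-- Theorem 1, part (2): if `L = A(x)Δ` with `A` comparable to
`(1+|x|)^m`, `m ∈ [0,2]`, `α(x) ≤ C exp(−|x|^{2−m+ε})` and
`β(x) ≥ −C(1+|x|)^{2−m+2δ}` with `δ < ε`, then there exists a nontrivial nonnegative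
classical solution of `u_t = AΔu + βu − αu^p` with zero initial data. -/
theorem stmt_3 {d : ℕ} (hd : 1 ≤ d) (p : ℝ) (hp1 : 1 < p) (hp2 : p ≤ 2)
    (m : ℝ) (hm0 : 0 ≤ m) (hm2 : m ≤ 2)
    (A : EuclideanSpace ℝ (Fin d) → ℝ) (hA_holder : LocHolder A)
    (C₀ : ℝ) (hC₀ : 0 < C₀)
    (hA_bound : ∀ x, C₀⁻¹ * (1 + ‖x‖) ^ m ≤ A x ∧ A x ≤ C₀ * (1 + ‖x‖) ^ m)
    (α β : EuclideanSpace ℝ (Fin d) → ℝ)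
    (hα_holder : LocHolder α) (hβ_holder : LocHolder β)
    (hα_pos : ∀ x, 0 < α x)
    (hβ_bdd : ∃ M : ℝ, ∀ x, β x ≤ M)
    (C ε δ : ℝ) (hC : 0 < C) (hε : 0 < ε) (hδ : δ < ε)
    (hα_upper : ∀ x, α x ≤ C * Real.exp (-(‖x‖ ^ (2 - m + ε))))
    (hβ_lower : ∀ x, -C * (1 + ‖x‖) ^ (2 - m + 2 * δ) ≤ β x) :
    ∃ u : EuclideanSpace ℝ (Fin d) → ℝ → ℝ,
      ContinuousOn (fun q : EuclideanSpace ℝ (Fin d) × ℝ => u q.1 q.2)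
        (univ ×ˢ Ici (0 : ℝ)) ∧
      (∀ x t, 0 ≤ t → 0 ≤ u x t) ∧
      (∀ t : ℝ, 0 < t → ContDiff ℝ 2 (fun x => u x t)) ∧
      (∀ x, ContDiffOn ℝ 1 (fun s => u x s) (Ioi (0 : ℝ))) ∧
      (∀ x t, 0 < t →
        deriv (fun s => u x s) t =
          A x * (∑ i, pd i (pd i (fun y => u y t)) x)
            + β x * u x t - α x * u x t ^ p) ∧
      (∀ x, u x 0 = 0) ∧
      (∃ x t, 0 ≤ t ∧ u x t ≠ 0) := by
  obtain ⟨M, hM⟩ := hβ_bdd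
  have hpos : ∀ x, 0 < A x := fun x => lt_of_lt_of_le (by positivity) (hA_bound x).1
  obtain ⟨P, E, E', hP, hP0, hE, hE', hE0, ⟨x₀, hx₀⟩, hsub⟩ :=
    exists_subsolution (δ := max δ 0) hd hp1 hp2 hm0 hm2 hC₀ hA_bound hα_pos hC hε
      (le_max_right _ _) (max_lt hδ hε) hα_upper fun x => by
        refine le_trans ?_ (hβ_lower x)
        refine mul_le_mul_of_nonpos_left ?_ (by linarith)
        exact Real.rpow_le_rpow_of_exponent_le (by linarith [norm_nonneg x])
          (by linarith [le_max_left δ 0])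
  obtain ⟨u, hw, hu0, hge⟩ := exists_solution_ge hp1 hA_holder hpos hα_holder hα_pos hβ_holder
    (le_max_right M 0) (fun x => (hM x).trans (le_max_left M 0)) hP hP0 hE hE' hE0 hsub
  obtain ⟨w, hwc, hder, hu2, heq⟩ :=
    hw.classical_absorption hp1 hA_holder hpos hα_holder hβ_holder hu0
  have hd1 : ∀ x, deriv (u x) = w x := fun x => funext fun t => (hder x t).deriv
  refine ⟨u, hw.cu.continuousOn, fun x t _ => hu0 x t, fun t _ => hu2 t, fun x => ?_,
    fun x t _ => ?_, fun x => hw.u0 x 0 le_rfl, x₀, 1, zero_le_one, ?_⟩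
  · have h : ContDiff ℝ 1 (u x) := by
      rw [contDiff_one_iff_deriv, hd1]
      exact ⟨fun t => (hder x t).differentiableAt,
        hwc.comp (by fun_prop : Continuous fun t : ℝ => (x, t))⟩
    exact h.contDiffOn
  · have h := heq x t
    rw [← hd1, ← add_sub_assoc] at h
    exact h
  · have := hge x₀
    linarith
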